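/- Any two ω-Sierpiński curves are homeomorphic. That is, if X with exhaustion X₁ ⊆ X₂ ⊆ ⋯ and X′ with exhaustion X′₁ ⊆ X′₂ ⊆ ⋯ are both ω-Sierpiński curves, then there is a homeomorphism X → X′. -/

import Mathlib

open Set Metric Filter Topology

/-- The unit sphere S² in ℝ³. -/
abbrev Sphere2 : Set (EuclideanSpace ℝ (Fin 3)) := Metric.sphere 0 1

/-- The closed unit disk in ℝ². -/
abbrev UnitDisk2 : Set (EuclideanSpace ℝ (Fin 2)) := Metric.closedBall 0 1

/-- The unit circle in ℝ². -/
abbrev UnitCircle : Set (EuclideanSpace ℝ (Fin 2)) := Metric.sphere 0 1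

/-- A closed disk in S²: a subset homeomorphic to the closed unit disk in ℝ². -/
def IsClosedDisk (E : Set ↥Sphere2) : Prop := Nonempty (↥E ≃ₜ ↥UnitDisk2)

/-- A family of open sets in S² realizing a Sierpiński curve as `S² \ ⋃ᵢ Dᵢ`:
each `Dᵢ` is the interior of a closed disk, the closures are pairwise disjoint,
the diameters tend to `0`, and the union of the closures is dense. -/
def IsSierpinskiFamily (D : ℕ → Set ↥Sphere2) : Prop :=
  (∀ i, ∃ E : Set ↥Sphere2, IsClosedDisk E ∧ D i = interior E) ∧
  (Pairwise fun i j => Disjoint (closure (D i)) (closure (D j))) ∧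
  Tendsto (fun i => Metric.diam (D i)) atTop (𝓝 0) ∧
  Dense (⋃ i, closure (D i))

/-- A Sierpiński curve: a space homeomorphic to `S² \ ⋃ᵢ Dᵢ` for some Sierpiński family. -/
def IsSierpinskiCurve (X : Type*) [TopologicalSpace X] : Prop :=
  ∃ D : ℕ → Set ↥Sphere2, IsSierpinskiFamily D ∧ Nonempty (X ≃ₜ ↥((⋃ i, D i)ᶜ))

/-- A peripheral circle of the space `X`: a subspace homeomorphic to the circle whose
complement is connected. -/
def IsPeriphCircle (X : Type*) [TopologicalSpace X] (γ : Set X) : Prop :=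
  Nonempty (↥γ ≃ₜ ↥UnitCircle) ∧ IsConnected γᶜ

/-- `γ` is a peripheral circle of the subset `S` (with its subspace topology). -/
def IsPeriphCircleIn {X : Type*} [TopologicalSpace X] (S γ : Set X) : Prop :=
  γ ⊆ S ∧ IsPeriphCircle ↥S (Subtype.val ⁻¹' γ)

/-- An ω-Sierpiński curve structure on `X` with exhaustion `Xn`: the `Xn` are increasing with
union `X`, `X` carries the direct limit topology, each `Xn` with the subspace topology is a
Sierpiński curve, and each `Xn` is entwined in `Xn₊₁` (no peripheral circle of `Xn` meets a
peripheral circle of `Xn₊₁`). -/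
def IsOmegaSierpinski (X : Type*) [TopologicalSpace X] (Xn : ℕ → Set X) : Prop :=
  Monotone Xn ∧ (⋃ n, Xn n) = Set.univ ∧
  (∀ U : Set X, IsOpen U ↔ ∀ n, IsOpen (Subtype.val ⁻¹' U : Set ↥(Xn n))) ∧
  (∀ n, IsSierpinskiCurve ↥(Xn n)) ∧
  (∀ n, ∀ γ δ : Set X,
    IsPeriphCircleIn (Xn n) γ → IsPeriphCircleIn (Xn (n + 1)) δ → Disjoint γ δ)

/-! ### Continuous logarithms -/

/-- `f` has a continuous logarithm on `K`. -/
def HasLog {α : Type*} [TopologicalSpace α] (f : α → ℂ) (K : Set α) : Prop :=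
  ∃ g : α → ℂ, ContinuousOn g K ∧ ∀ z ∈ K, Complex.exp (g z) = f z

section HasLog

variable {α β : Type*} [TopologicalSpace α] [TopologicalSpace β] {f f₁ f₂ : α → ℂ} {K L : Set α}

lemma HasLog.mono (h : HasLog f L) (hKL : K ⊆ L) : HasLog f K :=
  let ⟨g, hg, h⟩ := h
  ⟨g, hg.mono hKL, fun z hz => h z (hKL hz)⟩

lemma HasLog.congr (h : HasLog f₁ K) (he : ∀ z ∈ K, f₁ z = f₂ z) : HasLog f₂ K :=
  let ⟨g, hg, h⟩ := h
  ⟨g, hg, fun z hz => (h z hz).trans (he z hz)⟩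

lemma HasLog.mul (h₁ : HasLog f₁ K) (h₂ : HasLog f₂ K) : HasLog (fun z => f₁ z * f₂ z) K :=
  let ⟨g₁, hg₁, h₁⟩ := h₁
  let ⟨g₂, hg₂, h₂⟩ := h₂
  ⟨fun z => g₁ z + g₂ z, hg₁.add hg₂, fun z hz => by
    rw [Complex.exp_add, h₁ z hz, h₂ z hz]⟩

lemma HasLog.inv (h : HasLog f K) : HasLog (fun z => (f z)⁻¹) K :=
  let ⟨g, hg, h⟩ := h
  ⟨fun z => -g z, hg.neg, fun z hz => by rw [Complex.exp_neg, h z hz]⟩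

lemma HasLog.div (h₁ : HasLog f₁ K) (h₂ : HasLog f₂ K) : HasLog (fun z => f₁ z / f₂ z) K := by
  simpa only [div_eq_mul_inv] using h₁.mul h₂.inv

lemma HasLog.zpow (h : HasLog f K) (m : ℤ) : HasLog (fun z => f z ^ m) K :=
  let ⟨g, hg, h⟩ := h
  ⟨fun z => m * g z, continuousOn_const.mul hg, fun z hz => by
    rw [Complex.exp_int_mul, h z hz]⟩

lemma HasLog.comp {k : β → α} {M : Set β} (h : HasLog f K) (hk : ContinuousOn k M)
    (hm : MapsTo k M K) : HasLog (fun z => f (k z)) M :=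
  let ⟨g, hg, h⟩ := h
  ⟨fun z => g (k z), hg.comp hk hm, fun _ hz => h _ (hm hz)⟩

lemma HasLog.ne_zero (h : HasLog f K) {z : α} (hz : z ∈ K) : f z ≠ 0 :=
  let ⟨_, _, h⟩ := h
  h z hz ▸ Complex.exp_ne_zero _

lemma hasLog_of_mem_slitPlane (hf : ContinuousOn f K) (h : ∀ z ∈ K, f z ∈ Complex.slitPlane) :
    HasLog f K :=
  ⟨fun z => Complex.log (f z), hf.clog h, fun z hz =>
    Complex.exp_log (Complex.slitPlane_ne_zero (h z hz))⟩

lemma hasLog_const {c : ℂ} (hc : c ≠ 0) : HasLog (fun _ => c) K :=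
  ⟨fun _ => Complex.log c, continuousOn_const, fun _ _ => Complex.exp_log hc⟩

/-- Two logarithms of a function on a preconnected set differ by a constant in `2πiℤ`. -/
lemma log_sub_const {g₁ g₂ : α → ℂ} (hK : IsPreconnected K) (h₁ : ContinuousOn g₁ K)
    (h₂ : ContinuousOn g₂ K) (h : ∀ z ∈ K, Complex.exp (g₁ z) = Complex.exp (g₂ z)) :
    ∃ n : ℤ, ∀ z ∈ K, g₁ z = g₂ z + n * (2 * Real.pi * Complex.I) := by
  rcases K.eq_empty_or_nonempty with rfl | ⟨z₀, hz₀⟩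
  · exact ⟨0, by simp⟩
  have hex : ∀ z ∈ K, ∃ n : ℤ, g₁ z = g₂ z + n * (2 * Real.pi * Complex.I) := fun z hz =>
    Complex.exp_eq_exp_iff_exists_int.1 (h z hz)
  choose! N hN using hex
  have hπ : (2 * Real.pi * Complex.I : ℂ) ≠ 0 := Complex.two_pi_I_ne_zero
  have hNc : ContinuousOn (fun z => (N z : ℝ)) K := by
    have : ContinuousOn (fun z => ((g₁ z - g₂ z) / (2 * Real.pi * Complex.I)).re) K :=
      Complex.continuous_re.comp_continuousOn ((h₁.sub h₂).div_const _)
    refine this.congr fun z hz => ?_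
    have : (g₁ z - g₂ z) / (2 * Real.pi * Complex.I) = (N z : ℂ) := by
      rw [hN z hz, add_sub_cancel_left, mul_div_assoc, div_self hπ, mul_one]
    simp only [this, Complex.intCast_re]
  have hNc' : ContinuousOn N K :=
    Int.isClosedEmbedding_coe_real.isEmbedding.continuousOn_iff.2 hNc
  refine ⟨N z₀, fun z hz => ?_⟩
  have := hK.constant_of_mapsTo (T := (univ : Set ℤ)) (isDiscrete_univ_iff.2 inferInstance) hNc'
    (mapsTo_univ _ _) hz hz₀
  rw [hN z hz, this]

open Classical in
/-- Logarithms on `K` and `L` glue when `K ∩ L` is preconnected. -/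
lemma HasLog.union_aux (hKL : IsPreconnected (K ∩ L)) (h₁ : HasLog f K) (h₂ : HasLog f L) :
    ∃ g : α → ℂ, ContinuousOn g K ∧ ContinuousOn g L ∧ ∀ z ∈ K ∪ L, Complex.exp (g z) = f z := by
  obtain ⟨g₁, hg₁, h₁⟩ := h₁
  obtain ⟨g₂, hg₂, h₂⟩ := h₂
  obtain ⟨n, hn⟩ := log_sub_const hKL (hg₁.mono inter_subset_left) (hg₂.mono inter_subset_right)
    fun z hz => (h₁ z hz.1).trans (h₂ z hz.2).symm
  have e₁ : EqOn (fun z => if z ∈ K then g₁ z else g₂ z + n * (2 * Real.pi * Complex.I)) g₁ K :=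
    fun z hz => if_pos hz
  have e₂ : EqOn (fun z => if z ∈ K then g₁ z else g₂ z + n * (2 * Real.pi * Complex.I))
      (fun z => g₂ z + n * (2 * Real.pi * Complex.I)) L := fun z hz => by
    by_cases hzK : z ∈ K
    · simp only [hzK, if_true]; exact hn z ⟨hzK, hz⟩
    · simp [hzK]
  refine ⟨_, hg₁.congr e₁, (hg₂.add continuousOn_const).congr e₂, ?_⟩
  rintro z (hz | hz)
  · exact (congrArg Complex.exp (e₁ hz)).trans (h₁ z hz)
  · refine (congrArg Complex.exp (e₂ hz)).trans ?_
    simp only [Complex.exp_add, Complex.exp_int_mul_two_pi_mul_I, mul_one, h₂ z hz]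

lemma HasLog.union_of_isClosed (hK : IsClosed K) (hL : IsClosed L)
    (hKL : IsPreconnected (K ∩ L)) (h₁ : HasLog f K) (h₂ : HasLog f L) : HasLog f (K ∪ L) :=
  let ⟨g, hg₁, hg₂, h⟩ := h₁.union_aux hKL h₂
  ⟨g, hg₁.union_of_isClosed hg₂ hK hL, h⟩

lemma HasLog.union_of_isOpen (hK : IsOpen K) (hL : IsOpen L)
    (hKL : IsPreconnected (K ∩ L)) (h₁ : HasLog f K) (h₂ : HasLog f L) : HasLog f (K ∪ L) :=
  let ⟨g, hg₁, hg₂, h⟩ := h₁.union_aux hKL h₂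
  ⟨g, hg₁.union_of_isOpen hg₂ hK hL, h⟩

end HasLog

/-- A nonvanishing continuous function on `ℂ` has a logarithm. -/
lemma exists_log_complex {f : ℂ → ℂ} (hf : Continuous f) (h0 : ∀ z, f z ≠ 0) :
    ∃ g : ℂ → ℂ, Continuous g ∧ ∀ z, Complex.exp (g z) = f z := by
  let F : C(ℂ, {z : ℂ // z ≠ 0}) := ⟨fun z => ⟨f z, h0 z⟩, by fun_prop⟩
  obtain ⟨G, ⟨_, hG⟩, _⟩ := Complex.isCoveringMap_exp.existsUnique_continuousMap_lifts F 0
    (Complex.log (f 0)) (Subtype.ext (Complex.exp_log (h0 0)))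
  exact ⟨G, G.continuous, fun z => congrArg Subtype.val (congrFun hG z)⟩

/-- Retracts of `ℂ` admit logarithms of all nonvanishing functions. -/
lemma hasLog_of_retract {f : ℂ → ℂ} {K : Set ℂ} (r : ℂ → ℂ) (hr : Continuous r)
    (hrK : ∀ z, r z ∈ K) (hrid : ∀ z ∈ K, r z = z) (hf : ContinuousOn f K)
    (h0 : ∀ z ∈ K, f z ≠ 0) : HasLog f K := by
  obtain ⟨g, hg, h⟩ := exists_log_complex (f := fun z => f (r z))
    (hf.comp_continuous hr hrK) (fun z => h0 _ (hrK z))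
  exact ⟨g, hg.continuousOn, fun z hz => by rw [h z, hrid z hz]⟩

lemma hasLog_closedBall {f : ℂ → ℂ} (hf : ContinuousOn f (closedBall 0 1))
    (h0 : ∀ z ∈ closedBall (0 : ℂ) 1, f z ≠ 0) : HasLog f (closedBall 0 1) := by
  have hpos : ∀ z : ℂ, 0 < max 1 ‖z‖ := fun z => lt_max_of_lt_left one_pos
  refine hasLog_of_retract (fun z => z / (max 1 ‖z‖ : ℝ)) ?_ ?_ ?_ hf h0
  · exact continuous_id.div (Complex.continuous_ofReal.comp (continuous_const.max continuous_norm))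
      fun z => Complex.ofReal_ne_zero.2 (hpos z).ne'
  · intro z
    rw [mem_closedBall_zero_iff, norm_div, Complex.norm_real, Real.norm_of_nonneg (hpos z).le,
      div_le_one (hpos z)]
    exact le_max_right _ _
  · intro z hz
    rw [mem_closedBall_zero_iff] at hz
    simp [max_eq_left hz]

lemma hasLog_Icc {f : ℝ → ℂ} (hf : ContinuousOn f (Icc 0 1))
    (h0 : ∀ t ∈ Icc (0 : ℝ) 1, f t ≠ 0) : HasLog f (Icc 0 1) := by
  obtain ⟨g, hg, h⟩ := exists_log_complex (f := fun z => f (projIcc 0 1 zero_le_one z.re))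
    (hf.comp_continuous (continuous_subtype_val.comp
      ((continuous_projIcc (h := zero_le_one)).comp Complex.continuous_re)) fun z => Subtype.prop _)
    (fun z => h0 _ (Subtype.prop _))
  exact ⟨fun t => g t, (hg.comp Complex.continuous_ofReal).continuousOn, fun t ht => by
    rw [h]; simp [projIcc_of_mem _ ht]⟩

lemma zpow_no_log_sphere {p : ℂ} {r : ℝ} (hr : 0 < r) {m : ℤ}
    (h : HasLog (fun z => (z - p) ^ m) (sphere p r)) : m = 0 := by
  obtain ⟨g, hg, h⟩ := h
  let c : ℝ → ℂ := fun t => circleMap p r t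
  have hc : ∀ t, c t ∈ sphere p r := fun t => circleMap_mem_sphere p hr.le t
  have hgc : Continuous fun t => g (c t) :=
    hg.comp_continuous (continuous_circleMap p r) hc
  have hr' : (r : ℂ) ≠ 0 := Complex.ofReal_ne_zero.2 hr.ne'
  obtain ⟨n, hn⟩ := log_sub_const (K := (univ : Set ℝ)) (g₁ := fun t => g (c t))
    (g₂ := fun t => m * (Complex.log r + t * Complex.I)) isPreconnected_univ hgc.continuousOn
    (by fun_prop) (fun t _ => by
      refine (h _ (hc t)).trans ?_
      simp only [Complex.exp_int_mul, Complex.exp_add, Complex.exp_log hr', c, circleMap,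
        add_sub_cancel_left])
  have h1 := hn 0 (mem_univ _)
  have h2 := hn (2 * Real.pi) (mem_univ _)
  have h3 : c (2 * Real.pi) = c 0 := by simp [c, circleMap]
  simp only [h3] at h2
  rw [h1] at h2
  have h4 : (m : ℂ) * (2 * Real.pi * Complex.I) = 0 := by
    push_cast at h2
    linear_combination -h2
  exact_mod_cast (mul_eq_zero.1 h4).resolve_right Complex.two_pi_I_ne_zero

/-- Points in a preconnected set missing the compact set `K` have equivalent `z - p` on `K`. -/
lemma hasLog_of_isPreconnected {K V : Set ℂ} (hK : IsCompact K) (hV : IsPreconnected V)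
    (hVK : Disjoint V K) {p q : ℂ} (hp : p ∈ V) (hq : q ∈ V) :
    HasLog (fun z => (z - p) / (z - q)) K := by
  have hne : ∀ x ∈ V, ∀ z ∈ K, z - x ≠ 0 := fun x hx z hz h =>
    hVK.ne_of_mem hx hz (sub_eq_zero.1 h).symm
  refine hV.induction₂ (fun p q => HasLog (fun z => (z - p) / (z - q)) K) ?_ ?_ ?_ hp hq
  · intro x hx
    refine Filter.Eventually.filter_mono nhdsWithin_le_nhds ?_
    obtain ⟨ε, hε, hball⟩ := Metric.isOpen_iff.1 hK.isClosed.isOpen_compl x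
      (fun h => hVK.ne_of_mem hx h rfl)
    filter_upwards [ball_mem_nhds x hε] with y hy
    have : HasLog (fun z => (z - y) / (z - x)) K := by
      refine hasLog_of_mem_slitPlane ?_ ?_
      · exact (by fun_prop : ContinuousOn (fun z => z - y) K).div (by fun_prop) (hne x hx)
      · intro z hz
        have h1 : (z - y) / (z - x) = 1 + (x - y) / (z - x) := by
          rw [eq_comm, ← div_self (hne x hx z hz), ← add_div]; congr 1; ring
        rw [h1]
        refine Complex.mem_slitPlane_of_norm_lt_one ?_
        rw [norm_div, div_lt_one (norm_pos_iff.2 (hne x hx z hz))]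
        rw [mem_ball, dist_comm, dist_eq_norm] at hy
        refine hy.trans_le (not_lt.1 fun hlt => ?_)
        exact hball (show z ∈ ball x ε by rwa [mem_ball, dist_eq_norm]) hz
    exact this.inv.congr fun z _ => inv_div _ _
  · intro x y z hx hy hz h1 h2
    exact (h1.mul h2).congr fun w hw => div_mul_div_cancel₀ (hne y hy w hw)
  · intro x y _ _ h
    exact h.inv.congr fun z _ => inv_div _ _

lemma hasLog_of_norm_lt {K : Set ℂ} {p : ℂ} (h : ∀ z ∈ K, ‖z‖ < ‖p‖) :
    HasLog (fun z => z - p) K := by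
  rcases eq_or_ne p 0 with rfl | hp
  · exact ⟨0, continuousOn_const, fun z hz => absurd (h z hz) (by simp)⟩
  have : HasLog (fun z => 1 + -z / p) K := by
    refine hasLog_of_mem_slitPlane (by fun_prop) fun z hz => Complex.mem_slitPlane_of_norm_lt_one ?_
    rw [norm_div, norm_neg, div_lt_one (norm_pos_iff.2 hp)]
    exact h z hz
  refine ((hasLog_const (neg_ne_zero.2 hp)).mul this).congr fun z _ => ?_
  field_simp
  ring

/-- Tietze extension for functions continuous on a closed set. -/
lemma exists_continuous_eqOn {X : Type*} [TopologicalSpace X] [NormalSpace X] {F : Set X}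
    (hF : IsClosed F) {g : X → ℂ} (hg : ContinuousOn g F) :
    ∃ G : X → ℂ, Continuous G ∧ EqOn G g F := by
  obtain ⟨G, hG⟩ := ContinuousMap.exists_restrict_eq hF ⟨F.domRestrict g, hg.domRestrict⟩
  exact ⟨G, G.continuous, fun z hz => congrArg (fun F' : C(F, ℂ) => F' ⟨z, hz⟩) hG⟩

open Classical in
/-- The key topological obstruction: around a point `p` of a bounded open set `V`, the function
`(z - p) ^ m` is not a nonvanishing function on `closure V` times an exponential on the frontier. -/
lemma zpow_eq_zero_of_hasLog_frontier {V : Set ℂ} (hV : IsOpen V) (hb : Bornology.IsBounded V)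
    {p : ℂ} (hp : p ∈ V) {u : ℂ → ℂ} (hu : ContinuousOn u (closure V))
    (hu0 : ∀ z ∈ closure V, u z ≠ 0) {m : ℤ}
    (h : HasLog (fun z => (z - p) ^ m / u z) (frontier V)) : m = 0 := by
  obtain ⟨g, hg, h⟩ := h
  obtain ⟨G, hGc, hGg⟩ := exists_continuous_eqOn isClosed_frontier hg
  let Φ : ℂ → ℂ := fun z => if z ∈ V then Complex.exp (G z) * u z else (z - p) ^ m
  have hne : ∀ z ∈ Vᶜ, z - p ≠ 0 := fun z hz h => hz (sub_eq_zero.1 h ▸ hp)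
  have e₁ : EqOn Φ (fun z => Complex.exp (G z) * u z) (closure V) := fun z hz => by
    by_cases hzV : z ∈ V
    · simp [Φ, hzV]
    · have hfr : z ∈ frontier V := ⟨hz, by rwa [hV.interior_eq]⟩
      simp only [Φ, hzV, if_false, hGg hfr, h z hfr]
      rw [div_mul_cancel₀ _ (hu0 z hz)]
  have e₂ : EqOn Φ (fun z => (z - p) ^ m) Vᶜ := fun z hz => if_neg hz
  have hΦ : Continuous Φ := by
    rw [← continuousOn_univ]
    have : closure V ∪ Vᶜ = univ := by
      rw [eq_univ_iff_forall]; intro z; by_cases hz : z ∈ V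
      · exact Or.inl (subset_closure hz)
      · exact Or.inr hz
    rw [← this]
    refine ContinuousOn.union_of_isClosed ?_ ?_ isClosed_closure hV.isClosed_compl
    · exact ((Complex.continuous_exp.comp hGc).continuousOn.mul hu).congr e₁
    · refine ContinuousOn.congr ?_ e₂
      exact ContinuousOn.zpow₀ (by fun_prop) m fun z hz => Or.inl (hne z hz)
  have hΦ0 : ∀ z, Φ z ≠ 0 := fun z => by
    by_cases hz : z ∈ V
    · rw [e₁ (subset_closure hz)]
      exact mul_ne_zero (Complex.exp_ne_zero _) (hu0 z (subset_closure hz))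
    · rw [e₂ hz]; exact zpow_ne_zero _ (hne z hz)
  obtain ⟨L, hL, hLΦ⟩ := exists_log_complex hΦ hΦ0
  obtain ⟨r, hr0, hr⟩ := hb.subset_ball_lt 0 p
  refine zpow_no_log_sphere hr0 (p := p) ⟨L, hL.continuousOn, fun z hz => ?_⟩
  rw [hLΦ, e₂]
  exact fun hzV => (mem_ball.1 (hr hzV)).ne (mem_sphere.1 hz)

/-! ### Separation by compact sets -/

lemma isPreconnected_norm_gt {R : ℝ} (hR : 0 < R) : IsPreconnected {z : ℂ | R < ‖z‖} := by
  have : {z : ℂ | R < ‖z‖} = Complex.exp '' {w : ℂ | Real.log R < w.re} := by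
    ext z
    constructor
    · intro hz
      have hz0 : z ≠ 0 := norm_pos_iff.1 (hR.trans hz)
      exact ⟨Complex.log z, by simpa [Complex.log_re] using Real.log_lt_log hR hz,
        Complex.exp_log hz0⟩
    · rintro ⟨w, hw, rfl⟩
      rw [mem_ofPred_eq, Complex.norm_exp]
      exact (Real.log_lt_iff_lt_exp hR).1 hw
  rw [this]
  exact (convex_halfSpace_re_gt _).isPreconnected.image _ Complex.continuous_exp.continuousOn

/-- `p` and `q` lie in a common preconnected subset of the complement of `K`. -/
def NotSep (K : Set ℂ) (p q : ℂ) : Prop :=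
  ∃ V : Set ℂ, IsPreconnected V ∧ Disjoint V K ∧ p ∈ V ∧ q ∈ V

lemma NotSep.symm {K : Set ℂ} {p q : ℂ} (h : NotSep K p q) : NotSep K q p :=
  let ⟨V, h1, h2, h3, h4⟩ := h
  ⟨V, h1, h2, h4, h3⟩

lemma NotSep.trans {K : Set ℂ} {p q r : ℂ} (h : NotSep K p q) (h' : NotSep K q r) :
    NotSep K p r :=
  let ⟨V, h1, h2, h3, h4⟩ := h
  let ⟨W, k1, k2, k3, k4⟩ := h'
  ⟨V ∪ W, h1.union q h4 k3 k1, disjoint_union_left.2 ⟨h2, k2⟩, Or.inl h3, Or.inr k4⟩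

lemma NotSep.mono {K L : Set ℂ} {p q : ℂ} (h : NotSep L p q) (hKL : K ⊆ L) : NotSep K p q :=
  let ⟨V, h1, h2, h3, h4⟩ := h
  ⟨V, h1, h2.mono_right hKL, h3, h4⟩

lemma notSep_iff_mem {K : Set ℂ} {p q : ℂ} :
    NotSep K p q ↔ q ∈ connectedComponentIn Kᶜ p := by
  constructor
  · rintro ⟨V, h1, h2, h3, h4⟩
    exact h1.subset_connectedComponentIn h3 h2.subset_compl_right h4
  · intro h
    have hp : p ∈ Kᶜ := by
      by_contra hp; rw [connectedComponentIn_eq_empty hp] at h; exact h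
    exact ⟨_, isPreconnected_connectedComponentIn,
      disjoint_left.2 fun z hz => connectedComponentIn_subset _ _ hz, mem_connectedComponentIn hp, h⟩

lemma isPreconnected_compl_of_notSep {K : Set ℂ} (h : ∀ p ∉ K, ∀ q ∉ K, NotSep K p q) :
    IsPreconnected Kᶜ :=
  isPreconnected_of_forall_pair fun p hp q hq =>
    let ⟨V, h1, h2, h3, h4⟩ := h p hp q hq
    ⟨V, h2.subset_compl_right, h3, h4, h1⟩

lemma frontier_component_subset {K : Set ℂ} (hK : IsClosed K) (p : ℂ) :
    frontier (connectedComponentIn Kᶜ p) ⊆ K := by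
  intro z hz
  by_contra hzK
  have hopen := hK.isOpen_compl.connectedComponentIn (x := p)
  have hzo := hK.isOpen_compl.connectedComponentIn (x := z)
  have hz2 : z ∈ connectedComponentIn Kᶜ z := mem_connectedComponentIn hzK
  obtain ⟨w, hw1, hw2⟩ := mem_closure_iff.1 hz.1 _ hzo hz2
  have e1 := connectedComponentIn_eq hw1
  have e2 := connectedComponentIn_eq hw2
  rw [hopen.frontier_eq] at hz
  exact hz.2 (by rw [e2, ← e1]; exact hz2)

lemma notSep_of_hasLog_of_isBounded {K : Set ℂ} (hK : IsClosed K) {p q : ℂ} (hp : p ∉ K)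
    (hq : q ∉ K) (h : HasLog (fun z => (z - p) / (z - q)) K)
    (hb : Bornology.IsBounded (connectedComponentIn Kᶜ p)) : NotSep K p q := by
  by_contra hns
  rw [notSep_iff_mem] at hns
  have hopen := hK.isOpen_compl.connectedComponentIn (x := p)
  have hfr := frontier_component_subset hK p
  have := zpow_eq_zero_of_hasLog_frontier hopen hb (mem_connectedComponentIn hp)
    (u := fun z => z - q) (m := 1) (by fun_prop) (fun z hz h0 => ?_)
    ((h.mono hfr).congr fun z _ => by simp)
  · simp at this
  · rw [sub_eq_zero] at h0
    subst h0
    exact hq (hfr ⟨hz, by rwa [hopen.interior_eq]⟩)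

theorem notSep_iff_hasLog {K : Set ℂ} (hK : IsCompact K) {p q : ℂ} (hp : p ∉ K) (hq : q ∉ K) :
    NotSep K p q ↔ HasLog (fun z => (z - p) / (z - q)) K := by
  constructor
  · rintro ⟨V, h1, h2, h3, h4⟩
    exact hasLog_of_isPreconnected hK h1 h2 h3 h4
  · intro h
    by_cases hbp : Bornology.IsBounded (connectedComponentIn Kᶜ p)
    · exact notSep_of_hasLog_of_isBounded hK.isClosed hp hq h hbp
    by_cases hbq : Bornology.IsBounded (connectedComponentIn Kᶜ q)
    · exact (notSep_of_hasLog_of_isBounded hK.isClosed hq hp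
        (h.inv.congr fun z _ => inv_div _ _) hbq).symm
    obtain ⟨R, hR0, hR⟩ := hK.isBounded.subset_closedBall_lt 0 0
    have key : ∀ x, ¬ Bornology.IsBounded (connectedComponentIn Kᶜ x) →
        ∃ y, R < ‖y‖ ∧ NotSep K x y := by
      intro x hx
      by_contra! hcon
      refine hx ((isBounded_closedBall (x := (0 : ℂ)) (r := R)).subset fun y hy => ?_)
      by_contra hy'
      rw [mem_closedBall_zero_iff, not_le] at hy'
      exact hcon y hy' (notSep_iff_mem.2 hy)
    obtain ⟨y, hy, hpy⟩ := key p hbp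
    obtain ⟨w, hw, hqw⟩ := key q hbq
    refine hpy.trans (NotSep.trans ⟨_, isPreconnected_norm_gt hR0, ?_, hy, hw⟩ hqw.symm)
    exact disjoint_left.2 fun z hz hzK => (mem_closedBall_zero_iff.1 (hR hzK)).not_gt hz

/-- Janiszewski's theorem. -/
theorem NotSep.union {A B : Set ℂ} (hA : IsCompact A) (hB : IsCompact B)
    (hAB : IsPreconnected (A ∩ B)) {p q : ℂ} (h₁ : NotSep A p q) (h₂ : NotSep B p q) :
    NotSep (A ∪ B) p q := by
  have hp : p ∉ A ∪ B := fun h => by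
    obtain ⟨V, -, hV, hp, -⟩ := h₁
    obtain ⟨W, -, hW, hp', -⟩ := h₂
    exact h.elim (fun h => hV.ne_of_mem hp h rfl) (fun h => hW.ne_of_mem hp' h rfl)
  have hq : q ∉ A ∪ B := fun h => by
    obtain ⟨V, -, hV, -, hp⟩ := h₁
    obtain ⟨W, -, hW, -, hp'⟩ := h₂
    exact h.elim (fun h => hV.ne_of_mem hp h rfl) (fun h => hW.ne_of_mem hp' h rfl)
  rw [mem_union, not_or] at hp hq
  rw [notSep_iff_hasLog hA hp.1 hq.1] at h₁
  rw [notSep_iff_hasLog hB hp.2 hq.2] at h₂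
  rw [notSep_iff_hasLog (hA.union hB) (by simp [hp]) (by simp [hq])]
  exact h₁.union_of_isClosed hA.isClosed hB.isClosed hAB h₂

/-- Every nonvanishing continuous function on `K` has a logarithm. -/
def LogAcyclic (K : Set ℂ) : Prop :=
  ∀ f : ℂ → ℂ, ContinuousOn f K → (∀ z ∈ K, f z ≠ 0) → HasLog f K

lemma LogAcyclic.hasLog_sub {K : Set ℂ} (h : LogAcyclic K) {p : ℂ} (hp : p ∉ K) :
    HasLog (fun z => z - p) K :=
  h _ (by fun_prop) fun z hz h0 => hp (sub_eq_zero.1 h0 ▸ hz)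

lemma LogAcyclic.notSep {K : Set ℂ} (h : LogAcyclic K) (hK : IsCompact K) {p q : ℂ}
    (hp : p ∉ K) (hq : q ∉ K) : NotSep K p q :=
  (notSep_iff_hasLog hK hp hq).2 ((h.hasLog_sub hp).div (h.hasLog_sub hq))

lemma LogAcyclic.isPreconnected_compl {K : Set ℂ} (h : LogAcyclic K) (hK : IsCompact K) :
    IsPreconnected Kᶜ :=
  isPreconnected_compl_of_notSep fun _ hp _ hq => h.notSep hK hp hq

/-! ### Arcs -/

lemma continuousOn_invFunOn_image {α β : Type*} [TopologicalSpace α] [TopologicalSpace β]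
    [T2Space β] [Nonempty α] {f : α → β} {S : Set α} (hS : IsCompact S) (hf : ContinuousOn f S)
    (hi : InjOn f S) : ContinuousOn (Function.invFunOn f S) (f '' S) := by
  refine continuousOn_iff_isClosed.2 fun t ht => ⟨f '' (S ∩ t),
    ((hS.inter_right ht).image_of_continuousOn (hf.mono inter_subset_left)).isClosed, ?_⟩
  ext y
  constructor
  · rintro ⟨hy, x, hx, rfl⟩
    rw [mem_preimage, hi.leftInvOn_invFunOn hx] at hy
    exact ⟨⟨x, ⟨hx, hy⟩, rfl⟩, x, hx, rfl⟩
  · rintro ⟨⟨x, ⟨hx, hxt⟩, rfl⟩, -⟩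
    exact ⟨by rwa [mem_preimage, hi.leftInvOn_invFunOn hx], x, hx, rfl⟩

/-- `f` restricted to `[0, 1]` is an injective parametrization of `A` from `a` to `b`. -/
structure ArcParam (f : ℝ → ℂ) (A : Set ℂ) (a b : ℂ) : Prop where
  cont : ContinuousOn f (Icc 0 1)
  inj : InjOn f (Icc 0 1)
  zero : f 0 = a
  one : f 1 = b
  image : f '' Icc 0 1 = A

/-- `A` is an arc with endpoints `a` and `b`. -/
def IsArc (A : Set ℂ) (a b : ℂ) : Prop := ∃ f, ArcParam f A a b

lemma isArc_image_Icc {f : ℝ → ℂ} {s t : ℝ} (hst : s < t) (hf : ContinuousOn f (Icc s t))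
    (hi : InjOn f (Icc s t)) : IsArc (f '' Icc s t) (f s) (f t) := by
  have hpos : 0 < t - s := sub_pos.2 hst
  have hm : MapsTo (fun u => s + (t - s) * u) (Icc 0 1) (Icc s t) := fun u hu =>
    ⟨by nlinarith [hu.1], by nlinarith [hu.2]⟩
  have him : (fun u => s + (t - s) * u) '' Icc 0 1 = Icc s t := by
    refine Subset.antisymm (image_subset_iff.2 hm) fun x hx => ⟨(x - s) / (t - s), ?_, ?_⟩
    · exact ⟨div_nonneg (sub_nonneg.2 hx.1) hpos.le, (div_le_one hpos).2 (by linarith [hx.2])⟩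
    · field_simp; ring
  refine ⟨fun u => f (s + (t - s) * u), hf.comp (by fun_prop) hm, ?_, by simp, by simp, ?_⟩
  · intro x hx y hy hxy
    have := hi (hm hx) (hm hy) hxy
    simpa [hpos.ne'] using this
  · rw [← him, image_image]

namespace IsArc

variable {A B : Set ℂ} {a b c d : ℂ}

lemma isCompact (h : IsArc A a b) : IsCompact A := by
  obtain ⟨f, h⟩ := h
  exact h.image ▸ isCompact_Icc.image_of_continuousOn h.cont

lemma isClosed (h : IsArc A a b) : IsClosed A := h.isCompact.isClosed

lemma isPreconnected (h : IsArc A a b) : IsPreconnected A := by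
  obtain ⟨f, h⟩ := h
  exact h.image ▸ isPreconnected_Icc.image _ h.cont

lemma left_mem (h : IsArc A a b) : a ∈ A := by
  obtain ⟨f, h⟩ := h
  exact h.image ▸ ⟨0, by simp, h.zero⟩

lemma right_mem (h : IsArc A a b) : b ∈ A := by
  obtain ⟨f, h⟩ := h
  exact h.image ▸ ⟨1, by simp, h.one⟩

lemma ne (h : IsArc A a b) : a ≠ b := by
  obtain ⟨f, h⟩ := h
  intro hab
  have := h.inj (by simp : (0 : ℝ) ∈ Icc (0 : ℝ) 1) (by simp : (1 : ℝ) ∈ Icc (0 : ℝ) 1)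
    (by rw [h.zero, h.one, hab])
  exact zero_ne_one this

lemma symm (h : IsArc A a b) : IsArc A b a := by
  obtain ⟨f, h⟩ := h
  have hm : MapsTo (fun u : ℝ => 1 - u) (Icc 0 1) (Icc 0 1) := fun u hu =>
    ⟨by linarith [hu.2], by linarith [hu.1]⟩
  refine ⟨fun u => f (1 - u), h.cont.comp (by fun_prop) hm, ?_, by simp [h.one], by simp [h.zero], ?_⟩
  · intro x hx y hy hxy
    linarith [h.inj (hm hx) (hm hy) hxy]
  · rw [← h.image, ← image_image f]
    congr 1
    refine Subset.antisymm (image_subset_iff.2 hm) fun x hx => ⟨1 - x, hm hx, by ring⟩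

lemma trans (hA : IsArc A a b) (hB : IsArc B b c) (hAB : A ∩ B = {b}) : IsArc (A ∪ B) a c := by
  obtain ⟨f, hf⟩ := hA
  obtain ⟨g, hg⟩ := hB
  let k : ℝ → ℂ := fun t => if t ≤ 1 then f t else g (t - 1)
  have e₁ : EqOn k f (Icc 0 1) := fun t ht => if_pos ht.2
  have e₂ : EqOn k (fun t => g (t - 1)) (Icc 1 2) := fun t ht => by
    rcases ht.1.eq_or_lt with rfl | h
    · simp [k, hf.one, hg.zero]
    · simp [k, not_le.2 h]
  have hm : MapsTo (fun t : ℝ => t - 1) (Icc 1 2) (Icc 0 1) := fun t ht =>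
    ⟨by linarith [ht.1], by linarith [ht.2]⟩
  have hU : Icc (0 : ℝ) 2 = Icc 0 1 ∪ Icc 1 2 := by
    rw [Icc_union_Icc_eq_Icc] <;> norm_num
  have i₁ : k '' Icc 0 1 = A := by rw [e₁.image_eq, hf.image]
  have i₂ : k '' Icc 1 2 = B := by
    rw [e₂.image_eq, ← hg.image, ← image_image g]
    congr 1
    simp
    norm_num
  have hc : ContinuousOn k (Icc 0 2) := by
    rw [hU]
    exact (hf.cont.congr e₁).union_of_isClosed ((hg.cont.comp (by fun_prop) hm).congr e₂)
      isClosed_Icc isClosed_Icc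
  have inj₁ : InjOn k (Icc 0 1) := hf.inj.congr e₁.symm
  have inj₂ : InjOn k (Icc 1 2) := by
    refine InjOn.congr ?_ e₂.symm
    intro x hx y hy hxy
    linarith [hg.inj (hm hx) (hm hy) hxy]
  have hk1 : k 1 = b := by rw [e₁ (by simp), hf.one]
  have cross : ∀ x ∈ Icc (0 : ℝ) 1, ∀ y ∈ Icc (1 : ℝ) 2, k x = k y → x = y := by
    intro x hx y hy hxy
    have hb : k x ∈ A ∩ B := ⟨i₁ ▸ mem_image_of_mem k hx, hxy ▸ i₂ ▸ mem_image_of_mem k hy⟩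
    rw [hAB, mem_singleton_iff] at hb
    have h1 : x = 1 := inj₁ hx (by simp) (hb.trans hk1.symm)
    have h2 : y = 1 := inj₂ hy (by norm_num) ((hxy.symm.trans hb).trans hk1.symm)
    rw [h1, h2]
  have hi : InjOn k (Icc 0 2) := by
    rw [hU]
    rintro x (hx | hx) y (hy | hy) hxy
    · exact inj₁ hx hy hxy
    · exact cross x hx y hy hxy
    · exact (cross y hy x hx hxy.symm).symm
    · exact inj₂ hx hy hxy
  have := isArc_image_Icc two_pos hc hi
  rw [hU, image_union, i₁, i₂] at this
  convert this using 1
  · rw [e₁ (by simp), hf.zero]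
  · rw [e₂ (by norm_num)]; norm_num; exact hg.one.symm

/-- Splitting an arc at an interior point. -/
lemma split (h : IsArc A a b) (hc : c ∈ A) (hca : c ≠ a) (hcb : c ≠ b) :
    ∃ A₁ A₂, IsArc A₁ a c ∧ IsArc A₂ c b ∧ A₁ ∪ A₂ = A ∧ A₁ ∩ A₂ = {c} := by
  obtain ⟨f, h⟩ := h
  obtain ⟨t, ht, rfl⟩ := h.image ▸ hc
  have h0 : 0 < t := ht.1.lt_of_ne fun e => hca (e ▸ h.zero)
  have h1 : t < 1 := ht.2.lt_of_ne fun e => hcb (e ▸ h.one)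
  have s₁ : Icc 0 t ⊆ Icc 0 1 := Icc_subset_Icc_right h1.le
  have s₂ : Icc t 1 ⊆ Icc 0 1 := Icc_subset_Icc_left h0.le
  refine ⟨f '' Icc 0 t, f '' Icc t 1, ?_, ?_, ?_, ?_⟩
  · exact h.zero ▸ isArc_image_Icc h0 (h.cont.mono s₁) (h.inj.mono s₁)
  · have := isArc_image_Icc h1 (h.cont.mono s₂) (h.inj.mono s₂)
    rwa [h.one] at this
  · rw [← image_union, Icc_union_Icc_eq_Icc h0.le h1.le, h.image]
  · rw [← h.inj.image_inter s₁ s₂, Icc_inter_Icc_eq_singleton h0.le h1.le, image_singleton]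

lemma logAcyclic (h : IsArc A a b) : LogAcyclic A := by
  obtain ⟨f, h⟩ := h
  intro F hF h0
  have hm : MapsTo f (Icc 0 1) A := h.image ▸ mapsTo_image f _
  have hlog : HasLog (fun t => F (f t)) (Icc 0 1) :=
    hasLog_Icc (hF.comp h.cont hm) fun t ht => h0 _ (hm ht)
  obtain ⟨g, hg, hgF⟩ := hlog
  refine ⟨fun z => g (Function.invFunOn f (Icc 0 1) z), ?_, ?_⟩
  · have hinv : ContinuousOn (Function.invFunOn f (Icc 0 1)) A := by
      rw [← h.image]
      exact continuousOn_invFunOn_image isCompact_Icc h.cont h.inj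
    refine hg.comp hinv fun z hz => ?_
    rw [← h.image] at hz
    exact Function.invFunOn_mem hz
  · intro z hz
    rw [← h.image] at hz
    refine (hgF _ (Function.invFunOn_mem hz)).trans ?_
    simp only [Function.invFunOn_eq hz]

/-- Removing an endpoint neighbourhood. -/
lemma exists_subarc {F : Set ℂ} (h : IsArc A a b) (hF : IsClosed F) (ha : a ∉ F) :
    ∃ L c, IsArc L c b ∧ L ⊆ A ∧ a ∉ L ∧ F ∩ A ⊆ L := by
  obtain ⟨f, h⟩ := h
  have hev : ∀ᶠ t in 𝓝[Icc 0 1] (0 : ℝ), f t ∉ F :=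
    (h.cont 0 (by simp)).eventually (hF.isOpen_compl.mem_nhds (by rwa [h.zero]))
  obtain ⟨u, hu0, hsub⟩ := Metric.mem_nhdsWithin_iff.1 hev
  · set s : ℝ := min u 1 / 2 with hs
    have hs0 : 0 < s := by rw [hs]; positivity
    have hs1 : s < 1 := by rw [hs]; linarith [min_le_right u 1]
    have hsu : s < u := by rw [hs]; linarith [min_le_left u 1, lt_min hu0 one_pos]
    have s₂ : Icc s 1 ⊆ Icc 0 1 := Icc_subset_Icc_left hs0.le
    refine ⟨f '' Icc s 1, f s, ?_, ?_, ?_, ?_⟩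
    · have := isArc_image_Icc hs1 (h.cont.mono s₂) (h.inj.mono s₂)
      rwa [h.one] at this
    · rw [← h.image]; exact image_mono s₂
    · rintro ⟨t, ht, hta⟩
      have := h.inj (s₂ ht) (by simp) (hta.trans h.zero.symm)
      linarith [ht.1]
    · rintro z ⟨hzF, hzA⟩
      obtain ⟨t, ht, rfl⟩ := h.image ▸ hzA
      refine ⟨t, ⟨?_, ht.2⟩, rfl⟩
      by_contra! hlt
      exact hsub ⟨by rw [mem_ball, Real.dist_0_eq_abs, abs_of_nonneg ht.1]; linarith, ht⟩ hzF

/-- The interior of an arc is connected and accumulates at the endpoints. -/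
lemma isPreconnected_diff (h : IsArc A a b) : IsPreconnected (A \ {a, b}) := by
  obtain ⟨f, h⟩ := h
  have : A \ {a, b} = f '' Ioo 0 1 := by
    rw [← Icc_sdiff_both, ← h.image, h.inj.image_sdiff,
      inter_eq_right.2 (by simp [insert_subset_iff]), image_pair, h.zero, h.one]
  rw [this]
  exact isPreconnected_Ioo.image _ (h.cont.mono Ioo_subset_Icc_self)

lemma subset_closure_diff (h : IsArc A a b) : A ⊆ closure (A \ {a, b}) := by
  obtain ⟨f, h⟩ := h
  have : A \ {a, b} = f '' Ioo 0 1 := by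
    rw [← Icc_sdiff_both, ← h.image, h.inj.image_sdiff,
      inter_eq_right.2 (by simp [insert_subset_iff]), image_pair, h.zero, h.one]
  rw [this, ← h.image, ← closure_Ioo zero_ne_one]
  have := h.cont
  rw [← closure_Ioo zero_ne_one] at this
  exact this.image_closure

lemma nonempty_diff (h : IsArc A a b) : (A \ {a, b}).Nonempty :=
  closure_nonempty_iff.1 ⟨a, h.subset_closure_diff h.left_mem⟩

/-- `(z - a) / (z - b)` has a logarithm off an arc from `a` to `b`. -/
lemma hasLog_compl (h : IsArc A a b) : HasLog (fun z => (z - a) / (z - b)) Aᶜ := by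
  have hb := h.right_mem
  obtain ⟨f, h⟩ := h
  have hfA : ∀ t : unitInterval, f (unitInterval.symm t) ∈ A := fun t =>
    h.image ▸ mem_image_of_mem f (Subtype.prop _)
  have hne : ∀ z : (Aᶜ : Set ℂ), ∀ w ∈ A, (z : ℂ) - w ≠ 0 := fun z w hw h0 =>
    z.2 (sub_eq_zero.1 h0 ▸ hw)
  have hfc : Continuous fun t : unitInterval => f (unitInterval.symm t) :=
    h.cont.comp_continuous (by fun_prop) fun t => Subtype.prop _
  let H : C(unitInterval × (Aᶜ : Set ℂ), {z : ℂ // z ≠ 0}) :=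
    ⟨fun x => ⟨((x.2 : ℂ) - f (unitInterval.symm x.1)) / ((x.2 : ℂ) - b),
      div_ne_zero (hne _ _ (hfA _)) (hne _ _ hb)⟩, by
      refine Continuous.subtype_mk (Continuous.div ?_ (by fun_prop) fun x => hne _ _ hb) _
      exact (by fun_prop : Continuous fun x : unitInterval × (Aᶜ : Set ℂ) => (x.2 : ℂ)).sub
        (hfc.comp continuous_fst)⟩
  have H0 : ∀ z : (Aᶜ : Set ℂ), H (0, z) = ⟨Complex.exp 0, Complex.exp_ne_zero 0⟩ := fun z => by
    apply Subtype.ext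
    simp [H, h.one, div_self (hne z b hb)]
  let G := Complex.isCoveringMap_exp.liftHomotopy H (ContinuousMap.const _ 0) H0
  have hG := Complex.isCoveringMap_exp.liftHomotopy_lifts H (ContinuousMap.const _ 0) H0
  classical
  refine ⟨fun z => if hz : z ∈ Aᶜ then G (1, ⟨z, hz⟩) else 0, ?_, ?_⟩
  · rw [continuousOn_iff_continuous_domRestrict]
    have : Continuous fun z : (Aᶜ : Set ℂ) => G (1, z) := G.continuous.comp (by fun_prop)
    convert this using 2 with z
    simp only [domRestrict_apply, dif_pos z.2]
  · intro z hz
    have := congrArg Subtype.val (congrFun hG (1, ⟨z, hz⟩))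
    simp only [dif_pos hz]
    refine this.trans ?_
    simp [H, h.zero]

end IsArc

/-! ### Jordan curves -/

/-- The arcs `A` and `B` from `a` to `b` meet only at their endpoints. -/
structure ArcPair (A B : Set ℂ) (a b : ℂ) : Prop where
  left : IsArc A a b
  right : IsArc B a b
  inter : A ∩ B = {a, b}

/-- A Jordan curve in the plane, as a union of two arcs. -/
def IsJordanCurve (J : Set ℂ) : Prop := ∃ A B a b, ArcPair A B a b ∧ J = A ∪ B

lemma ArcPair.symm {A B : Set ℂ} {a b : ℂ} (h : ArcPair A B a b) : ArcPair B A a b :=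
  ⟨h.right, h.left, by rw [inter_comm, h.inter]⟩

lemma ArcPair.reverse {A B : Set ℂ} {a b : ℂ} (h : ArcPair A B a b) : ArcPair A B b a :=
  ⟨h.left.symm, h.right.symm, by rw [h.inter, pair_comm]⟩

lemma ArcPair.isJordanCurve {A B : Set ℂ} {a b : ℂ} (h : ArcPair A B a b) : IsJordanCurve (A ∪ B) :=
  ⟨A, B, a, b, h, rfl⟩

lemma ArcPair.exists_of_mem_left {A B : Set ℂ} {a b d : ℂ} (h : ArcPair A B a b) (hd : d ∈ A)
    (hda : d ≠ a) : ∃ A' B', ArcPair A' B' a d ∧ A' ∪ B' = A ∪ B := by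
  rcases eq_or_ne d b with rfl | hdb
  · exact ⟨A, B, h, rfl⟩
  obtain ⟨A₁, A₂, h₁, h₂, hU, hI⟩ := h.left.split hd hda hdb
  have hA₁ : A₁ ⊆ A := hU ▸ subset_union_left
  have hA₂ : A₂ ⊆ A := hU ▸ subset_union_right
  have ha₂ : a ∉ A₂ := fun ha => hda (hI.subset ⟨h₁.left_mem, ha⟩).symm
  have hb₁ : b ∉ A₁ := fun hb => hdb (hI.subset ⟨hb, h₂.right_mem⟩).symm
  have hdB : d ∉ B := fun hdB => (h.inter.subset ⟨hd, hdB⟩).elim hda hdb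
  refine ⟨A₁, A₂ ∪ B, ⟨h₁, ?_, ?_⟩, by rw [← union_assoc, hU]⟩
  · refine (h₂.trans h.right.symm ?_).symm
    refine Subset.antisymm (fun z hz => ?_)
      (singleton_subset_iff.2 ⟨h₂.right_mem, h.right.right_mem⟩)
    exact (h.inter.subset ⟨hA₂ hz.1, hz.2⟩).elim (fun e => absurd hz.1 (e ▸ ha₂)) id
  · rw [inter_union_distrib_left, hI]
    refine Subset.antisymm ?_ ?_
    · rintro z (hz | hz)
      · exact Or.inr hz
      · exact (h.inter.subset ⟨hA₁ hz.1, hz.2⟩).elim Or.inl fun e => absurd hz.1 (e ▸ hb₁)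
    · rintro z (rfl | rfl)
      · exact Or.inr ⟨h₁.left_mem, h.right.left_mem⟩
      · exact Or.inl rfl

namespace IsJordanCurve

variable {J : Set ℂ}

/-- A Jordan curve is the union of two arcs joining any two of its points. -/
lemma exists_arcPair (h : IsJordanCurve J) {c d : ℂ} (hc : c ∈ J) (hd : d ∈ J) (hcd : c ≠ d) :
    ∃ A B, ArcPair A B c d ∧ J = A ∪ B := by
  have step : ∀ {a b x : ℂ} {A B : Set ℂ}, ArcPair A B a b → x ∈ A ∪ B → x ≠ a →
      ∃ A' B', ArcPair A' B' a x ∧ A' ∪ B' = A ∪ B := by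
    intro a b x A B h hx hxa
    rcases hx with hx | hx
    · exact h.exists_of_mem_left hx hxa
    · obtain ⟨A', B', h', hU⟩ := h.symm.exists_of_mem_left hx hxa
      exact ⟨A', B', h', by rw [hU, union_comm]⟩
  obtain ⟨A, B, a, b, h, rfl⟩ := h
  have key : ∃ A' B' x, ArcPair A' B' c x ∧ A' ∪ B' = A ∪ B := by
    rcases eq_or_ne c a with rfl | hca
    · exact ⟨A, B, b, h, rfl⟩
    · obtain ⟨A', B', h', hU⟩ := step h hc hca
      exact ⟨A', B', a, h'.reverse, hU⟩
  obtain ⟨A', B', x, h', hU⟩ := key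
  obtain ⟨A'', B'', h'', hU'⟩ := step h' (hU ▸ hd) hcd.symm
  exact ⟨A'', B'', h'', by rw [hU', hU]⟩

lemma isCompact (h : IsJordanCurve J) : IsCompact J := by
  obtain ⟨A, B, a, b, h, rfl⟩ := h
  exact h.left.isCompact.union h.right.isCompact

lemma isClosed (h : IsJordanCurve J) : IsClosed J := h.isCompact.isClosed

lemma exists_ne (h : IsJordanCurve J) (x : ℂ) : ∃ y ∈ J, y ≠ x := by
  obtain ⟨A, B, a, b, h, rfl⟩ := h
  by_cases hx : a = x
  · exact ⟨b, Or.inl h.left.right_mem, hx ▸ h.left.ne.symm⟩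
  · exact ⟨a, Or.inl h.left.left_mem, hx⟩

lemma nonempty (h : IsJordanCurve J) : J.Nonempty :=
  let ⟨y, hy, _⟩ := h.exists_ne 0
  ⟨y, hy⟩

/-- A closed part of a Jordan curve missing the point `x` lies in an arc missing `x`. -/
lemma exists_arc_of_notMem (h : IsJordanCurve J) {x : ℂ} (hx : x ∈ J) {F : Set ℂ} (hF : IsClosed F)
    (hxF : x ∉ F) : ∃ L c d, IsArc L c d ∧ L ⊆ J ∧ x ∉ L ∧ F ∩ J ⊆ L := by
  obtain ⟨y, hy, hyx⟩ := h.exists_ne x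
  obtain ⟨A, B, hAB, rfl⟩ := h.exists_arcPair hx hy hyx.symm
  clear h
  have h := hAB
  obtain ⟨L, c, hL, hLA, hxL, hFL⟩ := h.left.exists_subarc hF hxF
  obtain ⟨M, d, hM, hMB, hxM, hFM⟩ := h.right.exists_subarc hF hxF
  refine ⟨L ∪ M, c, d, hL.trans hM.symm ?_, union_subset_union hLA hMB, by simp [hxL, hxM], ?_⟩
  · refine Subset.antisymm (fun z hz => ?_) (singleton_subset_iff.2 ⟨hL.right_mem, hM.right_mem⟩)
    exact (h.inter.subset ⟨hLA hz.1, hMB hz.2⟩).elim (fun e => absurd hz.1 (e ▸ hxL)) id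
  · rintro z ⟨hzF, hz | hz⟩
    · exact Or.inl (hFL ⟨hzF, hz⟩)
    · exact Or.inr (hFM ⟨hzF, hz⟩)

/-- A Jordan curve separates the plane. -/
lemma not_isPreconnected_compl (h : IsJordanCurve J) : ¬ IsPreconnected Jᶜ := by
  obtain ⟨A, B, a, b, h, rfl⟩ := h
  intro hJ
  rw [compl_union] at hJ
  have hlog := h.left.hasLog_compl.union_of_isOpen h.left.isClosed.isOpen_compl
    h.right.isClosed.isOpen_compl hJ h.right.hasLog_compl
  rw [← compl_inter, h.inter] at hlog
  have hab := h.left.ne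
  have hr : 0 < ‖a - b‖ / 2 := by have := norm_pos_iff.2 (sub_ne_zero.2 hab); positivity
  have hsub : sphere a (‖a - b‖ / 2) ⊆ ({a, b} : Set ℂ)ᶜ := by
    rintro z hz (rfl | rfl)
    · rw [mem_sphere, dist_self] at hz; linarith
    · rw [mem_sphere, dist_comm, dist_eq_norm] at hz; linarith
  have h2 : HasLog (fun z => (a - b) * (1 + (z - a) / (a - b))) (sphere a (‖a - b‖ / 2)) := by
    refine (hasLog_const (sub_ne_zero.2 hab)).mul (hasLog_of_mem_slitPlane (by fun_prop) ?_)
    intro z hz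
    refine Complex.mem_slitPlane_of_norm_lt_one ?_
    rw [mem_sphere, dist_eq_norm] at hz
    rw [norm_div, hz, div_lt_one (norm_pos_iff.2 (sub_ne_zero.2 hab))]
    linarith
  have h3 := (hlog.mono hsub).mul h2
  have := zpow_no_log_sphere hr (p := a) (m := 1) (h3.congr fun z hz => ?_)
  · simp at this
  · have hzb : z - b ≠ 0 := fun h0 => hsub hz (Or.inr (sub_eq_zero.1 h0))
    have := sub_ne_zero.2 hab
    field_simp
    ring

end IsJordanCurve

/-- The inside of a Jordan curve. -/
def Ins (J : Set ℂ) : Set ℂ := {p | p ∉ J ∧ ¬ HasLog (fun z => z - p) J}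

/-- The outside of a Jordan curve. -/
def Outs (J : Set ℂ) : Set ℂ := {p | p ∉ J ∧ HasLog (fun z => z - p) J}

lemma compl_eq_ins_union_ext (J : Set ℂ) : Jᶜ = Ins J ∪ Outs J := by
  ext z
  simp only [mem_compl_iff, mem_union, Ins, Outs, mem_ofPred_eq]
  tauto

lemma disjoint_ins_ext (J : Set ℂ) : Disjoint (Ins J) (Outs J) :=
  disjoint_left.2 fun _ h h' => h.2 h'.2

lemma disjoint_ins_self (J : Set ℂ) : Disjoint (Ins J) J :=
  disjoint_left.2 fun _ h => h.1

lemma disjoint_ext_self (J : Set ℂ) : Disjoint (Outs J) J :=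
  disjoint_left.2 fun _ h => h.1

lemma NotSep.hasLog_of_hasLog {K : Set ℂ} (hK : IsCompact K) {p q : ℂ} (h : NotSep K p q)
    (hp : HasLog (fun z => z - p) K) : HasLog (fun z => z - q) K := by
  obtain ⟨V, h1, h2, h3, h4⟩ := h
  refine ((hasLog_of_isPreconnected hK h1 h2 h4 h3).mul hp).congr fun z hz => ?_
  exact div_mul_cancel₀ _ (hp.ne_zero hz)

lemma mem_ext_of_isPreconnected {K V : Set ℂ} (hK : IsCompact K) (hV : IsPreconnected V)
    (hVK : Disjoint V K) {p : ℂ} (hp : p ∈ V) (hpE : p ∈ Outs K) : V ⊆ Outs K := fun q hq =>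
  ⟨disjoint_left.1 hVK hq, NotSep.hasLog_of_hasLog hK ⟨V, hV, hVK, hp, hq⟩ hpE.2⟩

lemma mem_ins_of_isPreconnected {K V : Set ℂ} (hK : IsCompact K) (hV : IsPreconnected V)
    (hVK : Disjoint V K) {p : ℂ} (hp : p ∈ V) (hpI : p ∈ Ins K) : V ⊆ Ins K := fun q hq =>
  ⟨disjoint_left.1 hVK hq, fun h =>
    hpI.2 (NotSep.hasLog_of_hasLog hK ⟨V, hV, hVK, hq, hp⟩ h)⟩

lemma isPreconnected_ext {K : Set ℂ} (hK : IsCompact K) : IsPreconnected (Outs K) :=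
  isPreconnected_of_forall_pair fun p hp q hq => by
    obtain ⟨V, h1, h2, h3, h4⟩ := (notSep_iff_hasLog hK hp.1 hq.1).2 (hp.2.div hq.2)
    exact ⟨V, mem_ext_of_isPreconnected hK h1 h2 h3 hp, h3, h4, h1⟩

lemma exists_component_nhds {K : Set ℂ} (hK : IsCompact K) {p : ℂ} (hp : p ∉ K) :
    ∃ ε > 0, Disjoint (ball p ε) K := by
  obtain ⟨ε, hε, h⟩ := Metric.isOpen_iff.1 hK.isClosed.isOpen_compl p hp
  exact ⟨ε, hε, disjoint_left.2 h⟩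

lemma isOpen_ext {K : Set ℂ} (hK : IsCompact K) : IsOpen (Outs K) := by
  refine Metric.isOpen_iff.2 fun p hp => ?_
  obtain ⟨ε, hε, h⟩ := exists_component_nhds hK hp.1
  exact ⟨ε, hε, mem_ext_of_isPreconnected hK (convex_ball p ε).isPreconnected h
    (mem_ball_self hε) hp⟩

lemma isOpen_ins {K : Set ℂ} (hK : IsCompact K) : IsOpen (Ins K) := by
  refine Metric.isOpen_iff.2 fun p hp => ?_
  obtain ⟨ε, hε, h⟩ := exists_component_nhds hK hp.1
  exact ⟨ε, hε, mem_ins_of_isPreconnected hK (convex_ball p ε).isPreconnected h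
    (mem_ball_self hε) hp⟩

lemma mem_ext_of_norm_lt {K : Set ℂ} {p : ℂ} (h : ∀ z ∈ K, ‖z‖ < ‖p‖) : p ∈ Outs K :=
  ⟨fun hp => lt_irrefl _ (h p hp), hasLog_of_norm_lt h⟩

lemma isBounded_ins {K : Set ℂ} (hK : IsCompact K) : Bornology.IsBounded (Ins K) := by
  obtain ⟨R, hR⟩ := hK.isBounded.subset_closedBall 0
  refine (isBounded_closedBall (x := (0 : ℂ)) (r := R)).subset fun p hp => ?_
  by_contra hpR
  rw [mem_closedBall_zero_iff, not_le] at hpR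
  exact hp.2 (hasLog_of_norm_lt fun z hz => (mem_closedBall_zero_iff.1 (hR hz)).trans_lt hpR)

/-- A preconnected unbounded set missing `K` is outside. -/
lemma subset_ext_of_not_isBounded {K V : Set ℂ} (hK : IsCompact K) (hV : IsPreconnected V)
    (hVK : Disjoint V K) (hb : ¬ Bornology.IsBounded V) : V ⊆ Outs K := by
  obtain ⟨p, hp, hpI⟩ : ∃ p ∈ V, p ∉ Ins K := by
    by_contra! h
    exact hb ((isBounded_ins hK).subset h)
  have : p ∈ Ins K ∪ Outs K := compl_eq_ins_union_ext K ▸ disjoint_left.1 hVK hp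
  exact mem_ext_of_isPreconnected hK hV hVK hp (this.resolve_left hpI)

lemma not_isBounded_ext {K : Set ℂ} (hK : IsCompact K) : ¬ Bornology.IsBounded (Outs K) := by
  intro hb
  obtain ⟨R, hR⟩ := (hb.union hK.isBounded).subset_closedBall 0
  have : ((|R| + 1 : ℝ) : ℂ) ∈ Outs K := mem_ext_of_norm_lt fun z hz => by
    have h1 := mem_closedBall_zero_iff.1 (hR (Or.inr hz))
    rw [Complex.norm_real, Real.norm_of_nonneg (by positivity)]
    linarith [le_abs_self R]
  have h2 := mem_closedBall_zero_iff.1 (hR (Or.inl this))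
  rw [Complex.norm_real, Real.norm_of_nonneg (by positivity)] at h2
  linarith [le_abs_self R]

namespace IsJordanCurve

variable {J : Set ℂ}

lemma ins_nonempty (h : IsJordanCurve J) : (Ins J).Nonempty := by
  by_contra hne
  rw [not_nonempty_iff_eq_empty] at hne
  apply h.not_isPreconnected_compl
  rw [compl_eq_ins_union_ext, hne, empty_union]
  exact isPreconnected_ext h.isCompact

/-- The degree argument: some nontrivial combination of two nonvanishing functions on a Jordan
curve has a logarithm. -/
lemma exists_zpow_mul_hasLog (h : IsJordanCurve J) {f₁ f₂ : ℂ → ℂ} (hf₁ : ContinuousOn f₁ J)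
    (hf₂ : ContinuousOn f₂ J) (h₁ : ∀ z ∈ J, f₁ z ≠ 0) (h₂ : ∀ z ∈ J, f₂ z ≠ 0)
    (hno : ¬ HasLog f₁ J) : ∃ m k : ℤ, m ≠ 0 ∧ HasLog (fun z => f₂ z ^ m * f₁ z ^ k) J := by
  obtain ⟨A, B, a, b, h, rfl⟩ := h
  have glue : ∀ {f gA gB : ℂ → ℂ}, ContinuousOn gA A → ContinuousOn gB B →
      (∀ z ∈ A, Complex.exp (gA z) = f z) → (∀ z ∈ B, Complex.exp (gB z) = f z) →
      gA a - gB a = gA b - gB b → HasLog f (A ∪ B) := by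
    classical
    intro f gA gB hA hB eA eB hab
    have e₁ : EqOn (fun z => if z ∈ A then gA z else gB z + (gA a - gB a)) gA A :=
      fun z hz => if_pos hz
    have e₂ : EqOn (fun z => if z ∈ A then gA z else gB z + (gA a - gB a))
        (fun z => gB z + (gA a - gB a)) B := fun z hz => by
      by_cases hzA : z ∈ A
      · simp only [hzA, if_true]
        rcases h.inter.subset ⟨hzA, hz⟩ with rfl | rfl
        · ring
        · rw [hab]; ring
      · simp [hzA]
    refine ⟨_, (hA.congr e₁).union_of_isClosed ((hB.add continuousOn_const).congr e₂)
      h.left.isClosed h.right.isClosed, ?_⟩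
    have hexp : Complex.exp (gA a - gB a) = 1 := by
      rw [Complex.exp_sub, eA a h.left.left_mem, eB a h.right.left_mem, div_self]
      rw [← eA a h.left.left_mem]
      exact Complex.exp_ne_zero _
    rintro z (hz | hz)
    · exact (congrArg Complex.exp (e₁ hz)).trans (eA z hz)
    · refine (congrArg Complex.exp (e₂ hz)).trans ?_
      simp only [Complex.exp_add, hexp, mul_one, eB z hz]
  obtain ⟨g₁A, c₁A, e₁A⟩ := h.left.logAcyclic f₁ (hf₁.mono subset_union_left)
    fun z hz => h₁ z (Or.inl hz)
  obtain ⟨g₁B, c₁B, e₁B⟩ := h.right.logAcyclic f₁ (hf₁.mono subset_union_right)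
    fun z hz => h₁ z (Or.inr hz)
  obtain ⟨g₂A, c₂A, e₂A⟩ := h.left.logAcyclic f₂ (hf₂.mono subset_union_left)
    fun z hz => h₂ z (Or.inl hz)
  obtain ⟨g₂B, c₂B, e₂B⟩ := h.right.logAcyclic f₂ (hf₂.mono subset_union_right)
    fun z hz => h₂ z (Or.inr hz)
  have int : ∀ {f gA gB : ℂ → ℂ}, (∀ z ∈ A, Complex.exp (gA z) = f z) →
      (∀ z ∈ B, Complex.exp (gB z) = f z) → ∀ z ∈ A ∩ B,
      ∃ n : ℤ, gA z - gB z = n * (2 * Real.pi * Complex.I) := fun eA eB z hz => by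
    obtain ⟨n, hn⟩ := Complex.exp_eq_exp_iff_exists_int.1 ((eA z hz.1).trans (eB z hz.2).symm)
    exact ⟨n, by rw [hn]; ring⟩
  have ha : a ∈ A ∩ B := ⟨h.left.left_mem, h.right.left_mem⟩
  have hb : b ∈ A ∩ B := ⟨h.left.right_mem, h.right.right_mem⟩
  obtain ⟨n₁, hn₁⟩ := int e₁A e₁B a ha
  obtain ⟨m₁, hm₁⟩ := int e₁A e₁B b hb
  obtain ⟨n₂, hn₂⟩ := int e₂A e₂B a ha
  obtain ⟨m₂, hm₂⟩ := int e₂A e₂B b hb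
  refine ⟨n₁ - m₁, -(n₂ - m₂), fun h0 => hno (glue c₁A c₁B e₁A e₁B ?_), ?_⟩
  · rw [hn₁, hm₁, sub_eq_zero.1 h0]
  · refine glue (gA := fun z => ((n₁ - m₁ : ℤ) : ℂ) * g₂A z + ((-(n₂ - m₂) : ℤ) : ℂ) * g₁A z)
      (gB := fun z => ((n₁ - m₁ : ℤ) : ℂ) * g₂B z + ((-(n₂ - m₂) : ℤ) : ℂ) * g₁B z)
      (by fun_prop) (by fun_prop) ?_ ?_ ?_
    · intro z hz
      rw [Complex.exp_add, Complex.exp_int_mul, Complex.exp_int_mul, e₁A z hz, e₂A z hz]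
    · intro z hz
      rw [Complex.exp_add, Complex.exp_int_mul, Complex.exp_int_mul, e₁B z hz, e₂B z hz]
    · push_cast
      linear_combination ((n₁ : ℂ) - m₁) * (hn₂ - hm₂) - ((n₂ : ℂ) - m₂) * (hn₁ - hm₁)

lemma frontier_component_eq (h : IsJordanCurve J) {p : ℂ} (hp : p ∉ J) :
    frontier (connectedComponentIn Jᶜ p) = J := by
  refine Subset.antisymm (frontier_component_subset h.isClosed p) fun x hx => ?_
  by_contra hxF
  obtain ⟨L, c, d, hL, hLJ, hxL, hFL⟩ := h.exists_arc_of_notMem hx isClosed_frontier hxF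
  rw [inter_eq_left.2 (frontier_component_subset h.isClosed p)] at hFL
  have hpre := hL.logAcyclic.isPreconnected_compl hL.isCompact
  have hpV : p ∈ connectedComponentIn Jᶜ p := mem_connectedComponentIn hp
  have hsub : Lᶜ ⊆ connectedComponentIn Jᶜ p := by
    refine hpre.subset_of_closure_inter_subset h.isClosed.isOpen_compl.connectedComponentIn
      ⟨p, fun hpL => hp (hLJ hpL), hpV⟩ ?_
    rintro z ⟨hz, hzL⟩
    by_contra hzV
    exact hzL (hFL ⟨hz, by rwa [h.isClosed.isOpen_compl.connectedComponentIn.interior_eq]⟩)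
  exact connectedComponentIn_subset _ _ (hsub hxL) hx

lemma component_eq_ins (h : IsJordanCurve J) {p : ℂ} (hp : p ∈ Ins J) :
    connectedComponentIn Jᶜ p = Ins J := by
  have hVI : connectedComponentIn Jᶜ p ⊆ Ins J :=
    mem_ins_of_isPreconnected h.isCompact isPreconnected_connectedComponentIn
    (disjoint_left.2 fun z hz => connectedComponentIn_subset _ _ hz)
    (mem_connectedComponentIn hp.1) hp
  refine Subset.antisymm hVI fun q hq => ?_
  by_contra hqV
  have hne : ∀ x ∈ Ins J, ∀ z ∈ J, z - x ≠ 0 := fun x hx z hz h0 =>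
    hx.1 (sub_eq_zero.1 h0 ▸ hz)
  obtain ⟨m, k, hm, hlog⟩ := h.exists_zpow_mul_hasLog (f₁ := fun z => z - q)
    (f₂ := fun z => z - p) (by fun_prop) (by fun_prop) (hne q hq) (hne p hp) hq.2
  have hopen := h.isClosed.isOpen_compl.connectedComponentIn (x := p)
  have hcl : ∀ z ∈ closure (connectedComponentIn Jᶜ p), z - q ≠ 0 := by
    intro z hz h0
    rw [sub_eq_zero] at h0
    subst h0
    have : z ∈ frontier (connectedComponentIn Jᶜ p) := ⟨hz, by rwa [hopen.interior_eq]⟩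
    exact hq.1 (frontier_component_subset h.isClosed p this)
  refine hm (zpow_eq_zero_of_hasLog_frontier hopen ((isBounded_ins h.isCompact).subset hVI)
    (mem_connectedComponentIn hp.1) (u := fun z => (z - q) ^ (-k)) ?_ ?_ ?_)
  · exact ContinuousOn.zpow₀ (by fun_prop) _ fun z hz => Or.inl (hcl z hz)
  · exact fun z hz => zpow_ne_zero _ (hcl z hz)
  · refine (hlog.mono (frontier_component_subset h.isClosed p)).congr fun z hz => ?_
    simp [zpow_neg]

lemma isPreconnected_ins (h : IsJordanCurve J) : IsPreconnected (Ins J) := by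
  obtain ⟨p, hp⟩ := h.ins_nonempty
  exact h.component_eq_ins hp ▸ isPreconnected_connectedComponentIn

lemma frontier_ins (h : IsJordanCurve J) : frontier (Ins J) = J := by
  obtain ⟨p, hp⟩ := h.ins_nonempty
  exact h.component_eq_ins hp ▸ h.frontier_component_eq hp.1

lemma frontier_ext (h : IsJordanCurve J) : frontier (Outs J) = J := by
  have hne : (Outs J).Nonempty := by
    by_contra hne
    rw [not_nonempty_iff_eq_empty] at hne
    exact not_isBounded_ext h.isCompact (hne ▸ Bornology.isBounded_empty)
  obtain ⟨p, hp⟩ := hne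
  have : connectedComponentIn Jᶜ p = Outs J := by
    refine Subset.antisymm ?_ ((isPreconnected_ext h.isCompact).subset_connectedComponentIn hp
      fun z hz => hz.1)
    exact mem_ext_of_isPreconnected h.isCompact isPreconnected_connectedComponentIn
      (disjoint_left.2 fun z hz => connectedComponentIn_subset _ _ hz)
      (mem_connectedComponentIn hp.1) hp
  exact this ▸ h.frontier_component_eq hp.1

lemma closure_ins (h : IsJordanCurve J) : closure (Ins J) = J ∪ Ins J := by
  rw [closure_eq_self_union_frontier, h.frontier_ins, union_comm]

/-- Nonvanishing functions on the closed inside have logarithms on the curve. -/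
lemma hasLog_of_closure (h : IsJordanCurve J) {G : ℂ → ℂ} (hG : ContinuousOn G (J ∪ Ins J))
    (h0 : ∀ z ∈ J ∪ Ins J, G z ≠ 0) : HasLog G J := by
  by_contra hno
  obtain ⟨p, hp⟩ := h.ins_nonempty
  obtain ⟨m, k, hm, hlog⟩ := h.exists_zpow_mul_hasLog (f₁ := G) (f₂ := fun z => z - p)
    (hG.mono subset_union_left) (by fun_prop) (fun z hz => h0 z (Or.inl hz))
    (fun z hz e => hp.1 (sub_eq_zero.1 e ▸ hz)) hno
  refine hm (zpow_eq_zero_of_hasLog_frontier (isOpen_ins h.isCompact) (isBounded_ins h.isCompact)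
    hp (u := fun z => G z ^ (-k)) ?_ ?_ ?_)
  · rw [h.closure_ins]
    exact ContinuousOn.zpow₀ hG _ fun z hz => Or.inl (h0 z hz)
  · rw [h.closure_ins]
    exact fun z hz => zpow_ne_zero _ (h0 z hz)
  · rw [h.frontier_ins]
    exact hlog.congr fun z _ => by simp [zpow_neg]

end IsJordanCurve

/-! ### Theta curves -/

/-- The closed region bounded by `J`. -/
def Reg (J : Set ℂ) : Set ℂ := J ∪ Ins J

lemma compl_reg (J : Set ℂ) : (Reg J)ᶜ = Outs J := by
  ext z
  simp only [Reg, Ins, Outs, mem_compl_iff, mem_union, mem_ofPred_eq]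
  tauto

lemma mem_reg_or_mem_outs (J : Set ℂ) (z : ℂ) : z ∈ Reg J ∨ z ∈ Outs J := by
  rw [← compl_reg]; exact em _

namespace IsJordanCurve

variable {J : Set ℂ}

lemma closure_ins_eq_reg (h : IsJordanCurve J) : closure (Ins J) = Reg J := h.closure_ins

lemma isCompact_reg (h : IsJordanCurve J) : IsCompact (Reg J) := by
  rw [← h.closure_ins_eq_reg]
  exact (isBounded_ins h.isCompact).isCompact_closure

lemma isPreconnected_reg (h : IsJordanCurve J) : IsPreconnected (Reg J) := by
  rw [← h.closure_ins_eq_reg]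
  exact h.isPreconnected_ins.closure

lemma subset_reg (J : Set ℂ) : J ⊆ Reg J := subset_union_left

lemma notSep_reg (h : IsJordanCurve J) {p q : ℂ} (hp : p ∉ Reg J) (hq : q ∉ Reg J) :
    NotSep (Reg J) p q := by
  rw [← mem_compl_iff, compl_reg] at hp hq
  refine ⟨_, isPreconnected_ext h.isCompact, ?_, hp, hq⟩
  rw [← compl_reg]
  exact disjoint_compl_left

lemma closure_outs (h : IsJordanCurve J) : closure (Outs J) = J ∪ Outs J := by
  rw [closure_eq_self_union_frontier, h.frontier_ext, union_comm]

/-- Monotonicity of insides. -/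
lemma ins_subset_of_subset_reg {J' : Set ℂ} (h : IsJordanCurve J) (h' : IsJordanCurve J')
    (hJ : J' ⊆ Reg J) : Ins J' ⊆ Reg J := by
  have : Outs J ⊆ Outs J' := by
    refine subset_ext_of_not_isBounded h'.isCompact (isPreconnected_ext h.isCompact) ?_
      (not_isBounded_ext h.isCompact)
    rw [← compl_reg]
    exact disjoint_compl_left.mono_right hJ
  intro z hz
  by_contra hzR
  rw [← mem_compl_iff, compl_reg] at hzR
  exact disjoint_left.1 (disjoint_ins_ext J') hz (this hzR)

lemma reg_subset_ins {J' : Set ℂ} (h : IsJordanCurve J) (h' : IsJordanCurve J')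
    (hJ : J' ⊆ Ins J) : Reg J' ⊆ Ins J := by
  have h1 : Ins J' ⊆ Reg J := h.ins_subset_of_subset_reg h' (hJ.trans subset_union_right)
  refine union_subset hJ fun z hz => (h1 hz).resolve_left fun hzJ => ?_
  have : z ∈ closure (Outs J) := h.closure_outs ▸ Or.inl hzJ
  obtain ⟨w, hw, hw'⟩ := mem_closure_iff.1 this _ (isOpen_ins h'.isCompact) hz
  have h2 := h1 hw
  rw [← compl_reg] at hw'
  exact hw' h2

lemma ins_subset_ins {J' : Set ℂ} (h : IsJordanCurve J) (h' : IsJordanCurve J')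
    (hJ : J' ⊆ Reg J) : Ins J' ⊆ Ins J := by
  have h1 : Ins J' ⊆ Reg J := h.ins_subset_of_subset_reg h' hJ
  refine fun z hz => (h1 hz).resolve_left fun hzJ => ?_
  have : z ∈ closure (Outs J) := h.closure_outs ▸ Or.inl hzJ
  obtain ⟨w, hw, hw'⟩ := mem_closure_iff.1 this _ (isOpen_ins h'.isCompact) hz
  have h2 := h1 hw
  rw [← compl_reg] at hw'
  exact hw' h2

end IsJordanCurve

/-- `T` is a crosscut from `a` to `b` of the Jordan curve `A ∪ B`. -/
structure Theta (A B T : Set ℂ) (a b : ℂ) : Prop where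
  pair : ArcPair A B a b
  arc : IsArc T a b
  sub : T \ {a, b} ⊆ Ins (A ∪ B)

namespace Theta

variable {A B T : Set ℂ} {a b : ℂ}

lemma symm (h : Theta A B T a b) : Theta B A T a b :=
  ⟨h.pair.symm, h.arc, by rw [union_comm]; exact h.sub⟩

lemma subset_reg (h : Theta A B T a b) : T ⊆ Reg (A ∪ B) := fun z hz => by
  by_cases hz' : z ∈ ({a, b} : Set ℂ)
  · exact Or.inl (Or.inl (h.pair.inter.symm.subset hz').1)
  · exact Or.inr (h.sub ⟨hz, hz'⟩)

lemma pairLeft (h : Theta A B T a b) : ArcPair A T a b := by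
  refine ⟨h.pair.left, h.arc, Subset.antisymm (fun z hz => ?_) ?_⟩
  · by_contra hz'
    exact (h.sub ⟨hz.2, hz'⟩).1 (Or.inl hz.1)
  · exact fun z hz => ⟨(h.pair.inter.symm.subset hz).1,
      hz.elim (fun e => e ▸ h.arc.left_mem) fun e => by
        rw [mem_singleton_iff] at e; exact e ▸ h.arc.right_mem⟩

lemma pairRight (h : Theta A B T a b) : ArcPair B T a b := h.symm.pairLeft

lemma outs_subset (h : Theta A B T a b) : Outs (A ∪ B) ⊆ Outs (A ∪ T) := by
  refine subset_ext_of_not_isBounded h.pairLeft.isJordanCurve.isCompact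
    (isPreconnected_ext h.pair.isJordanCurve.isCompact) ?_
    (not_isBounded_ext h.pair.isJordanCurve.isCompact)
  rw [← compl_reg]
  exact disjoint_compl_left.mono_right
    (union_subset (subset_union_left.trans subset_union_left) h.subset_reg)

/-- The opposite open arc lies outside. -/
lemma diff_subset_outs (h : Theta A B T a b) : B \ {a, b} ⊆ Outs (A ∪ T) := by
  intro z hz
  have h1 : z ∈ closure (Outs (A ∪ T)) := by
    refine closure_mono h.outs_subset ?_
    rw [h.pair.isJordanCurve.closure_outs]
    exact Or.inl (Or.inr hz.1)
  rw [h.pairLeft.isJordanCurve.closure_outs] at h1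
  refine h1.resolve_left ?_
  rintro (hA | hT)
  · exact hz.2 (h.pair.inter.subset ⟨hA, hz.1⟩)
  · exact hz.2 (h.pairRight.inter.subset ⟨hz.1, hT⟩)

lemma disjoint_ins_right (h : Theta A B T a b) : Disjoint (Ins (A ∪ T)) B := by
  refine disjoint_left.2 fun z hz hzB => ?_
  by_cases hz' : z ∈ ({a, b} : Set ℂ)
  · exact hz.1 (Or.inl (h.pair.inter.symm.subset hz').1)
  · exact disjoint_left.1 (disjoint_ins_ext _) hz (h.diff_subset_outs ⟨hzB, hz'⟩)

lemma ins_left_subset (h : Theta A B T a b) : Ins (A ∪ T) ⊆ Ins (A ∪ B) \ T := fun z hz => by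
  refine ⟨?_, fun hT => hz.1 (Or.inr hT)⟩
  have : z ∈ (A ∪ B)ᶜ := by
    rintro (hA | hB)
    · exact hz.1 (Or.inl hA)
    · exact disjoint_left.1 h.disjoint_ins_right hz hB
  rw [compl_eq_ins_union_ext] at this
  exact this.resolve_right fun ho => disjoint_left.1 (disjoint_ins_ext _) hz (h.outs_subset ho)

lemma disjoint_ins (h : Theta A B T a b) : Disjoint (Ins (A ∪ T)) (Ins (B ∪ T)) := by
  rw [disjoint_left]
  intro z hzA hzB
  have key : ∀ {A B : Set ℂ}, Theta A B T a b → z ∈ Ins (A ∪ T) → z ∈ Ins (B ∪ T) →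
      Ins (A ∪ T) ⊆ Ins (B ∪ T) := by
    intro A B h hzA hzB
    refine mem_ins_of_isPreconnected h.pairRight.isJordanCurve.isCompact
      h.pairLeft.isJordanCurve.isPreconnected_ins ?_ hzA hzB
    rw [disjoint_union_right]
    exact ⟨h.disjoint_ins_right, (disjoint_ins_self _).mono_right subset_union_right⟩
  have heq := Subset.antisymm (key h hzA hzB) (key h.symm hzB hzA)
  have hfr := h.pairLeft.isJordanCurve.frontier_ins
  rw [heq, h.pairRight.isJordanCurve.frontier_ins] at hfr
  obtain ⟨w, hw⟩ := h.pair.left.nonempty_diff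
  have hwB : w ∈ B ∪ T := hfr ▸ Or.inl hw.1
  rcases hwB with hwB | hwT
  · exact hw.2 (h.pair.inter.subset ⟨hw.1, hwB⟩)
  · exact hw.2 (h.pairLeft.inter.subset ⟨hw.1, hwT⟩)

lemma ins_diff_eq (h : Theta A B T a b) :
    Ins (A ∪ B) \ T = Ins (A ∪ T) ∪ Ins (B ∪ T) := by
  refine Subset.antisymm ?_ (union_subset h.ins_left_subset ?_)
  · rintro z ⟨hz, hzT⟩
    by_contra hcon
    rw [mem_union, not_or] at hcon
    have hA : z ∈ Outs (A ∪ T) := by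
      have : z ∈ (A ∪ T)ᶜ := by
        rintro (h' | h')
        · exact hz.1 (Or.inl h')
        · exact hzT h'
      rw [compl_eq_ins_union_ext] at this
      exact this.resolve_left hcon.1
    have hB : z ∈ Outs (B ∪ T) := by
      have : z ∈ (B ∪ T)ᶜ := by
        rintro (h' | h')
        · exact hz.1 (Or.inr h')
        · exact hzT h'
      rw [compl_eq_ins_union_ext] at this
      exact this.resolve_left hcon.2
    refine hz.2 (HasLog.mono (L := (A ∪ T) ∪ (B ∪ T)) ?_ ?_)
    · refine hA.2.union_of_isClosed h.pairLeft.isJordanCurve.isClosed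
        h.pairRight.isJordanCurve.isClosed ?_ hB.2
      rw [← inter_union_distrib_right, h.pair.inter, union_eq_right.2]
      · exact h.arc.isPreconnected
      · rintro x (rfl | hx)
        · exact h.arc.left_mem
        · rw [mem_singleton_iff] at hx; exact hx ▸ h.arc.right_mem
    · exact union_subset_union subset_union_left subset_union_left
  · have := h.symm.ins_left_subset
    rwa [union_comm B A] at this

lemma reg_eq (h : Theta A B T a b) : Reg (A ∪ B) = Reg (A ∪ T) ∪ Reg (B ∪ T) := by
  refine Subset.antisymm ?_ ?_
  · rintro z ((hz | hz) | hz)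
    · exact Or.inl (Or.inl (Or.inl hz))
    · exact Or.inr (Or.inl (Or.inl hz))
    · by_cases hT : z ∈ T
      · exact Or.inl (Or.inl (Or.inr hT))
      · rcases h.ins_diff_eq.subset ⟨hz, hT⟩ with h' | h'
        · exact Or.inl (Or.inr h')
        · exact Or.inr (Or.inr h')
  · refine union_subset (union_subset (union_subset (fun z hz => Or.inl (Or.inl hz)) h.subset_reg) ?_)
      (union_subset (union_subset (fun z hz => Or.inl (Or.inr hz)) h.subset_reg) ?_)
    · exact fun z hz => Or.inr (h.ins_diff_eq.symm.subset (Or.inl hz)).1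
    · exact fun z hz => Or.inr (h.ins_diff_eq.symm.subset (Or.inr hz)).1

lemma reg_inter (h : Theta A B T a b) : Reg (A ∪ T) ∩ Reg (B ∪ T) = T := by
  refine Subset.antisymm ?_ fun z hz => ⟨Or.inl (Or.inr hz), Or.inl (Or.inr hz)⟩
  have hab : ({a, b} : Set ℂ) ⊆ T := by
    rintro x (rfl | hx)
    · exact h.arc.left_mem
    · rw [mem_singleton_iff] at hx; exact hx ▸ h.arc.right_mem
  rintro z ⟨(hA | hT) | hI, (hB | hT') | hI'⟩
  · exact hab (h.pair.inter.subset ⟨hA, hB⟩)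
  · exact hT'
  · exact absurd hA (disjoint_left.1 h.symm.disjoint_ins_right hI')
  · exact hT
  · exact hT
  · exact hT
  · exact absurd hB (disjoint_left.1 h.disjoint_ins_right hI)
  · exact hT'
  · exact absurd hI' (disjoint_left.1 h.disjoint_ins hI)

lemma inter_reg (h : Theta A B T a b) : (A ∪ B) ∩ Reg (A ∪ T) = A := by
  refine Subset.antisymm ?_ fun z hz => ⟨Or.inl hz, Or.inl (Or.inl hz)⟩
  rintro z ⟨hA | hB, hz⟩
  · exact hA
  · rcases hz with (hA | hT) | hI
    · exact hA
    · exact (h.pair.inter.symm.subset (h.pairRight.inter.subset ⟨hB, hT⟩)).1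
    · exact absurd hB (disjoint_left.1 h.disjoint_ins_right hI)

end Theta

/-- Removing from an open set a compact set not separating two points. -/
lemma exists_preconnected_of_notSep {N F : Set ℂ} {p q : ℂ} (hN : IsOpen N) (hp : p ∈ N)
    (h : NotSep (F ∪ frontier N) p q) :
    ∃ V, IsPreconnected V ∧ V ⊆ N \ F ∧ p ∈ V ∧ q ∈ V := by
  obtain ⟨V, h1, h2, h3, h4⟩ := h
  rw [disjoint_union_right] at h2
  refine ⟨V, h1, fun z hz => ⟨?_, disjoint_left.1 h2.1 hz⟩, h3, h4⟩
  refine h1.subset_of_closure_inter_subset hN ⟨p, h3, hp⟩ ?_ hz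
  rintro w ⟨hw, hwV⟩
  by_contra hwN
  exact disjoint_left.1 h2.2 hwV ⟨hw, by rwa [hN.interior_eq]⟩

lemma isPreconnected_diff_of_notSep {N F : Set ℂ} (hN : IsOpen N) (hNb : Bornology.IsBounded N)
    (hNc : IsPreconnected N) (hF : IsCompact F) (hFN : IsPreconnected (F ∩ frontier N))
    (h : ∀ p ∉ F, ∀ q ∉ F, NotSep F p q) : IsPreconnected (N \ F) := by
  refine isPreconnected_of_forall_pair fun p hp q hq => ?_
  have hfr : NotSep (frontier N) p q :=
    ⟨N, hNc, disjoint_left.2 fun z hz hz' => by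
      rw [hN.frontier_eq] at hz'; exact hz'.2 hz, hp.1, hq.1⟩
  have hc : IsCompact (frontier N) :=
    (hNb.isCompact_closure).of_isClosed_subset isClosed_frontier frontier_subset_closure
  obtain ⟨V, h1, h2, h3, h4⟩ := exists_preconnected_of_notSep hN hp.1
    (NotSep.union hF hc hFN (h p hp.2 q hq.2) hfr)
  exact ⟨V, h2, h3, h4, h1⟩

/-! ### Every path contains an arc -/

/-- A closed subset of `[0, 1]` containing the endpoints such that `f` takes equal values at the
two ends of every complementary gap. -/
structure GapSet (f : ℝ → ℂ) (C : Set ℝ) : Prop where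
  closed : IsClosed C
  sub : C ⊆ Icc 0 1
  zero : (0 : ℝ) ∈ C
  one : (1 : ℝ) ∈ C
  gap : ∀ s ∈ C, ∀ t ∈ C, s < t → (∀ u ∈ C, s < u → t ≤ u) → f s = f t

namespace GapSet

variable {f : ℝ → ℂ} {C : Set ℝ}

lemma exists_last (h : GapSet f C) {x : ℝ} (hx : 0 ≤ x) : ∃ s, IsGreatest (C ∩ Iic x) s := by
  have hc : IsCompact (C ∩ Iic x) :=
    (isCompact_Icc.of_isClosed_subset h.closed h.sub).inter_right isClosed_Iic
  exact hc.exists_isGreatest ⟨0, h.zero, hx⟩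

lemma exists_first (h : GapSet f C) {x : ℝ} (hx : x ≤ 1) : ∃ s, IsLeast (C ∩ Ici x) s := by
  have hc : IsCompact (C ∩ Ici x) :=
    (isCompact_Icc.of_isClosed_subset h.closed h.sub).inter_right isClosed_Ici
  exact hc.exists_isLeast ⟨1, h.one, hx⟩

lemma eq_of_last_first (h : GapSet f C) {x s t : ℝ} (hs : IsGreatest (C ∩ Iic x) s)
    (ht : IsLeast (C ∩ Ici x) t) : f s = f t := by
  rcases (hs.1.2.trans ht.1.2 : s ≤ t).eq_or_lt with rfl | hlt
  · rfl
  refine h.gap s hs.1.1 t ht.1.1 hlt fun u hu hsu => ?_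
  rcases le_total u x with hux | hux
  · exact absurd (hs.2 ⟨hu, hux⟩) (not_le.2 hsu)
  · exact ht.2 ⟨hu, hux⟩

lemma sInter_of_chain (hf : Continuous f) {c : Set (Set ℝ)} (hc : ∀ C ∈ c, GapSet f C)
    (hch : IsChain (· ⊆ ·) c) (hne : c.Nonempty) : GapSet f (⋂₀ c) := by
  obtain ⟨C₀, hC₀⟩ := hne
  refine ⟨isClosed_sInter fun C hC => (hc C hC).closed, (sInter_subset_of_mem hC₀).trans
    (hc _ hC₀).sub, fun C hC => (hc C hC).zero, fun C hC => (hc C hC).one, ?_⟩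
  intro s hs t ht hst hgap
  refine eq_of_forall_dist_le fun ε hε => ?_
  obtain ⟨δ₁, hδ₁, h₁⟩ := Metric.continuous_iff.1 hf s (ε / 2) (half_pos hε)
  obtain ⟨δ₂, hδ₂, h₂⟩ := Metric.continuous_iff.1 hf t (ε / 2) (half_pos hε)
  set δ := min (min δ₁ δ₂) (t - s) / 3 with hδ
  have hm : 0 < min (min δ₁ δ₂) (t - s) := lt_min (lt_min hδ₁ hδ₂) (sub_pos.2 hst)
  have m₁ : min (min δ₁ δ₂) (t - s) ≤ δ₁ := (min_le_left _ _).trans (min_le_left _ _)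
  have m₂ : min (min δ₁ δ₂) (t - s) ≤ δ₂ := (min_le_left _ _).trans (min_le_right _ _)
  have m₃ : min (min δ₁ δ₂) (t - s) ≤ t - s := min_le_right _ _
  have hex : ∃ C ∈ c, Disjoint C (Icc (s + δ) (t - δ)) := by
    by_contra! hcon
    have := IsCompact.nonempty_sInter_of_directed_nonempty_isCompact_isClosed
      (S := (fun C => C ∩ Icc (s + δ) (t - δ)) '' c) (hS := ⟨⟨_, C₀, hC₀, rfl⟩⟩) ?_ ?_ ?_ ?_
    · obtain ⟨u, hu⟩ := this
      rw [sInter_image, mem_iInter₂] at hu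
      have huc : u ∈ ⋂₀ c := fun C hC => (hu C hC).1
      have hui := (hu _ hC₀).2
      have := hgap u huc (by linarith [hui.1])
      linarith [hui.2]
    · rintro _ ⟨A, hA, rfl⟩ _ ⟨B, hB, rfl⟩
      rcases hch.total hA hB with hAB | hAB
      · exact ⟨_, ⟨A, hA, rfl⟩, Subset.rfl, inter_subset_inter_left _ hAB⟩
      · exact ⟨_, ⟨B, hB, rfl⟩, inter_subset_inter_left _ hAB, Subset.rfl⟩
    · rintro _ ⟨A, hA, rfl⟩
      exact not_disjoint_iff_nonempty_inter.1 (hcon A hA)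
    · rintro _ ⟨A, hA, rfl⟩
      exact isCompact_Icc.inter_left (hc A hA).closed
    · rintro _ ⟨A, hA, rfl⟩
      exact (hc A hA).closed.inter isClosed_Icc
  obtain ⟨C, hC, hd⟩ := hex
  have hG := hc C hC
  have hs01 := hG.sub (hs C hC)
  have ht01 := hG.sub (ht C hC)
  obtain ⟨p, hp⟩ := hG.exists_last (x := s + δ) (by linarith [hs01.1])
  obtain ⟨q, hq⟩ := hG.exists_first (x := s + δ) (by linarith [ht01.2])
  have hsp : s ≤ p := hp.2 ⟨hs C hC, by simp only [mem_Iic]; linarith⟩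
  have hqt : q ≤ t := hq.2 ⟨ht C hC, by simp only [mem_Ici]; linarith⟩
  have hq2 : t - δ < q := by
    by_contra! hcon
    exact disjoint_left.1 hd hq.1.1 ⟨hq.1.2, hcon⟩
  have e := hG.eq_of_last_first hp hq
  have hp2 : p ≤ s + δ := hp.1.2
  have a₁ := h₁ p (by rw [Real.dist_eq, abs_lt]; constructor <;> linarith)
  have a₂ := h₂ q (by rw [Real.dist_eq, abs_lt]; constructor <;> linarith)
  rw [dist_comm] at a₁
  calc dist (f s) (f t) ≤ dist (f s) (f p) + dist (f p) (f t) := dist_triangle _ _ _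
    _ ≤ ε := by rw [e]; rw [e] at a₁; linarith

/-- A minimal gap set identifies only the ends of gaps. -/
lemma exists_minimal (hf : Continuous f) : ∃ C, GapSet f C ∧
    ∀ s ∈ C, ∀ t ∈ C, s < t → f s = f t → ∀ u ∈ C, s < u → t ≤ u := by
  obtain ⟨C, -, hC⟩ := zorn_superset_nonempty {C | GapSet f C}
    (fun c hc hch hne => ⟨⋂₀ c, sInter_of_chain hf hc hch hne, fun s hs => sInter_subset_of_mem hs⟩)
    (Icc 0 1) ⟨isClosed_Icc, Subset.rfl, by simp, by simp, fun s hs t ht hst hg => by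
      have := hg ((s + t) / 2) ⟨by linarith [hs.1], by linarith [ht.2]⟩ (by linarith)
      linarith⟩
  have hG : GapSet f C := hC.1
  refine ⟨C, hG, fun s hs t ht hst he u hu hsu => ?_⟩
  have hG' : GapSet f (C \ Ioo s t) := by
    have hs' : s ∈ C \ Ioo s t := ⟨hs, fun h => lt_irrefl _ h.1⟩
    have ht' : t ∈ C \ Ioo s t := ⟨ht, fun h => lt_irrefl _ h.2⟩
    refine ⟨hG.closed.inter isOpen_Ioo.isClosed_compl, sdiff_subset.trans hG.sub,
      ⟨hG.zero, fun h => ?_⟩, ⟨hG.one, fun h => ?_⟩, fun p hp q hq hpq hg => ?_⟩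
    · linarith [(hG.sub hs).1, h.1]
    · linarith [(hG.sub ht).2, h.2]
    · by_cases hps : p = s
      · subst hps
        have h1 := hg t ht' hst
        have h2 : t ≤ q := by
          by_contra! hcon
          exact hq.2 ⟨hpq, hcon⟩
        rw [le_antisymm h1 h2, he]
      · refine hG.gap p hp.1 q hq.1 hpq fun u hu hpu => ?_
        by_cases hut : u ∈ Ioo s t
        · rcases lt_or_gt_of_ne hps with hlt | hgt
          · exact (hg s hs' hlt).trans hut.1.le
          · exact absurd ⟨hgt, hpu.trans hut.2⟩ hp.2
        · exact hg u ⟨hu, hut⟩ hpu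
  have := hC.2 hG' sdiff_subset hu
  by_contra! hcon
  exact this.2 ⟨hsu, hcon⟩

end GapSet

/-- A path can be replaced by one whose fibres are intervals. -/
lemma exists_monotone_path {f : ℝ → ℂ} (hf : Continuous f) :
    ∃ g : ℝ → ℂ, Continuous g ∧ g 0 = f 0 ∧ g 1 = f 1 ∧ g '' Icc 0 1 ⊆ f '' Icc 0 1 ∧
      ∀ s ∈ Icc (0 : ℝ) 1, ∀ t ∈ Icc (0 : ℝ) 1, s ≤ t → g s = g t → ∀ u ∈ Icc s t, g u = g s := by
  obtain ⟨C, hC, hmin⟩ := GapSet.exists_minimal hf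
  choose! σ hσ using fun (x : ℝ) (hx : 0 ≤ x) => hC.exists_last hx
  have hfix : ∀ x ∈ C, σ x = x := fun x hx =>
    le_antisymm (hσ x (hC.sub hx).1).1.2 ((hσ x (hC.sub hx).1).2 ⟨hx, self_mem_Iic⟩)
  have hmono : ∀ s t, 0 ≤ s → s ≤ t → σ s ≤ σ t := fun s t hs hst =>
    (hσ t (hs.trans hst)).2 ⟨(hσ s hs).1.1, (hσ s hs).1.2.trans hst⟩
  have hcont : ContinuousOn (fun x => f (σ x)) (Icc 0 1) := by
    have huc := isCompact_Icc.uniformContinuousOn_of_continuous (hf.continuousOn (s := Icc (0:ℝ) 1))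
    have key : ∀ ε > 0, ∃ δ > 0, ∀ s ∈ Icc (0 : ℝ) 1, ∀ t ∈ Icc (0 : ℝ) 1, s ≤ t → t - s < δ →
        dist (f (σ s)) (f (σ t)) < ε := by
      intro ε hε
      obtain ⟨δ, hδ, h⟩ := Metric.uniformContinuousOn_iff.1 huc ε hε
      refine ⟨δ, hδ, fun s hs t ht hst hd => ?_⟩
      obtain ⟨p, hp⟩ := hC.exists_first hs.2
      have e := hC.eq_of_last_first (hσ s hs.1) hp
      rcases le_or_gt (σ t) s with hle | hlt
      · have : σ t = σ s := le_antisymm ((hσ s hs.1).2 ⟨(hσ t ht.1).1.1, hle⟩)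
          (hmono s t hs.1 hst)
        rw [this, dist_self]; exact hε
      · have hpt : p ≤ σ t := hp.2 ⟨(hσ t ht.1).1.1, hlt.le⟩
        have h1 : s ≤ p := hp.1.2
        have h2 : σ t ≤ t := (hσ t ht.1).1.2
        rw [e]
        exact h p (hC.sub hp.1.1) _ (hC.sub (hσ t ht.1).1.1) (by
          rw [Real.dist_eq, abs_lt]; constructor <;> linarith)
    refine Metric.continuousOn_iff.2 fun b hb ε hε => ?_
    obtain ⟨δ, hδ, h⟩ := key ε hε
    refine ⟨δ, hδ, fun a ha hab => ?_⟩
    rw [Real.dist_eq, abs_lt] at hab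
    rcases le_total a b with hle | hle
    · exact h a ha b hb hle (by linarith)
    · rw [dist_comm]; exact h b hb a ha hle (by linarith)
  refine ⟨IccExtend zero_le_one ((Icc 0 1).domRestrict fun x => f (σ x)), ?_, ?_, ?_, ?_, ?_⟩
  · exact (continuousOn_iff_continuous_domRestrict.1 hcont).Icc_extend'
  · simp [IccExtend, hfix 0 hC.zero]
  · simp [IccExtend, hfix 1 hC.one]
  · rintro _ ⟨t, ht, rfl⟩
    rw [IccExtend_of_mem _ _ ht]
    exact ⟨σ t, hC.sub (hσ t ht.1).1.1, rfl⟩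
  · intro s hs t ht hst he u hu
    have hu' : u ∈ Icc (0 : ℝ) 1 := ⟨hs.1.trans hu.1, hu.2.trans ht.2⟩
    rw [IccExtend_of_mem _ _ hs, IccExtend_of_mem _ _ ht] at he
    rw [IccExtend_of_mem _ _ hs, IccExtend_of_mem _ _ hu']
    simp only [domRestrict_apply] at he ⊢
    rcases (hmono s u hs.1 hu.1).eq_or_lt with h1 | h1
    · rw [h1]
    rcases (hmono u t hu'.1 hu.2).eq_or_lt with h2 | h2
    · rw [h2, he]
    · exact absurd (hmin _ (hσ s hs.1).1.1 _ (hσ t ht.1).1.1 (h1.trans h2) he _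
        (hσ u hu'.1).1.1 h1) (not_le.2 h2)

lemma continuousOn_image_of_comp {α β γ : Type*} [TopologicalSpace α] [TopologicalSpace β]
    [TopologicalSpace γ] [T2Space β] {φ : α → β} {h : β → γ} {S : Set α} (hS : IsCompact S)
    (hφ : ContinuousOn φ S) (hh : ContinuousOn (h ∘ φ) S) : ContinuousOn h (φ '' S) := by
  refine continuousOn_iff_isClosed.2 fun t ht => ?_
  obtain ⟨u, hu, he⟩ := continuousOn_iff_isClosed.1 hh t ht
  refine ⟨φ '' (S ∩ u), ((hS.inter_right hu).image_of_continuousOn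
    (hφ.mono inter_subset_left)).isClosed, ?_⟩
  ext y
  constructor
  · rintro ⟨hy, x, hx, rfl⟩
    exact ⟨⟨x, ⟨hx, (he.subset ⟨hy, hx⟩ : x ∈ u ∩ S).1⟩, rfl⟩, x, hx, rfl⟩
  · rintro ⟨⟨x, ⟨hx, hxt⟩, rfl⟩, -⟩
    exact ⟨(he.superset ⟨hxt, hx⟩ : x ∈ h ∘ φ ⁻¹' t ∩ S).1, x, hx, rfl⟩

/-- A monotone continuous function with the same fibres as a path with interval fibres. -/
lemma exists_monotone_same_fibres {g : ℝ → ℂ} (hg : Continuous g)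
    (hfib : ∀ s ∈ Icc (0 : ℝ) 1, ∀ t ∈ Icc (0 : ℝ) 1, s ≤ t → g s = g t → ∀ u ∈ Icc s t, g u = g s) :
    ∃ φ : ℝ → ℝ, Continuous φ ∧ MonotoneOn φ (Icc 0 1) ∧
      ∀ s ∈ Icc (0 : ℝ) 1, ∀ t ∈ Icc (0 : ℝ) 1, s ≤ t → (φ s = φ t ↔ g s = g t) := by
  -- oscillation of `g` from `q` to `max q t`, truncated
  let w : ℝ → ℝ → ℝ := fun q t =>
    sSup ((fun v => min 1 (dist (g (min (max q t) (max q v))) (g q))) '' Icc 0 1)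
  have hwc : ∀ q, Continuous (w q) := fun q => by
    refine isCompact_Icc.continuous_sSup
      (f := fun t v => min 1 (dist (g (min (max q t) (max q v))) (g q))) ?_
    exact continuous_const.min (((hg.comp ((continuous_const.max continuous_fst).min
      (continuous_const.max continuous_snd))).dist continuous_const))
  have hbdd : ∀ q t, BddAbove ((fun v => min 1 (dist (g (min (max q t) (max q v))) (g q))) ''
      Icc 0 1) := fun q t => ⟨1, by rintro _ ⟨v, -, rfl⟩; exact min_le_left _ _⟩
  have hne : ∀ q t, ((fun v => min 1 (dist (g (min (max q t) (max q v))) (g q))) ''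
      Icc (0 : ℝ) 1).Nonempty := fun q t => ⟨_, 0, by simp, rfl⟩
  have hw0 : ∀ q t, 0 ≤ w q t := fun q t => by
    refine (le_min zero_le_one dist_nonneg).trans (le_csSup (hbdd q t) ⟨0, by simp, rfl⟩)
  have hw1 : ∀ q t, w q t ≤ 1 := fun q t => csSup_le (hne q t) (by
    rintro _ ⟨v, -, rfl⟩; exact min_le_left _ _)
  have hwm : ∀ q ∈ Icc (0 : ℝ) 1, ∀ s ∈ Icc (0 : ℝ) 1, ∀ t, s ≤ t → w q s ≤ w q t := by
    intro q hq s hs t hst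
    refine csSup_le (hne q s) ?_
    rintro _ ⟨v, hv, rfl⟩
    refine le_csSup (hbdd q t) ⟨min (max q s) (max q v), ⟨?_, ?_⟩, ?_⟩
    · exact le_min (hq.1.trans (le_max_left _ _)) (hq.1.trans (le_max_left _ _))
    · exact (min_le_left _ _).trans (max_le hq.2 hs.2)
    · have h1 : max q (min (max q s) (max q v)) = min (max q s) (max q v) :=
        max_eq_right (le_min (le_max_left _ _) (le_max_left _ _))
      have h2 : min (max q t) (min (max q s) (max q v)) = min (max q s) (max q v) :=
        min_eq_right ((min_le_left _ _).trans (max_le_max le_rfl hst))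
      simp only [h1, h2]
  have hwe : ∀ q ∈ Icc (0 : ℝ) 1, ∀ s ∈ Icc (0 : ℝ) 1, ∀ t ∈ Icc (0 : ℝ) 1, s ≤ t → g s = g t →
      w q s = w q t := by
    intro q hq s hs t ht hst he
    refine le_antisymm (hwm q hq s hs t hst) (csSup_le (hne q t) ?_)
    rintro _ ⟨v, hv, rfl⟩
    refine le_csSup (hbdd q s) ⟨v, hv, ?_⟩
    have hE := hfib s hs t ht hst he
    suffices g (min (max q s) (max q v)) = g (min (max q t) (max q v)) by simp only [this]
    rcases le_total q s with hqs | hqs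
    · rw [max_eq_right hqs, max_eq_right (hqs.trans hst)]
      rcases le_total (max q v) s with hm | hm
      · rw [min_eq_right hm, min_eq_right (hm.trans hst)]
      · rw [min_eq_left hm, hE (min t (max q v)) ⟨le_min hst hm, min_le_left _ _⟩]
    · rw [max_eq_left hqs, min_eq_left (le_max_left _ _)]
      rcases le_total q t with hqt | hqt
      · rw [max_eq_right hqt, hE q ⟨hqs, hqt⟩]
        exact (hE _ ⟨le_min hst (hqs.trans (le_max_left _ _)), min_le_left _ _⟩).symm
      · rw [max_eq_left hqt, min_eq_left (le_max_left _ _)]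
  obtain ⟨d, hd⟩ := TopologicalSpace.exists_dense_seq (Icc (0 : ℝ) 1)
  have hsum : ∀ t, Summable fun k : ℕ => (1 / 2 : ℝ) ^ k * w (d k) t := fun t =>
    Summable.of_nonneg_of_le (fun k => mul_nonneg (by positivity) (hw0 _ _))
      (fun k => mul_le_of_le_one_right (by positivity) (hw1 _ _)) summable_geometric_two
  have hle : ∀ s ∈ Icc (0 : ℝ) 1, ∀ t, s ≤ t → ∀ k : ℕ,
      (1 / 2 : ℝ) ^ k * w (d k) s ≤ (1 / 2 : ℝ) ^ k * w (d k) t := fun s hs t hst k =>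
    mul_le_mul_of_nonneg_left (hwm _ (d k).2 s hs t hst) (by positivity)
  refine ⟨fun t => ∑' k : ℕ, (1 / 2 : ℝ) ^ k * w (d k) t, ?_, ?_, ?_⟩
  · refine continuous_tsum (fun k => continuous_const.mul (hwc _)) summable_geometric_two
      fun k t => ?_
    rw [Real.norm_of_nonneg (mul_nonneg (by positivity) (hw0 _ _))]
    exact mul_le_of_le_one_right (by positivity) (hw1 _ _)
  · exact fun s hs t ht hst => (hsum s).tsum_le_tsum (hle s hs t hst) (hsum t)
  · intro s hs t ht hst
    constructor
    · intro he
      by_contra hne'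
      have hst' : s < t := lt_of_le_of_ne hst fun h => hne' (by rw [h])
      -- a dense point strictly between, with a different value from the one at `t`
      obtain ⟨x, hx, hxt⟩ : ∃ x ∈ Ioo s t, g x ≠ g t := by
        by_contra! hcon
        have hcl : s ∈ closure (Ioo s t) := by
          rw [closure_Ioo hst'.ne]; exact left_mem_Icc.2 hst
        have : closure (Ioo s t) ⊆ {x | g x = g t} :=
          closure_minimal hcon (isClosed_eq hg continuous_const)
        exact hne' (this hcl)
      have hop : IsOpen {y : Icc (0 : ℝ) 1 | (y : ℝ) ∈ Ioo s t ∧ g y ≠ g t} :=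
        (isOpen_Ioo.preimage continuous_subtype_val).inter
          (isOpen_ne.preimage (hg.comp continuous_subtype_val))
      obtain ⟨y, ⟨hy, hyt⟩, k, rfl⟩ := hd.inter_open_nonempty _ hop
        ⟨⟨x, hs.1.trans hx.1.le, hx.2.le.trans ht.2⟩, hx, hxt⟩
      have hz : w (d k) s = 0 := by
        refine le_antisymm (csSup_le (hne _ _) ?_) (hw0 _ _)
        rintro _ ⟨v, hv, rfl⟩
        simp only [max_eq_left hy.1.le, min_eq_left (le_max_left _ _), dist_self]
        exact min_le_right _ _
      have hp : 0 < w (d k) t := by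
        refine (lt_min zero_lt_one (dist_pos.2 hyt.symm)).trans_le
          (le_csSup (hbdd (d k) t) ⟨t, ht, ?_⟩)
        simp only [max_eq_right hy.2.le, min_self]
      refine absurd he ((hsum s).tsum_lt_tsum (i := k) (hle s hs t hst) ?_ (hsum t)).ne
      rw [hz, mul_zero]; positivity
    · intro he
      exact tsum_congr fun k => by rw [hwe _ (d k).2 s hs t ht hst he]

/-- Every path between distinct points contains an arc. -/
theorem exists_isArc_of_path {f : ℝ → ℂ} (hf : ContinuousOn f (Icc 0 1)) (hne : f 0 ≠ f 1) :
    ∃ A ⊆ f '' Icc 0 1, IsArc A (f 0) (f 1) := by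
  wlog hf' : Continuous f generalizing f
  · have := this (f := IccExtend zero_le_one ((Icc (0 : ℝ) 1).domRestrict f))
      ((continuousOn_iff_continuous_domRestrict.1 hf).Icc_extend').continuousOn
      (by simpa [IccExtend] using hne)
      ((continuousOn_iff_continuous_domRestrict.1 hf).Icc_extend')
    have hE : EqOn (IccExtend zero_le_one ((Icc (0 : ℝ) 1).domRestrict f)) f (Icc 0 1) :=
      fun x hx => IccExtend_of_mem _ _ hx
    rwa [hE.image_eq, hE (by simp), hE (by simp)] at this
  obtain ⟨g, hg, g0, g1, him, hfib⟩ := exists_monotone_path hf'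
  obtain ⟨φ, hφ, hφm, hφe⟩ := exists_monotone_same_fibres hg hfib
  have hz : (0 : ℝ) ∈ Icc (0 : ℝ) 1 := by simp
  have ho : (1 : ℝ) ∈ Icc (0 : ℝ) 1 := by simp
  have hinv : ∀ s ∈ Icc (0 : ℝ) 1, ∀ t ∈ Icc (0 : ℝ) 1, (φ s = φ t ↔ g s = g t) := by
    intro s hs t ht
    rcases le_total s t with h | h
    · exact hφe s hs t ht h
    · rw [eq_comm, hφe t ht s hs h, eq_comm]
  have hlt : φ 0 < φ 1 := lt_of_le_of_ne (hφm hz ho zero_le_one) fun h =>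
    hne (by rw [← g0, ← g1]; exact (hinv 0 hz 1 ho).1 h)
  have himφ : φ '' Icc 0 1 = Icc (φ 0) (φ 1) := by
    refine Subset.antisymm ?_ (intermediate_value_Icc zero_le_one hφ.continuousOn)
    rintro _ ⟨t, ht, rfl⟩
    exact ⟨hφm hz ht ht.1, hφm ht ho ht.2⟩
  set h : ℝ → ℂ := fun y => g (Function.invFunOn φ (Icc 0 1) y) with hh
  have hcomp : ∀ t ∈ Icc (0 : ℝ) 1, h (φ t) = g t := fun t ht => by
    have hm : φ t ∈ φ '' Icc 0 1 := ⟨t, ht, rfl⟩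
    exact (hinv _ (Function.invFunOn_mem hm) _ ht).1 (Function.invFunOn_eq hm)
  have hc : ContinuousOn h (Icc (φ 0) (φ 1)) := by
    rw [← himφ]
    exact continuousOn_image_of_comp isCompact_Icc hφ.continuousOn
      (hg.continuousOn.congr fun t ht => hcomp t ht)
  have hi : InjOn h (Icc (φ 0) (φ 1)) := by
    rw [← himφ]
    rintro _ ⟨s, hs, rfl⟩ _ ⟨t, ht, rfl⟩ he
    rw [hcomp s hs, hcomp t ht] at he
    exact (hinv s hs t ht).2 he
  have hA := isArc_image_Icc hlt hc hi
  rw [hcomp 0 hz, hcomp 1 ho, g0, g1] at hA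
  refine ⟨_, ?_, hA⟩
  rw [← himφ, image_image]
  rintro _ ⟨t, ht, rfl⟩
  exact him ⟨t, ht, (hcomp t ht).symm⟩

/-! ### Paths avoiding a null sequence of holes -/

lemma continuousOn_ite_le {g h : ℝ → ℂ} {a b c : ℝ} (hab : a ≤ b) (hbc : b ≤ c)
    (hg : ContinuousOn g (Icc a b)) (hh : ContinuousOn h (Icc b c)) (hgh : g b = h b) :
    ContinuousOn (fun x => if x ≤ b then g x else h x) (Icc a c) := by
  rw [← Icc_union_Icc_eq_Icc hab hbc]
  refine ContinuousOn.union_of_isClosed (hg.congr fun x hx => if_pos hx.2)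
    (hh.congr fun x hx => ?_) isClosed_Icc isClosed_Icc
  rcases hx.1.eq_or_lt with rfl | hlt
  · simp [hgh]
  · exact if_neg (not_le.2 hlt)

/-- Pushing a path off one set `D` inside a neighbourhood `N`. -/
lemma exists_path_push {f : ℝ → ℂ} {N D : Set ℂ} (hf : ContinuousOn f (Icc 0 1)) (hN : IsOpen N)
    (hD : IsClosed D) (hDN : D ⊆ N) (hjoin : ∀ p ∈ N \ D, ∀ q ∈ N \ D, JoinedIn (N \ D) p q)
    (hne : D.Nonempty → (N \ D).Nonempty) (h0 : f 0 ∉ D) (h1 : f 1 ∉ D) :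
    ∃ g : ℝ → ℂ, ContinuousOn g (Icc 0 1) ∧ g 0 = f 0 ∧ g 1 = f 1 ∧
      ∀ t ∈ Icc (0 : ℝ) 1, g t ∉ D ∧ (g t = f t ∨ (f t ∈ N ∧ g t ∈ N)) := by
  obtain ⟨τ, hτ0, hτm, ⟨m, hm⟩, hτ⟩ := exists_monotone_Icc_subset_open_cover_Icc zero_le_one
    (c := fun i : Bool => if i then (Icc (0 : ℝ) 1).domRestrict f ⁻¹' N
      else (Icc (0 : ℝ) 1).domRestrict f ⁻¹' Dᶜ) (by
      have := continuousOn_iff_continuous_domRestrict.1 hf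
      rintro (_ | _)
      · exact hD.isOpen_compl.preimage this
      · exact hN.preimage this) (by
      intro x _
      rw [mem_iUnion]
      by_cases hx : f x ∈ D
      · exact ⟨true, hDN hx⟩
      · exact ⟨false, hx⟩)
  suffices H : ∀ n, ∃ g : ℝ → ℂ, ContinuousOn g (Icc 0 (τ n)) ∧ g 0 = f 0 ∧
      (f (τ n) ∉ D → g (τ n) = f (τ n)) ∧
      ∀ t ∈ Icc (0 : ℝ) (τ n), g t ∉ D ∧ (g t = f t ∨ (f t ∈ N ∧ g t ∈ N)) by
    obtain ⟨g, hg, hg0, hg1, hg2⟩ := H m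
    rw [hm m le_rfl] at hg hg1 hg2
    exact ⟨g, hg, hg0, hg1 h1, hg2⟩
  intro n
  induction n with
  | zero =>
    rw [hτ0]
    exact ⟨f, by simp, rfl, fun _ => rfl, fun t ht => by
      rw [Icc_self, mem_singleton_iff] at ht
      rw [ht]; exact ⟨h0, Or.inl rfl⟩⟩
  | succ n ih =>
    obtain ⟨g, hg, hg0, hg1, hg2⟩ := ih
    have hle : (τ n : ℝ) ≤ τ (n + 1) := hτm (Nat.le_succ n)
    rcases hle.eq_or_lt with heq | hlt
    · rw [← heq]; exact ⟨g, hg, hg0, hg1, hg2⟩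
    -- it suffices to find the new piece
    suffices H : ∃ h : ℝ → ℂ, ContinuousOn h (Icc (τ n) (τ (n + 1))) ∧ g (τ n) = h (τ n) ∧
        (f (τ (n + 1)) ∉ D → h (τ (n + 1)) = f (τ (n + 1))) ∧
        ∀ t ∈ Icc (τ n : ℝ) (τ (n + 1)), h t ∉ D ∧ (h t = f t ∨ (f t ∈ N ∧ h t ∈ N)) by
      obtain ⟨h, hh, hgh, hh1, hh2⟩ := H
      refine ⟨_, continuousOn_ite_le (τ n).2.1 hle hg hh hgh, ?_, fun hD => ?_, fun t ht => ?_⟩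
      · simp only [if_pos (τ n).2.1, hg0]
      · simp only [if_neg (not_le.2 hlt), hh1 hD]
      · by_cases htn : t ≤ τ n
        · simp only [if_pos htn]; exact hg2 t ⟨ht.1, htn⟩
        · simp only [if_neg htn]; exact hh2 t ⟨(not_le.1 htn).le, ht.2⟩
    have hsub : ∀ t ∈ Icc (τ n : ℝ) (τ (n + 1)), t ∈ Icc (0 : ℝ) 1 := fun t ht =>
      ⟨(τ n).2.1.trans ht.1, ht.2.trans (τ (n + 1)).2.2⟩
    obtain ⟨_ | _, hi⟩ := hτ n
    · have hmem : ∀ t ∈ Icc (τ n : ℝ) (τ (n + 1)), f t ∉ D := fun t ht =>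
        hi (a := ⟨t, hsub t ht⟩) ⟨ht.1, ht.2⟩
      exact ⟨f, hf.mono hsub, hg1 (hmem _ (left_mem_Icc.2 hle)), fun _ => rfl,
        fun t ht => ⟨hmem t ht, Or.inl rfl⟩⟩
    · have hmem : ∀ t ∈ Icc (τ n : ℝ) (τ (n + 1)), f t ∈ N := fun t ht =>
        hi (a := ⟨t, hsub t ht⟩) ⟨ht.1, ht.2⟩
      have hl := hg2 (τ n) (right_mem_Icc.2 (τ n).2.1)
      have hw : g (τ n) ∈ N \ D := ⟨by
        rcases hl.2 with h | h
        · rw [h]; exact hmem _ (left_mem_Icc.2 hle)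
        · exact h.2, hl.1⟩
      obtain ⟨w, hw', hwD⟩ : ∃ w ∈ N \ D, f (τ (n + 1)) ∉ D → w = f (τ (n + 1)) := by
        by_cases hD' : f (τ (n + 1)) ∈ D
        · obtain ⟨w, hw⟩ := hne ⟨_, hD'⟩
          exact ⟨w, hw, fun h => absurd hD' h⟩
        · exact ⟨_, ⟨hmem _ (right_mem_Icc.2 hle), hD'⟩, fun _ => rfl⟩
      have hJ := hjoin _ hw _ hw'
      have hpos : (0 : ℝ) < τ (n + 1) - τ n := sub_pos.2 hlt
      refine ⟨fun t => hJ.somePath.extend ((t - τ n) / (τ (n + 1) - τ n)), ?_, ?_, ?_, ?_⟩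
      · exact (hJ.somePath.continuous_extend.comp (by fun_prop)).continuousOn
      · simp
      · intro h
        simp only [div_self hpos.ne', Path.extend_one]
        exact hwD h
      · intro t ht
        have hin : (t - τ n) / (τ (n + 1) - τ n) ∈ Icc (0 : ℝ) 1 :=
          ⟨div_nonneg (by linarith [ht.1]) hpos.le, (div_le_one hpos).2 (by linarith [ht.2])⟩
        have := hJ.somePath_mem ⟨_, hin⟩
        rw [← Path.extend_apply _ hin] at this
        exact ⟨this.2, Or.inr ⟨hmem t ht, this.1⟩⟩

section Moves

variable {x : ℕ → ℂ} {N : ℕ → Set ℂ} {ε : ℕ → ℝ}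

lemma dist_le_of_moves (hmove : ∀ n, x (n + 1) = x n ∨ (x n ∈ N n ∧ x (n + 1) ∈ N n))
    (hb : ∀ n, Bornology.IsBounded (N n))
    (hdiam : ∀ n m, n < m → (N n ∩ N m).Nonempty → diam (N m) ≤ ε n) (hpos : ∀ n, 0 < ε n)
    (hhalf : ∀ n m, n < m → ε m ≤ ε n / 2) {n : ℕ} (hn : x (n + 1) ∈ N n) {j : ℕ} (hj : n < j) :
    dist (x j) (x (n + 1)) ≤ 2 * ε n := by
  suffices H : ∃ l, l < j ∧ x j ∈ N l ∧ dist (x j) (x (n + 1)) ≤ 2 * ε n - 2 * ε l by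
    obtain ⟨l, -, -, h⟩ := H
    linarith [hpos l]
  induction j, hj using Nat.le_induction with
  | base => exact ⟨n, Nat.lt_succ_self n, hn, by simp⟩
  | succ j hj ih =>
    obtain ⟨l, hl, hm, hd⟩ := ih
    rcases hmove j with h | ⟨h₁, h₂⟩
    · rw [h]; exact ⟨l, hl.trans (Nat.lt_succ_self j), hm, hd⟩
    · refine ⟨j, Nat.lt_succ_self j, h₂, ?_⟩
      have h3 := hdiam l j hl ⟨x j, hm, h₁⟩
      have h4 := dist_le_diam_of_mem (hb j) h₂ h₁
      have h5 := hhalf l j hl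
      have h6 := dist_triangle (x (j + 1)) (x j) (x (n + 1))
      linarith

lemma eq_or_exists_move (hmove : ∀ n, x (n + 1) = x n ∨ (x n ∈ N n ∧ x (n + 1) ∈ N n))
    {k j : ℕ} (hj : k ≤ j) :
    x j = x k ∨ ∃ m, k ≤ m ∧ m < j ∧ x k ∈ N m ∧ x (m + 1) ∈ N m := by
  induction j, hj using Nat.le_induction with
  | base => exact Or.inl rfl
  | succ j hj ih =>
    rcases ih with h | ⟨m, h1, h2, h3⟩
    · rcases hmove j with h' | ⟨h₁, h₂⟩
      · exact Or.inl (h'.trans h)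
      · exact Or.inr ⟨j, hj, Nat.lt_succ_self j, h ▸ h₁, h₂⟩
    · exact Or.inr ⟨m, h1, h2.trans (Nat.lt_succ_self j), h3⟩

end Moves

/-- A null sequence of pairwise disjoint nonseparating continua (possibly empty). -/
structure NullHoles (D : ℕ → Set ℂ) : Prop where
  compact : ∀ n, IsCompact (D n)
  preconn : ∀ n, IsPreconnected (D n)
  notSep : ∀ n, ∀ p ∉ D n, ∀ q ∉ D n, NotSep (D n) p q
  disj : Pairwise fun i j => Disjoint (D i) (D j)
  null : Tendsto (fun n => diam (D n)) atTop (𝓝 0)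

lemma isPreconnected_thickening {D : Set ℂ} (hD : IsPreconnected D) (r : ℝ) :
    IsPreconnected (thickening r D) := by
  have : thickening r D = (fun p : ℂ × ℂ => p.1 + p.2) '' (D ×ˢ ball 0 r) := by
    ext z
    rw [mem_thickening_iff]
    constructor
    · rintro ⟨y, hy, hz⟩
      exact ⟨(y, z - y), ⟨hy, by rwa [mem_ball_zero_iff, ← dist_eq_norm]⟩, by simp⟩
    · rintro ⟨⟨y, w⟩, ⟨hy, hw⟩, rfl⟩
      exact ⟨y, hy, by simpa [dist_eq_norm] using hw⟩
  rw [this]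
  exact (hD.prod (convex_ball 0 r).isPreconnected).image _ (by fun_prop)

lemma eventually_le_pos {c : ℝ} (hc : 0 < c) : ∀ᶠ e in 𝓝[>] (0 : ℝ), e ≤ c := by
  filter_upwards [Ioo_mem_nhdsGT hc] with e he using he.2.le

lemma eventually_pos_nhdsGT : ∀ᶠ e in 𝓝[>] (0 : ℝ), 0 < e := self_mem_nhdsWithin

lemma exists_gap_of_disjoint {A B : Set ℂ} (hA : IsCompact A) (hB : IsCompact B)
    (h : Disjoint A B) : ∃ d > 0, ∀ x ∈ A, ∀ y ∈ B, d ≤ dist x y := by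
  obtain ⟨δ, hδ, hd⟩ := h.exists_thickenings hA hB.isClosed
  refine ⟨δ, hδ, fun x hx y hy => ?_⟩
  by_contra! hcon
  exact disjoint_left.1 hd (mem_thickening_iff.2 ⟨x, hx, by rwa [dist_comm]⟩)
    (self_subset_thickening hδ _ hy)

namespace NullHoles

variable {D : ℕ → Set ℂ}

lemma exists_scales (h : NullHoles D) {O : Set ℂ} (hO : IsOpen O) (hDO : ∀ n, D n ⊆ O) {η : ℝ}
    (hη : 0 < η) : ∃ ε r : ℕ → ℝ, (∀ n, 0 < ε n) ∧ (∀ n m, n < m → ε m ≤ ε n / 2) ∧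
      (∀ n, 0 < r n) ∧ (∀ n, r n ≤ ε n / 4) ∧ (∀ n, ε n ≤ η / 4) ∧
      (∀ n, thickening (4 * ε n) (D n) ⊆ O) ∧
      (∀ i n, i < n → ∀ x ∈ D i, ∀ y ∈ D n, 8 * ε n ≤ dist x y) ∧
      (∀ n m, n < m → (thickening (r n) (D n) ∩ thickening (r m) (D m)).Nonempty →
        diam (thickening (r m) (D m)) ≤ ε n) := by
  have hgap : ∀ i n, ∃ d > 0, i < n → ∀ x ∈ D i, ∀ y ∈ D n, d ≤ dist x y := by
    intro i n
    by_cases hin : i < n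
    · obtain ⟨d, hd, h'⟩ := exists_gap_of_disjoint (h.compact i) (h.compact n) (h.disj hin.ne)
      exact ⟨d, hd, fun _ => h'⟩
    · exact ⟨1, one_pos, fun h => absurd h hin⟩
  choose d hd hdist using hgap
  choose ρ hρ hρO using fun n => (h.compact n).exists_thickening_subset_open hO (hDO n)
  have he : ∀ n, ∃ e > 0, e ≤ η / 4 ∧ 4 * e ≤ ρ n ∧ ∀ i < n, 8 * e ≤ d i n := by
    intro n
    have h1 : ∀ᶠ e in 𝓝[>] (0 : ℝ), ∀ i ∈ Iio n, e ≤ d i n / 8 :=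
      (finite_Iio n).eventually_all.2 fun i _ => eventually_le_pos (by linarith [hd i n])
    obtain ⟨e, e0, e1, e2, e3⟩ := (eventually_pos_nhdsGT.and ((eventually_le_pos
      (by positivity : 0 < η / 4)).and ((eventually_le_pos (by linarith [hρ n] :
        0 < ρ n / 4)).and h1))).exists
    exact ⟨e, e0, e1, by linarith, fun i hi => by linarith [e3 i hi]⟩
  choose e e0 e1 e2 e3 using he
  let ε : ℕ → ℝ := fun n => Nat.rec (e 0) (fun k p => min (p / 2) (e (k + 1))) n
  have hεs : ∀ n, ε (n + 1) = min (ε n / 2) (e (n + 1)) := fun n => rfl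
  have hεpos : ∀ n, 0 < ε n := by
    intro n
    induction n with
    | zero => exact e0 0
    | succ n ih => rw [hεs]; exact lt_min (half_pos ih) (e0 _)
  have hεe : ∀ n, ε n ≤ e n := by
    rintro (_ | n)
    · exact le_rfl
    · rw [hεs]; exact min_le_right _ _
  have hhalf : ∀ n m, n < m → ε m ≤ ε n / 2 := by
    intro n m hnm
    induction m, hnm using Nat.le_induction with
    | base => rw [hεs]; exact min_le_left _ _
    | succ m hm ih =>
      rw [hεs]
      refine (min_le_left _ _).trans ?_
      linarith [hεpos n]
  have hr : ∀ n, ∃ r > 0, r ≤ ε n / 4 ∧ (∀ i < n, r ≤ d i n / 2) ∧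
      ∀ m, ε n / 2 < diam (D m) → r ≤ d n m / 2 := by
    intro n
    have h1 : ∀ᶠ e in 𝓝[>] (0 : ℝ), ∀ i ∈ Iio n, e ≤ d i n / 2 :=
      (finite_Iio n).eventually_all.2 fun i _ => eventually_le_pos (by linarith [hd i n])
    have hfin : {m | ε n / 2 < diam (D m)}.Finite := by
      have := h.null.eventually (gt_mem_nhds (half_pos (hεpos n)))
      rw [← Nat.cofinite_eq_atTop, eventually_cofinite] at this
      exact this.subset fun m hm => not_lt.2 (le_of_lt hm)
    have h2 : ∀ᶠ e in 𝓝[>] (0 : ℝ), ∀ m ∈ {m | ε n / 2 < diam (D m)}, e ≤ d n m / 2 :=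
      hfin.eventually_all.2 fun i _ => eventually_le_pos (by linarith [hd n i])
    obtain ⟨r, r0, r1, r2, r3⟩ := (eventually_pos_nhdsGT.and ((eventually_le_pos
      (by linarith [hεpos n] : 0 < ε n / 4)).and (h1.and h2))).exists
    exact ⟨r, r0, r1, r2, r3⟩
  choose r r0 r1 r2 r3 using hr
  refine ⟨ε, r, hεpos, hhalf, r0, r1, fun n => (hεe n).trans (e1 n), fun n => ?_, ?_, ?_⟩
  · exact (thickening_mono (by linarith [hεe n, e2 n]) _).trans (hρO n)
  · intro i n hin x hx y hy
    exact le_trans (by linarith [hεe n, e3 n i hin]) (hdist i n hin x hx y hy)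
  · rintro n m hnm ⟨z, hz₁, hz₂⟩
    by_cases hdm : ε n / 2 < diam (D m)
    · obtain ⟨x, hx, hzx⟩ := mem_thickening_iff.1 hz₁
      obtain ⟨y, hy, hzy⟩ := mem_thickening_iff.1 hz₂
      have := hdist n m hnm x hx y hy
      have h1 := r3 n m hdm
      have h2 := r2 m n hnm
      have h3 := dist_triangle_left x y z
      linarith
    · have h1 := diam_thickening_le (D m) (r0 m).le
      have h2 := r1 m
      have h3 := hhalf n m hnm
      have := hεpos n
      linarith

lemma exists_push (h : NullHoles D) (n : ℕ) {r : ℝ} (hr : 0 < r) {f : ℝ → ℂ}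
    (hf : ContinuousOn f (Icc 0 1)) (h0 : f 0 ∉ D n) (h1 : f 1 ∉ D n) :
    ∃ g : ℝ → ℂ, ContinuousOn g (Icc 0 1) ∧ g 0 = f 0 ∧ g 1 = f 1 ∧ ∀ t ∈ Icc (0 : ℝ) 1,
      g t ∉ D n ∧ (g t = f t ∨ (f t ∈ thickening r (D n) ∧ g t ∈ thickening r (D n))) := by
  have hc := h.compact n
  have hsub : D n ⊆ thickening r (D n) := self_subset_thickening hr _
  have hopen : IsOpen (thickening r (D n) \ D n) := isOpen_thickening.sdiff hc.isClosed
  have hpre : IsPreconnected (thickening r (D n) \ D n) := by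
    refine isPreconnected_diff_of_notSep isOpen_thickening hc.isBounded.thickening
      (isPreconnected_thickening (h.preconn n) r) hc ?_ (h.notSep n)
    rw [isOpen_thickening.frontier_eq, show D n ∩ (closure (thickening r (D n)) \
      thickening r (D n)) = ∅ from eq_empty_of_forall_notMem fun z hz => hz.2.2 (hsub hz.1)]
    exact isPreconnected_empty
  refine exists_path_push hf isOpen_thickening hc.isClosed hsub (fun p hp q hq => ?_) ?_ h0 h1
  · exact (hopen.isConnected_iff_isPathConnected.1 ⟨⟨p, hp⟩, hpre⟩).joinedIn p hp q hq
  · intro hne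
    by_contra hemp
    rw [not_nonempty_iff_eq_empty, sdiff_eq_empty] at hemp
    have heq : D n = thickening r (D n) := hsub.antisymm hemp
    have : IsClopen (D n) := ⟨hc.isClosed, by rw [heq]; exact isOpen_thickening⟩
    rcases isClopen_iff.1 this with h' | h'
    · exact hne.ne_empty h'
    · exact noncompact_univ ℂ (by rwa [h'] at hc)

/-- A path can be moved off a null sequence of holes lying in an open set, moving it only inside
this open set and not much farther than the size of the holes. -/
theorem exists_path_avoiding (h : NullHoles D) {O : Set ℂ} (hO : IsOpen O) (hDO : ∀ n, D n ⊆ O)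
    {f₀ : ℝ → ℂ} (hf₀ : ContinuousOn f₀ (Icc 0 1)) (h0 : ∀ n, f₀ 0 ∉ D n) (h1 : ∀ n, f₀ 1 ∉ D n)
    {B η : ℝ} (hB : ∀ n, diam (D n) ≤ B) (hη : 0 < η) :
    ∃ f : ℝ → ℂ, ContinuousOn f (Icc 0 1) ∧ f 0 = f₀ 0 ∧ f 1 = f₀ 1 ∧ ∀ t ∈ Icc (0 : ℝ) 1,
      (∀ n, f t ∉ D n) ∧ (f t = f₀ t ∨ f t ∈ O) ∧ dist (f t) (f₀ t) ≤ B + η := by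
  obtain ⟨ε, r, hε0, hhalf, hr0, hr1, hεη, hεO, hεd, hdiam⟩ := h.exists_scales hO hDO hη
  set N : ℕ → Set ℂ := fun n => thickening (r n) (D n) with hN
  have hNb : ∀ n, Bornology.IsBounded (N n) := fun n => (h.compact n).isBounded.thickening
  let P : Type := {f : ℝ → ℂ // ContinuousOn f (Icc 0 1) ∧ f 0 = f₀ 0 ∧ f 1 = f₀ 1}
  have hstep : ∀ n (f : P), ∃ g : P, ∀ t ∈ Icc (0 : ℝ) 1,
      g.1 t ∉ D n ∧ (g.1 t = f.1 t ∨ (f.1 t ∈ N n ∧ g.1 t ∈ N n)) := by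
    intro n f
    obtain ⟨g, hg, hg0, hg1, hg2⟩ := h.exists_push n (hr0 n) f.2.1
      (by rw [f.2.2.1]; exact h0 n) (by rw [f.2.2.2]; exact h1 n)
    exact ⟨⟨g, hg, hg0.trans f.2.2.1, hg1.trans f.2.2.2⟩, hg2⟩
  choose S hS using hstep
  let F : ℕ → P := fun n => Nat.rec ⟨f₀, hf₀, rfl, rfl⟩ (fun k p => S k p) n
  have hmove : ∀ t ∈ Icc (0 : ℝ) 1, ∀ n, (F (n + 1)).1 t = (F n).1 t ∨
      ((F n).1 t ∈ N n ∧ (F (n + 1)).1 t ∈ N n) := fun t ht n => (hS n (F n) t ht).2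
  have hav : ∀ t ∈ Icc (0 : ℝ) 1, ∀ n, (F (n + 1)).1 t ∉ D n := fun t ht n =>
    (hS n (F n) t ht).1
  have htail : ∀ t ∈ Icc (0 : ℝ) 1, ∀ n j, n < j → (F (n + 1)).1 t ∈ N n →
      dist ((F j).1 t) ((F (n + 1)).1 t) ≤ 2 * ε n := fun t ht n j hnj hn =>
    dist_le_of_moves (x := fun n => (F n).1 t) (hmove t ht) hNb hdiam hε0 hhalf hn hnj
  have hNdiam : ∀ n, diam (N n) ≤ diam (D n) + ε n / 2 := fun n => by
    have := diam_thickening_le (D n) (hr0 n).le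
    linarith [hr1 n]
  have hmv : ∀ t ∈ Icc (0 : ℝ) 1, ∀ k j, k ≤ j → (F j).1 t = (F k).1 t ∨ ∃ m, k ≤ m ∧
      dist ((F j).1 t) ((F k).1 t) ≤ diam (D m) + 5 / 2 * ε m := by
    intro t ht k j hkj
    rcases eq_or_exists_move (x := fun n => (F n).1 t) (hmove t ht) hkj with h' | ⟨m, h2, h3, h4, h5⟩
    · exact Or.inl h'
    · refine Or.inr ⟨m, h2, ?_⟩
      have a1 := htail t ht m j h3 h5
      have a2 := dist_le_diam_of_mem (hNb m) h5 h4
      have a3 := dist_triangle ((F j).1 t) ((F (m + 1)).1 t) ((F k).1 t)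
      linarith [hNdiam m]
  have hεt : Tendsto ε atTop (𝓝 0) := by
    refine squeeze_zero (fun n => (hε0 n).le) (g := fun n => ε 0 * (1 / 2) ^ n) (fun n => ?_) ?_
    · induction n with
      | zero => simp
      | succ n ih =>
        have := hhalf n (n + 1) (Nat.lt_succ_self n)
        rw [pow_succ]; linarith
    · simpa using (tendsto_pow_atTop_nhds_zero_of_lt_one (by norm_num : (0 : ℝ) ≤ 1 / 2)
        (by norm_num)).const_mul (ε 0)
  have hunif : UniformCauchySeqOn (fun n => (F n).1) atTop (Icc 0 1) := by
    rw [Metric.uniformCauchySeqOn_iff]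
    intro δ hδ
    have hT : Tendsto (fun m => diam (D m) + 5 / 2 * ε m) atTop (𝓝 0) := by
      simpa using h.null.add (hεt.const_mul (5 / 2))
    obtain ⟨M, hM⟩ := eventually_atTop.1 (hT.eventually (gt_mem_nhds hδ))
    have key : ∀ j ≥ M, ∀ k ≥ j, ∀ t ∈ Icc (0 : ℝ) 1, dist ((F k).1 t) ((F j).1 t) < δ := by
      intro j hj k hk t ht
      rcases hmv t ht j k hk with h' | ⟨m, h2, h3⟩
      · rw [h', dist_self]; exact hδ
      · exact h3.trans_lt (hM m (hj.trans h2))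
    refine ⟨M, fun j hj k hk t ht => ?_⟩
    rcases le_total j k with hjk | hjk
    · rw [dist_comm]; exact key j hj k hjk t ht
    · exact key k hk j hjk t ht
  have hlim : ∀ t ∈ Icc (0 : ℝ) 1, ∃ y, Tendsto (fun n => (F n).1 t) atTop (𝓝 y) := fun t ht =>
    cauchySeq_tendsto_of_complete (hunif.cauchySeq ht)
  choose! f hf using hlim
  have hcont : ContinuousOn f (Icc 0 1) :=
    (hunif.tendstoUniformlyOn_of_tendsto hf).continuousOn (Frequently.of_forall fun n => (F n).2.1)
  have hz : (0 : ℝ) ∈ Icc (0 : ℝ) 1 := by simp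
  have ho : (1 : ℝ) ∈ Icc (0 : ℝ) 1 := by simp
  have hmlim : ∀ t ∈ Icc (0 : ℝ) 1, ∀ k, f t = (F k).1 t ∨ ∃ m ≥ k, (F k).1 t ∈ N m ∧
      (F (m + 1)).1 t ∈ N m ∧ dist (f t) ((F (m + 1)).1 t) ≤ 2 * ε m := by
    intro t ht k
    by_cases hex : ∃ m ≥ k, (F k).1 t ∈ N m ∧ (F (m + 1)).1 t ∈ N m
    · obtain ⟨m, hmk, hm, hm'⟩ := hex
      exact Or.inr ⟨m, hmk, hm, hm', le_of_tendsto ((hf t ht).dist tendsto_const_nhds)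
        ((eventually_gt_atTop m).mono fun j hj => htail t ht m j hj hm')⟩
    · refine Or.inl (tendsto_nhds_unique (hf t ht) (tendsto_const_nhds.congr' ?_))
      filter_upwards [eventually_ge_atTop k] with j hj
      rcases eq_or_exists_move (x := fun n => (F n).1 t) (hmove t ht) hj with
        h' | ⟨m, h2, -, h4, h5⟩
      · exact h'.symm
      · exact absurd ⟨m, h2, h4, h5⟩ hex
  refine ⟨f, hcont, ?_, ?_, fun t ht => ⟨fun i hi => ?_, ?_, ?_⟩⟩
  · exact tendsto_nhds_unique (hf 0 hz) (tendsto_const_nhds.congr fun n => (F n).2.2.1.symm)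
  · exact tendsto_nhds_unique (hf 1 ho) (tendsto_const_nhds.congr fun n => (F n).2.2.2.symm)
  · rcases hmlim t ht (i + 1) with h' | ⟨m, hm, -, h4, h5⟩
    · exact hav t ht i (h' ▸ hi)
    · obtain ⟨y, hy, hxy⟩ := mem_thickening_iff.1 h4
      have := hεd i m hm (f t) hi y hy
      have a := dist_triangle (f t) ((F (m + 1)).1 t) y
      linarith [hr1 m, hε0 m]
  · rcases hmlim t ht 0 with h' | ⟨m, -, -, h4, h5⟩
    · exact Or.inl h'
    · obtain ⟨y, hy, hxy⟩ := mem_thickening_iff.1 h4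
      refine Or.inr (hεO m (mem_thickening_iff.2 ⟨y, hy, ?_⟩))
      have a := dist_triangle (f t) ((F (m + 1)).1 t) y
      linarith [hr1 m, hε0 m]
  · rcases hmlim t ht 0 with h' | ⟨m, -, h3, h4, h5⟩
    · rw [h']
      have hB0 := diam_nonneg.trans (hB 0)
      change dist (f₀ t) (f₀ t) ≤ _
      rw [dist_self]; linarith
    · have a1 : dist ((F (m + 1)).1 t) (f₀ t) ≤ diam (N m) := dist_le_diam_of_mem (hNb m) h4 h3
      have a2 := dist_triangle (f t) ((F (m + 1)).1 t) (f₀ t)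
      linarith [hNdiam m, hB m, hεη m]

end NullHoles

/-! ### Accessibility and crosscuts -/

/-- `x` is the initial point of a path lying otherwise in `O`. -/
def Accessible (O : Set ℂ) (x : ℂ) : Prop :=
  ∃ g : ℝ → ℂ, ContinuousOn g (Icc 0 1) ∧ g 0 = x ∧ ∀ t ∈ Ioc (0 : ℝ) 1, g t ∈ O

lemma Accessible.mono {O O' : Set ℂ} {x : ℂ} (h : Accessible O x) (hO : O ⊆ O') : Accessible O' x := by
  obtain ⟨g, hg, h0, h1⟩ := h
  exact ⟨g, hg, h0, fun t ht => hO (h1 t ht)⟩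

lemma Accessible.diff {O F : Set ℂ} {x : ℂ} (h : Accessible O x) (hF : IsClosed F) (hx : x ∉ F) :
    Accessible (O \ F) x := by
  obtain ⟨g, hg, h0, h1⟩ := h
  have hev : ∀ᶠ t in 𝓝[Icc 0 1] (0 : ℝ), g t ∉ F :=
    (hg 0 (by simp)).eventually (hF.isOpen_compl.mem_nhds (by rwa [h0]))
  obtain ⟨u, hu0, hsub⟩ := Metric.mem_nhdsWithin_iff.1 hev
  have hs0 : 0 < min u 1 / 2 := by positivity
  have hs1 : min u 1 / 2 ≤ 1 := by linarith [min_le_right u 1]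
  have hsu : min u 1 / 2 < u := by linarith [min_le_left u 1, lt_min hu0 one_pos]
  have hm : ∀ t ∈ Icc (0 : ℝ) 1, min u 1 / 2 * t ∈ Icc (0 : ℝ) 1 := fun t ht =>
    ⟨mul_nonneg hs0.le ht.1, mul_le_one₀ hs1 ht.1 ht.2⟩
  refine ⟨fun t => g (min u 1 / 2 * t), hg.comp (by fun_prop) hm, by simp [h0], fun t ht => ?_⟩
  have ht' := hm t ⟨ht.1.le, ht.2⟩
  refine ⟨h1 _ ⟨mul_pos hs0 ht.1, ht'.2⟩, hsub ⟨?_, ht'⟩⟩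
  rw [mem_ball_zero_iff, Real.norm_of_nonneg ht'.1]
  nlinarith [ht.1, ht.2]

/-- Infinite concatenation of paths. -/
lemma acc_of_local {O : Set ℂ} {x : ℂ} (hx : x ∈ closure O)
    (hloc : ∀ ε > 0, ∃ δ > 0, ∀ p ∈ O ∩ ball x δ, ∀ q ∈ O ∩ ball x δ, JoinedIn (O ∩ ball x ε) p q) :
    Accessible O x := by
  choose! δ hδ hJ using hloc
  have hε : ∀ n : ℕ, (0 : ℝ) < 1 / (n + 1) := fun n => Nat.one_div_pos_of_nat
  have hp : ∀ n : ℕ, ∃ p ∈ O, dist p x < min (δ (1 / (n + 1))) (δ (1 / ((n - 1 : ℕ) + 1))) := by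
    intro n
    obtain ⟨p, hp, hd⟩ := Metric.mem_closure_iff.1 hx _ (lt_min (hδ _ (hε n)) (hδ _ (hε (n - 1))))
    exact ⟨p, hp, by rwa [dist_comm]⟩
  choose p hpO hpd using hp
  have hγ : ∀ n : ℕ, JoinedIn (O ∩ ball x (1 / (n + 1))) (p n) (p (n + 1)) := fun n =>
    hJ _ (hε n) _ ⟨hpO n, (hpd n).trans_le (min_le_left _ _)⟩ _
      ⟨hpO (n + 1), (hpd (n + 1)).trans_le (by simpa using min_le_right _ _)⟩
  obtain ⟨e, hec, he0, he1, heO⟩ : ∃ e : ℕ → ℝ → ℂ, (∀ n, Continuous (e n)) ∧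
      (∀ n, e n 0 = p n) ∧ (∀ n, e n 1 = p (n + 1)) ∧
      ∀ n : ℕ, ∀ s ∈ Icc (0 : ℝ) 1, e n s ∈ O ∩ ball x (1 / (n + 1)) := by
    refine ⟨fun n => (hγ n).somePath.extend, fun n => Path.continuous_extend _, fun n => by simp,
      fun n => by simp, fun n s hs => ?_⟩
    have := (hγ n).somePath_mem ⟨_, hs⟩
    rwa [← Path.extend_apply _ hs] at this
  obtain ⟨G, hG⟩ : ∃ G : ℝ → ℂ, ∀ s, G s = e ⌊s⌋₊ (s - ⌊s⌋₊) := ⟨_, fun _ => rfl⟩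
  have hGn : ∀ n : ℕ, ∀ s ∈ Icc (n : ℝ) (n + 1), G s = e n (s - n) := by
    intro n s hs
    rcases hs.2.eq_or_lt with heq | hlt
    · have : ⌊s⌋₊ = n + 1 := by rw [heq]; exact_mod_cast Nat.floor_natCast (n + 1)
      rw [hG, this, heq]
      simp [he0, he1]
    · have : ⌊s⌋₊ = n := (Nat.floor_eq_iff ((Nat.cast_nonneg n).trans hs.1)).2 ⟨hs.1, hlt⟩
      rw [hG, this]
  have hGO : ∀ n : ℕ, ∀ s : ℝ, (n : ℝ) ≤ s → G s ∈ O ∩ ball x (1 / (n + 1)) := by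
    intro n s hs
    have hs0 : 0 ≤ s := (Nat.cast_nonneg n).trans hs
    have hfl : (⌊s⌋₊ : ℝ) ≤ s := Nat.floor_le hs0
    have hin : s - ⌊s⌋₊ ∈ Icc (0 : ℝ) 1 := ⟨by linarith, by linarith [Nat.lt_floor_add_one s]⟩
    have := heO ⌊s⌋₊ _ hin
    rw [← hG] at this
    refine ⟨this.1, ball_subset_ball ?_ this.2⟩
    have h1 : n ≤ ⌊s⌋₊ := Nat.le_floor hs
    exact one_div_le_one_div_of_le (by positivity) (by exact_mod_cast Nat.succ_le_succ h1)
  have hGc : ∀ n : ℕ, ContinuousOn G (Icc 0 n) := by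
    intro n
    induction n with
    | zero => simp
    | succ n ih =>
      have := ih.union_of_isClosed (t := Icc (n : ℝ) (n + 1))
        (((hec n).comp (continuous_id.sub continuous_const)).continuousOn.congr
          (hGn n)) isClosed_Icc isClosed_Icc
      rwa [Icc_union_Icc_eq_Icc (Nat.cast_nonneg n) (by linarith), ← Nat.cast_add_one] at this
  have hGc' : ContinuousOn G (Ici 0) := by
    intro s hs
    obtain ⟨n, hn⟩ := exists_nat_gt s
    refine (hGc n s ⟨hs, hn.le⟩).mono_of_mem_nhdsWithin ?_
    filter_upwards [self_mem_nhdsWithin, nhdsWithin_le_nhds (Iio_mem_nhds hn)] with y hy hy'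
    exact ⟨hy, le_of_lt hy'⟩
  refine ⟨fun t => if t = 0 then x else G (1 / t - 1), ?_, by simp, fun t ht => ?_⟩
  · intro t ht
    rcases ht.1.eq_or_lt with rfl | htpos
    · rw [Metric.continuousWithinAt_iff]
      intro ε hε
      obtain ⟨n, hn⟩ := exists_nat_one_div_lt hε
      refine ⟨1 / (n + 1), Nat.one_div_pos_of_nat, fun s hs hd => ?_⟩
      simp only [if_true]
      by_cases hs0 : s = 0
      · simp [hs0, hε]
      · rw [if_neg hs0]
        have hspos : 0 < s := lt_of_le_of_ne hs.1 (Ne.symm hs0)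
        rw [Real.dist_eq, sub_zero, abs_of_pos hspos] at hd
        have hle : (n : ℝ) ≤ 1 / s - 1 := by
          rw [lt_one_div hspos (by positivity)] at hd
          linarith
        exact (hGO n _ hle).2.trans hn
    · have hev : (fun t => if t = 0 then x else G (1 / t - 1)) =ᶠ[𝓝[Icc 0 1] t]
          fun t => G (1 / t - 1) := by
        filter_upwards [nhdsWithin_le_nhds (Ioi_mem_nhds htpos)] with s hs
        exact if_neg (ne_of_gt hs)
      refine ContinuousWithinAt.congr_of_eventuallyEq ?_ hev (if_neg htpos.ne')
      have h1 : ContinuousWithinAt (fun t : ℝ => 1 / t - 1) (Icc 0 1 ∩ Ioi 0) t :=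
        ContinuousAt.continuousWithinAt (by fun_prop (disch := exact htpos.ne'))
      have h2 : ContinuousWithinAt (fun t : ℝ => G (1 / t - 1)) (Icc 0 1 ∩ Ioi 0) t := by
        refine ContinuousWithinAt.comp (f := fun t : ℝ => 1 / t - 1) (x := t) (g := G)
          (t := Ici 0) (hGc' _ ?_) h1 fun s hs => ?_
        · rw [mem_Ici, sub_nonneg, le_div_iff₀ htpos]; linarith [ht.2]
        · have : (0 : ℝ) < s := hs.2
          rw [mem_Ici, sub_nonneg, le_div_iff₀ this]; linarith [hs.1.2]
      exact h2.mono_of_mem_nhdsWithin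
        (inter_mem_nhdsWithin _ (Ioi_mem_nhds htpos))
  · simp only [if_neg ht.1.ne']
    have : (0 : ℝ) ≤ 1 / t - 1 := by
      rw [sub_nonneg, le_div_iff₀ ht.1]; linarith [ht.2]
    exact (hGO 0 _ (by simpa using this)).1

lemma joinedIn_of_isPreconnected {U W : Set ℂ} (hU : IsOpen U) (hW : IsPreconnected W)
    (hWU : W ⊆ U) {p q : ℂ} (hp : p ∈ W) (hq : q ∈ W) : JoinedIn U p q := by
  have hc : IsConnected (connectedComponentIn U p) :=
    isConnected_connectedComponentIn_iff.2 (hWU hp)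
  have := ((hU.connectedComponentIn (x := p)).isConnected_iff_isPathConnected.1 hc).joinedIn p
    (mem_connectedComponentIn (hWU hp)) q (hW.subset_connectedComponentIn hp hWU hq)
  exact this.mono (connectedComponentIn_subset U p)

/-- Local connectedness of a complementary domain of a Jordan curve at a boundary point. -/
lemma IsJordanCurve.acc_of_side {J V : Set ℂ} (hJ : IsJordanCurve J) (hVo : IsOpen V)
    (hV : IsPreconnected V) (hVJ : Disjoint V J)
    (hVmax : ∀ W, IsPreconnected W → Disjoint W J → (W ∩ V).Nonempty → W ⊆ V)
    {x : ℂ} (hxV : x ∈ closure V) (hx : x ∈ J) : Accessible V x := by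
  refine acc_of_local hxV fun ε hε => ?_
  obtain ⟨L, c, d, hL, hLJ, hxL, hFL⟩ := hJ.exists_arc_of_notMem hx
    (isOpen_ball (x := x) (ε := ε)).isClosed_compl (by simpa using hε)
  obtain ⟨ρ, hρ, hρL⟩ := Metric.isOpen_iff.1 hL.isClosed.isOpen_compl x hxL
  refine ⟨min ρ ε, lt_min hρ hε, fun p hp q hq => ?_⟩
  have hbε : ball x (min ρ ε) ⊆ ball x ε := ball_subset_ball (min_le_right _ _)
  have hbρ : ball x (min ρ ε) ⊆ ball x ρ := ball_subset_ball (min_le_left _ _)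
  have h₁ : NotSep J p q := ⟨V, hV, hVJ, hp.1, hq.1⟩
  have h₂ : NotSep (sphere x ε ∪ L) p q := by
    refine ⟨ball x (min ρ ε), (convex_ball _ _).isPreconnected, ?_, hp.2, hq.2⟩
    refine disjoint_left.2 fun z hz hz' => hz'.elim (fun h => ?_) fun h => hρL (hbρ hz) h
    exact (hbε hz).ne h
  have hmeet : J ∩ (sphere x ε ∪ L) = L := by
    refine Subset.antisymm ?_ fun z hz => ⟨hLJ hz, Or.inr hz⟩
    rintro z ⟨hzJ, hz | hz⟩
    · exact hFL ⟨fun h => (mem_ball.1 h).ne hz, hzJ⟩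
    · exact hz
  have h₃ := NotSep.union hJ.isCompact ((isCompact_sphere x ε).union
    hL.isCompact) (by rw [hmeet]; exact hL.isPreconnected) h₁ h₂
  obtain ⟨W, hW, hWd, hpW, hqW⟩ := exists_preconnected_of_notSep (F := J) (isOpen_ball (x := x))
    (hbε hp.2) (h₃.mono (by
      rw [frontier_ball x hε.ne']
      exact union_subset_union_right _ subset_union_left))
  have hWV : W ⊆ V := hVmax W hW (disjoint_left.2 fun z hz => (hWd hz).2) ⟨p, hpW, hp.1⟩
  exact joinedIn_of_isPreconnected (hVo.inter isOpen_ball) hW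
    (fun z hz => ⟨hWV hz, (hWd hz).1⟩) hpW hqW

lemma IsJordanCurve.acc_ins {J : Set ℂ} (hJ : IsJordanCurve J) {x : ℂ} (hx : x ∈ J) :
    Accessible (Ins J) x :=
  hJ.acc_of_side (isOpen_ins hJ.isCompact) hJ.isPreconnected_ins (disjoint_ins_self J)
    (fun _ hW hWJ ⟨_, hp, hpI⟩ => mem_ins_of_isPreconnected hJ.isCompact hW hWJ hp hpI)
    (by rw [hJ.closure_ins_eq_reg]; exact Or.inl hx) hx

lemma IsJordanCurve.acc_outs {J : Set ℂ} (hJ : IsJordanCurve J) {x : ℂ} (hx : x ∈ J) :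
    Accessible (Outs J) x :=
  hJ.acc_of_side (isOpen_ext hJ.isCompact) (isPreconnected_ext hJ.isCompact) (disjoint_ext_self J)
    (fun _ hW hWJ ⟨_, hp, hpI⟩ => mem_ext_of_isPreconnected hJ.isCompact hW hWJ hp hpI)
    (by rw [hJ.closure_outs]; exact Or.inl hx) hx

/-! ### Concatenation of three paths -/

/-- Concatenation of three paths parametrized by the unit interval. -/
noncomputable def concat₃ (p m q : ℝ → ℂ) (t : ℝ) : ℂ :=
  if t ≤ 1 / 3 then p (3 * t) else if t ≤ 2 / 3 then m (3 * t - 1) else q (3 * t - 2)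

lemma concat₃_cases {t : ℝ} (ht : t ∈ Icc (0 : ℝ) 1) (p m q : ℝ → ℂ) :
    (t ≤ 1 / 3 ∧ 3 * t ∈ Icc (0 : ℝ) 1 ∧ concat₃ p m q t = p (3 * t)) ∨
    (1 / 3 < t ∧ t ≤ 2 / 3 ∧ 3 * t - 1 ∈ Ioc (0 : ℝ) 1 ∧ concat₃ p m q t = m (3 * t - 1)) ∨
    (2 / 3 < t ∧ 3 * t - 2 ∈ Ioc (0 : ℝ) 1 ∧ concat₃ p m q t = q (3 * t - 2)) := by
  by_cases h1 : t ≤ 1 / 3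
  · exact Or.inl ⟨h1, ⟨by linarith [ht.1], by linarith⟩, if_pos h1⟩
  · by_cases h2 : t ≤ 2 / 3
    · exact Or.inr (Or.inl ⟨not_le.1 h1, h2, ⟨by linarith, by linarith⟩,
        by simp only [concat₃, if_neg h1, if_pos h2]⟩)
    · exact Or.inr (Or.inr ⟨not_le.1 h2, ⟨by linarith, by linarith [ht.2]⟩,
        by simp only [concat₃, if_neg h1, if_neg h2]⟩)

section

variable {p m q : ℝ → ℂ}

lemma concat₃_left {t : ℝ} (ht : t ≤ 1 / 3) : concat₃ p m q t = p (3 * t) := if_pos ht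

lemma concat₃_mid (hpm : p 1 = m 0) {t : ℝ} (ht : t ∈ Icc (1 / 3 : ℝ) (2 / 3)) :
    concat₃ p m q t = m (3 * t - 1) := by
  rcases ht.1.eq_or_lt with h | h
  · rw [concat₃_left h.symm.le, ← h]; norm_num [hpm]
  · rw [concat₃, if_neg h.not_ge, if_pos ht.2]

lemma concat₃_right (hmq : m 1 = q 0) {t : ℝ} (ht : 2 / 3 ≤ t) :
    concat₃ p m q t = q (3 * t - 2) := by
  have h1 : ¬ t ≤ 1 / 3 := by linarith
  rcases ht.eq_or_lt with h | h
  · rw [concat₃, if_neg h1, if_pos h.symm.le, ← h]; norm_num [hmq]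
  · rw [concat₃, if_neg h1, if_neg h.not_ge]

lemma concat₃_zero : concat₃ p m q 0 = p 0 := by rw [concat₃_left (by norm_num)]; simp

lemma concat₃_one : concat₃ p m q 1 = q 1 := by norm_num [concat₃]

lemma continuousOn_concat₃ (hp : ContinuousOn p (Icc 0 1)) (hm : ContinuousOn m (Icc 0 1))
    (hq : ContinuousOn q (Icc 0 1)) (hpm : p 1 = m 0) (hmq : m 1 = q 0) :
    ContinuousOn (concat₃ p m q) (Icc 0 1) := by
  have hp' : ContinuousOn (fun t => p (3 * t)) (Icc 0 (1 / 3)) :=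
    hp.comp (by fun_prop) fun t ht => ⟨by linarith [ht.1], by linarith [ht.2]⟩
  have hm' : ContinuousOn (fun t => m (3 * t - 1)) (Icc (1 / 3) (2 / 3)) :=
    hm.comp (by fun_prop) fun t ht => ⟨by linarith [ht.1], by linarith [ht.2]⟩
  have hq' : ContinuousOn (fun t => q (3 * t - 2)) (Icc (2 / 3) 1) :=
    hq.comp (by fun_prop) fun t ht => ⟨by linarith [ht.1], by linarith [ht.2]⟩
  refine continuousOn_ite_le (by norm_num) (by norm_num) hp'
    (continuousOn_ite_le (by norm_num) (by norm_num) hm' hq' ?_) ?_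
  · norm_num [hmq]
  · norm_num [hpm]

lemma image_concat₃ (hpm : p 1 = m 0) (hmq : m 1 = q 0) :
    concat₃ p m q '' Icc 0 1 = p '' Icc 0 1 ∪ m '' Icc 0 1 ∪ q '' Icc 0 1 := by
  refine Subset.antisymm ?_ ?_
  · rintro _ ⟨t, ht, rfl⟩
    rcases concat₃_cases ht p m q with ⟨-, h, e⟩ | ⟨-, -, h, e⟩ | ⟨-, h, e⟩ <;> rw [e]
    · exact Or.inl (Or.inl (mem_image_of_mem _ h))
    · exact Or.inl (Or.inr (mem_image_of_mem _ (Ioc_subset_Icc_self h)))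
    · exact Or.inr (mem_image_of_mem _ (Ioc_subset_Icc_self h))
  · rintro _ ((⟨s, hs, rfl⟩ | ⟨s, hs, rfl⟩) | ⟨s, hs, rfl⟩)
    · refine ⟨s / 3, ⟨by linarith [hs.1], by linarith [hs.2]⟩, ?_⟩
      rw [concat₃_left (by linarith [hs.2])]; congr 1; ring
    · refine ⟨(s + 1) / 3, ⟨by linarith [hs.1], by linarith [hs.2]⟩, ?_⟩
      rw [concat₃_mid hpm ⟨by linarith [hs.1], by linarith [hs.2]⟩]; congr 1; ring
    · refine ⟨(s + 2) / 3, ⟨by linarith [hs.1], by linarith [hs.2]⟩, ?_⟩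
      rw [concat₃_right hmq (by linarith [hs.1])]; congr 1; ring

lemma image_concat₃_ends (hmq : m 1 = q 0) :
    concat₃ p m q '' (Icc 0 (1 / 3) ∪ Icc (2 / 3) 1) = p '' Icc 0 1 ∪ q '' Icc 0 1 := by
  refine Subset.antisymm ?_ ?_
  · rintro _ ⟨t, ht | ht, rfl⟩
    · rw [concat₃_left ht.2]
      exact Or.inl (mem_image_of_mem _ ⟨by linarith [ht.1], by linarith [ht.2]⟩)
    · rw [concat₃_right hmq ht.1]
      exact Or.inr (mem_image_of_mem _ ⟨by linarith [ht.1], by linarith [ht.2]⟩)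
  · rintro _ (⟨s, hs, rfl⟩ | ⟨s, hs, rfl⟩)
    · refine ⟨s / 3, Or.inl ⟨by linarith [hs.1], by linarith [hs.2]⟩, ?_⟩
      rw [concat₃_left (by linarith [hs.2])]; congr 1; ring
    · refine ⟨(s + 2) / 3, Or.inr ⟨by linarith [hs.1], by linarith [hs.2]⟩, ?_⟩
      rw [concat₃_right hmq (by linarith [hs.1])]; congr 1; ring

end

lemma ArcParam.concat₃ {p m q : ℝ → ℂ} {P M Q : Set ℂ} {a c d b : ℂ} (hp : ArcParam p P a c)
    (hm : ArcParam m M c d) (hq : ArcParam q Q d b) (hPM : P ∩ M = {c}) (hMQ : M ∩ Q = {d})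
    (hPQ : Disjoint P Q) : ArcParam (concat₃ p m q) (P ∪ M ∪ Q) a b := by
  have hpm : p 1 = m 0 := by rw [hp.one, hm.zero]
  have hmq : m 1 = q 0 := by rw [hm.one, hq.zero]
  have hP : ∀ s ∈ Icc (0 : ℝ) 1, p s ∈ P := fun s hs => hp.image ▸ mem_image_of_mem _ hs
  have hM : ∀ s ∈ Icc (0 : ℝ) 1, m s ∈ M := fun s hs => hm.image ▸ mem_image_of_mem _ hs
  have hQ : ∀ s ∈ Icc (0 : ℝ) 1, q s ∈ Q := fun s hs => hq.image ▸ mem_image_of_mem _ hs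
  have hpm' : ∀ s ∈ Icc (0 : ℝ) 1, ∀ t ∈ Ioc (0 : ℝ) 1, p s ≠ m t := by
    intro s hs t ht he
    have ht' := Ioc_subset_Icc_self ht
    have h1 : m t = c := hPM.subset ⟨he ▸ hP s hs, hM t ht'⟩
    exact ht.1.ne' (hm.inj ht' (by simp) (h1.trans hm.zero.symm))
  have hmq' : ∀ s ∈ Icc (0 : ℝ) 1, ∀ t ∈ Ioc (0 : ℝ) 1, m s ≠ q t := by
    intro s hs t ht he
    have ht' := Ioc_subset_Icc_self ht
    have h1 : q t = d := hMQ.subset ⟨he ▸ hM s hs, hQ t ht'⟩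
    exact ht.1.ne' (hq.inj ht' (by simp) (h1.trans hq.zero.symm))
  have hpq' : ∀ s ∈ Icc (0 : ℝ) 1, ∀ t ∈ Ioc (0 : ℝ) 1, p s ≠ q t := fun s hs t ht he =>
    disjoint_left.1 hPQ (hP s hs) (he ▸ hQ t (Ioc_subset_Icc_self ht))
  refine ⟨continuousOn_concat₃ hp.cont hm.cont hq.cont hpm hmq, ?_, by rw [concat₃_zero, hp.zero],
    by rw [concat₃_one, hq.one], by rw [image_concat₃ hpm hmq, hp.image, hm.image, hq.image]⟩
  intro s hs t ht he
  rcases concat₃_cases hs p m q with ⟨-, h, e⟩ | ⟨-, -, h, e⟩ | ⟨-, h, e⟩ <;>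
  rcases concat₃_cases ht p m q with ⟨-, h', e'⟩ | ⟨-, -, h', e'⟩ | ⟨-, h', e'⟩ <;>
  rw [e, e'] at he
  · linarith [hp.inj h h' he]
  · exact absurd he (hpm' _ h _ h')
  · exact absurd he (hpq' _ h _ h')
  · exact absurd he.symm (hpm' _ h' _ h)
  · linarith [hm.inj (Ioc_subset_Icc_self h) (Ioc_subset_Icc_self h') he]
  · exact absurd he (hmq' _ (Ioc_subset_Icc_self h) _ h')
  · exact absurd he.symm (hpq' _ h' _ h)
  · exact absurd he.symm (hmq' _ (Ioc_subset_Icc_self h') _ h)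
  · have := hq.inj (Ioc_subset_Icc_self h) (Ioc_subset_Icc_self h') he
    linarith

/-! ### Families of holes -/

lemma reg_empty : Reg (∅ : Set ℂ) = ∅ := by
  refine eq_empty_iff_forall_notMem.2 fun z hz => ?_
  rcases hz with hz | hz
  · exact hz
  · exact hz.2 ⟨fun _ => 0, continuousOn_empty _, fun _ h => h.elim⟩

/-- A null family of pairwise disjoint closed Jordan domains, given by their boundary curves
(empty curves are allowed as placeholders). -/
structure Holes (C : ℕ → Set ℂ) : Prop where
  jordan : ∀ i, C i = ∅ ∨ IsJordanCurve (C i)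
  disj : Pairwise fun i j => Disjoint (Reg (C i)) (Reg (C j))
  null : Tendsto (fun i => diam (Reg (C i))) atTop (𝓝 0)

/-- A Jordan curve not crossing the holes, with holes dense inside. -/
structure Good (C : ℕ → Set ℂ) (J : Set ℂ) : Prop where
  jordan : IsJordanCurve J
  dense : Ins J ⊆ closure (⋃ i, Reg (C i))
  hole : ∀ i, Reg (C i) ⊆ Ins J ∨ Disjoint (Ins (C i)) (Reg J)

/-- The part of the closed Jordan domain outside the holes. -/
def Carpet (C : ℕ → Set ℂ) (J : Set ℂ) : Set ℂ := Reg J \ ⋃ i, Ins (C i)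

section

variable {C : ℕ → Set ℂ}

lemma Holes.isCompact_reg (h : Holes C) (i : ℕ) : IsCompact (Reg (C i)) := by
  rcases h.jordan i with e | e
  · rw [e, reg_empty]; exact isCompact_empty
  · exact e.isCompact_reg

lemma Holes.isCompact (h : Holes C) (i : ℕ) : IsCompact (C i) := by
  rcases h.jordan i with e | e
  · rw [e]; exact isCompact_empty
  · exact e.isCompact

lemma Holes.reg_subset_closure (h : Holes C) (i : ℕ) : Reg (C i) ⊆ closure (Ins (C i)) := by
  rcases h.jordan i with e | e
  · rw [e, reg_empty]; exact empty_subset _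
  · rw [e.closure_ins_eq_reg]

lemma Holes.disjoint_reg_of_isOpen (h : Holes C) {i : ℕ} {O : Set ℂ} (hO : IsOpen O)
    (hd : Disjoint (Ins (C i)) O) : Disjoint (Reg (C i)) O :=
  (hd.closure_left hO).mono_left (h.reg_subset_closure i)

lemma Holes.nullHoles (h : Holes C) (O : Set ℂ) :
    NullHoles fun i => {z ∈ Reg (C i) | Reg (C i) ⊆ O} := by
  classical
  have key : ∀ i, {z ∈ Reg (C i) | Reg (C i) ⊆ O} = if Reg (C i) ⊆ O then Reg (C i) else ∅ := by
    intro i; split_ifs with hi <;> simp [hi]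
  refine ⟨fun i => ?_, fun i => ?_, fun i => ?_, fun i j hij => ?_, ?_⟩
  · rw [key]; split_ifs
    · exact h.isCompact_reg i
    · exact isCompact_empty
  · rw [key]; split_ifs
    · rcases h.jordan i with e | e
      · rw [e, reg_empty]; exact isPreconnected_empty
      · exact e.isPreconnected_reg
    · exact isPreconnected_empty
  · have hem : ∀ p ∉ (∅ : Set ℂ), ∀ q ∉ (∅ : Set ℂ), NotSep (∅ : Set ℂ) p q := fun p _ q _ =>
      ⟨univ, isPreconnected_univ, disjoint_empty _, trivial, trivial⟩
    rw [key]; split_ifs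
    · rcases h.jordan i with e | e
      · rw [e, reg_empty]; exact hem
      · exact fun p hp q hq => e.notSep_reg hp hq
    · exact hem
  · exact (h.disj hij).mono (sep_subset _ _) (sep_subset _ _)
  · refine squeeze_zero (fun _ => diam_nonneg) (fun i => ?_) h.null
    exact diam_mono (sep_subset _ _) (h.isCompact_reg i).isBounded

/-- A path crossing an open set can be replaced by an arc avoiding the holes. -/
lemma Holes.exists_crosscut_near (h : Holes C) {O : Set ℂ} (hO : IsOpen O) {f : ℝ → ℂ}
    (hf : ContinuousOn f (Icc 0 1)) (hne : f 0 ≠ f 1) (h0 : f 0 ∉ O) (h1 : f 1 ∉ O)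
    (hfO : ∀ t ∈ Ioo (0 : ℝ) 1, f t ∈ O) {B η : ℝ} (hB0 : 0 ≤ B)
    (hB : ∀ i, Reg (C i) ⊆ O → diam (Reg (C i)) ≤ B) (hη : 0 < η) :
    ∃ T, IsArc T (f 0) (f 1) ∧ T \ {f 0, f 1} ⊆ O ∧
      (∀ i, Reg (C i) ⊆ O → Disjoint T (Reg (C i))) ∧
      ∀ z ∈ T, ∃ t ∈ Icc (0 : ℝ) 1, dist z (f t) ≤ B + η := by
  obtain ⟨g, hg, hg0, hg1, hgt⟩ := (h.nullHoles O).exists_path_avoiding hO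
    (fun i z hz => hz.2 hz.1) hf (fun i hz => h0 (hz.2 hz.1)) (fun i hz => h1 (hz.2 hz.1))
    (B := B) (fun i => by
      by_cases hi : Reg (C i) ⊆ O
      · simpa [hi] using hB i hi
      · simpa [hi] using hB0) hη
  rw [← hg0, ← hg1] at hne ⊢
  obtain ⟨T, hTg, hT⟩ := exists_isArc_of_path hg hne
  refine ⟨T, hT, fun z hz => ?_, fun i hi => disjoint_left.2 fun z hz hzC => ?_, fun z hz => ?_⟩
  · obtain ⟨t, ht, rfl⟩ := hTg hz.1
    rcases (hgt t ht).2.1 with e | e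
    · have h0' : t ≠ 0 := by rintro rfl; exact hz.2 (Or.inl rfl)
      have h1' : t ≠ 1 := by rintro rfl; exact hz.2 (Or.inr rfl)
      rw [e]
      exact hfO t ⟨lt_of_le_of_ne ht.1 h0'.symm, lt_of_le_of_ne ht.2 h1'⟩
    · exact e
  · obtain ⟨t, ht, rfl⟩ := hTg hz
    exact (hgt t ht).1 i ⟨hzC, hi⟩
  · obtain ⟨t, ht, rfl⟩ := hTg hz
    exact ⟨t, ht, (hgt t ht).2.2⟩

/-- Two accessible boundary points of a domain are joined by a crosscut avoiding the holes. -/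
lemma Holes.exists_crosscut (h : Holes C) {O : Set ℂ} (hO : IsOpen O) (hOc : IsPreconnected O)
    {x y : ℂ} (hne : x ≠ y) (hx : x ∉ O) (hy : y ∉ O) (hax : Accessible O x) (hay : Accessible O y) :
    ∃ T, IsArc T x y ∧ T \ {x, y} ⊆ O ∧ ∀ i, Reg (C i) ⊆ O → Disjoint T (Reg (C i)) := by
  obtain ⟨p, hp, hp0, hpO⟩ := hax
  obtain ⟨q, hq, hq0, hqO⟩ := hay
  have hJ : JoinedIn O (p 1) (q 1) := joinedIn_of_isPreconnected hO hOc Subset.rfl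
    (hpO 1 (by simp)) (hqO 1 (by simp))
  have hq' : ContinuousOn (fun t => q (1 - t)) (Icc 0 1) :=
    hq.comp (by fun_prop) fun t ht => ⟨by linarith [ht.2], by linarith [ht.1]⟩
  have hc := continuousOn_concat₃ hp (Path.continuous_extend hJ.somePath).continuousOn hq'
    (by simp) (by simp)
  have e0 : concat₃ p hJ.somePath.extend (fun t => q (1 - t)) 0 = x := by rw [concat₃_zero, hp0]
  have e1 : concat₃ p hJ.somePath.extend (fun t => q (1 - t)) 1 = y := by
    rw [concat₃_one]; simpa using hq0
  obtain ⟨R, hR⟩ := h.null.bddAbove_range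
  obtain ⟨T, hT, hTO, hTC, -⟩ := h.exists_crosscut_near hO hc (by rwa [e0, e1]) (by rwa [e0])
    (by rwa [e1]) (fun t ht => by
      rcases concat₃_cases (Ioo_subset_Icc_self ht) p hJ.somePath.extend (fun t => q (1 - t))
        with ⟨-, h, e⟩ | ⟨-, -, h, e⟩ | ⟨-, h, e⟩ <;> rw [e]
      · exact hpO _ ⟨by linarith [ht.1], h.2⟩
      · rw [Path.extend_apply _ (Ioc_subset_Icc_self h)]
        exact hJ.somePath_mem _
      · exact hqO _ ⟨by linarith [ht.2], by linarith [h.1]⟩)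
    (B := R) (diam_nonneg.trans (hR (mem_range_self 0))) (fun i _ => hR (mem_range_self i)) one_pos
  rw [e0, e1] at hT hTO
  exact ⟨T, hT, hTO, hTC⟩

end

/-! ### Cutting a good Jordan domain in two -/

section

variable {C : ℕ → Set ℂ}

lemma Good.ins_disjoint_curve {J : Set ℂ} (hG : Good C J) (i : ℕ) : Disjoint (Ins (C i)) J := by
  rcases hG.hole i with h | h
  · exact ((disjoint_ins_self J).mono_left (subset_union_right.trans h))
  · exact h.mono_right (IsJordanCurve.subset_reg J)

lemma Good.subset_carpet {J : Set ℂ} (hG : Good C J) : J ⊆ Carpet C J := fun z hz =>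
  ⟨Or.inl hz, fun h => by
    obtain ⟨i, hi⟩ := mem_iUnion.1 h
    exact disjoint_left.1 (hG.ins_disjoint_curve i) hi hz⟩

lemma IsJordanCurve.reg_subset_reg {J J' : Set ℂ} (hJ : IsJordanCurve J) (hJ' : IsJordanCurve J')
    (hsub : J' ⊆ Reg J) : Reg J' ⊆ Reg J :=
  union_subset hsub ((hJ.ins_subset_ins hJ' hsub).trans subset_union_right)

lemma Good.of_subset (h : Holes C) {J J' : Set ℂ} (hG : Good C J) (hJ' : IsJordanCurve J')
    (hsub : J' ⊆ Reg J) (hh : ∀ i, Reg (C i) ⊆ Ins J →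
      Disjoint (Reg (C i)) J' ∨ Disjoint (Ins (C i)) (Reg J')) : Good C J' := by
  refine ⟨hJ', (hG.jordan.ins_subset_ins hJ' hsub).trans hG.dense, fun i => ?_⟩
  rcases hG.hole i with hi | hi
  · rcases hh i hi with hd | hd
    · rcases h.jordan i with e | e
      · rw [e, reg_empty]; exact Or.inl (empty_subset _)
      · obtain ⟨z, hz⟩ := e.nonempty
        have hz' : z ∈ Reg (C i) := Or.inl hz
        rcases mem_reg_or_mem_outs J' z with hr | ho
        · exact Or.inl (mem_ins_of_isPreconnected hJ'.isCompact e.isPreconnected_reg hd hz'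
            (hr.resolve_left fun hzJ => disjoint_left.1 hd hz' hzJ))
        · refine Or.inr ?_
          have := mem_ext_of_isPreconnected hJ'.isCompact e.isPreconnected_reg hd hz' ho
          rw [← compl_reg] at this
          exact (disjoint_compl_left.mono_left (subset_union_right.trans this))
    · exact Or.inr hd
  · exact Or.inr (hi.mono_right (hG.jordan.reg_subset_reg hJ' hsub))

lemma Good.exists_hole (h : Holes C) {J : Set ℂ} (hG : Good C J) :
    ∃ i, IsJordanCurve (C i) ∧ Reg (C i) ⊆ Ins J := by
  obtain ⟨z, hz⟩ := hG.jordan.ins_nonempty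
  obtain ⟨w, hw, hwU⟩ := mem_closure_iff.1 (hG.dense hz) _ (isOpen_ins hG.jordan.isCompact) hz
  obtain ⟨i, hi⟩ := mem_iUnion.1 hwU
  refine ⟨i, (h.jordan i).resolve_left fun e => ?_, (hG.hole i).resolve_right fun hd => ?_⟩
  · rw [e, reg_empty] at hi; exact hi
  · exact disjoint_left.1 (h.disjoint_reg_of_isOpen (isOpen_ins hG.jordan.isCompact)
      (hd.mono_right subset_union_right)) hi hw

/-- The Jordan domain bounded by `A ∪ B` is cut along arcs `f` and `g` with the same endpoints,
agreeing on the parameter set `S` and enclosing at most a hole. -/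
structure Cut (C : ℕ → Set ℂ) (A B : Set ℂ) (a b : ℂ) (f g : ℝ → ℂ) (S : Set ℝ) : Prop where
  pair : ArcPair A B a b
  sub : S ⊆ Icc 0 1
  eq : EqOn f g S
  fparam : ArcParam f (f '' Icc 0 1) a b
  gparam : ArcParam g (g '' Icc 0 1) a b
  left : ArcPair A (f '' Icc 0 1) a b
  right : ArcPair B (g '' Icc 0 1) a b
  goodLeft : Good C (A ∪ f '' Icc 0 1)
  goodRight : Good C (B ∪ g '' Icc 0 1)
  cover : Carpet C (A ∪ B) = Carpet C (A ∪ f '' Icc 0 1) ∪ Carpet C (B ∪ g '' Icc 0 1)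
  inter : Carpet C (A ∪ f '' Icc 0 1) ∩ Carpet C (B ∪ g '' Icc 0 1) ⊆ f '' S
  bdryLeft : (A ∪ B) ∩ Reg (A ∪ f '' Icc 0 1) ⊆ A
  bdryRight : (A ∪ B) ∩ Reg (B ∪ g '' Icc 0 1) ⊆ B

lemma Cut.symm {A B : Set ℂ} {a b : ℂ} {f g : ℝ → ℂ} {S : Set ℝ} (h : Cut C A B a b f g S) :
    Cut C B A a b g f S where
  pair := h.pair.symm
  sub := h.sub
  eq := h.eq.symm
  fparam := h.gparam
  gparam := h.fparam
  left := h.right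
  right := h.left
  goodLeft := h.goodRight
  goodRight := h.goodLeft
  cover := by rw [union_comm B A, h.cover, union_comm]
  inter := by rw [inter_comm, ← h.eq.image_eq]; exact h.inter
  bdryLeft := by rw [union_comm B A]; exact h.bdryRight
  bdryRight := by rw [union_comm B A]; exact h.bdryLeft

lemma Cut.subset_reg_left {A B : Set ℂ} {a b : ℂ} {f g : ℝ → ℂ} {S : Set ℝ}
    (h : Cut C A B a b f g S) : A ∪ f '' Icc 0 1 ⊆ Reg (A ∪ B) := fun _ hz =>
  (h.cover.symm.subset (Or.inl (h.goodLeft.subset_carpet hz))).1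

lemma Cut.ins_left {A B : Set ℂ} {a b : ℂ} {f g : ℝ → ℂ} {S : Set ℝ}
    (h : Cut C A B a b f g S) : Ins (A ∪ f '' Icc 0 1) ⊆ Ins (A ∪ B) :=
  h.pair.isJordanCurve.ins_subset_ins h.left.isJordanCurve h.subset_reg_left

lemma Cut.ins_right {A B : Set ℂ} {a b : ℂ} {f g : ℝ → ℂ} {S : Set ℝ}
    (h : Cut C A B a b f g S) : Ins (B ∪ g '' Icc 0 1) ⊆ Ins (A ∪ B) := by
  rw [union_comm A B]; exact h.symm.ins_left

lemma carpet_cover {J L R : Set ℂ} (h₁ : Reg J ⊆ Reg L ∪ Reg R ∪ ⋃ i, Ins (C i))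
    (hL : Reg L ⊆ Reg J) (hR : Reg R ⊆ Reg J) : Carpet C J = Carpet C L ∪ Carpet C R := by
  rw [Carpet, Carpet, Carpet, ← union_sdiff_distrib]
  refine Subset.antisymm (fun z hz => ⟨(h₁ hz.1).resolve_right hz.2, hz.2⟩)
    (sdiff_subset_sdiff_left (union_subset hL hR))

/-- Cutting along a crosscut avoiding the holes. -/
lemma Theta.exists_cut (h : Holes C) {A B T : Set ℂ} {a b : ℂ} (hT : Theta A B T a b)
    (hG : Good C (A ∪ B)) (hTC : ∀ i, Reg (C i) ⊆ Ins (A ∪ B) → Disjoint T (Reg (C i))) :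
    ∃ f, f '' Icc 0 1 = T ∧ Cut C A B a b f f (Icc 0 1) := by
  obtain ⟨f, hf⟩ := hT.arc
  obtain rfl := hf.image
  have good : ∀ {A B : Set ℂ}, Theta A B (f '' Icc 0 1) a b → Good C (A ∪ B) →
      (∀ i, Reg (C i) ⊆ Ins (A ∪ B) → Disjoint (f '' Icc 0 1) (Reg (C i))) →
      Good C (A ∪ f '' Icc 0 1) := by
    intro A B hT hG hTC
    refine hG.of_subset h hT.pairLeft.isJordanCurve
      (union_subset (subset_union_left.trans subset_union_left) hT.subset_reg) fun i hi => ?_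
    refine Or.inl (disjoint_union_right.2 ⟨?_, (hTC i hi).symm⟩)
    exact (disjoint_ins_self _).mono hi subset_union_left
  refine ⟨f, rfl, ⟨hT.pair, Subset.rfl, fun _ _ => rfl, hf, hf, hT.pairLeft, hT.pairRight,
    good hT hG hTC, good hT.symm (by rwa [union_comm]) (by rwa [union_comm B A]), ?_, ?_,
    hT.inter_reg.subset, ?_⟩⟩
  · exact carpet_cover (by rw [hT.reg_eq]; exact subset_union_left)
      (hT.reg_eq ▸ subset_union_left) (hT.reg_eq ▸ subset_union_right)
  · exact (inter_subset_inter sdiff_subset sdiff_subset).trans hT.reg_inter.subset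
  · rw [union_comm A B]; exact hT.symm.inter_reg.subset

/-- The parameters of the two outer thirds of the unit interval. -/
def outerThirds : Set ℝ := Icc 0 (1 / 3) ∪ Icc (2 / 3) 1

lemma outerThirds_subset : outerThirds ⊆ Icc 0 1 :=
  union_subset (Icc_subset_Icc_right (by norm_num)) (Icc_subset_Icc_left (by norm_num))

/-- Cutting around a hole, on the two sides of it. -/
lemma cut_around (h : Holes C) {A B T₁ T₂ M N : Set ℂ} {a b c d : ℂ} {p q m n : ℝ → ℂ}
    {i : ℕ} (hp : ArcPair A B a b) (hG : Good C (A ∪ B)) (hT₁ : ArcParam p T₁ a c)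
    (hT₂ : ArcParam q T₂ d b) (hM : ArcParam m M c d) (hN : ArcParam n N c d)
    (hMN : M ∩ N = {c, d}) (hC : C i = M ∪ N) (h1C : T₁ ∩ (M ∪ N) = {c}) (h2C : T₂ ∩ (M ∪ N) = {d})
    (h12 : Disjoint T₁ T₂) (h1J : T₁ \ {a} ⊆ Ins (A ∪ B)) (h2J : T₂ \ {b} ⊆ Ins (A ∪ B))
    (hCJ : Reg (C i) ⊆ Ins (A ∪ B))
    (hav : ∀ j, j ≠ i → Reg (C j) ⊆ Ins (A ∪ B) → Disjoint (Reg (C j)) (T₁ ∪ T₂))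
    (hside : N \ {c, d} ⊆ Ins (B ∪ (T₁ ∪ M ∪ T₂))) :
    Cut C A B a b (concat₃ p m q) (concat₃ p n q) outerThirds := by
  have hcM : c ∈ M := IsArc.left_mem ⟨m, hM⟩
  have hdM : d ∈ M := IsArc.right_mem ⟨m, hM⟩
  have hcN : c ∈ N := IsArc.left_mem ⟨n, hN⟩
  have hdN : d ∈ N := IsArc.right_mem ⟨n, hN⟩
  have ha1 : a ∈ T₁ := IsArc.left_mem ⟨p, hT₁⟩
  have hc1 : c ∈ T₁ := IsArc.right_mem ⟨p, hT₁⟩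
  have hd2 : d ∈ T₂ := IsArc.left_mem ⟨q, hT₂⟩
  have hb2 : b ∈ T₂ := IsArc.right_mem ⟨q, hT₂⟩
  have haAB : a ∈ A ∩ B := hp.inter.symm.subset (Or.inl rfl)
  have hbAB : b ∈ A ∩ B := hp.inter.symm.subset (Or.inr rfl)
  have hMNJ : M ∪ N ⊆ Ins (A ∪ B) := hC ▸ subset_union_left.trans hCJ
  have hF : ArcParam (concat₃ p m q) (T₁ ∪ M ∪ T₂) a b := hT₁.concat₃ hM hT₂
    (Subset.antisymm (fun z hz => h1C.subset ⟨hz.1, Or.inl hz.2⟩)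
      (singleton_subset_iff.2 ⟨hc1, hcM⟩))
    (Subset.antisymm (fun z hz => h2C.subset ⟨hz.2, Or.inl hz.1⟩)
      (singleton_subset_iff.2 ⟨hdM, hd2⟩)) h12
  have hF' : ArcParam (concat₃ p n q) (T₁ ∪ N ∪ T₂) a b := hT₁.concat₃ hN hT₂
    (Subset.antisymm (fun z hz => h1C.subset ⟨hz.1, Or.inr hz.2⟩)
      (singleton_subset_iff.2 ⟨hc1, hcN⟩))
    (Subset.antisymm (fun z hz => h2C.subset ⟨hz.2, Or.inr hz.1⟩)
      (singleton_subset_iff.2 ⟨hdN, hd2⟩)) h12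
  have hθ : Theta A B (T₁ ∪ M ∪ T₂) a b := by
    refine ⟨hp, ⟨_, hF⟩, ?_⟩
    rintro z ⟨(hz | hz) | hz, hz'⟩
    · exact h1J ⟨hz, fun e => hz' (Or.inl e)⟩
    · exact hMNJ (Or.inl hz)
    · exact h2J ⟨hz, fun e => hz' (Or.inr e)⟩
  have h1B : T₁ ∩ B = {a} := by
    refine Subset.antisymm (fun z hz => ?_) (singleton_subset_iff.2 ⟨ha1, haAB.2⟩)
    by_contra hza
    exact (h1J ⟨hz.1, hza⟩).1 (Or.inr hz.2)
  have h2B : B ∩ T₂ = {b} := by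
    refine Subset.antisymm (fun z hz => ?_) (singleton_subset_iff.2 ⟨hbAB.2, hb2⟩)
    by_contra hza
    exact (h2J ⟨hz.2, hza⟩).1 (Or.inr hz.1)
  have hP : IsArc (T₁ ∪ B ∪ T₂) c d := by
    refine ((IsArc.symm ⟨p, hT₁⟩).trans hp.right h1B).trans (IsArc.symm ⟨q, hT₂⟩) ?_
    rw [union_inter_distrib_right, h12.inter_eq, h2B, empty_union]
  have hPM : ArcPair (T₁ ∪ B ∪ T₂) M c d := by
    refine ⟨hP, ⟨m, hM⟩, Subset.antisymm ?_ ?_⟩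
    · rintro z ⟨(hz | hz) | hz, hzM⟩
      · exact Or.inl (h1C.subset ⟨hz, Or.inl hzM⟩)
      · exact absurd (Or.inr hz) (hMNJ (Or.inl hzM)).1
      · exact Or.inr (h2C.subset ⟨hz, Or.inl hzM⟩)
    · rintro z (rfl | hz)
      · exact ⟨Or.inl (Or.inl hc1), hcM⟩
      · rw [mem_singleton_iff] at hz; rw [hz]; exact ⟨Or.inr hd2, hdM⟩
  have eM : T₁ ∪ B ∪ T₂ ∪ M = B ∪ (T₁ ∪ M ∪ T₂) := by ext z; simp only [mem_union]; tauto
  have eN : T₁ ∪ B ∪ T₂ ∪ N = B ∪ (T₁ ∪ N ∪ T₂) := by ext z; simp only [mem_union]; tauto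
  have hθ' : Theta (T₁ ∪ B ∪ T₂) M N c d := ⟨hPM, ⟨n, hN⟩, by rw [eM]; exact hside⟩
  have hInsC : Ins (C i) ⊆ Ins (B ∪ (T₁ ∪ M ∪ T₂)) := by
    rw [hC, ← eM]
    exact fun z hz => (hθ'.ins_diff_eq.symm.subset (Or.inr hz)).1
  have hdL : Disjoint (Ins (C i)) (Reg (A ∪ (T₁ ∪ M ∪ T₂))) := by
    refine Disjoint.mono_left hInsC (disjoint_union_right.2 ⟨disjoint_union_right.2
      ⟨hθ.symm.disjoint_ins_right, (disjoint_ins_self _).mono_right subset_union_right⟩,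
      hθ.disjoint_ins.symm⟩)
  have hdR : Disjoint (Ins (C i)) (Reg (B ∪ (T₁ ∪ N ∪ T₂))) := by
    rw [← eN, hC]
    exact disjoint_union_right.2 ⟨disjoint_union_right.2
      ⟨hθ'.symm.disjoint_ins_right, (disjoint_ins_self _).mono_right subset_union_right⟩,
      hθ'.disjoint_ins.symm⟩
  have hRsub : Reg (B ∪ (T₁ ∪ N ∪ T₂)) ⊆ Reg (B ∪ (T₁ ∪ M ∪ T₂)) := by
    rw [← eN, ← eM, hθ'.reg_eq]; exact subset_union_left
  have hRJ : Reg (B ∪ (T₁ ∪ N ∪ T₂)) ⊆ Reg (A ∪ B) :=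
    hRsub.trans (by rw [hθ.reg_eq]; exact subset_union_right)
  have hLJ : Reg (A ∪ (T₁ ∪ M ∪ T₂)) ⊆ Reg (A ∪ B) := by
    rw [hθ.reg_eq]; exact subset_union_left
  have hav' : ∀ j, j ≠ i → Reg (C j) ⊆ Ins (A ∪ B) → ∀ X, X ⊆ A ∪ B →
      ∀ Y ⊆ M ∪ N, Disjoint (Reg (C j)) (X ∪ (T₁ ∪ Y ∪ T₂)) := by
    intro j hj hjJ X hX Y hY
    have h12 := disjoint_union_right.1 (hav j hj hjJ)
    refine disjoint_union_right.2 ⟨(disjoint_ins_self _).mono hjJ hX, disjoint_union_right.2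
      ⟨disjoint_union_right.2 ⟨h12.1, (h.disj hj).mono_right (hY.trans ?_)⟩, h12.2⟩⟩
    rw [← hC]; exact subset_union_left
  have hpR : ArcPair B (T₁ ∪ N ∪ T₂) a b := by
    refine ⟨hp.right, ⟨_, hF'⟩, Subset.antisymm ?_ ?_⟩
    · rintro z ⟨hzB, (hz | hz) | hz⟩
      · exact Or.inl (h1B.subset ⟨hz, hzB⟩)
      · exact absurd (Or.inr hzB) (hMNJ (Or.inr hz)).1
      · exact Or.inr (h2B.subset ⟨hzB, hz⟩)
    · rintro z (rfl | hz)
      · exact ⟨haAB.2, Or.inl (Or.inl ha1)⟩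
      · rw [mem_singleton_iff] at hz; rw [hz]; exact ⟨hbAB.2, Or.inr hb2⟩
  have ends : ∀ k : ℝ → ℂ, k 1 = q 0 → concat₃ p k q '' outerThirds = T₁ ∪ T₂ := fun k hk => by
    rw [outerThirds, image_concat₃_ends hk, hT₁.image, hT₂.image]
  refine ⟨hp, outerThirds_subset, ?_, ?_, ?_, ?_, ?_, ?_, ?_, ?_, ?_, ?_, ?_⟩ <;>
    try simp only [hF.image, hF'.image]
  · rintro t (ht | ht)
    · rw [concat₃_left ht.2, concat₃_left ht.2]
    · rw [concat₃_right (by rw [hM.one, hT₂.zero]) ht.1,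
        concat₃_right (by rw [hN.one, hT₂.zero]) ht.1]
  · exact hF
  · exact hF'
  · exact hθ.pairLeft
  · exact hpR
  · refine hG.of_subset h hθ.pairLeft.isJordanCurve ((IsJordanCurve.subset_reg _).trans hLJ) fun j hj => ?_
    rcases eq_or_ne j i with rfl | hji
    · exact Or.inr hdL
    · exact Or.inl (hav' j hji hj A subset_union_left M subset_union_left)
  · refine hG.of_subset h hpR.isJordanCurve ((IsJordanCurve.subset_reg _).trans hRJ) fun j hj => ?_
    rcases eq_or_ne j i with rfl | hji
    · exact Or.inr hdR
    · exact Or.inl (hav' j hji hj B subset_union_right N subset_union_right)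
  · refine carpet_cover ?_ hLJ hRJ
    rw [hθ.reg_eq, ← eM, hθ'.reg_eq, eN]
    refine union_subset (fun z hz => Or.inl (Or.inl hz))
      (union_subset (fun z hz => Or.inl (Or.inr hz)) ?_)
    rintro z ((hz | hz) | hz)
    · exact Or.inl (Or.inl (Or.inl (Or.inr (Or.inl (Or.inr hz)))))
    · exact Or.inl (Or.inr (Or.inl (Or.inr (Or.inl (Or.inr hz)))))
    · exact Or.inr (mem_iUnion.2 ⟨i, by rwa [hC]⟩)
  · rw [ends m (by rw [hM.one, hT₂.zero])]
    rintro z ⟨hzL, hzR⟩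
    have hz1 : z ∈ T₁ ∪ M ∪ T₂ := hθ.reg_inter.subset ⟨hzL.1, hRsub hzR.1⟩
    rcases hz1 with (hz1 | hz1) | hz1
    · exact Or.inl hz1
    · have : z ∈ T₁ ∪ B ∪ T₂ := hθ'.inter_reg.subset ⟨Or.inr hz1, by rw [eN]; exact hzR.1⟩
      rcases this with (hz2 | hz2) | hz2
      · exact Or.inl hz2
      · exact absurd (Or.inr hz2) (hMNJ (Or.inl hz1)).1
      · exact Or.inr hz2
    · exact Or.inr hz1
  · exact hθ.inter_reg.subset
  · rintro z ⟨hzJ, hzR⟩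
    have := hθ.symm.inter_reg.subset ⟨by rwa [union_comm B A], hRsub hzR⟩
    exact this

lemma Theta.subset_or_subset {A B T Z : Set ℂ} {a b : ℂ} (hθ : Theta A B T a b)
    (hZ : IsPreconnected Z) (hZJ : Z ⊆ Ins (A ∪ B)) (hZT : Disjoint Z T) :
    Z ⊆ Ins (A ∪ T) ∨ Z ⊆ Ins (B ∪ T) := by
  refine isPreconnected_iff_subset_of_disjoint.1 hZ _ _
    (isOpen_ins hθ.pairLeft.isJordanCurve.isCompact)
    (isOpen_ins hθ.pairRight.isJordanCurve.isCompact) ?_ ?_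
  · rw [← hθ.ins_diff_eq]
    exact fun z hz => ⟨hZJ hz, disjoint_left.1 hZT hz⟩
  · rw [hθ.disjoint_ins.inter_eq, inter_empty]

lemma exists_cut_around (h : Holes C) {A B : Set ℂ} {a b : ℂ} {i : ℕ} (hp : ArcPair A B a b)
    (hG : Good C (A ∪ B)) (hi : IsJordanCurve (C i)) (hCJ : Reg (C i) ⊆ Ins (A ∪ B)) :
    ∃ f g, Cut C A B a b f g outerThirds ∧ (C i ∩ f '' outerThirds).Nonempty := by
  have hJ := hG.jordan
  have hIo : IsOpen (Ins (A ∪ B)) := isOpen_ins hJ.isCompact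
  have hfr : frontier (Ins (A ∪ B)) = A ∪ B := hJ.frontier_ins
  have hCr : IsClosed (Reg (C i)) := hi.isCompact_reg.isClosed
  have haAB : a ∈ A ∪ B := Or.inl hp.left.left_mem
  have hbAB : b ∈ A ∪ B := Or.inl hp.left.right_mem
  have hJR : ∀ z ∈ A ∪ B, z ∉ Reg (C i) := fun z hz hzC => (hCJ hzC).1 hz
  obtain ⟨c, hc⟩ := hi.nonempty
  obtain ⟨d, hd, hdc⟩ := hi.exists_ne c
  obtain ⟨M, N, hMN, hCMN⟩ := hi.exists_arcPair hc hd hdc.symm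
  have hcR : c ∈ Reg (C i) := Or.inl hc
  have hdR : d ∈ Reg (C i) := Or.inl hd
  have hO₁ : IsPreconnected (Ins (A ∪ B) \ Reg (C i)) := by
    refine isPreconnected_diff_of_notSep hIo (isBounded_ins hJ.isCompact) hJ.isPreconnected_ins
      hi.isCompact_reg ?_ fun p hp q hq => hi.notSep_reg hp hq
    rw [hfr, (disjoint_right.2 hJR).inter_eq]; exact isPreconnected_empty
  have hac : a ≠ c := fun e => hJR a haAB (e ▸ hcR)
  obtain ⟨T₁, hT₁, hT₁O, hT₁C⟩ := h.exists_crosscut (hIo.sdiff hCr) hO₁ hac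
    (fun hz => hz.1.1 haAB) (fun hz => hz.2 hcR) ((hJ.acc_ins haAB).diff hCr (hJR a haAB))
    (((hi.acc_outs hc).diff hIo.isClosed_compl (not_not.2 (hCJ hcR))).mono fun z hz =>
      ⟨not_not.1 hz.2, by rw [← mem_compl_iff, compl_reg]; exact hz.1⟩)
  have hT₁C' : T₁ ∩ Reg (C i) = {c} := by
    refine Subset.antisymm (fun z hz => ?_) (singleton_subset_iff.2 ⟨hT₁.right_mem, hcR⟩)
    by_contra hzc
    rcases eq_or_ne z a with rfl | hza
    · exact hJR _ haAB hz.2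
    · exact (hT₁O ⟨hz.1, by simp only [mem_insert_iff, not_or]; exact ⟨hza, hzc⟩⟩).2 hz.2
  have hT₁J : T₁ \ {a} ⊆ Ins (A ∪ B) := by
    rintro z ⟨hz, hza⟩
    rcases eq_or_ne z c with rfl | hzc
    · exact hCJ hcR
    · exact (hT₁O ⟨hz, by simp only [mem_insert_iff, not_or]; exact ⟨hza, hzc⟩⟩).1
  have hab : a ≠ b := hp.left.ne
  have hbT₁ : b ∉ T₁ := fun hb => (hT₁J ⟨hb, hab.symm⟩).1 hbAB
  have hdT₁ : d ∉ T₁ := fun hd => hdc (hT₁C'.subset ⟨hd, hdR⟩)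
  have hF : IsCompact (Reg (C i) ∪ T₁) := hi.isCompact_reg.union hT₁.isCompact
  have hO₂ : IsPreconnected (Ins (A ∪ B) \ (Reg (C i) ∪ T₁)) := by
    refine isPreconnected_diff_of_notSep hIo (isBounded_ins hJ.isCompact) hJ.isPreconnected_ins
      hF ?_ fun p hp q hq => ?_
    · have : (Reg (C i) ∪ T₁) ∩ frontier (Ins (A ∪ B)) ⊆ {a} := by
        rw [hfr]
        rintro z ⟨hz | hz, hzJ⟩
        · exact absurd hz (hJR z hzJ)
        · by_contra hza
          exact (hT₁J ⟨hz, hza⟩).1 hzJ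
      exact (subsingleton_singleton.anti this).isPreconnected
    · rw [mem_union, not_or] at hp hq
      refine NotSep.union hi.isCompact_reg hT₁.isCompact ?_ (hi.notSep_reg hp.1 hq.1)
        (hT₁.logAcyclic.notSep hT₁.isCompact hp.2 hq.2)
      rw [inter_comm, hT₁C']; exact isPreconnected_singleton
  have hdb : d ≠ b := fun e => hJR b hbAB (e ▸ hdR)
  obtain ⟨T₂, hT₂, hT₂O, hT₂C⟩ := h.exists_crosscut (hIo.sdiff hF.isClosed) hO₂ hdb
    (fun hz => hz.2 (Or.inl hdR)) (fun hz => hz.1.1 hbAB)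
    (((hi.acc_outs hd).diff (hIo.isClosed_compl.union hT₁.isClosed)
      (by rw [mem_union, not_or]; exact ⟨not_not.2 (hCJ hdR), hdT₁⟩)).mono fun z hz => by
        rw [Set.mem_sdiff, mem_union, not_or] at hz
        refine ⟨not_not.1 hz.2.1, ?_⟩
        rw [mem_union, not_or, ← mem_compl_iff, compl_reg]; exact ⟨hz.1, hz.2.2⟩)
    ((hJ.acc_ins hbAB).diff hF.isClosed (by rw [mem_union, not_or]; exact ⟨hJR b hbAB, hbT₁⟩))
  have hT₂F : ∀ z ∈ T₂, z ∈ Reg (C i) ∪ T₁ → z = d := by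
    intro z hz hzF
    by_contra hzd
    rcases eq_or_ne z b with rfl | hzb
    · exact hzF.elim (hJR _ hbAB) hbT₁
    · exact (hT₂O ⟨hz, by simp only [mem_insert_iff, not_or]; exact ⟨hzd, hzb⟩⟩).2 hzF
  have hT₂J : T₂ \ {b} ⊆ Ins (A ∪ B) := by
    rintro z ⟨hz, hzb⟩
    rcases eq_or_ne z d with rfl | hzd
    · exact hCJ hdR
    · exact (hT₂O ⟨hz, by simp only [mem_insert_iff, not_or]; exact ⟨hzd, hzb⟩⟩).1
  have h12 : Disjoint T₁ T₂ := disjoint_left.2 fun z hz hz' =>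
    hdT₁ (hT₂F z hz' (Or.inr hz) ▸ hz)
  have h1C : T₁ ∩ (M ∪ N) = {c} := by
    rw [← hCMN]
    exact Subset.antisymm (fun z hz => hT₁C'.subset ⟨hz.1, Or.inl hz.2⟩)
      (singleton_subset_iff.2 ⟨hT₁.right_mem, hc⟩)
  have h2C : T₂ ∩ (M ∪ N) = {d} := by
    rw [← hCMN]
    exact Subset.antisymm (fun z hz => hT₂F z hz.1 (Or.inl (Or.inl hz.2)))
      (singleton_subset_iff.2 ⟨hT₂.left_mem, hd⟩)
  have hav : ∀ j, j ≠ i → Reg (C j) ⊆ Ins (A ∪ B) → Disjoint (Reg (C j)) (T₁ ∪ T₂) := by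
    intro j hj hjJ
    have h1 := hT₁C j fun z hz => ⟨hjJ hz, disjoint_left.1 (h.disj hj) hz⟩
    have h2 := hT₂C j fun z hz => ⟨hjJ hz, fun hz' => hz'.elim (disjoint_left.1 (h.disj hj) hz)
      (disjoint_right.1 h1 hz)⟩
    exact disjoint_union_right.2 ⟨h1.symm, h2.symm⟩
  obtain ⟨p, hp'⟩ := hT₁
  obtain ⟨q, hq'⟩ := hT₂
  obtain ⟨m, hm⟩ := hMN.left
  obtain ⟨n, hn⟩ := hMN.right
  have hmeet : ∀ k : ℝ → ℂ, (C i ∩ concat₃ p k q '' outerThirds).Nonempty := fun k => by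
    refine ⟨c, hc, 1 / 3, Or.inl ⟨by norm_num, le_rfl⟩, ?_⟩
    rw [concat₃_left le_rfl, ← hp'.one]; norm_num
  have hθ : Theta A B (T₁ ∪ M ∪ T₂) a b := by
    refine ⟨hp, ⟨_, hp'.concat₃ hm hq' ?_ ?_ h12⟩, ?_⟩
    · exact Subset.antisymm (fun z hz => h1C.subset ⟨hz.1, Or.inl hz.2⟩)
        (singleton_subset_iff.2 ⟨(h1C.symm.subset rfl).1, hMN.left.left_mem⟩)
    · exact Subset.antisymm (fun z hz => h2C.subset ⟨hz.2, Or.inl hz.1⟩)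
        (singleton_subset_iff.2 ⟨hMN.left.right_mem, (h2C.symm.subset rfl).1⟩)
    · rintro z ⟨(hz | hz) | hz, hz'⟩
      · exact hT₁J ⟨hz, fun e => hz' (Or.inl e)⟩
      · exact hCJ (Or.inl (hCMN ▸ Or.inl hz))
      · exact hT₂J ⟨hz, fun e => hz' (Or.inr e)⟩
  have hNJ : N \ {c, d} ⊆ Ins (A ∪ B) := fun z hz => hCJ (Or.inl (hCMN ▸ Or.inr hz.1))
  have hNT : Disjoint (N \ {c, d}) (T₁ ∪ M ∪ T₂) := by
    refine disjoint_left.2 ?_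
    rintro z ⟨hzN, hz⟩ ((hz1 | hz1) | hz1)
    · exact hz (Or.inl (h1C.subset ⟨hz1, Or.inr hzN⟩))
    · exact hz (hMN.inter.subset ⟨hz1, hzN⟩)
    · exact hz (Or.inr (h2C.subset ⟨hz1, Or.inr hzN⟩))
  rcases hθ.subset_or_subset hMN.right.isPreconnected_diff hNJ hNT with hs | hs
  · refine ⟨_, _, (cut_around h hp.symm (by rwa [union_comm]) hp' hq' hm hn hMN.inter hCMN h1C h2C
      h12 ?_ ?_ ?_ ?_ hs).symm, hmeet n⟩
    all_goals rwa [union_comm B A]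
  · exact ⟨_, _, cut_around h hp hG hp' hq' hm hn hMN.inter hCMN h1C h2C
      h12 hT₁J hT₂J hCJ hav hs, hmeet m⟩

lemma exists_cut_straight (h : Holes C) {A B : Set ℂ} {a b : ℂ} (hp : ArcPair A B a b)
    (hG : Good C (A ∪ B)) : ∃ f g, Cut C A B a b f g (Icc 0 1) := by
  obtain ⟨T, hT, hTO, hTC⟩ := h.exists_crosscut (isOpen_ins hG.jordan.isCompact)
    hG.jordan.isPreconnected_ins hp.left.ne
    (fun hz => hz.1 (Or.inl hp.left.left_mem)) (fun hz => hz.1 (Or.inl hp.left.right_mem))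
    (hG.jordan.acc_ins (Or.inl hp.left.left_mem)) (hG.jordan.acc_ins (Or.inl hp.left.right_mem))
  obtain ⟨f, -, hf⟩ := Theta.exists_cut h ⟨hp, hT, hTO⟩ hG hTC
  exact ⟨f, f, hf⟩

end

/-! ### Straight cuts -/

section

variable {u : ℂ}

lemma re_mul_add (hu : ‖u‖ = 1) (z w : ℂ) (t : ℝ) :
    (u * (z + t * (starRingEnd ℂ u * w))).re = (u * z).re + t * w.re := by
  have h : u * starRingEnd ℂ u = 1 := by rw [Complex.mul_conj, Complex.normSq_eq_norm_sq, hu]; simp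
  have : u * (z + t * (starRingEnd ℂ u * w)) = u * z + t * w := by linear_combination (t * w) * h
  rw [this, Complex.add_re, Complex.re_ofReal_mul]

lemma continuous_re_mul (u : ℂ) : Continuous fun z : ℂ => (u * z).re :=
  Complex.continuous_re.comp (continuous_const.mul continuous_id)

lemma convex_re_mul_gt (u : ℂ) (c : ℝ) : Convex ℝ {z : ℂ | c < (u * z).re} :=
  (convex_Ioi c).linear_preimage (Complex.reLm ∘ₗ LinearMap.mulLeft ℝ u)

lemma convex_re_mul_lt (u : ℂ) (c : ℝ) : Convex ℝ {z : ℂ | (u * z).re < c} :=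
  (convex_Iio c).linear_preimage (Complex.reLm ∘ₗ LinearMap.mulLeft ℝ u)

lemma abs_re_mul_sub_le (hu : ‖u‖ = 1) (z w : ℂ) : |(u * z).re - (u * w).re| ≤ dist z w := by
  rw [← Complex.sub_re, ← mul_sub]
  refine (Complex.abs_re_le_norm _).trans ?_
  rw [norm_mul, hu, one_mul, dist_eq_norm]

lemma mem_component_of_mem_closure {U : Set ℂ} (hU : IsOpen U) {p w : ℂ}
    (hw : w ∈ closure (connectedComponentIn U p)) (hwU : w ∈ U) :
    w ∈ connectedComponentIn U p := by
  by_contra hn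
  have := frontier_component_subset hU.isClosed_compl p
  rw [compl_compl] at this
  refine this ⟨hw, ?_⟩ hwU
  rwa [(hU.connectedComponentIn).interior_eq]

/-- The first exit from a bounded open set along a ray. -/
lemma exists_exit {O : Set ℂ} (hO : IsOpen O) (hb : Bornology.IsBounded O) {w v : ℂ} (hw : w ∈ O)
    (hv : ‖v‖ = 1) : ∃ s : ℝ, 0 < s ∧ w + s * v ∈ closure O \ O ∧ ∀ t ∈ Ico (0 : ℝ) s, w + t * v ∈ O := by
  have hc : Continuous fun t : ℝ => w + t * v := by fun_prop
  set F : Set ℝ := {t | 0 ≤ t ∧ w + t * v ∉ O} with hF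
  have hFc : IsClosed F := isClosed_Ici.inter (hO.isClosed_compl.preimage hc)
  obtain ⟨R, hR⟩ := hb.subset_closedBall w
  have hFn : F.Nonempty := by
    refine ⟨|R| + 1, by positivity, fun h => ?_⟩
    have := mem_closedBall.1 (hR h)
    rw [dist_eq_norm, add_sub_cancel_left, norm_mul, hv, mul_one, Complex.norm_real,
      Real.norm_of_nonneg (by positivity)] at this
    linarith [le_abs_self R]
  have hFb : BddBelow F := ⟨0, fun t ht => ht.1⟩
  have hm : sInf F ∈ F := hFc.csInf_mem hFn hFb
  have hpos : 0 < sInf F := lt_of_le_of_ne hm.1 fun e => hm.2 (by rw [← e]; simpa using hw)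
  have hlt : ∀ t ∈ Ico (0 : ℝ) (sInf F), w + t * v ∈ O := fun t ht => by
    by_contra hn
    exact (csInf_le hFb ⟨ht.1, hn⟩).not_gt ht.2
  refine ⟨sInf F, hpos, ⟨?_, hm.2⟩, hlt⟩
  have h1 : sInf F ∈ closure (Ico 0 (sInf F)) := by
    rw [closure_Ico hpos.ne]; exact right_mem_Icc.2 hpos.le
  exact closure_mono (image_subset_iff.2 hlt) (image_closure_subset_closure_image hc ⟨_, h1, rfl⟩)

/-- The extreme value of a linear functional on a closed Jordan domain is reached on the curve. -/
lemma IsJordanCurve.exists_re_mul_ge {J : Set ℂ} (hJ : IsJordanCurve J) (hu : ‖u‖ = 1) {z : ℂ}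
    (hz : z ∈ Ins J) : ∃ w ∈ J, (u * z).re < (u * w).re := by
  obtain ⟨s, hs, hw, -⟩ := exists_exit (isOpen_ins hJ.isCompact) (isBounded_ins hJ.isCompact) hz
    (v := starRingEnd ℂ u * 1) (by simpa using hu)
  refine ⟨z + s * (starRingEnd ℂ u * 1), ?_, ?_⟩
  · rw [hJ.closure_ins] at hw
    exact hw.1.resolve_right hw.2
  · rw [re_mul_add hu]; simpa using hs

lemma exists_separating_segment {J : Set ℂ} (hJ : IsJordanCurve J) (hu : ‖u‖ = 1) {c : ℝ}
    {r l : ℂ} (hr : r ∈ Ins J) (hrc : c < (u * r).re) (hl : l ∈ Ins J) (hlc : (u * l).re < c) :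
    ∃ A B a b f, J = A ∪ B ∧ ArcParam f (f '' Icc 0 1) a b ∧ Theta A B (f '' Icc 0 1) a b ∧
      (∀ t, (u * f t).re = c) ∧ r ∈ Ins (A ∪ f '' Icc 0 1) ∧ l ∈ Ins (B ∪ f '' Icc 0 1) := by
  have hIo : IsOpen (Ins J) := isOpen_ins hJ.isCompact
  have hUo : IsOpen {z : ℂ | c < (u * z).re} := isOpen_Ioi.preimage (continuous_re_mul u)
  have hU : IsOpen (Ins J ∩ {z : ℂ | c < (u * z).re}) := hIo.inter hUo
  set G := connectedComponentIn (Ins J ∩ {z : ℂ | c < (u * z).re}) r with hG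
  have hGo : IsOpen G := hU.connectedComponentIn
  have hGs : G ⊆ Ins J ∩ {z : ℂ | c < (u * z).re} := connectedComponentIn_subset _ _
  have hrG : r ∈ G := mem_connectedComponentIn ⟨hr, hrc⟩
  have hGcl : closure G ⊆ {z : ℂ | c ≤ (u * z).re} :=
    closure_minimal (fun z hz => (show c < _ from (hGs hz).2).le) (isClosed_Ici.preimage (continuous_re_mul u))
  have hV : IsOpen (Ins J \ closure G) := hIo.sdiff isClosed_closure
  set H := connectedComponentIn (Ins J \ closure G) l with hH
  have hHs : H ⊆ Ins J \ closure G := connectedComponentIn_subset _ _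
  have hlH : l ∈ H := mem_connectedComponentIn ⟨hl, fun h => (hGcl h).not_gt hlc⟩
  have hGH : Disjoint G (closure H) :=
    (disjoint_left.2 fun z hz hz' => (hHs hz').2 (subset_closure hz)).closure_right hGo
  obtain ⟨w, hwH, hwI, hwn⟩ : ∃ w ∈ closure H, w ∈ Ins J ∧ w ∉ H := by
    by_contra! hcon
    have := hJ.isPreconnected_ins.subset_of_closure_inter_subset hV.connectedComponentIn
      ⟨l, hl, hlH⟩ (fun z hz => hcon z hz.1 hz.2)
    exact disjoint_left.1 hGH hrG (subset_closure (this hr))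
  have hwG : w ∈ closure G := by
    by_contra hn
    exact hwn (mem_component_of_mem_closure hV hwH ⟨hwI, hn⟩)
  have hwc : (u * w).re = c := by
    refine le_antisymm (not_lt.1 fun hlt => ?_) (hGcl hwG)
    exact disjoint_left.1 hGH (mem_component_of_mem_closure hU hwG ⟨hwI, hlt⟩) hwH
  have hhalf : ∀ v ∈ Ins J, v ∈ closure G →
      ∃ ρ > 0, ball v ρ ⊆ Ins J ∧ ball v ρ ∩ {z : ℂ | c < (u * z).re} ⊆ G := by
    intro v hv hvG
    obtain ⟨ρ, hρ, hb⟩ := Metric.isOpen_iff.1 hIo v hv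
    refine ⟨ρ, hρ, hb, ?_⟩
    obtain ⟨z, hz, hzG⟩ := mem_closure_iff.1 hvG _ isOpen_ball (mem_ball_self hρ)
    have hsub := ((convex_ball v ρ).inter (convex_re_mul_gt u c)).isPreconnected
      |>.subset_connectedComponentIn ⟨hz, (hGs hzG).2⟩ (inter_subset_inter_left _ hb)
    rwa [← connectedComponentIn_eq hzG] at hsub
  set v : ℂ := starRingEnd ℂ u * Complex.I with hv
  have hv1 : ‖v‖ = 1 := by rw [hv, norm_mul, RCLike.norm_conj, hu, Complex.norm_I, one_mul]
  have hline : ∀ t : ℝ, (u * (w + t * v)).re = c := fun t => by rw [re_mul_add hu, hwc]; simp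
  have hon : ∀ z : ℂ, (u * z).re = c → ∃ t : ℝ, z = w + t * v ∧ |t| = dist z w := by
    intro z hz
    have h1 : u * starRingEnd ℂ u = 1 := by
      rw [Complex.mul_conj, Complex.normSq_eq_norm_sq, hu]; simp
    have h2 : u * (z - w) = (u * (z - w)).im * Complex.I := by
      apply Complex.ext
      · rw [mul_sub, Complex.sub_re, hz, hwc]; simp
      · simp
    have h3 : z = w + (u * (z - w)).im * v := by
      rw [hv]
      linear_combination (-(z - w)) * h1 + (starRingEnd ℂ u) * h2
    refine ⟨_, h3, ?_⟩
    conv_rhs => rw [h3]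
    rw [dist_eq_norm, add_sub_cancel_left, norm_mul, hv1, mul_one, Complex.norm_real,
      Real.norm_eq_abs]
  obtain ⟨s₁, hs₁, hs₁J, hs₁I⟩ := exists_exit hIo (isBounded_ins hJ.isCompact) hwI hv1
  obtain ⟨s₀, hs₀, hs₀J, hs₀I⟩ := exists_exit hIo (isBounded_ins hJ.isCompact) hwI
    (v := -v) (by rwa [norm_neg])
  obtain ⟨f, hf⟩ : ∃ f : ℝ → ℂ, ∀ t : ℝ, f t = w + ((t * (s₀ + s₁) - s₀ : ℝ) : ℂ) * v :=
    ⟨_, fun _ => rfl⟩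
  have hfc : Continuous f := by rw [funext hf]; fun_prop
  have hv0 : v ≠ 0 := fun h => by rw [h, norm_zero] at hv1; exact zero_ne_one hv1
  have hfi : Function.Injective f := by
    intro s t hst
    rw [hf, hf, add_right_inj, mul_left_inj' hv0, Complex.ofReal_inj] at hst
    have : s * (s₀ + s₁) = t * (s₀ + s₁) := by linarith
    exact mul_right_cancel₀ (by positivity) this
  have hfc' : ∀ t, (u * f t).re = c := fun t => by rw [hf, hline]
  have hfI : ∀ t ∈ Ioo (0 : ℝ) 1, f t ∈ Ins J := by
    intro t ht
    rw [hf]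
    have h1 : 0 < t * (s₀ + s₁) := mul_pos ht.1 (by positivity)
    have h2 : t * (s₀ + s₁) < s₀ + s₁ := mul_lt_of_lt_one_left (by positivity) ht.2
    rcases le_total 0 (t * (s₀ + s₁) - s₀) with h | h
    · exact hs₁I _ ⟨h, by linarith⟩
    · have := hs₀I (-(t * (s₀ + s₁) - s₀)) ⟨by linarith, by linarith⟩
      rwa [Complex.ofReal_neg, neg_mul_neg] at this
  have hf0 : f 0 ∈ J := by
    rw [hJ.closure_ins] at hs₀J
    have := hs₀J.1.resolve_right hs₀J.2
    rw [hf]; simpa using this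
  have hf1 : f 1 ∈ J := by
    rw [hJ.closure_ins] at hs₁J
    have := hs₁J.1.resolve_right hs₁J.2
    rw [hf]; simpa using this
  have hpar : ArcParam f (f '' Icc 0 1) (f 0) (f 1) :=
    ⟨hfc.continuousOn, hfi.injOn, rfl, rfl, rfl⟩
  have hfT : ∀ z ∈ f '' Icc 0 1, z ∈ J ∨ ∃ t ∈ Ioo (0 : ℝ) 1, f t = z := by
    rintro _ ⟨t, ht, rfl⟩
    rcases ht.1.eq_or_lt with rfl | h0
    · exact Or.inl hf0
    rcases ht.2.eq_or_lt with rfl | h1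
    · exact Or.inl hf1
    exact Or.inr ⟨t, ⟨h0, h1⟩, rfl⟩
  have hseg : Ioo (0 : ℝ) 1 ⊆ {t | f t ∈ closure G} := by
    have hopen : IsOpen {t | t ∈ Ioo (0 : ℝ) 1 ∧ f t ∈ closure G} := by
      rw [isOpen_iff_mem_nhds]
      rintro t ⟨ht, htG⟩
      obtain ⟨ρ, hρ, -, hbG⟩ := hhalf _ (hfI t ht) htG
      filter_upwards [isOpen_Ioo.mem_nhds ht, hfc.continuousAt.preimage_mem_nhds
        (ball_mem_nhds _ hρ)] with s hs hsb
      refine ⟨hs, Metric.mem_closure_iff.2 fun ε hε => ?_⟩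
      have hgap : 0 < ρ - dist (f s) (f t) := sub_pos.2 hsb
      set τ := min ε (ρ - dist (f s) (f t)) / 2 with hτ
      have hτ0 : 0 < τ := by positivity
      have hd : dist (f s) (f s + τ * (starRingEnd ℂ u * 1)) = τ := by
        rw [dist_comm, dist_eq_norm, add_sub_cancel_left, mul_one, norm_mul, RCLike.norm_conj, hu,
          mul_one, Complex.norm_real, Real.norm_of_nonneg hτ0.le]
      refine ⟨f s + τ * (starRingEnd ℂ u * 1), hbG ⟨?_, ?_⟩, ?_⟩
      · rw [mem_ball]
        have := dist_triangle_left (f s + τ * (starRingEnd ℂ u * 1)) (f t) (f s)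
        have h2 := min_le_right ε (ρ - dist (f s) (f t))
        linarith
      · rw [mem_ofPred_eq, re_mul_add hu, hfc']; simpa using hτ0
      · rw [hd]
        have h2 := min_le_left ε (ρ - dist (f s) (f t))
        linarith
    have hwt : f (s₀ / (s₀ + s₁)) = w := by
      rw [hf, div_mul_cancel₀ _ (by positivity)]; simp
    have := isPreconnected_Ioo.subset_of_closure_inter_subset hopen
      ⟨s₀ / (s₀ + s₁), ⟨by positivity, by rw [div_lt_one (by positivity)]; linarith⟩,
        ⟨by positivity, by rw [div_lt_one (by positivity)]; linarith⟩, by rwa [hwt]⟩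
      fun t ht => ⟨ht.2, closure_minimal (fun s hs => hs.2) (isClosed_closure.preimage hfc) ht.1⟩
    exact fun t ht => (this ht).2
  have hGT : Disjoint G (f '' Icc 0 1) := by
    refine disjoint_left.2 ?_
    rintro _ hz ⟨t, -, rfl⟩
    exact (hGs hz).2.ne' (hfc' t)
  have hHT : Disjoint H (f '' Icc 0 1) := by
    refine disjoint_left.2 fun z hz hzT => ?_
    rcases hfT z hzT with h | ⟨t, ht, rfl⟩
    · exact (hHs hz).1.1 h
    · exact (hHs hz).2 (hseg ht)
  obtain ⟨ρ', hρ', hbI, hbG⟩ := hhalf w hwI hwG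
  set ρ := min ρ' (min s₀ s₁) with hρ
  have hρ0 : 0 < ρ := by positivity
  have hbI' : ball w ρ ⊆ Ins J := (ball_subset_ball (min_le_left _ _)).trans hbI
  have hwT : ∀ z ∈ ball w ρ, (u * z).re = c → z ∈ f '' Icc 0 1 := by
    intro z hz hzc
    obtain ⟨t, ht, htd⟩ := hon z hzc
    have hd : |t| < min s₀ s₁ := by rw [htd]; exact (mem_ball.1 hz).trans_le (min_le_right _ _)
    have h1 := abs_lt.1 (hd.trans_le (min_le_left _ _))
    have h2 := abs_lt.1 (hd.trans_le (min_le_right _ _))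
    refine ⟨(t + s₀) / (s₀ + s₁), ⟨div_nonneg (by linarith) (by positivity),
      (div_le_one (by positivity)).2 (by linarith)⟩, ?_⟩
    rw [hf, div_mul_cancel₀ _ (by positivity), ht, add_sub_cancel_right]
  have key : ∀ A B : Set ℂ, J = A ∪ B → Theta A B (f '' Icc 0 1) (f 0) (f 1) →
      G ⊆ Ins (A ∪ f '' Icc 0 1) → H ⊆ Ins (B ∪ f '' Icc 0 1) := by
    intro A B hAB hθ hGA
    rcases hθ.subset_or_subset isPreconnected_connectedComponentIn
      (hAB ▸ fun z hz => (hHs hz).1) hHT with hHA | hHB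
    · exfalso
      have hwf : w ∈ f '' Icc 0 1 := hwT w (mem_ball_self hρ0) hwc
      have hwB : w ∈ closure (Ins (B ∪ f '' Icc 0 1)) := by
        rw [hθ.pairRight.isJordanCurve.closure_ins]; exact Or.inl (Or.inr hwf)
      obtain ⟨z, hzb, hzB⟩ := mem_closure_iff.1 hwB _ isOpen_ball (mem_ball_self hρ0)
      have hup : ∀ z ∈ ball w ρ, c < (u * z).re → z ∈ G := fun z hz hzc =>
        hbG ⟨ball_subset_ball (min_le_left _ _) hz, hzc⟩
      have hAB' := disjoint_left.1 hθ.disjoint_ins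
      have hlow : ball w ρ ∩ {z : ℂ | (u * z).re < c} ⊆ Ins (B ∪ f '' Icc 0 1) := by
        refine (hθ.subset_or_subset ((convex_ball w ρ).inter (convex_re_mul_lt u c)).isPreconnected
          (hAB ▸ inter_subset_left.trans hbI') ?_).resolve_left fun hA => ?_
        · refine disjoint_left.2 ?_
          rintro _ hz ⟨t, -, rfl⟩
          exact hz.2.ne (hfc' t)
        · rcases lt_trichotomy (u * z).re c with h | h | h
          · exact hAB' (hA ⟨hzb, h⟩) hzB
          · exact hzB.1 (Or.inr (hwT z hzb h))
          · exact hAB' (hGA (hup z hzb h)) hzB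
      obtain ⟨y, hyb, hyH⟩ := mem_closure_iff.1 hwH _ isOpen_ball (mem_ball_self hρ0)
      rcases lt_trichotomy (u * y).re c with h | h | h
      · exact hAB' (hHA hyH) (hlow ⟨hyb, h⟩)
      · exact disjoint_left.1 hHT hyH (hwT y hyb h)
      · exact disjoint_left.1 hGH (hup y hyb h) (subset_closure hyH)
    · exact hHB
  obtain ⟨A, B, hp, hAB⟩ := hJ.exists_arcPair hf0 hf1 (fun e => zero_ne_one (hfi e))
  have hθ : Theta A B (f '' Icc 0 1) (f 0) (f 1) := by
    refine ⟨hp, ⟨f, hpar⟩, fun z hz => ?_⟩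
    obtain ⟨⟨t, ht, rfl⟩, hz'⟩ := hz
    rw [← hAB]
    have h0 : t ≠ 0 := by rintro rfl; exact hz' (Or.inl rfl)
    have h1 : t ≠ 1 := by rintro rfl; exact hz' (Or.inr rfl)
    exact hfI t ⟨lt_of_le_of_ne ht.1 h0.symm, lt_of_le_of_ne ht.2 h1⟩
  rcases hθ.subset_or_subset isPreconnected_connectedComponentIn
    (hAB ▸ fun z hz => (hGs hz).1) hGT with hA | hB
  · exact ⟨A, B, _, _, f, hAB, hpar, hθ, hfc', hA hrG, key A B hAB hθ hA hlH⟩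
  · exact ⟨B, A, _, _, f, by rw [hAB, union_comm], hpar, hθ.symm, hfc', hB hrG,
      key B A (by rw [hAB, union_comm]) hθ.symm hB hlH⟩

end

/-! ### Fine subdivisions -/

/-- Iterated cutting of a good Jordan domain until the pieces satisfy `P`. -/
inductive Division (C : ℕ → Set ℂ) (P : Set ℂ → Prop) : Set ℂ → Prop
  | leaf {J : Set ℂ} : Good C J → P J → Division C P J
  | node {A B : Set ℂ} {a b : ℂ} {f g : ℝ → ℂ} {S : Set ℝ} : Cut C A B a b f g S →
      S = Icc 0 1 ∨ S = outerThirds → Division C P (A ∪ f '' Icc 0 1) →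
      Division C P (B ∪ g '' Icc 0 1) → Division C P (A ∪ B)

section

variable {C : ℕ → Set ℂ} {P Q : Set ℂ → Prop}

lemma Division.bind {J : Set ℂ} (hD : Division C P J)
    (h : ∀ J', Good C J' → P J' → Ins J' ⊆ Ins J → Division C Q J') : Division C Q J := by
  induction hD with
  | leaf hG hP => exact h _ hG hP Subset.rfl
  | node hc hS _ _ ih₁ ih₂ =>
    exact .node hc hS (ih₁ fun J' hG hP hs => h J' hG hP (hs.trans hc.ins_left))
      (ih₂ fun J' hG hP hs => h J' hG hP (hs.trans hc.ins_right))

lemma Holes.exists_division_small_holes (h : Holes C) {δ : ℝ} (hδ : 0 < δ) {J : Set ℂ}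
    (hG : Good C J) :
    Division C (fun J' => ∀ i, Reg (C i) ⊆ Ins J' → diam (Reg (C i)) < δ) J := by
  let bad : Set ℂ → Set ℕ := fun J => {i | Reg (C i) ⊆ Ins J ∧ δ ≤ diam (Reg (C i))}
  have hfin : ∀ J, (bad J).Finite := fun J => by
    have h1 : {i | ¬ diam (Reg (C i)) < δ}.Finite := by
      have := h.null.eventually (gt_mem_nhds hδ)
      rw [← Nat.cofinite_eq_atTop] at this
      exact this
    exact h1.subset fun i hi => not_lt.2 hi.2
  suffices H : ∀ n, ∀ J, Good C J → (bad J).ncard ≤ n →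
      Division C (fun J' => ∀ i, Reg (C i) ⊆ Ins J' → diam (Reg (C i)) < δ) J from
    H _ J hG le_rfl
  intro n
  induction n with
  | zero =>
    intro J hG hn
    refine .leaf hG fun i hi => ?_
    by_contra hd
    have := (ncard_eq_zero (hfin J)).1 (Nat.le_zero.1 hn)
    exact (this.subset (show i ∈ bad J from ⟨hi, not_lt.1 hd⟩) : i ∈ (∅ : Set ℕ))
  | succ n ih =>
    intro J hG hn
    by_cases he : bad J = ∅
    · exact ih J hG (by simp [he])
    obtain ⟨i, hiI, hid⟩ := nonempty_iff_ne_empty.2 he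
    have hiJ : IsJordanCurve (C i) := by
      refine (h.jordan i).resolve_left fun e => ?_
      rw [e, reg_empty, diam_empty] at hid
      exact hid.not_gt hδ
    obtain ⟨A, B, a, b, hp, rfl⟩ := hG.jordan
    obtain ⟨f, g, hc, z, hzC, hzf⟩ := exists_cut_around h hp hG hiJ hiI
    have hzg : z ∈ g '' outerThirds := by rwa [← hc.eq.image_eq]
    have key : ∀ J', Ins J' ⊆ Ins (A ∪ B) → z ∈ J' → (bad J').ncard ≤ n := fun J' hJ' hz => by
      have : bad J' ⊂ bad (A ∪ B) := by
        refine ⟨fun j hj => ⟨hj.1.trans hJ', hj.2⟩, fun hs => ?_⟩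
        exact ((hs ⟨hiI, hid⟩).1 (Or.inl hzC)).1 hz
      have := ncard_lt_ncard this (hfin _)
      omega
    exact .node hc (Or.inr rfl)
      (ih _ hc.goodLeft (key _ hc.ins_left (Or.inr (image_mono hc.sub hzf))))
      (ih _ hc.goodRight (key _ hc.ins_right (Or.inr (image_mono hc.sub hzg))))

lemma IsArc.exists_small_cover {A : Set ℂ} {a b : ℂ} (h : IsArc A a b) {δ : ℝ} (hδ : 0 < δ) :
    ∃ F : Set (Set ℂ), F.Finite ∧ A ⊆ ⋃₀ F ∧
      ∀ P ∈ F, IsPreconnected P ∧ P ⊆ A ∧ ∀ x ∈ P, ∀ y ∈ P, dist x y < δ := by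
  obtain ⟨f, hf⟩ := h
  have hloc : ∀ t ∈ Icc (0 : ℝ) 1, ∃ r > 0, ∀ s ∈ Icc (0 : ℝ) 1 ∩ ball t r,
      dist (f s) (f t) < δ / 2 := fun t ht => by
    obtain ⟨r, hr, hr'⟩ := Metric.continuousOn_iff.1 hf.cont t ht (δ / 2) (half_pos hδ)
    exact ⟨r, hr, fun s hs => hr' s hs.1 hs.2⟩
  choose! r hr hrd using hloc
  obtain ⟨T, hT, hcov⟩ := (isCompact_Icc (a := (0 : ℝ)) (b := 1)).elim_nhds_subcover
    (fun t => ball t (r t)) fun t ht => ball_mem_nhds t (hr t ht)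
  refine ⟨(fun t => f '' (Icc 0 1 ∩ ball t (r t))) '' T, T.finite_toSet.image _, ?_, ?_⟩
  · rw [← hf.image]
    rintro _ ⟨s, hs, rfl⟩
    obtain ⟨t, ht, hst⟩ := mem_iUnion₂.1 (hcov hs)
    exact ⟨_, ⟨t, ht, rfl⟩, s, ⟨hs, hst⟩, rfl⟩
  · rintro _ ⟨t, ht, rfl⟩
    refine ⟨?_, ?_, ?_⟩
    · exact ((convex_Icc 0 1).inter (convex_ball t (r t))).isPreconnected.image _
        (hf.cont.mono inter_subset_left)
    · rw [← hf.image]; exact image_mono inter_subset_left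
    · rintro _ ⟨s, hs, rfl⟩ _ ⟨s', hs', rfl⟩
      have h1 := hrd t (hT t ht) s hs
      have h2 := hrd t (hT t ht) s' hs'
      have := dist_triangle_right (f s) (f s') (f t)
      linarith

lemma IsJordanCurve.exists_small_cover {J : Set ℂ} (h : IsJordanCurve J) {δ : ℝ} (hδ : 0 < δ) :
    ∃ F : Set (Set ℂ), F.Finite ∧ J ⊆ ⋃₀ F ∧
      ∀ P ∈ F, IsPreconnected P ∧ P ⊆ J ∧ ∀ x ∈ P, ∀ y ∈ P, dist x y < δ := by
  obtain ⟨A, B, a, b, hp, rfl⟩ := h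
  obtain ⟨F, hf, hc, h1⟩ := hp.left.exists_small_cover hδ
  obtain ⟨F₂, hf', hc', h2⟩ := hp.right.exists_small_cover hδ
  refine ⟨F ∪ F₂, hf.union hf', ?_, ?_⟩
  · rw [sUnion_union]; exact union_subset_union hc hc'
  · rintro P (hP | hP)
    · exact ⟨(h1 P hP).1, (h1 P hP).2.1.trans subset_union_left, (h1 P hP).2.2⟩
    · exact ⟨(h2 P hP).1, (h2 P hP).2.1.trans subset_union_right, (h2 P hP).2.2⟩

lemma ArcPair.subset_left_of_isPreconnected {A B Z : Set ℂ} {a b : ℂ} (h : ArcPair A B a b)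
    (hZ : IsPreconnected Z) (hZJ : Z ⊆ A ∪ B) (ha : a ∉ Z) (hb : b ∉ Z) (hn : (Z ∩ A).Nonempty) :
    Z ⊆ A := by
  refine (isPreconnected_iff_subset_of_disjoint_closed.1 hZ A B h.left.isClosed h.right.isClosed
    hZJ ?_).resolve_right ?_
  · rw [h.inter]
    ext z
    simp only [mem_inter_iff, mem_insert_iff, mem_singleton_iff, mem_empty_iff_false, iff_false]
    rintro ⟨hz, rfl | rfl⟩ <;> contradiction
  · intro hB
    obtain ⟨z, hz, hzA⟩ := hn
    rcases h.inter.subset ⟨hzA, hB hz⟩ with rfl | rfl <;> contradiction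

/-- The domain does not reach beyond distance `η` on both sides of a line. -/
def NotAcross (u : ℂ) (c η : ℝ) (J : Set ℂ) : Prop :=
  (∀ r ∈ Ins J, (u * r).re ≤ c + η) ∨ ∀ l ∈ Ins J, c - η ≤ (u * l).re

lemma Holes.exists_division_notAcross (h : Holes C) {u : ℂ} (hu : ‖u‖ = 1) (c : ℝ) {η : ℝ}
    (hη : 0 < η) {J₀ : Set ℂ} (hG₀ : Good C J₀)
    (hs : ∀ i, Reg (C i) ⊆ Ins J₀ → diam (Reg (C i)) < η / 8) :
    Division C (NotAcross u c η) J₀ := by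
  obtain ⟨F, hFf, hFc, hF⟩ := hG₀.jordan.exists_small_cover (δ := η / 4) (by positivity)
  set far : Set ℂ := {z | η / 2 ≤ |(u * z).re - c|} with hfar
  let meas : Set ℂ → Set (Set ℂ) := fun J => {P ∈ F | P ⊆ J ∩ far}
  have hmf : ∀ J, (meas J).Finite := fun J => hFf.subset fun P hP => hP.1
  suffices H : ∀ n, ∀ J, Good C J → Ins J ⊆ Ins J₀ → J ∩ far ⊆ J₀ →
      (∀ Z, IsPreconnected Z → Z ⊆ J₀ ∩ far → (Z ∩ J).Nonempty → Z ⊆ J) →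
      (meas J).ncard < n → Division C (NotAcross u c η) J from
    H _ J₀ hG₀ Subset.rfl inter_subset_left (fun Z _ hZ _ => hZ.trans inter_subset_left)
      (Nat.lt_succ_self _)
  intro n
  induction n with
  | zero => intro J _ _ _ _ hn; exact absurd hn (Nat.not_lt_zero _)
  | succ n ih =>
    intro J hG hJJ hJf hJZ hn
    by_cases hQ : NotAcross u c η J
    · exact .leaf hG hQ
    simp only [NotAcross, not_or, not_forall, not_le] at hQ
    obtain ⟨⟨r, hr, hrc⟩, l, hl, hlc⟩ := hQ
    obtain ⟨A, B, a, b, f, rfl, hf, hθ, hfc, hrA, hlB⟩ := exists_separating_segment hG.jordan hu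
      (c := c) hr (by linarith) hl (by linarith)

    obtain ⟨T, hT, hTO, hTC, hTf⟩ := h.exists_crosscut_near (O := Ins (A ∪ B)) (f := f)
      (B := η / 8) (η := η / 8) (isOpen_ins hG.jordan.isCompact) hf.cont
      (fun e => zero_ne_one (hf.inj (by simp) (by simp) e))
      (by rw [hf.zero]; exact fun hz => hz.1 (Or.inl hθ.pair.left.left_mem))
      (by rw [hf.one]; exact fun hz => hz.1 (Or.inl hθ.pair.left.right_mem))
      (fun t ht => hθ.sub ⟨⟨t, Ioo_subset_Icc_self ht, rfl⟩, by
        rintro (e | e)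
        · rw [← hf.zero] at e
          exact ht.1.ne' (hf.inj (Ioo_subset_Icc_self ht) (by simp) e)
        · rw [mem_singleton_iff, ← hf.one] at e
          exact ht.2.ne (hf.inj (Ioo_subset_Icc_self ht) (by simp) e)⟩)
      (by positivity) (fun i hi => (hs i (hi.trans hJJ)).le) (by positivity)
    rw [hf.zero, hf.one] at hT hTO
    have hTfar : Disjoint T far := by
      refine disjoint_left.2 fun z hz hzf => ?_
      obtain ⟨t, -, ht⟩ := hTf z hz
      have h1 := abs_re_mul_sub_le hu z (f t)
      rw [hfc] at h1
      have h2 : η / 2 ≤ _ := hzf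
      linarith
    obtain ⟨g, rfl, hcut⟩ := Theta.exists_cut h ⟨hθ.pair, hT, hTO⟩ hG hTC
    have key : ∀ {A' B' : Set ℂ} {f' : ℝ → ℂ}, A' ∪ B' = A ∪ B → ArcPair A' B' a b →
        Cut C A' B' a b g f' (Icc 0 1) → (∃ w ∈ B', w ∉ A' ∧ η < |(u * w).re - c|) →
        Division C (NotAcross u c η) (A' ∪ g '' Icc 0 1) := by
      rintro A' B' f' hAB hp hc ⟨w, hwB, hwA, hwc⟩
      rw [← hAB] at hJJ hJf hJZ hn
      have hside : ∀ {A' B' : Set ℂ}, ArcPair A' B' a b → ∀ Z, IsPreconnected Z → Z ⊆ J₀ ∩ far →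
          Z ⊆ A' ∪ B' → (Z ∩ A').Nonempty → Z ⊆ A' := fun hp Z hZ hZf hZJ hZA =>
        hp.subset_left_of_isPreconnected hZ hZJ
          (fun ha => disjoint_left.1 hTfar hT.left_mem (hZf ha).2)
          (fun hb => disjoint_left.1 hTfar hT.right_mem (hZf hb).2) hZA
      have hchild : (A' ∪ g '' Icc 0 1) ∩ far ⊆ A' := by
        rintro z ⟨hz | hz, hzf⟩
        · exact hz
        · exact absurd hzf (disjoint_left.1 hTfar hz)
      refine ih _ hc.goodLeft (hc.ins_left.trans hJJ)
        (fun z hz => hJf ⟨Or.inl (hchild hz), hz.2⟩) (fun Z hZ hZf hZn => ?_) ?_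
      · obtain ⟨z, hz, hz'⟩ := hZn
        have hzA : z ∈ A' := hchild ⟨hz', (hZf hz).2⟩
        exact (hside hp Z hZ hZf (hJZ Z hZ hZf ⟨z, hz, Or.inl hzA⟩) ⟨z, hz, hzA⟩).trans
          subset_union_left
      · have hwf : w ∈ far := (by linarith : η / 2 ≤ |(u * w).re - c|)
        obtain ⟨P, hP, hwP⟩ := hFc (hJf ⟨Or.inr hwB, hwf⟩)
        obtain ⟨hPc, hPJ, hPd⟩ := hF P hP
        have hPf : P ⊆ far := fun z hz => by
          have h1 := (abs_re_mul_sub_le hu w z).trans_lt (hPd w hwP z hz)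
          have h2 := abs_sub_le (u * w).re (u * z).re c
          show η / 2 ≤ |(u * z).re - c|
          linarith
        have hPAB := hJZ P hPc (subset_inter hPJ hPf) ⟨w, hwP, Or.inr hwB⟩
        have : meas (A' ∪ g '' Icc 0 1) ⊂ meas (A' ∪ B') := by
          refine ⟨fun P hP => ⟨hP.1, fun z hz => ⟨Or.inl (hchild (hP.2 hz)), (hP.2 hz).2⟩⟩,
            fun hs => hwA ?_⟩
          exact hchild ((hs ⟨hP, subset_inter hPAB hPf⟩).2 hwP)
        have := ncard_lt_ncard this (hmf _)
        omega
    have hnot : ∀ z, η < |(u * z).re - c| → z ∉ g '' Icc 0 1 := fun z hz hz' =>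
      disjoint_left.1 hTfar hz' (by linarith : η / 2 ≤ |(u * z).re - c|)
    have hline : ∀ z ∈ f '' Icc 0 1, (u * z).re = c := by rintro _ ⟨t, -, rfl⟩; exact hfc t
    have hend : ∀ z, η < |(u * z).re - c| → z ∉ A ∩ B := fun z hz hz' => by
      rw [hθ.pair.inter] at hz'
      rcases hz' with rfl | rfl
      · exact hnot _ hz hT.left_mem
      · exact hnot _ hz hT.right_mem
    refine .node hcut (Or.inl rfl) (key rfl hθ.pair hcut ?_)
      (key (union_comm _ _) hθ.pair.symm hcut.symm ?_)
    · obtain ⟨w, hw, hwl⟩ := hθ.symm.pairLeft.isJordanCurve.exists_re_mul_ge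
        (u := -u) (by simpa using hu) hlB
      simp only [neg_mul, Complex.neg_re, neg_lt_neg_iff] at hwl
      have hwa : η < |(u * w).re - c| := by rw [lt_abs]; right; linarith
      have hwB : w ∈ B := hw.resolve_right fun hz => by have := hline w hz; linarith
      exact ⟨w, hwB, fun hwA => hend w hwa ⟨hwA, hwB⟩, hwa⟩
    · obtain ⟨w, hw, hwr⟩ := hθ.pairLeft.isJordanCurve.exists_re_mul_ge hu hrA
      have hwa : η < |(u * w).re - c| := by rw [lt_abs]; left; linarith
      have hwA : w ∈ A := hw.resolve_right fun hz => by have := hline w hz; linarith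
      exact ⟨w, hwA, fun hwB => hend w hwa ⟨hwA, hwB⟩, hwa⟩

lemma NotAcross.mono {u : ℂ} {c η : ℝ} {J J' : Set ℂ} (h : NotAcross u c η J)
    (hs : Ins J' ⊆ Ins J) : NotAcross u c η J' :=
  h.imp (fun h r hr => h r (hs hr)) fun h r hr => h r (hs hr)

lemma abs_re_sub_le_of_notAcross {u : ℂ} {η R : ℝ} (hη : 0 < η) {K : ℕ} (hK : R ≤ K * η)
    {J : Set ℂ} (hR : ∀ z ∈ Ins J, |(u * z).re| ≤ R)
    (h : ∀ k ∈ Finset.range (2 * K + 1), NotAcross u ((k - K : ℝ) * η) η J) {z w : ℂ}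
    (hz : z ∈ Ins J) (hw : w ∈ Ins J) : (u * z).re - (u * w).re ≤ 4 * η := by
  by_contra! hlt
  have hz' := abs_le.1 (hR z hz)
  have hw' := abs_le.1 (hR w hw)
  set x := (u * w).re / η + K + 1 with hx
  have hwη : (u * w).re = (x - K - 1) * η := by rw [hx]; field_simp; ring
  have hx1 : 1 ≤ x := by
    have : 0 ≤ ((u * w).re + K * η) := by linarith
    by_contra! hx1
    nlinarith
  have hxK : x + 1 < 2 * K + 1 := by
    by_contra! hx1
    nlinarith
  have hfl := Nat.floor_le (a := x) (by linarith)
  have hfl' := Nat.lt_floor_add_one x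
  have hk : ⌊x⌋₊ + 1 ∈ Finset.range (2 * K + 1) := by
    rw [Finset.mem_range]
    have : ((⌊x⌋₊ + 1 : ℕ) : ℝ) < (2 * K + 1 : ℕ) := by push_cast; linarith
    exact_mod_cast this
  rcases h _ hk with h1 | h1
  · have := h1 z hz
    push_cast at this
    nlinarith
  · have := h1 w hw
    push_cast at this
    nlinarith

lemma Holes.exists_division_diam_le (h : Holes C) {ε : ℝ} (hε : 0 < ε) {J : Set ℂ}
    (hG : Good C J) : Division C (fun J' => diam (Reg J') ≤ ε) J := by
  set η := ε / 8 with hη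
  have hη0 : 0 < η := by positivity
  obtain ⟨R, hR⟩ := (isBounded_ins hG.jordan.isCompact).subset_closedBall 0
  obtain ⟨K, hK⟩ := exists_nat_ge (R / η)
  rw [div_le_iff₀ hη0] at hK
  have hstep : ∀ s : Finset (ℂ × ℝ), (∀ p ∈ s, ‖p.1‖ = 1) → Division C (fun J' =>
      (∀ i, Reg (C i) ⊆ Ins J' → diam (Reg (C i)) < η / 8) ∧ Ins J' ⊆ Ins J ∧
      ∀ p ∈ s, NotAcross p.1 p.2 η J') J := by
    intro s
    induction s using Finset.induction_on with
    | empty =>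
      intro _
      exact (h.exists_division_small_holes (δ := η / 8) (by positivity) hG).bind
        fun J' hG' hP hI => .leaf hG' ⟨hP, hI, by simp⟩
    | insert p s _ ih =>
      intro hs
      refine (ih fun q hq => hs q (Finset.mem_insert_of_mem hq)).bind fun J' hG' hP _ => ?_
      refine (h.exists_division_notAcross (hs p (Finset.mem_insert_self _ _)) p.2 hη0 hG'
        hP.1).bind fun J'' hG'' hQ hI => .leaf hG'' ⟨fun i hi => hP.1 i (hi.trans hI),
          hI.trans hP.2.1, fun q hq => ?_⟩
      rcases Finset.mem_insert.1 hq with rfl | hq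
      · exact hQ
      · exact (hP.2.2 q hq).mono hI
  have hnorm : ∀ u ∈ ({1, -Complex.I} : Finset ℂ), ‖u‖ = 1 := by simp
  refine (hstep (({1, -Complex.I} : Finset ℂ) ×ˢ
    ((Finset.range (2 * K + 1)).image fun k : ℕ => (k - K : ℝ) * η)) fun p hp =>
      hnorm _ (Finset.mem_product.1 hp).1).bind fun J' hG' hP _ => .leaf hG' ?_
  have hle : ∀ u ∈ ({1, -Complex.I} : Finset ℂ), ∀ z ∈ Ins J', ∀ w ∈ Ins J',
      (u * z).re - (u * w).re ≤ 4 * η := fun u hu z hz w hw => by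
    refine abs_re_sub_le_of_notAcross hη0 hK (fun z hz => ?_) (fun k hk => ?_) hz hw
    · refine (Complex.abs_re_le_norm _).trans ?_
      rw [norm_mul, hnorm u hu, one_mul]
      simpa using hR (hP.2.1 hz)
    · exact hP.2.2 (u, _) (Finset.mem_product.2 ⟨hu, Finset.mem_image_of_mem _ hk⟩)
  rw [← hG'.jordan.closure_ins_eq_reg, diam_closure]
  refine diam_le_of_forall_dist_le hε.le fun z hz w hw => ?_
  have h1 := hle 1 (by simp) z hz w hw
  have h2 := hle 1 (by simp) w hw z hz
  have h3 := hle (-Complex.I) (by simp) z hz w hw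
  have h4 := hle (-Complex.I) (by simp) w hw z hz
  simp only [one_mul, neg_mul, Complex.neg_re, Complex.I_mul_re, neg_neg] at h1 h2 h3 h4
  rw [dist_eq_norm]
  refine (Complex.norm_le_abs_re_add_abs_im _).trans ?_
  have h5 : |(z - w).re| ≤ 4 * η := abs_le.2 ⟨by simp; linarith, by simp; linarith⟩
  have h6 : |(z - w).im| ≤ 4 * η := abs_le.2 ⟨by simp; linarith, by simp; linarith⟩
  rw [hη] at h5 h6
  linarith

end

/-! ### Matched decompositions -/

lemma IsArc.map {A : Set ℂ} {a b : ℂ} (h : IsArc A a b) {σ : ℂ → ℂ} (hc : ContinuousOn σ A)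
    (hi : InjOn σ A) : IsArc (σ '' A) (σ a) (σ b) := by
  obtain ⟨f, hf⟩ := h
  have hm : MapsTo f (Icc 0 1) A := fun t ht => hf.image.subset ⟨t, ht, rfl⟩
  exact ⟨σ ∘ f, hc.comp hf.cont hm, hi.comp hf.inj hm, by simp [hf.zero], by simp [hf.one],
    by rw [image_comp, hf.image]⟩

lemma ArcPair.map {A B : Set ℂ} {a b : ℂ} (h : ArcPair A B a b) {σ : ℂ → ℂ}
    (hc : ContinuousOn σ (A ∪ B)) (hi : InjOn σ (A ∪ B)) :
    ArcPair (σ '' A) (σ '' B) (σ a) (σ b) where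
  left := h.left.map (hc.mono subset_union_left) (hi.mono subset_union_left)
  right := h.right.map (hc.mono subset_union_right) (hi.mono subset_union_right)
  inter := by
    rw [← hi.image_inter subset_union_left subset_union_right, h.inter, image_pair]

lemma IsJordanCurve.map {J : Set ℂ} (h : IsJordanCurve J) {σ : ℂ → ℂ}
    (hc : ContinuousOn σ J) (hi : InjOn σ J) : IsJordanCurve (σ '' J) := by
  obtain ⟨A, B, a, b, hp, rfl⟩ := h
  exact ⟨_, _, _, _, hp.map hc hi, image_union _ _ _⟩

lemma Holes.isCompact_carpet {C : ℕ → Set ℂ} (h : Holes C) {J : Set ℂ} (hJ : IsJordanCurve J) :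
    IsCompact (Carpet C J) :=
  hJ.isCompact_reg.diff (isOpen_iUnion fun i => isOpen_ins (h.isCompact i))

/-- The projection `π` maps `Γ` injectively onto a good curve. -/
structure Leg (C : ℕ → Set ℂ) (π : ℂ × ℂ → ℂ) (Γ : Set (ℂ × ℂ)) : Prop where
  inj : InjOn π Γ
  good : Good C (image π Γ)

/-- The projections of the members of `D` decompose the carpet bounded by the projection
of `Γ`, compatibly with `Γ` and with each other. -/
structure Decomp (C : ℕ → Set ℂ) (π : ℂ × ℂ → ℂ) (Γ : Set (ℂ × ℂ)) (D : Set (Set (ℂ × ℂ))) :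
    Prop where
  leg : ∀ Δ ∈ D, Leg C π Δ
  cover : Carpet C (π '' Γ) = ⋃ Δ ∈ D, Carpet C (π '' Δ)
  bdry : ∀ p ∈ Γ, ∀ Δ ∈ D, π p ∈ Carpet C (π '' Δ) → p ∈ Δ
  pair : ∀ Δ ∈ D, ∀ Δ' ∈ D, Δ ≠ Δ' → ∀ x ∈ Carpet C (π '' Δ), x ∈ Carpet C (π '' Δ') →
    ∃ p ∈ Δ ∩ Δ', π p = x

section

variable {C C' : ℕ → Set ℂ} {π π' : ℂ × ℂ → ℂ} {Γ : Set (ℂ × ℂ)}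

lemma Decomp.singleton (h : Leg C π Γ) : Decomp C π Γ {Γ} where
  leg := by rintro Δ rfl; exact h
  cover := by simp
  bdry := by rintro p hp Δ rfl _; exact hp
  pair := by rintro Δ rfl Δ' rfl hne; exact absurd rfl hne

lemma Decomp.carpet_subset {D : Set (Set (ℂ × ℂ))} (h : Decomp C π Γ D) {Δ : Set (ℂ × ℂ)}
    (hΔ : Δ ∈ D) : Carpet C (π '' Δ) ⊆ Carpet C (π '' Γ) := by
  rw [h.cover]; exact subset_biUnion_of_mem (u := fun Δ => Carpet C (π '' Δ)) hΔ

lemma Decomp.bind {D : Set (Set (ℂ × ℂ))} (h : Decomp C π Γ D)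
    {E : Set (ℂ × ℂ) → Set (Set (ℂ × ℂ))} (hE : ∀ Δ ∈ D, Decomp C π Δ (E Δ)) :
    Decomp C π Γ (⋃ Δ ∈ D, E Δ) where
  leg := by
    intro Θ hΘ
    obtain ⟨Δ, hΔ, hΘ⟩ := mem_iUnion₂.1 hΘ
    exact (hE Δ hΔ).leg Θ hΘ
  cover := by
    rw [h.cover]
    ext x
    simp only [mem_iUnion]
    constructor
    · rintro ⟨Δ, hΔ, hx⟩
      rw [(hE Δ hΔ).cover] at hx
      obtain ⟨Θ, hΘ, hx⟩ := mem_iUnion₂.1 hx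
      exact ⟨Θ, ⟨Δ, hΔ, hΘ⟩, hx⟩
    · rintro ⟨Θ, ⟨Δ, hΔ, hΘ⟩, hx⟩
      exact ⟨Δ, hΔ, (hE Δ hΔ).carpet_subset hΘ hx⟩
  bdry := by
    intro p hp Θ hΘ hx
    obtain ⟨Δ, hΔ, hΘ⟩ := mem_iUnion₂.1 hΘ
    exact (hE Δ hΔ).bdry p (h.bdry p hp Δ hΔ ((hE Δ hΔ).carpet_subset hΘ hx)) Θ hΘ hx
  pair := by
    intro Θ hΘ Θ' hΘ' hne x hx hx'
    obtain ⟨Δ, hΔ, hΘ⟩ := mem_iUnion₂.1 hΘ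
    obtain ⟨Δ', hΔ', hΘ'⟩ := mem_iUnion₂.1 hΘ'
    rcases eq_or_ne Δ Δ' with rfl | hD
    · exact (hE Δ hΔ).pair Θ hΘ Θ' hΘ' hne x hx hx'
    · obtain ⟨p, ⟨hp, hp'⟩, rfl⟩ := h.pair Δ hΔ Δ' hΔ' hD x ((hE Δ hΔ).carpet_subset hΘ hx)
        ((hE Δ' hΔ').carpet_subset hΘ' hx')
      exact ⟨p, ⟨(hE Δ hΔ).bdry p hp Θ hΘ hx, (hE Δ' hΔ').bdry p hp' Θ' hΘ' hx'⟩, rfl⟩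

lemma image_union_path {ΓA : Set (ℂ × ℂ)} {F : ℝ → ℂ × ℂ} :
    π '' (ΓA ∪ F '' Icc 0 1) = π '' ΓA ∪ (π ∘ F) '' Icc 0 1 := by
  rw [image_union, image_comp]

lemma injOn_union_path {ΓA : Set (ℂ × ℂ)} {F : ℝ → ℂ × ℂ} (hi : InjOn π ΓA)
    (hp : ArcPair (π '' ΓA) ((π ∘ F) '' Icc 0 1) (π (F 0)) (π (F 1)))
    (hF : InjOn (π ∘ F) (Icc 0 1)) (h0 : F 0 ∈ ΓA) (h1 : F 1 ∈ ΓA) :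
    InjOn π (ΓA ∪ F '' Icc 0 1) := by
  have key : ∀ p ∈ ΓA, ∀ t ∈ Icc (0 : ℝ) 1, π p = π (F t) → p = F t := fun p hpA t ht e => by
    have h0' : (0 : ℝ) ∈ Icc (0 : ℝ) 1 := by simp
    have h1' : (1 : ℝ) ∈ Icc (0 : ℝ) 1 := by simp
    rcases hp.inter.subset ⟨⟨p, hpA, rfl⟩, ⟨t, ht, e.symm⟩⟩ with e' | e'
    · have : t = 0 := hF ht h0' (e.symm.trans e')
      rw [this]; exact hi hpA h0 e'
    · have : t = 1 := hF ht h1' (e.symm.trans e')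
      rw [this]; exact hi hpA h1 e'
  rintro p (hpA | ⟨s, hs, rfl⟩) q (hqA | ⟨t, ht, rfl⟩) e
  · exact hi hpA hqA e
  · exact key p hpA t ht e
  · exact (key q hqA s hs e.symm).symm
  · rw [hF hs ht e]

lemma Decomp.of_cut {ΓA ΓB : Set (ℂ × ℂ)} {F G : ℝ → ℂ × ℂ} {S : Set ℝ}
    (hi : InjOn π (ΓA ∪ ΓB)) (hFG : EqOn F G S) (h0 : F 0 ∈ ΓA ∩ ΓB) (h1 : F 1 ∈ ΓA ∩ ΓB)
    (hG0 : G 0 = F 0) (hG1 : G 1 = F 1)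
    (hc : Cut C (π '' ΓA) (π '' ΓB) (π (F 0)) (π (F 1)) (π ∘ F) (π ∘ G) S) :
    Decomp C π (ΓA ∪ ΓB) {ΓA ∪ F '' Icc 0 1, ΓB ∪ G '' Icc 0 1} := by
  have hA := image_union_path (π := π) (ΓA := ΓA) (F := F)
  have hB := image_union_path (π := π) (ΓA := ΓB) (F := G)
  have hpr := hc.right
  rw [← hG0, ← hG1] at hpr
  refine ⟨?_, ?_, ?_, ?_⟩
  · rintro Δ (rfl | rfl)
    · exact ⟨injOn_union_path (hi.mono subset_union_left) hc.left hc.fparam.inj h0.1 h1.1,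
        hA ▸ hc.goodLeft⟩
    · exact ⟨injOn_union_path (hi.mono subset_union_right) hpr hc.gparam.inj
        (hG0 ▸ h0.2) (hG1 ▸ h1.2), hB ▸ hc.goodRight⟩
  · rw [biUnion_pair, image_union, hc.cover, hA, hB]
  · rintro p hp Δ (rfl | rfl) hx
    · rw [hA] at hx
      obtain ⟨q, hq, e⟩ := hc.bdryLeft ⟨(image_union π ΓA ΓB).subset ⟨p, hp, rfl⟩, hx.1⟩
      exact Or.inl (hi (Or.inl hq) hp e ▸ hq)
    · rw [hB] at hx
      obtain ⟨q, hq, e⟩ := hc.bdryRight ⟨(image_union π ΓA ΓB).subset ⟨p, hp, rfl⟩, hx.1⟩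
      exact Or.inl (hi (Or.inr hq) hp e ▸ hq)
  · have key : ∀ x ∈ Carpet C (π '' (ΓA ∪ F '' Icc 0 1)), x ∈ Carpet C (π '' (ΓB ∪ G '' Icc 0 1)) →
        ∃ p ∈ (ΓA ∪ F '' Icc 0 1) ∩ (ΓB ∪ G '' Icc 0 1), π p = x := fun x hx hx' => by
      rw [hA] at hx
      rw [hB] at hx'
      obtain ⟨t, ht, rfl⟩ := hc.inter ⟨hx, hx'⟩
      exact ⟨F t, ⟨Or.inr ⟨t, hc.sub ht, rfl⟩, Or.inr ⟨t, hc.sub ht, (hFG ht).symm⟩⟩, rfl⟩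
    rintro Δ (rfl | rfl) Δ' (rfl | rfl) hne x hx hx'
    · exact absurd rfl hne
    · exact key x hx hx'
    · obtain ⟨p, hp, e⟩ := key x hx' hx
      exact ⟨p, hp.symm, e⟩
    · exact absurd rfl hne

/-- Any type of cut is available across any pair of arcs bounding a good domain. -/
lemma Holes.exists_cut_of_type (h : Holes C) {A B : Set ℂ} {a b : ℂ} (hp : ArcPair A B a b)
    (hG : Good C (A ∪ B)) {S : Set ℝ} (hS : S = Icc 0 1 ∨ S = outerThirds) :
    ∃ f g, Cut C A B a b f g S := by
  rcases hS with rfl | rfl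
  · exact exists_cut_straight h hp hG
  · obtain ⟨i, hi, hiJ⟩ := hG.exists_hole h
    obtain ⟨f, g, hc, -⟩ := exists_cut_around h hp hG hi hiJ
    exact ⟨f, g, hc⟩

/-- A finite family decomposing both carpets bounded by the two projections of `Γ`. -/
structure Matched (C C' : ℕ → Set ℂ) (π π' : ℂ × ℂ → ℂ) (Γ : Set (ℂ × ℂ))
    (D : Set (Set (ℂ × ℂ))) : Prop where
  finite : D.Finite
  compact : ∀ Δ ∈ D, IsCompact Δ
  left : Decomp C π Γ D
  right : Decomp C' π' Γ D

lemma Matched.symm {D : Set (Set (ℂ × ℂ))} (h : Matched C C' π π' Γ D) :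
    Matched C' C π' π Γ D :=
  ⟨h.finite, h.compact, h.right, h.left⟩

lemma Matched.singleton (hΓ : IsCompact Γ) (h : Leg C π Γ) (h' : Leg C' π' Γ) :
    Matched C C' π π' Γ {Γ} :=
  ⟨finite_singleton _, by rintro Δ rfl; exact hΓ, .singleton h, .singleton h'⟩

lemma Matched.bind {D : Set (Set (ℂ × ℂ))} (h : Matched C C' π π' Γ D)
    {E : Set (ℂ × ℂ) → Set (Set (ℂ × ℂ))} (hE : ∀ Δ ∈ D, Matched C C' π π' Δ (E Δ)) :
    Matched C C' π π' Γ (⋃ Δ ∈ D, E Δ) where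
  finite := h.finite.biUnion fun Δ hΔ => (hE Δ hΔ).finite
  compact := by
    intro Θ hΘ
    obtain ⟨Δ, hΔ, hΘ⟩ := mem_iUnion₂.1 hΘ
    exact (hE Δ hΔ).compact Θ hΘ
  left := h.left.bind fun Δ hΔ => (hE Δ hΔ).left
  right := h.right.bind fun Δ hΔ => (hE Δ hΔ).right

/-- `π` and `π'` are the two coordinates of a product structure with pairing `mk`. -/
structure Coords (π π' : ℂ × ℂ → ℂ) (mk : ℂ × ℂ → ℂ × ℂ) : Prop where
  cont_left : Continuous π
  cont_right : Continuous π'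
  cont_mk : Continuous mk
  left_mk : ∀ x y, π (mk (x, y)) = x
  right_mk : ∀ x y, π' (mk (x, y)) = y
  mk_eq : ∀ p, mk (π p, π' p) = p

lemma Holes.exists_matched_cut {mk : ℂ × ℂ → ℂ × ℂ} (h' : Holes C') (hco : Coords π π' mk)
    {A B : Set ℂ} {a b : ℂ} {f g : ℝ → ℂ} {S : Set ℝ} (hc : Cut C A B a b f g S)
    (hS : S = Icc 0 1 ∨ S = outerThirds) (hΓ : IsCompact Γ) (hl : Leg C π Γ) (hr : Leg C' π' Γ)
    (hJ : π '' Γ = A ∪ B) : ∃ Δ₁ Δ₂, Matched C C' π π' Γ {Δ₁, Δ₂} ∧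
      π '' Δ₁ = A ∪ f '' Icc 0 1 ∧ π '' Δ₂ = B ∪ g '' Icc 0 1 := by
  have hAc : IsClosed A := hc.pair.left.isClosed
  have hBc : IsClosed B := hc.pair.right.isClosed
  set ΓA := Γ ∩ π ⁻¹' A with hΓA
  set ΓB := Γ ∩ π ⁻¹' B with hΓB
  have hAi : π '' ΓA = A := by
    rw [hΓA, image_inter_preimage, hJ]; exact inter_eq_right.2 subset_union_left
  have hBi : π '' ΓB = B := by
    rw [hΓB, image_inter_preimage, hJ]; exact inter_eq_right.2 subset_union_right
  have hU : ΓA ∪ ΓB = Γ := by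
    rw [← inter_union_distrib_left, ← preimage_union, ← hJ]
    exact inter_eq_left.2 (subset_preimage_image π Γ)
  have hinv := hl.inj.leftInvOn_invFunOn
  set τ := Function.invFunOn π Γ with hτ
  have hτc : ContinuousOn τ (A ∪ B) := by
    rw [← hJ]; exact continuousOn_invFunOn_image hΓ hco.cont_left.continuousOn hl.inj
  have hτm : ∀ x ∈ A ∪ B, τ x ∈ Γ ∧ π (τ x) = x := fun x hx => by
    rw [← hJ] at hx
    exact Function.invFunOn_pos hx
  have hτi : InjOn τ (A ∪ B) := fun x hx y hy e => by
    rw [← (hτm x hx).2, ← (hτm y hy).2, e]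
  have hτA : τ '' A = ΓA := by
    ext p
    constructor
    · rintro ⟨x, hx, rfl⟩
      exact ⟨(hτm x (Or.inl hx)).1, by rw [mem_preimage, (hτm x (Or.inl hx)).2]; exact hx⟩
    · rintro ⟨hp, hpA⟩
      exact ⟨π p, hpA, hinv hp⟩
  have hτB : τ '' B = ΓB := by
    ext p
    constructor
    · rintro ⟨x, hx, rfl⟩
      exact ⟨(hτm x (Or.inr hx)).1, by rw [mem_preimage, (hτm x (Or.inr hx)).2]; exact hx⟩
    · rintro ⟨hp, hpA⟩
      exact ⟨π p, hpA, hinv hp⟩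
  have hτU : τ '' (A ∪ B) = Γ := by rw [image_union, hτA, hτB, hU]
  have hp' : ArcPair ((π') '' ΓA) ((π') '' ΓB) (π' (τ a)) (π' (τ b)) := by
    have := hc.pair.map (σ := π' ∘ τ) (hco.cont_right.comp_continuousOn hτc)
      (fun x hx y hy e => hτi hx hy (hr.inj (hτm x hx).1 (hτm y hy).1 e))
    rwa [image_comp, image_comp, hτA, hτB] at this
  have hG' : Good C' ((π') '' ΓA ∪ (π') '' ΓB) := by rw [← image_union, hU]; exact hr.good
  obtain ⟨f', g', hc'⟩ := h'.exists_cut_of_type hp' hG' hS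
  have haA : a ∈ A := hc.pair.left.left_mem
  have hbA : b ∈ A := hc.pair.left.right_mem
  have haB : a ∈ B := hc.pair.right.left_mem
  have hbB : b ∈ B := hc.pair.right.right_mem
  set F : ℝ → ℂ × ℂ := fun t => mk (f t, f' t) with hF
  set G : ℝ → ℂ × ℂ := fun t => mk (g t, g' t) with hG
  have hF1 : π ∘ F = f := funext fun t => hco.left_mk _ _
  have hF2 : π' ∘ F = f' := funext fun t => hco.right_mk _ _
  have hG1 : π ∘ G = g := funext fun t => hco.left_mk _ _
  have hG2 : π' ∘ G = g' := funext fun t => hco.right_mk _ _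
  have hmk : ∀ x ∈ A ∪ B, mk (x, π' (τ x)) = τ x := fun x hx => by
    conv_lhs => rw [← (hτm x hx).2]
    rw [(hτm x hx).2]
    have := hco.mk_eq (τ x)
    rwa [(hτm x hx).2] at this
  have hFa : F 0 = τ a := by
    simp only [hF, hc.fparam.zero, hc'.fparam.zero]; exact hmk a (Or.inl haA)
  have hFb : F 1 = τ b := by
    simp only [hF, hc.fparam.one, hc'.fparam.one]; exact hmk b (Or.inl hbA)
  have hGa : G 0 = τ a := by
    simp only [hG, hc.gparam.zero, hc'.gparam.zero]; exact hmk a (Or.inl haA)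
  have hGb : G 1 = τ b := by
    simp only [hG, hc.gparam.one, hc'.gparam.one]; exact hmk b (Or.inl hbA)
  have hmem : ∀ x, x ∈ A → x ∈ B → τ x ∈ ΓA ∩ ΓB := fun x hA hB =>
    ⟨hτA.subset ⟨x, hA, rfl⟩, hτB.subset ⟨x, hB, rfl⟩⟩
  have hFG : EqOn F G S := fun t ht => by simp only [hF, hG, hc.eq ht, hc'.eq ht]
  have hFc : ContinuousOn F (Icc 0 1) :=
    hco.cont_mk.comp_continuousOn (hc.fparam.cont.prodMk hc'.fparam.cont)
  have hGc : ContinuousOn G (Icc 0 1) :=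
    hco.cont_mk.comp_continuousOn (hc.gparam.cont.prodMk hc'.gparam.cont)
  have e0 : π (F 0) = a := by rw [hFa, (hτm a (Or.inl haA)).2]
  have e1 : π (F 1) = b := by rw [hFb, (hτm b (Or.inl hbA)).2]
  have hd := Decomp.of_cut (C := C) (π := π) (ΓA := ΓA) (ΓB := ΓB) (F := F) (G := G) (S := S)
    (by rw [hU]; exact hl.inj) hFG (hFa ▸ hmem a haA haB) (hFb ▸ hmem b hbA hbB)
    (hGa.trans hFa.symm) (hGb.trans hFb.symm) (by rw [hAi, hBi, hF1, hG1, e0, e1]; exact hc)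
  have hd' := Decomp.of_cut (C := C') (π := π') (ΓA := ΓA) (ΓB := ΓB) (F := F) (G := G) (S := S)
    (by rw [hU]; exact hr.inj) hFG (hFa ▸ hmem a haA haB) (hFb ▸ hmem b hbA hbB)
    (hGa.trans hFa.symm) (hGb.trans hFb.symm) (by rw [hF2, hG2, hFa, hFb]; exact hc')
  rw [hU] at hd hd'
  refine ⟨_, _, ⟨(finite_singleton _).insert _, ?_, hd, hd'⟩, ?_, ?_⟩
  · rintro Δ (rfl | rfl)
    · exact (hΓ.inter_right (hAc.preimage hco.cont_left)).union (isCompact_Icc.image_of_continuousOn hFc)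
    · exact (hΓ.inter_right (hBc.preimage hco.cont_left)).union (isCompact_Icc.image_of_continuousOn hGc)
  · rw [image_union_path, hAi, hF1]
  · rw [image_union_path, hBi, hG1]

lemma Division.exists_matched {mk : ℂ × ℂ → ℂ × ℂ} {P : Set ℂ → Prop} {J : Set ℂ}
    (h' : Holes C') (hco : Coords π π' mk) (hD : Division C P J) :
    ∀ Γ, IsCompact Γ → Leg C π Γ → Leg C' π' Γ → π '' Γ = J →
      ∃ D, Matched C C' π π' Γ D ∧ ∀ Δ ∈ D, P (π '' Δ) := by
  induction hD with
  | leaf _ hP =>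
    rintro Γ hΓ hl hr rfl
    exact ⟨{Γ}, .singleton hΓ hl hr, by rintro Δ rfl; exact hP⟩
  | node hc hS _ _ ih₁ ih₂ =>
    intro Γ hΓ hl hr hJ
    obtain ⟨Δ₁, Δ₂, hM, h1, h2⟩ := h'.exists_matched_cut hco hc hS hΓ hl hr hJ
    have hall : ∀ Δ ∈ ({Δ₁, Δ₂} : Set (Set (ℂ × ℂ))), ∃ D, Matched C C' π π' Δ D ∧
        ∀ Θ ∈ D, P (π '' Θ) := by
      rintro Δ hΔ
      have hl := hM.left.leg Δ hΔ
      have hr := hM.right.leg Δ hΔ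
      have hk := hM.compact Δ hΔ
      rcases hΔ with rfl | rfl
      · exact ih₁ _ hk hl hr h1
      · exact ih₂ _ hk hl hr h2
    choose! E hE hEP using hall
    refine ⟨_, hM.bind hE, fun Θ hΘ => ?_⟩
    obtain ⟨Δ, hΔ, hΘ⟩ := mem_iUnion₂.1 hΘ
    exact hEP Δ hΔ Θ hΘ

lemma Holes.exists_matched_small {mk : ℂ × ℂ → ℂ × ℂ} (h : Holes C) (h' : Holes C')
    (hco : Coords π π' mk) {ε : ℝ} (hε : 0 < ε) (hΓ : IsCompact Γ) (hl : Leg C π Γ)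
    (hr : Leg C' π' Γ) : ∃ D, Matched C C' π π' Γ D ∧
      ∀ Δ ∈ D, ∀ x ∈ Carpet C (π '' Δ), ∀ y ∈ Carpet C (π '' Δ), dist x y ≤ ε := by
  obtain ⟨D, hD, hs⟩ := (h.exists_division_diam_le hε hl.good).exists_matched h' hco Γ hΓ hl hr rfl
  exact ⟨D, hD, fun Δ hΔ x hx y hy => (dist_le_diam_of_mem
    (hD.left.leg Δ hΔ).good.jordan.isCompact_reg.isBounded hx.1 hy.1).trans (hs Δ hΔ)⟩

/-- The union of the products of corresponding pieces. -/
def BoxUnion (C C' : ℕ → Set ℂ) (D : Set (Set (ℂ × ℂ))) : Set (ℂ × ℂ) :=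
  ⋃ Δ ∈ D, Carpet C (Prod.fst '' Δ) ×ˢ Carpet C' (Prod.snd '' Δ)

lemma Matched.exists_refinement (h : Holes C) (h' : Holes C') {ε : ℝ} (hε : 0 < ε)
    {D : Set (Set (ℂ × ℂ))} (hM : Matched C C' Prod.fst Prod.snd Γ D) :
    ∃ E, Matched C C' Prod.fst Prod.snd Γ E ∧ BoxUnion C C' E ⊆ BoxUnion C C' D ∧
      ∀ Δ ∈ E, (∀ x ∈ Carpet C (Prod.fst '' Δ), ∀ y ∈ Carpet C (Prod.fst '' Δ), dist x y ≤ ε) ∧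
        ∀ x ∈ Carpet C' (Prod.snd '' Δ), ∀ y ∈ Carpet C' (Prod.snd '' Δ), dist x y ≤ ε := by
  have hco : Coords Prod.fst Prod.snd id :=
    ⟨continuous_fst, continuous_snd, continuous_id, fun _ _ => rfl, fun _ _ => rfl, fun _ => rfl⟩
  have hco' : Coords Prod.snd Prod.fst Prod.swap :=
    ⟨continuous_snd, continuous_fst, continuous_swap, fun _ _ => rfl, fun _ _ => rfl, fun _ => rfl⟩
  have sub : ∀ {D : Set (Set (ℂ × ℂ))} {E : Set (ℂ × ℂ) → Set (Set (ℂ × ℂ))},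
      (∀ Δ ∈ D, Matched C C' Prod.fst Prod.snd Δ (E Δ)) →
      BoxUnion C C' (⋃ Δ ∈ D, E Δ) ⊆ BoxUnion C C' D := by
    intro D E hE p hp
    obtain ⟨Θ, hΘ, hp⟩ := mem_iUnion₂.1 hp
    obtain ⟨Δ, hΔ, hΘ⟩ := mem_iUnion₂.1 hΘ
    exact mem_iUnion₂.2 ⟨Δ, hΔ, (hE Δ hΔ).left.carpet_subset hΘ hp.1,
      (hE Δ hΔ).right.carpet_subset hΘ hp.2⟩
  have h1 : ∀ Δ ∈ D, _ := fun Δ hΔ => h.exists_matched_small h' hco hε (hM.compact Δ hΔ)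
    (hM.left.leg Δ hΔ) (hM.right.leg Δ hΔ)
  choose! E hE hEs using h1
  have hM₁ := hM.bind hE
  have h2 : ∀ Δ ∈ ⋃ Δ ∈ D, E Δ, _ := fun Δ hΔ => h'.exists_matched_small h hco' hε
    (hM₁.compact Δ hΔ) (hM₁.right.leg Δ hΔ) (hM₁.left.leg Δ hΔ)
  choose! E' hE' hEs' using h2
  refine ⟨_, hM₁.bind fun Δ hΔ => (hE' Δ hΔ).symm,
    (sub fun Δ hΔ => (hE' Δ hΔ).symm).trans (sub hE), fun Θ hΘ => ?_⟩
  obtain ⟨Δ, hΔ, hΘ⟩ := mem_iUnion₂.1 hΘ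
  obtain ⟨Δ₀, hΔ₀, hΔ'⟩ := mem_iUnion₂.1 hΔ
  exact ⟨fun x hx y hy => hEs Δ₀ hΔ₀ Δ hΔ' x ((hE' Δ hΔ).right.carpet_subset hΘ hx) y
    ((hE' Δ hΔ).right.carpet_subset hΘ hy), hEs' Δ hΔ Θ hΘ⟩

/-- A correspondence between two good curves extends to a correspondence between the carpets
that they bound. -/
theorem Holes.exists_carpet_corr (h : Holes C) (h' : Holes C') (hΓ : IsCompact Γ)
    (hl : Leg C Prod.fst Γ) (hr : Leg C' Prod.snd Γ) :
    ∃ R : Set (ℂ × ℂ), IsCompact R ∧ Γ ⊆ R ∧ InjOn Prod.fst R ∧ InjOn Prod.snd R ∧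
      Prod.fst '' R = Carpet C (Prod.fst '' Γ) ∧ Prod.snd '' R = Carpet C' (Prod.snd '' Γ) := by
  obtain ⟨D, hM, hanti, hsmall⟩ : ∃ D : ℕ → Set (Set (ℂ × ℂ)),
      (∀ n, Matched C C' Prod.fst Prod.snd Γ (D n)) ∧
      (∀ n, BoxUnion C C' (D (n + 1)) ⊆ BoxUnion C C' (D n)) ∧ ∀ n : ℕ, ∀ Δ ∈ D (n + 1),
        (∀ x ∈ Carpet C (Prod.fst '' Δ), ∀ y ∈ Carpet C (Prod.fst '' Δ),
          dist x y ≤ 1 / (n + 1 : ℝ)) ∧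
        ∀ x ∈ Carpet C' (Prod.snd '' Δ), ∀ y ∈ Carpet C' (Prod.snd '' Δ),
          dist x y ≤ 1 / (n + 1 : ℝ) := by
    choose! step hstep hsub hsmall using fun (n : ℕ) (D : Set (Set (ℂ × ℂ)))
      (hD : Matched C C' Prod.fst Prod.snd Γ D) =>
        hD.exists_refinement h h' (ε := 1 / (n + 1 : ℝ)) (by positivity)
    let D : ℕ → Set (Set (ℂ × ℂ)) := fun n => Nat.rec {Γ} (fun n D => step n D) n
    have hM : ∀ n, Matched C C' Prod.fst Prod.snd Γ (D n) := fun n => by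
      induction n with
      | zero => exact .singleton hΓ hl hr
      | succ n ih => exact hstep n _ ih
    exact ⟨D, hM, fun n => hsub n _ (hM n), fun n => hsmall n _ (hM n)⟩
  have hcomp : ∀ n, IsCompact (BoxUnion C C' (D n)) := fun n =>
    (hM n).finite.isCompact_biUnion fun Δ hΔ =>
      (h.isCompact_carpet ((hM n).left.leg Δ hΔ).good.jordan).prod
        (h'.isCompact_carpet ((hM n).right.leg Δ hΔ).good.jordan)
  have hΓR : ∀ n, Γ ⊆ BoxUnion C C' (D n) := fun n p hp => by
    have h1 := hl.good.subset_carpet ⟨p, hp, rfl⟩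
    rw [(hM n).left.cover] at h1
    obtain ⟨Δ, hΔ, hx⟩ := mem_iUnion₂.1 h1
    have hpΔ := (hM n).left.bdry p hp Δ hΔ hx
    exact mem_iUnion₂.2 ⟨Δ, hΔ, hx,
      ((hM n).right.leg Δ hΔ).good.subset_carpet ⟨p, hpΔ, rfl⟩⟩
  have hclose : ∀ n, ∀ p ∈ BoxUnion C C' (D (n + 1)), ∀ q ∈ BoxUnion C C' (D (n + 1)),
      (p.1 = q.1 → dist p.2 q.2 ≤ 2 * (1 / (n + 1 : ℝ))) ∧
      (p.2 = q.2 → dist p.1 q.1 ≤ 2 * (1 / (n + 1 : ℝ))) := by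
    intro n p hp q hq
    have hpos : 0 ≤ 1 / (n + 1 : ℝ) := by positivity
    obtain ⟨Δ, hΔ, hp⟩ := mem_iUnion₂.1 hp
    obtain ⟨Δ', hΔ', hq⟩ := mem_iUnion₂.1 hq
    have hs := hsmall n Δ hΔ
    have hs' := hsmall n Δ' hΔ'
    have hm : ∀ r ∈ Δ ∩ Δ', r.1 ∈ Carpet C (Prod.fst '' Δ) ∩ Carpet C (Prod.fst '' Δ') ∧
        r.2 ∈ Carpet C' (Prod.snd '' Δ) ∩ Carpet C' (Prod.snd '' Δ') := fun r hr =>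
      ⟨⟨((hM (n + 1)).left.leg Δ hΔ).good.subset_carpet ⟨r, hr.1, rfl⟩,
        ((hM (n + 1)).left.leg Δ' hΔ').good.subset_carpet ⟨r, hr.2, rfl⟩⟩,
      ((hM (n + 1)).right.leg Δ hΔ).good.subset_carpet ⟨r, hr.1, rfl⟩,
        ((hM (n + 1)).right.leg Δ' hΔ').good.subset_carpet ⟨r, hr.2, rfl⟩⟩
    constructor
    · intro e
      rcases eq_or_ne Δ Δ' with rfl | hne
      · exact (hs.2 _ hp.2 _ hq.2).trans (by linarith)
      · obtain ⟨r, hr, -⟩ := (hM (n + 1)).left.pair Δ hΔ Δ' hΔ' hne p.1 hp.1 (e ▸ hq.1)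
        have h1 := hs.2 _ hp.2 _ (hm r hr).2.1
        have h2 := hs'.2 _ (hm r hr).2.2 _ hq.2
        linarith [dist_triangle p.2 r.2 q.2]
    · intro e
      rcases eq_or_ne Δ Δ' with rfl | hne
      · exact (hs.1 _ hp.1 _ hq.1).trans (by linarith)
      · obtain ⟨r, hr, -⟩ := (hM (n + 1)).right.pair Δ hΔ Δ' hΔ' hne p.2 hp.2 (e ▸ hq.2)
        have h1 := hs.1 _ hp.1 _ (hm r hr).1.1
        have h2 := hs'.1 _ (hm r hr).1.2 _ hq.1
        linarith [dist_triangle p.1 r.1 q.1]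
  have hlim : ∀ d : ℝ, (∀ n : ℕ, d ≤ 2 * (1 / (n + 1 : ℝ))) → d ≤ 0 := fun d hd =>
    ge_of_tendsto (by simpa using tendsto_one_div_add_atTop_nhds_zero_nat.const_mul (2 : ℝ))
      (Eventually.of_forall hd)
  have hne : ∀ n, ∀ Δ ∈ D n, Δ.Nonempty := fun n Δ hΔ =>
    ((hM n).left.leg Δ hΔ).good.jordan.nonempty.of_image
  have hfib : ∀ {π : ℂ × ℂ → ℂ}, Continuous π → ∀ x,
      (∀ n, (BoxUnion C C' (D n) ∩ π ⁻¹' {x}).Nonempty) →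
      x ∈ π '' ⋂ n, BoxUnion C C' (D n) := by
    intro π hπ x hx
    have hc : ∀ n, IsCompact (BoxUnion C C' (D n) ∩ π ⁻¹' {x}) := fun n =>
      (hcomp n).inter_right (isClosed_singleton.preimage hπ)
    obtain ⟨p, hp⟩ := IsCompact.nonempty_iInter_of_sequence_nonempty_isCompact_isClosed _
      (fun n => inter_subset_inter_left _ (hanti n)) hx (hc 0) (fun n => (hc n).isClosed)
    rw [mem_iInter] at hp
    exact ⟨p, mem_iInter.2 fun n => (hp n).1, (hp 0).2⟩
  refine ⟨⋂ n, BoxUnion C C' (D n), (hcomp 0).of_isClosed_subset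
    (isClosed_iInter fun n => (hcomp n).isClosed) (iInter_subset _ 0), subset_iInter hΓR, ?_, ?_, ?_, ?_⟩
  · intro p hp q hq e
    rw [mem_iInter] at hp hq
    exact Prod.ext e (dist_le_zero.1 (hlim _ fun n =>
      (hclose n p (hp (n + 1)) q (hq (n + 1))).1 e))
  · intro p hp q hq e
    rw [mem_iInter] at hp hq
    exact Prod.ext (dist_le_zero.1 (hlim _ fun n =>
      (hclose n p (hp (n + 1)) q (hq (n + 1))).2 e)) e
  · refine Subset.antisymm ?_ fun x hx => hfib continuous_fst x fun n => ?_
    · rintro _ ⟨p, hp, rfl⟩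
      obtain ⟨Δ, hΔ, hp⟩ := mem_iUnion₂.1 (mem_iInter.1 hp 0)
      exact (hM 0).left.carpet_subset hΔ hp.1
    · rw [(hM n).left.cover] at hx
      obtain ⟨Δ, hΔ, hx⟩ := mem_iUnion₂.1 hx
      obtain ⟨q, hq⟩ := hne n Δ hΔ
      exact ⟨(x, q.2), mem_iUnion₂.2 ⟨Δ, hΔ, hx,
        ((hM n).right.leg Δ hΔ).good.subset_carpet ⟨q, hq, rfl⟩⟩, rfl⟩
  · refine Subset.antisymm ?_ fun x hx => hfib continuous_snd x fun n => ?_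
    · rintro _ ⟨p, hp, rfl⟩
      obtain ⟨Δ, hΔ, hp⟩ := mem_iUnion₂.1 (mem_iInter.1 hp 0)
      exact (hM 0).right.carpet_subset hΔ hp.2
    · rw [(hM n).right.cover] at hx
      obtain ⟨Δ, hΔ, hx⟩ := mem_iUnion₂.1 hx
      obtain ⟨q, hq⟩ := hne n Δ hΔ
      exact ⟨(q.1, x), mem_iUnion₂.2 ⟨Δ, hΔ,
        ((hM n).left.leg Δ hΔ).good.subset_carpet ⟨q, hq, rfl⟩, hx⟩, rfl⟩

end

/-! ### Carpets in the plane and their boundary curves -/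

/-- The closed region of the Jordan curve `J` with infinitely many holes, bounded by the Jordan
curves `C i`, that are dense and lie inside `J`. -/
structure Model (C : ℕ → Set ℂ) (J : Set ℂ) : Prop where
  holes : Holes C
  good : Good C J
  jordan : ∀ i, IsJordanCurve (C i)
  inner : ∀ i, Reg (C i) ⊆ Ins J

/-- The boundary curves of a carpet. -/
def Bd (C : ℕ → Set ℂ) (J : Set ℂ) : Option ℕ → Set ℂ
  | none => J
  | some i => C i

namespace Model

variable {C : ℕ → Set ℂ} {J : Set ℂ}

lemma jordan_bd (h : Model C J) : ∀ j, IsJordanCurve (Bd C J j)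
  | none => h.good.jordan
  | some i => h.jordan i

lemma isCompact_carpet (h : Model C J) : IsCompact (Carpet C J) :=
  h.holes.isCompact_carpet h.good.jordan

lemma bd_subset (h : Model C J) : ∀ j, Bd C J j ⊆ Carpet C J
  | none => h.good.subset_carpet
  | some i => fun z hz => by
    have hz' : z ∈ Reg (C i) := Or.inl hz
    refine ⟨Or.inr (h.inner i hz'), fun hU => ?_⟩
    obtain ⟨k, hk⟩ := mem_iUnion.1 hU
    rcases eq_or_ne i k with rfl | hik
    · exact disjoint_left.1 (disjoint_ins_self _) hk hz
    · exact disjoint_left.1 (h.holes.disj hik) hz' (Or.inr hk)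

lemma disjoint_bd (h : Model C J) : Pairwise fun j k => Disjoint (Bd C J j) (Bd C J k) := by
  have key : ∀ i, Disjoint J (C i) := fun i => disjoint_left.2 fun z hz hz' =>
    disjoint_left.1 (disjoint_ins_self _) (h.inner i (Or.inl hz')) hz
  rintro (_ | i) (_ | k) hjk
  · exact absurd rfl hjk
  · exact key k
  · exact (key i).symm
  · exact (h.holes.disj fun e => hjk (congrArg some e)).mono subset_union_left subset_union_left

/-- The complement of the boundary curves in a carpet. -/
lemma isPreconnected_core (h : Model C J) : IsPreconnected (Ins J \ ⋃ i, Reg (C i)) := by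
  refine isPreconnected_of_forall_pair fun p hp q hq => ?_
  have hJ := h.good.jordan
  obtain ⟨g, hg⟩ := joinedIn_of_isPreconnected (isOpen_ins hJ.isCompact) hJ.isPreconnected_ins
    Subset.rfl hp.1 hq.1
  obtain ⟨B, hB⟩ := h.holes.null.bddAbove_range
  have hreg : ∀ i, {z ∈ Reg (C i) | Reg (C i) ⊆ Ins J} = Reg (C i) := fun i => by
    simp [h.inner i]
  obtain ⟨f, hf, hf0, hf1, hft⟩ := (h.holes.nullHoles (Ins J)).exists_path_avoiding
    (isOpen_ins hJ.isCompact) (fun i z hz => hz.2 hz.1) (f₀ := fun t => g.extend t)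
    g.continuous_extend.continuousOn
    (fun i hz => hp.2 (mem_iUnion.2 ⟨i, by simpa using hz.1⟩))
    (fun i hz => hq.2 (mem_iUnion.2 ⟨i, by simpa using hz.1⟩)) (B := B)
    (fun i => by simpa only [hreg] using hB ⟨i, rfl⟩) one_pos
  refine ⟨f '' Icc 0 1, ?_, ⟨0, by simp, by simp [hf0]⟩, ⟨1, by simp, by simp [hf1]⟩,
    isPreconnected_Icc.image _ hf⟩
  rintro _ ⟨t, ht, rfl⟩
  refine ⟨?_, fun hU => ?_⟩
  · rcases (hft t ht).2.1 with e | e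
    · rw [e, g.extend_apply ht]; exact hg _
    · exact e
  · obtain ⟨i, hi⟩ := mem_iUnion.1 hU
    exact (hft t ht).1 i ⟨hi, h.inner i⟩

lemma core_subset_bd (h : Model C J) (j : Option ℕ) :
    Ins J \ ⋃ i, Reg (C i) ⊆ Carpet C J \ Bd C J j := by
  rintro z ⟨hz, hzU⟩
  refine ⟨⟨Or.inr hz, fun hU => hzU (iUnion_mono (fun i => subset_union_right) hU)⟩, fun hzj => ?_⟩
  cases j with
  | none => exact disjoint_left.1 (disjoint_ins_self _) hz hzj
  | some i => exact hzU (mem_iUnion.2 ⟨i, Or.inl hzj⟩)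

lemma subset_closure_core (h : Model C J) : Carpet C J ⊆ closure (Ins J \ ⋃ i, Reg (C i)) := by
  have hJ := h.good.jordan
  have key : ∀ {O S : Set ℂ} {x : ℂ}, IsJordanCurve S → IsOpen O → IsPreconnected O → x ∈ S →
      Disjoint S O → (∀ y ∈ S, Accessible O y) → O ⊆ Ins J →
      (∀ i, Reg (C i) ⊆ O ∨ Disjoint O (Reg (C i))) → x ∈ closure (Ins J \ ⋃ i, Reg (C i)) := by
    intro O S x hS hO hOc hx hSO hacc hOJ hOi
    obtain ⟨y, hy, hyx⟩ := hS.exists_ne x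
    obtain ⟨T, hT, hTO, hTC⟩ := h.holes.exists_crosscut hO hOc hyx.symm
      (disjoint_left.1 hSO hx) (disjoint_left.1 hSO hy) (hacc x hx) (hacc y hy)
    have hsub : T \ {x, y} ⊆ Ins J \ ⋃ i, Reg (C i) := ?_
    · exact closure_mono hsub (hT.subset_closure_diff hT.left_mem)
    refine fun z hz => ⟨hOJ (hTO hz), fun hU => ?_⟩
    obtain ⟨i, hi⟩ := mem_iUnion.1 hU
    rcases hOi i with hi' | hi'
    · exact disjoint_left.1 (hTC i hi') hz.1 hi
    · exact disjoint_left.1 hi' (hTO hz) hi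
  rintro x ⟨hxJ | hxJ, hxU⟩
  · exact key hJ (isOpen_ins hJ.isCompact) hJ.isPreconnected_ins hxJ (disjoint_ins_self _).symm
      (fun y hy => hJ.acc_ins hy) Subset.rfl fun i => Or.inl (h.inner i)
  by_cases hxR : x ∈ ⋃ i, Reg (C i)
  · obtain ⟨k, hk | hk⟩ := mem_iUnion.1 hxR
    · refine key (O := Ins J \ Reg (C k)) (h.jordan k)
        ((isOpen_ins hJ.isCompact).sdiff (h.holes.isCompact_reg k).isClosed) ?_ hk ?_ ?_ sdiff_subset ?_
      · refine isPreconnected_diff_of_notSep (isOpen_ins hJ.isCompact) (isBounded_ins hJ.isCompact)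
          hJ.isPreconnected_ins (h.holes.isCompact_reg k) ?_
          fun p hp q hq => (h.jordan k).notSep_reg hp hq
        have : Reg (C k) ∩ frontier (Ins J) = ∅ := by
          rw [hJ.frontier_ins]
          exact ((disjoint_ins_self J).mono_left (h.inner k)).inter_eq
        rw [this]; exact isPreconnected_empty
      · exact disjoint_left.2 fun z hz hz' => hz'.2 (Or.inl hz)
      · intro y hy
        refine (((h.jordan k).acc_outs hy).diff (F := (Ins J)ᶜ)
          (isOpen_ins hJ.isCompact).isClosed_compl fun hn => hn (h.inner k (Or.inl hy))).mono ?_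
        rintro z ⟨hz, hzJ⟩
        refine ⟨not_not.1 hzJ, ?_⟩
        rw [← compl_reg] at hz; exact hz
      · intro i
        rcases eq_or_ne i k with rfl | hik
        · exact Or.inr disjoint_sdiff_left
        · exact Or.inl fun z hz => ⟨h.inner i hz, disjoint_left.1 (h.holes.disj hik) hz⟩
    · exact absurd (mem_iUnion.2 ⟨k, hk⟩) hxU
  · exact subset_closure ⟨hxJ, hxR⟩

lemma isConnected_diff_bd (h : Model C J) (j : Option ℕ) :
    IsConnected (Carpet C J \ Bd C J j) := by
  refine ⟨?_, h.isPreconnected_core.subset_closure (h.core_subset_bd j)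
    (sdiff_subset.trans h.subset_closure_core)⟩
  obtain ⟨z, hz⟩ := h.good.jordan.nonempty
  obtain ⟨w, hw⟩ := closure_nonempty_iff.1 ⟨z, h.subset_closure_core (h.good.subset_carpet hz)⟩
  exact ⟨w, h.core_subset_bd j hw⟩

end Model

/-! ### Logarithms on a carpet -/

lemma tendsto_diam_image {α β ι : Type*} [PseudoMetricSpace α] [PseudoMetricSpace β] {l : Filter ι}
    {f : α → β} {K : Set α} (hK : IsCompact K) (hf : ContinuousOn f K) {A : ι → Set α}
    (hA : ∀ i, A i ⊆ K) (h0 : Tendsto (fun i => diam (A i)) l (𝓝 0)) :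
    Tendsto (fun i => diam (f '' A i)) l (𝓝 0) := by
  rw [Metric.tendsto_nhds]
  intro ε hε
  obtain ⟨δ, hδ, h⟩ := Metric.uniformContinuousOn_iff.1
    (hK.uniformContinuousOn_of_continuous hf) (ε / 2) (by positivity)
  filter_upwards [h0.eventually_lt_const hδ] with i hi
  rw [Real.dist_0_eq_abs, abs_of_nonneg diam_nonneg]
  refine (diam_le_of_forall_dist_le (by positivity : 0 ≤ ε / 2) ?_).trans_lt (by linarith)
  rintro _ ⟨x, hx, rfl⟩ _ ⟨y, hy, rfl⟩
  exact (h x (hA i hx) y (hA i hy)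
    ((dist_le_diam_of_mem (hK.isBounded.subset (hA i)) hx hy).trans_lt hi)).le

lemma HasLog.exists_extension {A : Set ℂ} (hA : IsClosed A) (hne : A.Nonempty) {F : ℂ → ℂ}
    (hF : ContinuousOn F A) (h : HasLog F A) {m r : ℝ} (hm : ∀ z ∈ A, m ≤ ‖F z‖) (hr : 0 < r)
    (hd : ∀ z ∈ A, ∀ w ∈ A, dist (F z) (F w) ≤ r) :
    ∃ G : ℂ → ℂ, Continuous G ∧ EqOn G F A ∧ (∀ z, G z ≠ 0) ∧
      (r < m → ∀ z, ∀ w ∈ A, dist (G z) (F w) ≤ 2 * r) := by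
  by_cases hrm : r < m
  · obtain ⟨c, hc⟩ := hne
    have := Metric.instTietzeExtensionClosedBall.{0, 0} ℂ (F c) hr
    obtain ⟨G, hGr, hG⟩ := ContinuousMap.exists_forall_mem_restrict_eq hA
      ⟨A.domRestrict F, hF.domRestrict⟩ (t := closedBall (F c) r) (fun z => hd z z.2 c hc)
    refine ⟨G, G.continuous, fun z hz => congrArg (fun F' : C(A, ℂ) => F' ⟨z, hz⟩) hG,
      fun z hz => ?_, fun _ z w hw => ?_⟩
    · have := hGr z
      rw [hz, mem_closedBall, dist_comm, dist_zero_right] at this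
      linarith [hm c hc]
    · linarith [dist_triangle (G z) (F c) (F w), mem_closedBall.1 (hGr z), hd c hc w hw]
  · obtain ⟨g, hg, hgF⟩ := h
    obtain ⟨G, hG, hGg⟩ := exists_continuous_eqOn hA hg
    exact ⟨fun z => Complex.exp (G z), by fun_prop, fun z hz => by rw [← hgF z hz, ← hGg hz],
      fun z => Complex.exp_ne_zero _, fun h => absurd h hrm⟩

namespace Model

variable {C : ℕ → Set ℂ} {J : Set ℂ}

lemma hasLog_outer (h : Model C J) {F : ℂ → ℂ} (hF : ContinuousOn F (Carpet C J))
    (hF0 : ∀ z ∈ Carpet C J, F z ≠ 0) (hlog : ∀ i, HasLog F (C i)) : HasLog F J := by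
  classical
  have hsub : ∀ i, C i ⊆ Carpet C J := fun i => h.bd_subset (some i)
  obtain ⟨m, hm, hmF⟩ : ∃ m > 0, ∀ z ∈ Carpet C J, m ≤ ‖F z‖ := by
    obtain ⟨x, hx, hmin⟩ := h.isCompact_carpet.exists_isMinOn
      (h.good.jordan.nonempty.mono h.good.subset_carpet) hF.norm
    exact ⟨‖F x‖, norm_pos_iff.2 (hF0 x hx), fun z hz => hmin hz⟩
  have hbd : ∀ i, Bornology.IsBounded (Reg (C i)) := fun i => (h.holes.isCompact_reg i).isBounded
  have hdC : Tendsto (fun i => diam (C i)) atTop (𝓝 0) :=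
    squeeze_zero (fun _ => diam_nonneg) (fun i => diam_mono subset_union_left (hbd i)) h.holes.null
  have hr0 : Tendsto (fun i : ℕ => diam (F '' C i) + 1 / ((i : ℝ) + 1)) atTop (𝓝 0) := by
    simpa using (tendsto_diam_image h.isCompact_carpet hF hsub hdC).add
      tendsto_one_div_add_atTop_nhds_zero_nat
  set r : ℕ → ℝ := fun i => diam (F '' C i) + 1 / ((i : ℝ) + 1) with hr
  have hex := fun i => (hlog i).exists_extension (h.jordan i).isClosed (h.jordan i).nonempty
    (hF.mono (hsub i)) (m := m) (r := r i) (fun z hz => hmF z (hsub i hz)) (by positivity)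
    (fun z hz w hw => (dist_le_diam_of_mem ((h.jordan i).isCompact.image_of_continuousOn
      (hF.mono (hsub i))).isBounded (mem_image_of_mem F hz) (mem_image_of_mem F hw)).trans
      (le_add_of_nonneg_right (by positivity)))
  choose Gs hGc hGF hG0 hGr using hex
  obtain ⟨G, hGin, hGout⟩ : ∃ G : ℂ → ℂ, (∀ i, ∀ z ∈ Ins (C i), G z = Gs i z) ∧
      ∀ z, z ∉ ⋃ i, Ins (C i) → G z = F z := by
    refine ⟨fun z => if hz : ∃ i, z ∈ Ins (C i) then Gs hz.choose z else F z,
      fun i z hz => ?_, fun z hz => dif_neg (by simpa using hz)⟩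
    have hz' : ∃ i, z ∈ Ins (C i) := ⟨i, hz⟩
    have : hz'.choose = i := by
      by_contra hne
      exact disjoint_left.1 (h.holes.disj hne) (Or.inr hz'.choose_spec) (Or.inr hz)
    simp only [dif_pos hz', this]
  have hcont : ContinuousOn G (J ∪ Ins J) := by
    intro x hx
    by_cases hxU : x ∈ ⋃ i, Ins (C i)
    · obtain ⟨i, hi⟩ := mem_iUnion.1 hxU
      refine ((hGc i).continuousAt.congr ?_).continuousWithinAt
      filter_upwards [(isOpen_ins (h.jordan i).isCompact).mem_nhds hi] with z hz
      exact (hGin i z hz).symm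
    have hxK : x ∈ Carpet C J := ⟨hx, hxU⟩
    rw [Metric.continuousWithinAt_iff']
    intro ε hε
    rw [hGout x hxU]
    obtain ⟨δ, hδ, hFδ⟩ := Metric.continuousWithinAt_iff.1 (hF x hxK) (ε / 2) (by positivity)
    obtain ⟨N, hN⟩ := eventually_atTop.1 ((h.holes.null.eventually_lt_const (half_pos hδ)).and
      ((hr0.eventually_lt_const hm).and (hr0.eventually_lt_const (by positivity : 0 < ε / 4))))
    have hsmall : ∀ᶠ z in 𝓝 x, ∀ i < N, z ∈ Ins (C i) → dist (Gs i z) (F x) < ε := by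
      refine (eventually_all_finite (finite_lt_nat N)).2 fun i _ => ?_
      by_cases hxi : x ∈ Reg (C i)
      · have hxC : x ∈ C i := hxi.resolve_right fun hI => hxU (mem_iUnion.2 ⟨i, hI⟩)
        have := (hGc i).continuousAt.eventually (Metric.ball_mem_nhds (Gs i x) hε)
        filter_upwards [this] with z hz _
        rw [← hGF i hxC]; exact hz
      · filter_upwards [(h.holes.isCompact_reg i).isClosed.isOpen_compl.mem_nhds hxi] with z hz hzI
        exact absurd (Or.inr hzI) hz
    filter_upwards [mem_nhdsWithin_of_mem_nhds hsmall, self_mem_nhdsWithin,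
      mem_nhdsWithin_of_mem_nhds (ball_mem_nhds x (half_pos hδ))] with z hz hzR hzx
    by_cases hzU : z ∈ ⋃ i, Ins (C i)
    · obtain ⟨i, hi⟩ := mem_iUnion.1 hzU
      rw [hGin i z hi]
      rcases lt_or_ge i N with hiN | hiN
      · exact hz i hiN hi
      obtain ⟨h1, h2, h3⟩ := hN i hiN
      obtain ⟨w, hw⟩ := (h.jordan i).nonempty
      have e1 := dist_le_diam_of_mem (hbd i) (Or.inl hw) (Or.inr hi)
      have e2 := hFδ (hsub i hw) (by
        linarith [dist_triangle w z x, mem_ball.1 hzx])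
      linarith [hGr i h2 z w hw, dist_triangle (Gs i z) (F w) (F x)]
    · rw [hGout z hzU]
      linarith [hFδ ⟨hzR, hzU⟩ (by linarith [mem_ball.1 hzx])]
  refine (h.good.jordan.hasLog_of_closure hcont fun z hz => ?_).congr fun z hz =>
    hGout z (h.good.subset_carpet hz).2
  by_cases hzU : z ∈ ⋃ i, Ins (C i)
  · obtain ⟨i, hi⟩ := mem_iUnion.1 hzU
    rw [hGin i z hi]; exact hG0 i z
  · rw [hGout z hzU]; exact hF0 z ⟨hz, hzU⟩

/-- A nonvanishing function on a carpet that has a logarithm on all but one boundary curve has one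
on the remaining curve. -/
lemma hasLog_bd (h : Model C J) {F : ℂ → ℂ} (hF : ContinuousOn F (Carpet C J))
    (hF0 : ∀ z ∈ Carpet C J, F z ≠ 0) {j : Option ℕ} (hlog : ∀ k ≠ j, HasLog F (Bd C J k)) :
    HasLog F (Bd C J j) := by
  cases j with
  | none => exact h.hasLog_outer hF hF0 fun i => hlog (some i) (by simp)
  | some i =>
    by_contra hno
    obtain ⟨p, hp⟩ := (h.jordan i).ins_nonempty
    have hpK : ∀ z ∈ Carpet C J, z - p ≠ 0 := fun z hz e =>
      hz.2 (mem_iUnion.2 ⟨i, by rwa [sub_eq_zero.1 e]⟩)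
    obtain ⟨m, k, hm, hmk⟩ := (h.jordan i).exists_zpow_mul_hasLog (f₁ := F) (f₂ := fun z => z - p)
      (hF.mono (h.bd_subset (some i))) (by fun_prop) (fun z hz => hF0 z (h.bd_subset (some i) hz))
      (fun z hz => hpK z (h.bd_subset (some i) hz)) hno
    have hJ : HasLog (fun z => (z - p) ^ m * F z ^ k) J := by
      refine h.hasLog_outer ?_ (fun z hz => mul_ne_zero (zpow_ne_zero _ (hpK z hz))
        (zpow_ne_zero _ (hF0 z hz))) fun i' => ?_
      · exact ((by fun_prop : ContinuousOn (fun z : ℂ => z - p) _).zpow₀ m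
          fun z hz => Or.inl (hpK z hz)).mul (hF.zpow₀ k fun z hz => Or.inl (hF0 z hz))
      · rcases eq_or_ne i' i with rfl | hi
        · exact hmk
        · refine HasLog.mul (HasLog.zpow ?_ m) ((hlog (some i') (by simpa using hi)).zpow k)
          have hp' : p ∉ Reg (C i') := fun hp' =>
            disjoint_left.1 (h.holes.disj hi) hp' (Or.inr hp)
          rw [← mem_compl_iff, compl_reg] at hp'
          exact hp'.2
    have hp' : HasLog (fun z => (z - p) ^ m) J := by
      refine (hJ.mul ((hlog none (by simp)).zpow (-k))).congr fun z hz => ?_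
      have := hF0 z (h.good.subset_carpet hz)
      simp only [zpow_neg]
      field_simp
    have hpJ := h.inner i (Or.inr hp)
    refine hm (zpow_eq_zero_of_hasLog_frontier (isOpen_ins h.good.jordan.isCompact)
      (isBounded_ins h.good.jordan.isCompact) hpJ (u := fun _ => 1) (by fun_prop)
      (fun _ _ => one_ne_zero) ?_)
    rw [h.good.jordan.frontier_ins]
    simpa using hp'

end Model

/-! ### Inversions -/

/-- Inversion at `p`, with the convention that `p` goes to `0`. -/
noncomputable def invAt (p z : ℂ) : ℂ := (z - p)⁻¹

lemma invAt_injective (p : ℂ) : Function.Injective (invAt p) := fun x y h =>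
  sub_left_injective (inv_injective h)

lemma invAt_surjective (p : ℂ) : Function.Surjective (invAt p) := fun w =>
  ⟨w⁻¹ + p, by simp [invAt]⟩

@[simp] lemma invAt_self (p : ℂ) : invAt p p = 0 := by simp [invAt]

lemma continuousAt_invAt {p z : ℂ} (h : z ≠ p) : ContinuousAt (invAt p) z :=
  (continuousAt_id.sub continuousAt_const).inv₀ (sub_ne_zero.2 h)

lemma continuousOn_invAt {p : ℂ} {A : Set ℂ} (h : p ∉ A) : ContinuousOn (invAt p) A := fun z hz =>
  (continuousAt_invAt (z := z) fun e => h (by rwa [← e])).continuousWithinAt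

lemma hasLog_image_invAt_iff {A : Set ℂ} {p : ℂ} (hp : p ∉ A) {f : ℂ → ℂ} :
    HasLog f (invAt p '' A) ↔ HasLog (fun z => f (invAt p z)) A := by
  refine ⟨fun h => h.comp (continuousOn_invAt hp) (mapsTo_image _ _), fun h => ?_⟩
  have hne : ∀ w ∈ invAt p '' A, w ≠ 0 := by
    rintro _ ⟨z, hz, rfl⟩
    exact inv_ne_zero (sub_ne_zero.2 fun e => hp (e ▸ hz))
  refine (h.comp (k := fun w => w⁻¹ + p)
    ((continuousOn_id.inv₀ hne).add continuousOn_const) ?_).congr fun w _ => ?_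
  · rintro _ ⟨z, hz, rfl⟩; simpa [invAt] using hz
  · simp [invAt]

namespace IsJordanCurve

variable {A : Set ℂ} {p q : ℂ}

lemma image_invAt (h : IsJordanCurve A) (hp : p ∉ A) : IsJordanCurve (invAt p '' A) :=
  h.map (continuousOn_invAt hp) (invAt_injective p).injOn

lemma invAt_mem_outs_iff (h : IsJordanCurve A) (hp : p ∉ A) (hq : q ∉ A) (hqp : q ≠ p) :
    invAt p q ∈ Outs (invAt p '' A) ↔ HasLog (fun z => (z - q) / (z - p)) A := by
  have hq' : invAt p q ∉ invAt p '' A := by rwa [(invAt_injective p).mem_set_image]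
  have hqp' : q - p ≠ 0 := sub_ne_zero.2 hqp
  have hne : ∀ z ∈ A, z - p ≠ 0 := fun z hz => sub_ne_zero.2 fun e => hp (e ▸ hz)
  have e : ∀ z ∈ A, invAt p z - invAt p q = (z - q) / (z - p) * (-(q - p)⁻¹) := by
    intro z hz
    have := hne z hz
    simp only [invAt]; field_simp; ring
  refine (and_iff_right hq').trans ((hasLog_image_invAt_iff hp).trans ⟨fun H => ?_, fun H => ?_⟩)
  · refine (H.mul (hasLog_const (neg_ne_zero.2 hqp'))).congr fun z hz => ?_
    rw [e z hz]; field_simp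
  · exact (H.mul (hasLog_const (neg_ne_zero.2 (inv_ne_zero hqp')))).congr
      fun z hz => (e z hz).symm

lemma zero_mem_outs_iff (h : IsJordanCurve A) (hp : p ∉ A) :
    0 ∈ Outs (invAt p '' A) ↔ p ∈ Outs A := by
  have h0 : (0 : ℂ) ∉ invAt p '' A := by
    rw [← invAt_self p, (invAt_injective p).mem_set_image]; exact hp
  refine (and_iff_right h0).trans ((hasLog_image_invAt_iff hp).trans
    (Iff.trans ⟨fun H => ?_, fun H => ?_⟩ (and_iff_right hp).symm))
  · simpa [invAt] using H.inv
  · simpa [invAt] using H.inv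

lemma outs_image_invAt_of_mem_ins (h : IsJordanCurve A) (hp : p ∈ Ins A) :
    Outs (invAt p '' A) = invAt p '' (Ins A \ {p}) := by
  ext w
  obtain ⟨q, rfl⟩ := invAt_surjective p w
  rw [(invAt_injective p).mem_set_image]
  rcases eq_or_ne q p with rfl | hqp
  · rw [invAt_self, h.zero_mem_outs_iff hp.1]
    simp only [Set.mem_sdiff, mem_singleton_iff, not_true, and_false, iff_false]
    exact disjoint_left.1 (disjoint_ins_ext A) hp
  by_cases hq : q ∈ A
  · exact ⟨fun H => absurd (mem_image_of_mem _ hq) H.1, fun H => absurd hq H.1.1⟩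
  rw [h.invAt_mem_outs_iff hp.1 hq hqp]
  refine ⟨fun H => ⟨⟨hq, fun H' => hp.2 ((H'.div H).congr fun z hz => ?_)⟩, hqp⟩, fun H => ?_⟩
  · have h1 : z - q ≠ 0 := sub_ne_zero.2 fun e => hq (e ▸ hz)
    have h2 : z - p ≠ 0 := sub_ne_zero.2 fun e => hp.1 (e ▸ hz)
    field_simp
  · exact (notSep_iff_hasLog h.isCompact hq hp.1).1
      ⟨_, h.isPreconnected_ins, disjoint_ins_self A, H.1, hp⟩

lemma outs_image_invAt_of_mem_outs (h : IsJordanCurve A) (hp : p ∈ Outs A) :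
    Outs (invAt p '' A) = invAt p '' Outs A := by
  ext w
  obtain ⟨q, rfl⟩ := invAt_surjective p w
  rw [(invAt_injective p).mem_set_image]
  rcases eq_or_ne q p with rfl | hqp
  · rw [invAt_self, h.zero_mem_outs_iff hp.1]
  by_cases hq : q ∈ A
  · exact ⟨fun H => absurd (mem_image_of_mem _ hq) H.1, fun H => absurd hq H.1⟩
  rw [h.invAt_mem_outs_iff hp.1 hq hqp]
  refine ⟨fun H => ⟨hq, (H.mul hp.2).congr fun z hz => ?_⟩, fun H => H.2.div hp.2⟩
  have h2 : z - p ≠ 0 := sub_ne_zero.2 fun e => hp.1 (e ▸ hz)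
  field_simp

lemma reg_image_invAt_of_mem_ins (h : IsJordanCurve A) (hp : p ∈ Ins A) :
    Reg (invAt p '' A) = invAt p '' (Ins A \ {p})ᶜ := by
  rw [image_compl_eq ⟨invAt_injective p, invAt_surjective p⟩, ← h.outs_image_invAt_of_mem_ins hp,
    ← compl_reg, compl_compl]

lemma reg_image_invAt_of_mem_outs (h : IsJordanCurve A) (hp : p ∈ Outs A) :
    Reg (invAt p '' A) = invAt p '' Reg A := by
  rw [← compl_compl (Reg A), compl_reg, image_compl_eq ⟨invAt_injective p, invAt_surjective p⟩,
    ← h.outs_image_invAt_of_mem_outs hp, ← compl_reg, compl_compl]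

lemma ins_eq_reg_diff (A : Set ℂ) : Ins A = Reg A \ A := by
  rw [Reg, union_sdiff_left, (disjoint_ins_self A).sdiff_eq_left]

lemma ins_image_invAt_of_mem_ins (h : IsJordanCurve A) (hp : p ∈ Ins A) :
    Ins (invAt p '' A) = invAt p '' (insert p (Outs A)) := by
  rw [ins_eq_reg_diff, h.reg_image_invAt_of_mem_ins hp, ← image_sdiff (invAt_injective p)]
  congr 1
  ext z
  rw [Set.mem_sdiff, mem_compl_iff, Set.mem_sdiff, mem_insert_iff, ← compl_reg]
  simp only [mem_singleton_iff, Reg, mem_compl_iff, mem_union]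
  have h1 : z = p → z ∈ Ins A := fun e => e ▸ hp
  have h2 : z ∈ Ins A → z ∉ A := fun h => disjoint_left.1 (disjoint_ins_self A) h
  tauto

lemma ins_image_invAt_of_mem_outs (h : IsJordanCurve A) (hp : p ∈ Outs A) :
    Ins (invAt p '' A) = invAt p '' Ins A := by
  rw [ins_eq_reg_diff, h.reg_image_invAt_of_mem_outs hp, ← image_sdiff (invAt_injective p),
    ← ins_eq_reg_diff]

end IsJordanCurve

/-! ### Complementary regions of a curve in a carpet -/

/-- The compact set `S`, bounded by `γ`, is carried onto a carpet by `ι`. -/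
structure Flattens (ι : ℂ → ℂ) (C : ℕ → Set ℂ) (γ S : Set ℂ) : Prop where
  holes : Holes C
  good : Good C (ι '' γ)
  compact : IsCompact S
  cont : ContinuousOn ι S
  inj : InjOn ι S
  sub : γ ⊆ S
  carpet : Carpet C (ι '' γ) = ι '' S

lemma Flattens.exists_corr {ι ι' : ℂ → ℂ} {C C' : ℕ → Set ℂ} {γ γ' S S' : Set ℂ}
    (h : Flattens ι C γ S) (h' : Flattens ι' C' γ' S') {Γ : Set (ℂ × ℂ)} (hΓ : IsCompact Γ)
    (h1 : InjOn Prod.fst Γ) (h2 : InjOn Prod.snd Γ) (hγ : Prod.fst '' Γ = γ)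
    (hγ' : Prod.snd '' Γ = γ') :
    ∃ R : Set (ℂ × ℂ), IsCompact R ∧ Γ ⊆ R ∧ InjOn Prod.fst R ∧ InjOn Prod.snd R ∧
      Prod.fst '' R = S ∧ Prod.snd '' R = S' := by
  subst hγ hγ'
  have hS : ∀ x ∈ Γ, x.1 ∈ S ∧ x.2 ∈ S' := fun x hx =>
    ⟨h.sub (mem_image_of_mem _ hx), h'.sub (mem_image_of_mem _ hx)⟩
  have hcont : ContinuousOn (Prod.map ι ι') (S ×ˢ S') := h.cont.prodMap h'.cont
  have e1 : Prod.fst '' (Prod.map ι (ι') '' Γ) = ι '' (Prod.fst '' Γ) := by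
    simp [image_image]
  have e2 : Prod.snd '' (Prod.map ι (ι') '' Γ) = (ι') '' (Prod.snd '' Γ) := by
    simp [image_image]
  obtain ⟨R, hRc, hΓR, hR1, hR2, hR1', hR2'⟩ := h.holes.exists_carpet_corr h'.holes
    (hΓ.image_of_continuousOn (hcont.mono fun x hx => hS x hx)) (Γ := Prod.map ι (ι') '' Γ)
    ⟨by
      rintro _ ⟨x, hx, rfl⟩ _ ⟨y, hy, rfl⟩ hxy
      rw [h1 hx hy (h.inj (hS x hx).1 (hS y hy).1 hxy)], by rw [e1]; exact h.good⟩
    ⟨by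
      rintro _ ⟨x, hx, rfl⟩ _ ⟨y, hy, rfl⟩ hxy
      rw [h2 hx hy (h'.inj (hS x hx).2 (hS y hy).2 hxy)], by rw [e2]; exact h'.good⟩
  rw [e1, h.carpet] at hR1'
  rw [e2, h'.carpet] at hR2'
  have hlift : ∀ r ∈ R, ∃ x ∈ S ×ˢ S', Prod.map ι ι' x = r := by
    intro r hr
    obtain ⟨x, hx, hxr⟩ : r.1 ∈ ι '' S := hR1' ▸ mem_image_of_mem _ hr
    obtain ⟨y, hy, hyr⟩ : r.2 ∈ (ι') '' S' := hR2' ▸ mem_image_of_mem _ hr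
    exact ⟨(x, y), ⟨hx, hy⟩, Prod.ext hxr hyr⟩
  refine ⟨S ×ˢ S' ∩ Prod.map ι ι' ⁻¹' R, ?_, fun x hx => ⟨hS x hx, hΓR (mem_image_of_mem _ hx)⟩,
    ?_, ?_, ?_, ?_⟩
  · exact (h.compact.prod h'.compact).of_isClosed_subset (hcont.preimage_isClosed_of_isClosed
      (h.compact.prod h'.compact).isClosed hRc.isClosed) inter_subset_left
  · rintro ⟨x, y⟩ hx ⟨x', y'⟩ hy (rfl : x = x')
    have := hR1 hx.2 hy.2 rfl
    exact Prod.ext rfl (h'.inj hx.1.2 hy.1.2 (congrArg Prod.snd this))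
  · rintro ⟨x, y⟩ hx ⟨x', y'⟩ hy (rfl : y = y')
    have := hR2 hx.2 hy.2 rfl
    exact Prod.ext (h.inj hx.1.1 hy.1.1 (congrArg Prod.fst this)) rfl
  · refine Subset.antisymm (by rintro _ ⟨x, hx, rfl⟩; exact hx.1.1) fun x hx => ?_
    obtain ⟨r, hr, hrx⟩ : ι x ∈ Prod.fst '' R := hR1' ▸ mem_image_of_mem _ hx
    obtain ⟨y, hy, rfl⟩ := hlift r hr
    exact ⟨y, ⟨hy, hr⟩, h.inj hy.1 hx hrx⟩
  · refine Subset.antisymm (by rintro _ ⟨x, hx, rfl⟩; exact hx.1.2) fun x hx => ?_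
    obtain ⟨r, hr, hrx⟩ : ι' x ∈ Prod.snd '' R := hR2' ▸ mem_image_of_mem _ hx
    obtain ⟨y, hy, rfl⟩ := hlift r hr
    exact ⟨y, ⟨hy, hr⟩, h'.inj hy.2 hx hrx⟩

namespace Model

variable {C : ℕ → Set ℂ} {J γ : Set ℂ}

lemma reg_subset_ins_of_disjoint (h : Model C J) (hγ : IsJordanCurve γ) (hK : γ ⊆ Carpet C J)
    (hd : ∀ j, Disjoint γ (Bd C J j)) : Reg γ ⊆ Ins J :=
  h.good.jordan.reg_subset_ins hγ fun z hz =>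
    (hK hz).1.resolve_left fun hz' => disjoint_left.1 (hd none) hz hz'

lemma disjoint_reg (hK : γ ⊆ Carpet C J) (hd : ∀ j, Disjoint γ (Bd C J j)) (i : ℕ) :
    Disjoint (Reg (C i)) γ :=
  disjoint_left.2 fun z hz hzγ => hz.elim (fun hz => disjoint_left.1 (hd (some i)) hzγ hz)
    fun hz => (hK hzγ).2 (mem_iUnion.2 ⟨i, hz⟩)

lemma flattens_ins (h : Model C J) (hγ : IsJordanCurve γ) (hK : γ ⊆ Carpet C J)
    (hd : ∀ j, Disjoint γ (Bd C J j)) : Flattens id C γ (Reg γ ∩ Carpet C J) where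
  holes := h.holes
  good := by
    rw [image_id]
    exact h.good.of_subset h.holes hγ (hK.trans sdiff_subset)
      fun i _ => Or.inl (disjoint_reg hK hd i)
  compact := hγ.isCompact_reg.inter h.isCompact_carpet
  cont := continuousOn_id
  inj := injOn_id _
  sub := subset_inter (IsJordanCurve.subset_reg γ) hK
  carpet := by
    have : Reg γ ⊆ Reg J := (h.reg_subset_ins_of_disjoint hγ hK hd).trans subset_union_right
    rw [image_id, image_id, Carpet, Carpet, ← inter_sdiff_assoc, inter_eq_left.2 this]

open Classical in
lemma exists_flattens_outs (h : Model C J) (hγ : IsJordanCurve γ) (hK : γ ⊆ Carpet C J)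
    (hd : ∀ j, Disjoint γ (Bd C J j)) :
    ∃ ι C', Flattens ι C' γ ((γ ∪ Outs γ) ∩ Carpet C J) := by
  obtain ⟨p, hp⟩ := hγ.ins_nonempty
  have hJ := h.good.jordan
  have hRJ := h.reg_subset_ins_of_disjoint hγ hK hd
  have hpJ : p ∈ Ins J := hRJ (Or.inr hp)
  have hinj := invAt_injective p
  have hJO : (Ins J)ᶜ ⊆ Outs γ := by
    rw [← compl_reg]; exact compl_subset_compl.2 hRJ
  have hcases : ∀ i, Reg (C i) ⊆ Outs γ ∨ Reg (C i) ⊆ Ins γ := fun i => by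
    obtain ⟨z, hz⟩ := (h.jordan i).nonempty
    have hz' : z ∈ Reg (C i) := Or.inl hz
    have hdi := disjoint_reg hK hd i
    rcases mem_reg_or_mem_outs γ z with hr | ho
    · exact Or.inr (mem_ins_of_isPreconnected hγ.isCompact (h.jordan i).isPreconnected_reg hdi hz'
        (hr.resolve_left (disjoint_left.1 hdi hz')))
    · exact Or.inl (mem_ext_of_isPreconnected hγ.isCompact (h.jordan i).isPreconnected_reg hdi hz' ho)
  have hpO : ∀ i, Reg (C i) ⊆ Outs γ → p ∈ Outs (C i) := fun i hi => by
    rw [← compl_reg]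
    exact fun hpi => disjoint_left.1 (disjoint_ins_ext γ) hp (hi hpi)
  have hpγ : p ∉ γ ∪ Outs γ := fun hh => hh.elim (disjoint_left.1 (disjoint_ins_self γ) hp)
    (disjoint_left.1 (disjoint_ins_ext γ) hp)
  have hclosed : IsClosed (γ ∪ Outs γ) := by rw [← hγ.closure_outs]; exact isClosed_closure
  have hcont : ContinuousOn (invAt p) (γ ∪ Outs γ) := continuousOn_invAt hpγ
  set C' : ℕ → Set ℂ := fun n => n.casesOn (invAt p '' J)
    fun i => if Reg (C i) ⊆ Outs γ then invAt p '' C i else ∅ with hC'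
  have hC0 : C' 0 = invAt p '' J := rfl
  have hCs : ∀ i, Reg (C i) ⊆ Outs γ → C' (i + 1) = invAt p '' C i := fun i hi => if_pos hi
  have hCn : ∀ i, ¬ Reg (C i) ⊆ Outs γ → C' (i + 1) = ∅ := fun i hi => if_neg hi
  have hR0 : Reg (C' 0) = invAt p '' (Ins J \ {p})ᶜ := hJ.reg_image_invAt_of_mem_ins hpJ
  have hRs : ∀ i, Reg (C' (i + 1)) = invAt p '' {z ∈ Reg (C i) | Reg (C i) ⊆ Outs γ} := fun i => by
    by_cases hi : Reg (C i) ⊆ Outs γ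
    · rw [hCs i hi, (h.jordan i).reg_image_invAt_of_mem_outs (hpO i hi)]; simp [hi]
    · rw [hCn i hi, reg_empty]; simp [hi]
  have hI0 : Ins (C' 0) = invAt p '' insert p (Outs J) := hJ.ins_image_invAt_of_mem_ins hpJ
  have hIs : ∀ i, Ins (C' (i + 1)) = invAt p '' {z ∈ Ins (C i) | Reg (C i) ⊆ Outs γ} := fun i => by
    by_cases hi : Reg (C i) ⊆ Outs γ
    · rw [hCs i hi, (h.jordan i).ins_image_invAt_of_mem_outs (hpO i hi)]; simp [hi]
    · rw [hCn i hi, subset_empty_iff.1 (subset_union_right.trans reg_empty.subset)]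
      simp [hi]
  have hIγ : Ins (invAt p '' γ) = invAt p '' insert p (Outs γ) := hγ.ins_image_invAt_of_mem_ins hp
  refine ⟨invAt p, C', ⟨?_, ?_, ?_⟩, ⟨hγ.image_invAt hp.1, ?_, ?_⟩, ?_,
    hcont.mono inter_subset_left, hinj.injOn, subset_inter subset_union_left hK, ?_⟩
  · rintro (_ | i)
    · exact Or.inr (hJ.image_invAt hpJ.1)
    · by_cases hi : Reg (C i) ⊆ Outs γ
      · rw [hCs i hi]; exact Or.inr ((h.jordan i).image_invAt (hpO i hi).1)
      · exact Or.inl (hCn i hi)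
  · have key : ∀ i, Disjoint (Reg (C' 0)) (Reg (C' (i + 1))) := fun i => by
      rw [hR0, hRs]
      refine (disjoint_image_iff hinj).2 (disjoint_left.2 fun z hz hz' => hz ⟨h.inner i hz'.1, ?_⟩)
      rintro rfl
      exact hpγ (Or.inr (hz'.2 hz'.1))
    rintro (_ | i) (_ | k) hik
    · exact absurd rfl hik
    · exact key k
    · exact (key i).symm
    · rw [hRs, hRs]
      exact (disjoint_image_iff hinj).2 ((h.holes.disj fun e => hik (by rw [e])).mono
        (sep_subset _ _) (sep_subset _ _))
  · refine (tendsto_add_atTop_iff_nat 1).1 ?_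
    simp only [hRs]
    refine tendsto_diam_image (K := (γ ∪ Outs γ) ∩ Reg J) ?_ (hcont.mono inter_subset_left)
      (fun i z hz => ⟨Or.inr (hz.2 hz.1), Or.inr (h.inner i hz.1)⟩) ?_
    · exact hJ.isCompact_reg.inter_left hclosed
    · exact squeeze_zero (fun _ => diam_nonneg) (fun i => diam_mono (sep_subset _ _)
        (h.holes.isCompact_reg i).isBounded) h.holes.null
  · rw [hIγ]
    rintro _ ⟨z, hz, rfl⟩
    by_cases hzJ : z ∈ Ins J \ {p}
    · have hzO : z ∈ Outs γ := hz.resolve_left hzJ.2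
      have h1 : z ∈ closure (Outs γ ∩ ⋃ i, Reg (C i)) :=
        (isOpen_ext hγ.isCompact).inter_closure ⟨hzO, h.good.dense hzJ.1⟩
      refine closure_mono ?_ (mem_closure_image (continuousAt_invAt hzJ.2) h1)
      rintro _ ⟨w, ⟨hwO, hw⟩, rfl⟩
      obtain ⟨i, hi⟩ := mem_iUnion.1 hw
      refine mem_iUnion.2 ⟨i + 1, ?_⟩
      rw [hRs]
      refine mem_image_of_mem _ ⟨hi, (hcases i).resolve_right fun hh => ?_⟩
      exact disjoint_left.1 (disjoint_ins_ext γ) (hh hi) hwO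
    · refine subset_closure (mem_iUnion.2 ⟨0, ?_⟩)
      rw [hR0]; exact mem_image_of_mem _ hzJ
  · rintro (_ | i)
    · refine Or.inl ?_
      rw [hR0, hIγ]
      refine image_mono fun z hz => ?_
      by_cases hzp : z = p
      · exact Or.inl hzp
      · exact Or.inr (hJO fun hzJ => hz ⟨hzJ, hzp⟩)
    · refine Or.inl ?_
      rw [hRs, hIγ]
      exact image_mono fun z hz => Or.inr (hz.2 hz.1)
  · exact h.isCompact_carpet.inter_left hclosed
  · have hU : ⋃ n, Ins (C' n) =
        invAt p '' (insert p (Outs J) ∪ ⋃ i, {z ∈ Ins (C i) | Reg (C i) ⊆ Outs γ}) := by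
      rw [image_union, image_iUnion, ← hI0]
      simp only [← hIs]
      ext z
      simp only [mem_union, mem_iUnion]
      exact ⟨fun ⟨n, hn⟩ => by
        rcases n with _ | i
        exacts [Or.inl hn, Or.inr ⟨i, hn⟩], fun hz => hz.elim (fun hz => ⟨0, hz⟩)
          fun ⟨i, hi⟩ => ⟨i + 1, hi⟩⟩
    rw [Carpet, hU, hγ.reg_image_invAt_of_mem_ins hp, ← image_sdiff hinj]
    congr 1
    ext z
    constructor
    · rintro ⟨hz, hzU⟩
      have hzp : z ≠ p := fun e => hzU (Or.inl (Or.inl e))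
      have hzI : z ∉ Ins γ := fun hzI => hz ⟨hzI, hzp⟩
      refine ⟨?_, ?_, fun hzC => ?_⟩
      · rcases mem_reg_or_mem_outs γ z with hr | ho
        exacts [Or.inl (hr.resolve_right hzI), Or.inr ho]
      · exact (mem_reg_or_mem_outs J z).resolve_right fun ho => hzU (Or.inl (Or.inr ho))
      · obtain ⟨i, hi⟩ := mem_iUnion.1 hzC
        refine hzU (Or.inr (mem_iUnion.2 ⟨i, hi, (hcases i).resolve_right fun hh => ?_⟩))
        exact hzI (hh (Or.inr hi))
    · rintro ⟨hz, hzR, hzC⟩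
      refine ⟨fun hzI => ?_, ?_⟩
      · exact hz.elim (disjoint_left.1 (disjoint_ins_self γ) hzI.1)
          (disjoint_left.1 (disjoint_ins_ext γ) hzI.1)
      · rintro ((rfl | ho) | hzU)
        · exact hpγ hz
        · rw [← compl_reg] at ho; exact ho hzR
        · obtain ⟨i, hi, -⟩ := mem_iUnion.1 hzU
          exact hzC (mem_iUnion.2 ⟨i, hi⟩)

end Model

/-! ### Regions cut out by an embedded carpet -/

lemma reg_subset_closedBall {K : Set ℂ} {c : ℂ} {r : ℝ} (h : K ⊆ closedBall c r) :
    Reg K ⊆ closedBall c r := by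
  refine union_subset h fun p hp => ?_
  by_contra hpr
  rw [mem_closedBall, not_le, dist_eq_norm] at hpr
  refine hp.2 ?_
  have h1 : HasLog (fun w => w - (p - c)) ((fun z => z - c) '' K) := by
    refine hasLog_of_norm_lt ?_
    rintro _ ⟨z, hz, rfl⟩
    exact (dist_eq_norm z c ▸ mem_closedBall.1 (h hz)).trans_lt hpr
  simpa using h1.comp (k := fun z => z - c) (by fun_prop) (mapsTo_image _ K)

lemma diam_reg_le {K : Set ℂ} (hK : IsCompact K) : diam (Reg K) ≤ 2 * diam K := by
  rcases K.eq_empty_or_nonempty with rfl | ⟨c, hc⟩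
  · simp [reg_empty]
  · refine (diam_mono (reg_subset_closedBall (c := c) (r := diam K) fun z hz =>
      dist_le_diam_of_mem hK.isBounded hz hc) isBounded_closedBall).trans
      (diam_closedBall diam_nonneg)

lemma outs_inter_nonempty {K L : Set ℂ} (hK : IsCompact K) (hL : IsCompact L) :
    (Outs K ∩ Outs L).Nonempty := by
  obtain ⟨r, hr⟩ := (hK.union hL).isBounded.exists_norm_le
  have hn : ‖((|r| + 1 : ℝ) : ℂ)‖ = |r| + 1 := by
    rw [Complex.norm_real, Real.norm_eq_abs, abs_of_pos (by positivity)]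
  have key : ∀ z ∈ K ∪ L, ‖z‖ < ‖((|r| + 1 : ℝ) : ℂ)‖ := fun z hz => by
    rw [hn]; linarith [hr z hz, le_abs_self r]
  exact ⟨_, mem_ext_of_norm_lt fun z hz => key z (Or.inl hz),
    mem_ext_of_norm_lt fun z hz => key z (Or.inr hz)⟩

/-- `e` embeds one carpet into another, carrying boundary curves off boundary curves. -/
structure Embeds (C : ℕ → Set ℂ) (J : Set ℂ) (C₁ : ℕ → Set ℂ) (J₁ : Set ℂ) (e : ℂ → ℂ) :
    Prop where
  model : Model C J
  target : Model C₁ J₁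
  cont : ContinuousOn e (Carpet C J)
  inj : InjOn e (Carpet C J)
  maps : e '' Carpet C J ⊆ Carpet C₁ J₁
  disj : ∀ j k, Disjoint (e '' Bd C J j) (Bd C₁ J₁ k)

/-- The image of the carpet lies inside the image of the `j`-th boundary curve. -/
def Outer (C : ℕ → Set ℂ) (J : Set ℂ) (e : ℂ → ℂ) (j : Option ℕ) : Prop :=
  e '' Carpet C J \ e '' Bd C J j ⊆ Ins (e '' Bd C J j)

open Classical in
/-- The side of the image of the `j`-th boundary curve that misses the image of the carpet. -/
noncomputable def FreeSide (C : ℕ → Set ℂ) (J : Set ℂ) (e : ℂ → ℂ) (j : Option ℕ) : Set ℂ :=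
  if Outer C J e j then Outs (e '' Bd C J j) else Ins (e '' Bd C J j)

namespace Embeds

variable {C C₁ : ℕ → Set ℂ} {J J₁ : Set ℂ} {e : ℂ → ℂ}

lemma jordan (h : Embeds C J C₁ J₁ e) (j : Option ℕ) : IsJordanCurve (e '' Bd C J j) :=
  (h.model.jordan_bd j).map (h.cont.mono (h.model.bd_subset j)) (h.inj.mono (h.model.bd_subset j))

lemma disjoint_image (h : Embeds C J C₁ J₁ e) {j k : Option ℕ} (hjk : j ≠ k) :
    Disjoint (e '' Bd C J j) (e '' Bd C J k) :=
  disjoint_left.2 fun _ ⟨x, hx, hxz⟩ ⟨y, hy, hyz⟩ => disjoint_left.1 (h.model.disjoint_bd hjk) hx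
    (h.inj (h.model.bd_subset j hx) (h.model.bd_subset k hy) (hxz.trans hyz.symm) ▸ hy)

lemma subset_outs (h : Embeds C J C₁ J₁ e) {j : Option ℕ} (hj : ¬ Outer C J e j) :
    e '' Carpet C J \ e '' Bd C J j ⊆ Outs (e '' Bd C J j) := by
  have hpre : IsPreconnected (e '' Carpet C J \ e '' Bd C J j) := by
    rw [← h.inj.image_sdiff_subset (h.model.bd_subset j)]
    exact (h.model.isConnected_diff_bd j).isPreconnected.image _ (h.cont.mono sdiff_subset)
  obtain ⟨z, hz, hzI⟩ := not_subset.1 hj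
  refine mem_ext_of_isPreconnected (h.jordan j).isCompact hpre disjoint_sdiff_left hz ?_
  exact (mem_reg_or_mem_outs _ z).resolve_left fun hr => hr.elim hz.2 hzI

lemma disjoint_freeSide (h : Embeds C J C₁ J₁ e) (j : Option ℕ) :
    Disjoint (FreeSide C J e j) (e '' Carpet C J) := by
  refine disjoint_left.2 fun z hz hzL => ?_
  unfold FreeSide at hz
  split_ifs at hz with hj
  · exact disjoint_left.1 (disjoint_ins_ext _) (hj ⟨hzL, hz.1⟩) hz
  · exact disjoint_left.1 (disjoint_ins_ext _) hz (h.subset_outs hj ⟨hzL, hz.1⟩)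

lemma freeSide_subset (h : Embeds C J C₁ J₁ e) {j k : Option ℕ}
    (hjk : (FreeSide C J e j ∩ FreeSide C J e k).Nonempty) :
    FreeSide C J e j ⊆ FreeSide C J e k := by
  have hpre : IsPreconnected (FreeSide C J e j) := by
    unfold FreeSide; split_ifs
    · exact isPreconnected_ext (h.jordan j).isCompact
    · exact (h.jordan j).isPreconnected_ins
  have hd : Disjoint (FreeSide C J e j) (e '' Bd C J k) :=
    (h.disjoint_freeSide j).mono_right (image_mono (h.model.bd_subset k))
  obtain ⟨z, hz, hzk⟩ := hjk
  by_cases hk : Outer C J e k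
  · have hfree : FreeSide C J e k = Outs (e '' Bd C J k) := if_pos hk
    rw [hfree] at hzk ⊢
    exact mem_ext_of_isPreconnected (h.jordan k).isCompact hpre hd hz hzk
  · have hfree : FreeSide C J e k = Ins (e '' Bd C J k) := if_neg hk
    rw [hfree] at hzk ⊢
    exact mem_ins_of_isPreconnected (h.jordan k).isCompact hpre hd hz hzk

lemma closure_freeSide (h : Embeds C J C₁ J₁ e) (j : Option ℕ) :
    closure (FreeSide C J e j) = e '' Bd C J j ∪ FreeSide C J e j := by
  unfold FreeSide; split_ifs
  · exact (h.jordan j).closure_outs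
  · exact (h.jordan j).closure_ins_eq_reg

lemma pairwise_disjoint_freeSide (h : Embeds C J C₁ J₁ e) {j k : Option ℕ} (hjk : j ≠ k) :
    Disjoint (FreeSide C J e j) (FreeSide C J e k) := by
  rw [disjoint_iff_inter_eq_empty]
  by_contra hne
  have hne' := nonempty_iff_ne_empty.2 hne
  have heq : FreeSide C J e j = FreeSide C J e k :=
    (h.freeSide_subset hne').antisymm (h.freeSide_subset (by rwa [inter_comm]))
  obtain ⟨z, hz⟩ := (h.jordan j).nonempty
  have hzk : z ∈ e '' Bd C J k ∪ FreeSide C J e k := by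
    rw [← h.closure_freeSide, ← heq, h.closure_freeSide]; exact Or.inl hz
  rcases hzk with hzk | hzk
  · exact disjoint_left.1 (h.disjoint_image hjk) hz hzk
  · exact disjoint_left.1 (h.disjoint_freeSide k) hzk (image_mono (h.model.bd_subset j) hz)

lemma not_outer (h : Embeds C J C₁ J₁ e) {j k : Option ℕ} (hjk : j ≠ k) (hj : Outer C J e j) :
    ¬ Outer C J e k := by
  intro hk
  have := h.pairwise_disjoint_freeSide hjk
  simp only [FreeSide, hj, hk, if_true] at this
  obtain ⟨z, hz, hz'⟩ := outs_inter_nonempty (h.jordan j).isCompact (h.jordan k).isCompact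
  exact disjoint_left.1 this hz hz'

lemma mem_outs_of_forall (h : Embeds C J C₁ J₁ e) {z : ℂ} (hz : z ∉ e '' Carpet C J)
    {j : Option ℕ} (hj : ∀ k ≠ j, z ∈ Outs (e '' Bd C J k)) : z ∈ Outs (e '' Bd C J j) := by
  have hlog : HasLog (fun x => e x - z) (Bd C J j) := by
    refine h.model.hasLog_bd (h.cont.sub continuousOn_const)
      (fun x hx => sub_ne_zero.2 fun he => hz ⟨x, hx, he⟩) fun k hk => ?_
    exact (hj k hk).2.comp (h.cont.mono (h.model.bd_subset k)) (mapsTo_image _ _)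
  have hi := h.inj.mono (h.model.bd_subset j)
  refine ⟨fun hzj => hz (image_mono (h.model.bd_subset j) hzj), ?_⟩
  refine (hlog.comp (continuousOn_invFunOn_image (h.model.jordan_bd j).isCompact
    (h.cont.mono (h.model.bd_subset j)) hi) ?_).congr ?_
  · rintro _ ⟨x, hx, rfl⟩
    exact Function.invFunOn_mem ⟨x, hx, rfl⟩
  · rintro _ ⟨x, hx, rfl⟩
    rw [Function.invFunOn_eq (f := e) ⟨x, hx, rfl⟩]

lemma exists_outer (h : Embeds C J C₁ J₁ e) : ∃ j, Outer C J e j := by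
  by_contra! hno
  have hfree : ∀ j, FreeSide C J e j = Ins (e '' Bd C J j) := fun j => if_neg (hno j)
  obtain ⟨z, hz⟩ := (h.jordan none).ins_nonempty
  have hzU : z ∈ FreeSide C J e none := by rwa [hfree]
  have hzL := disjoint_left.1 (h.disjoint_freeSide none) hzU
  refine disjoint_left.1 (disjoint_ins_ext _) hz (h.mem_outs_of_forall hzL fun k hk => ?_)
  refine (mem_reg_or_mem_outs _ z).resolve_left fun hr => hr.elim
    (fun hr => hzL (image_mono (h.model.bd_subset k) hr)) fun hr => ?_
  rw [← hfree] at hr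
  exact disjoint_left.1 (h.pairwise_disjoint_freeSide hk) hr hzU

lemma exists_mem_freeSide (h : Embeds C J C₁ J₁ e) {z : ℂ} (hz : z ∉ e '' Carpet C J) :
    ∃ j, z ∈ FreeSide C J e j := by
  by_contra! hno
  obtain ⟨j, hj⟩ := h.exists_outer
  have hzB : ∀ k, z ∉ e '' Bd C J k := fun k hk => hz (image_mono (h.model.bd_subset k) hk)
  have hnj := hno j
  simp only [FreeSide, hj, if_true] at hnj
  refine hnj (h.mem_outs_of_forall hz fun k hk => ?_)
  have hnk := hno k
  simp only [FreeSide, h.not_outer hk.symm hj, if_false] at hnk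
  exact (mem_reg_or_mem_outs _ z).resolve_left fun hr => hr.elim (hzB k) hnk

lemma exists_regions (h : Embeds C J C₁ J₁ e) : ∃ S : Option ℕ → Set ℂ,
    (∀ j, ∃ ι C', Flattens ι C' (e '' Bd C J j) (S j)) ∧ (Pairwise fun j k => Disjoint (S j) (S k)) ∧
    (∀ j, S j ∩ e '' Carpet C J ⊆ e '' Bd C J j) ∧ e '' Carpet C J ∪ ⋃ j, S j = Carpet C₁ J₁ ∧
    Tendsto (fun j => diam (S j)) cofinite (𝓝 0) := by
  have hB : ∀ j, e '' Bd C J j ⊆ e '' Carpet C J := fun j => image_mono (h.model.bd_subset j)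
  refine ⟨fun j => (e '' Bd C J j ∪ FreeSide C J e j) ∩ Carpet C₁ J₁, fun j => ?_, ?_, fun j => ?_,
    ?_, ?_⟩
  · by_cases hj : Outer C J e j
    · simp only [FreeSide, hj, if_true]
      exact h.target.exists_flattens_outs (h.jordan j) ((hB j).trans h.maps) (h.disj j)
    · simp only [FreeSide, hj, if_false]
      exact ⟨id, C₁, h.target.flattens_ins (h.jordan j) ((hB j).trans h.maps) (h.disj j)⟩
  · intro j k hjk
    refine Disjoint.mono inter_subset_left inter_subset_left ?_
    rw [disjoint_union_left, disjoint_union_right, disjoint_union_right]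
    exact ⟨⟨h.disjoint_image hjk, ((h.disjoint_freeSide k).mono_right (hB j)).symm⟩,
      (h.disjoint_freeSide j).mono_right (hB k), h.pairwise_disjoint_freeSide hjk⟩
  · rintro z ⟨⟨hz | hz, -⟩, hzL⟩
    · exact hz
    · exact absurd hzL (disjoint_left.1 (h.disjoint_freeSide j) hz)
  · refine Subset.antisymm (union_subset h.maps (iUnion_subset fun j => inter_subset_right))
      fun z hz => ?_
    by_cases hzL : z ∈ e '' Carpet C J
    · exact Or.inl hzL
    · obtain ⟨j, hj⟩ := h.exists_mem_freeSide hzL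
      exact Or.inr (mem_iUnion.2 ⟨j, Or.inr hj, hz⟩)
  · obtain ⟨j₀, hj₀⟩ := h.exists_outer
    have h0 : Tendsto (fun j => diam (Bd C J j)) cofinite (𝓝 0) := by
      have hC : Tendsto (fun i => diam (C i)) cofinite (𝓝 0) := by
        rw [Nat.cofinite_eq_atTop]
        exact squeeze_zero (fun _ => diam_nonneg) (fun i => diam_mono subset_union_left
          (h.model.holes.isCompact_reg i).isBounded) h.model.holes.null
      intro s hs
      refine (((hC hs : _ ∈ cofinite) : {i | ¬ _}.Finite).image some |>.insert none).subset ?_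
      rintro (_ | i) hj
      · exact mem_insert _ _
      · exact Or.inr ⟨i, hj, rfl⟩
    have h1 := (tendsto_diam_image h.model.isCompact_carpet h.cont h.model.bd_subset h0).const_mul 2
    rw [mul_zero] at h1
    refine tendsto_of_tendsto_of_tendsto_of_le_of_le' tendsto_const_nhds h1
      (Eventually.of_forall fun _ => diam_nonneg) ?_
    refine (finite_singleton j₀).subset fun j hj => ?_
    by_contra hne
    refine hj ?_
    have hfree : FreeSide C J e j = Ins (e '' Bd C J j) := if_neg (h.not_outer (Ne.symm hne) hj₀)
    refine (diam_mono (t := Reg (e '' Bd C J j)) ?_ (h.jordan j).isCompact_reg.isBounded).trans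
      (diam_reg_le (h.jordan j).isCompact)
    simp only [hfree]
    exact inter_subset_left

end Embeds

/-! ### Extending homeomorphisms -/

lemma isClosed_union_iUnion {α ι : Type*} [PseudoMetricSpace α] {A : Set α} {R : ι → Set α}
    (hA : IsClosed A) (hR : ∀ j, IsClosed (R j))
    (h : ∀ ε > 0, ∀ᶠ j in cofinite, R j ⊆ cthickening ε A) : IsClosed (A ∪ ⋃ j, R j) := by
  refine isClosed_of_closure_subset fun z hz => ?_
  by_contra hzn
  rw [mem_union, not_or] at hzn
  obtain ⟨ε, hε, hzε⟩ : ∃ ε > 0, z ∉ cthickening ε A := by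
    by_contra! hall
    refine hzn.1 ?_
    rw [← hA.closure_eq, closure_eq_iInter_cthickening]
    exact mem_iInter₂.2 hall
  have hfin := h ε hε
  have hcl : IsClosed (cthickening ε A ∪ ⋃ j ∈ {j | ¬ R j ⊆ cthickening ε A}, R j) :=
    isClosed_cthickening.union (Finite.isClosed_biUnion hfin fun j _ => hR j)
  have hsub : A ∪ ⋃ j, R j ⊆ cthickening ε A ∪ ⋃ j ∈ {j | ¬ R j ⊆ cthickening ε A}, R j := by
    rintro w (hw | hw)
    · exact Or.inl (self_subset_cthickening A hw)
    · obtain ⟨j, hj⟩ := mem_iUnion.1 hw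
      by_cases hjs : R j ⊆ cthickening ε A
      · exact Or.inl (hjs hj)
      · exact Or.inr (mem_iUnion₂.2 ⟨j, hjs, hj⟩)
  rcases closure_minimal hsub hcl hz with hz' | hz'
  · exact hzε hz'
  · obtain ⟨j, -, hj⟩ := mem_iUnion₂.1 hz'
    exact hzn.2 (mem_iUnion.2 ⟨j, hj⟩)

lemma injOn_union_iUnion {α β ι : Type*} {π : α → β} {G : Set α} {g R : ι → Set α} {S : ι → Set β}
    (hG : InjOn π G) (hg : ∀ j, g j ⊆ G) (hgR : ∀ j, g j ⊆ R j) (hR : ∀ j, InjOn π (R j))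
    (hS : ∀ j, π '' R j = S j) (hd : Pairwise fun j k => Disjoint (S j) (S k))
    (hSG : ∀ j, S j ∩ π '' G ⊆ π '' g j) : InjOn π (G ∪ ⋃ j, R j) := by
  have key : ∀ j, ∀ a ∈ G, ∀ b ∈ R j, π a = π b → a = b := by
    intro j a ha b hb hab
    obtain ⟨c, hc, hca⟩ := hSG j ⟨(by rw [← hS, hab]; exact mem_image_of_mem _ hb),
      mem_image_of_mem π ha⟩
    obtain rfl := hG (hg j hc) ha hca
    exact hR j (hgR j hc) hb hab
  rintro a (ha | ha) b (hb | hb) hab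
  · exact hG ha hb hab
  · obtain ⟨j, hj⟩ := mem_iUnion.1 hb
    exact key j a ha b hj hab
  · obtain ⟨j, hj⟩ := mem_iUnion.1 ha
    exact (key j b hb a hj hab.symm).symm
  · obtain ⟨j, hj⟩ := mem_iUnion.1 ha
    obtain ⟨k, hk⟩ := mem_iUnion.1 hb
    rcases eq_or_ne j k with rfl | hjk
    · exact hR j hj hk hab
    · have h1 : π a ∈ S j := by rw [← hS]; exact mem_image_of_mem _ hj
      have h2 : π a ∈ S k := by rw [← hS, hab]; exact mem_image_of_mem _ hk
      exact absurd h2 (disjoint_left.1 (hd hjk) h1)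

theorem Embeds.exists_corr {C C₁ C₁' : ℕ → Set ℂ} {J J₁ J₁' : Set ℂ} {e e' : ℂ → ℂ}
    (h : Embeds C J C₁ J₁ e) (h' : Embeds C J C₁' J₁' e') :
    ∃ R : Set (ℂ × ℂ), IsCompact R ∧ InjOn Prod.fst R ∧ InjOn Prod.snd R ∧
      Prod.fst '' R = Carpet C₁ J₁ ∧ Prod.snd '' R = Carpet C₁' J₁' ∧
      ∀ x ∈ Carpet C J, (e x, e' x) ∈ R := by
  obtain ⟨S, hS, hSd, hSe, hSu, hS0⟩ := h.exists_regions
  obtain ⟨S', hS', hSd', hSe', hSu', hS0'⟩ := h'.exists_regions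
  set E : ℂ → ℂ × ℂ := fun x => (e x, e' x) with hE
  have hEc : ContinuousOn E (Carpet C J) := h.cont.prodMk h'.cont
  have hB := h.model.bd_subset
  have e1 : ∀ A : Set ℂ, Prod.fst '' (E '' A) = e '' A := fun A => by simp [image_image, hE]
  have e2 : ∀ A : Set ℂ, Prod.snd '' (E '' A) = (e') '' A := fun A => by simp [image_image, hE]
  have i1 : InjOn Prod.fst (E '' Carpet C J) := by
    rintro _ ⟨x, hx, rfl⟩ _ ⟨y, hy, rfl⟩ hxy; rw [h.inj hx hy hxy]
  have i2 : InjOn Prod.snd (E '' Carpet C J) := by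
    rintro _ ⟨x, hx, rfl⟩ _ ⟨y, hy, rfl⟩ hxy; rw [h'.inj hx hy hxy]
  have hex : ∀ j, ∃ R : Set (ℂ × ℂ), IsCompact R ∧ E '' Bd C J j ⊆ R ∧ InjOn Prod.fst R ∧
      InjOn Prod.snd R ∧ Prod.fst '' R = S j ∧ Prod.snd '' R = S' j := fun j => by
    obtain ⟨ι, D, hD⟩ := hS j
    obtain ⟨ι', D', hD'⟩ := hS' j
    exact hD.exists_corr hD' ((h.model.jordan_bd j).isCompact.image_of_continuousOn
      (hEc.mono (hB j))) (i1.mono (image_mono (hB j))) (i2.mono (image_mono (hB j))) (e1 _) (e2 _)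
  choose R hRc hER hR1 hR2 hRS hRS' using hex
  have hfst : Prod.fst '' (E '' Carpet C J ∪ ⋃ j, R j) = Carpet C₁ J₁ := by
    rw [image_union, image_iUnion, e1]; simp only [hRS]; exact hSu
  have hsnd : Prod.snd '' (E '' Carpet C J ∪ ⋃ j, R j) = Carpet C₁' J₁' := by
    rw [image_union, image_iUnion, e2]; simp only [hRS']; exact hSu'
  refine ⟨E '' Carpet C J ∪ ⋃ j, R j, ?_, ?_, ?_, hfst, hsnd, fun x hx => Or.inl ⟨x, hx, rfl⟩⟩
  · refine (h.target.isCompact_carpet.prod h'.target.isCompact_carpet).of_isClosed_subset ?_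
      fun r hr => ⟨hfst ▸ mem_image_of_mem _ hr, hsnd ▸ mem_image_of_mem _ hr⟩
    refine isClosed_union_iUnion (h.model.isCompact_carpet.image_of_continuousOn hEc).isClosed
      (fun j => (hRc j).isClosed) fun ε hε => ?_
    filter_upwards [hS0.eventually_lt_const hε, hS0'.eventually_lt_const hε] with j h1 h2 r hr
    obtain ⟨x, hx⟩ := (h.model.jordan_bd j).nonempty
    have hxR := hER j (mem_image_of_mem E hx)
    refine mem_cthickening_of_dist_le r (E x) ε _ (mem_image_of_mem E (hB j hx)) ?_
    rw [Prod.dist_eq, max_le_iff]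
    rw [← hRS] at h1
    rw [← hRS'] at h2
    exact ⟨(dist_le_diam_of_mem ((hRc j).image continuous_fst).isBounded
      (mem_image_of_mem _ hr) (mem_image_of_mem _ hxR)).trans h1.le,
      (dist_le_diam_of_mem ((hRc j).image continuous_snd).isBounded
      (mem_image_of_mem _ hr) (mem_image_of_mem _ hxR)).trans h2.le⟩
  · exact injOn_union_iUnion i1 (fun j => image_mono (hB j)) hER hR1 hRS hSd fun j => by
      rw [e1, e1]; exact hSe j
  · exact injOn_union_iUnion i2 (fun j => image_mono (hB j)) hER hR2 hRS' hSd' fun j => by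
      rw [e2, e2]; exact hSe' j

/-! ### Closed disks in the plane -/

/-- The unit circle in the plane is a Jordan curve. -/
lemma isJordanCurve_sphere : IsJordanCurve (sphere (0 : ℂ) 1) := by
  have hnorm : ∀ t : ℝ, ‖Complex.exp ((Real.pi * t : ℝ) * Complex.I)‖ = 1 :=
    fun t => Complex.norm_exp_ofReal_mul_I _
  have hre : ∀ t ∈ Icc (0 : ℝ) 1, Real.pi * t ∈ Icc 0 Real.pi := fun t ht =>
    ⟨mul_nonneg Real.pi_pos.le ht.1, mul_le_of_le_one_right Real.pi_pos.le ht.2⟩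
  have hcont : Continuous fun t : ℝ => Complex.exp ((Real.pi * t : ℝ) * Complex.I) := by fun_prop
  have hinj : InjOn (fun t : ℝ => Complex.exp ((Real.pi * t : ℝ) * Complex.I)) (Icc 0 1) := by
    intro s hs t ht hst
    have hs' := hre s hs
    have ht' := hre t ht
    have := Complex.exp_inj_of_neg_pi_lt_of_le_pi (by simp; linarith [Real.pi_pos, hs'.1])
      (by simp; exact hs'.2) (by simp; linarith [Real.pi_pos, ht'.1]) (by simp; exact ht'.2) hst
    have h2 := mul_right_cancel₀ Complex.I_ne_zero this
    exact mul_left_cancel₀ Real.pi_ne_zero (by exact_mod_cast h2)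
  have him : ∀ t ∈ Icc (0 : ℝ) 1, 0 ≤ (Complex.exp ((Real.pi * t : ℝ) * Complex.I)).im :=
    fun t ht => by
      rw [Complex.exp_ofReal_mul_I_im]
      exact Real.sin_nonneg_of_nonneg_of_le_pi (hre t ht).1 (hre t ht).2
  refine ⟨_, _, 1, -1, ⟨⟨_, hcont.continuousOn, hinj, by simp, by simp, rfl⟩,
    ⟨fun t => (starRingEnd ℂ) (Complex.exp ((Real.pi * t : ℝ) * Complex.I)),
      (Complex.continuous_conj.comp hcont).continuousOn,
      fun s hs t ht hst => hinj hs ht ((starRingEnd ℂ).injective hst), by simp, by simp, rfl⟩,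
      ?_⟩, ?_⟩
  · apply Subset.antisymm
    · rintro _ ⟨⟨t, ht, rfl⟩, ⟨s, hs, hst⟩⟩
      have h1 := him t ht
      have h2 := him s hs
      have h3 := congrArg Complex.im hst
      have h4 := hnorm t
      simp only [Complex.conj_im] at h3
      have h0 : (Complex.exp ((Real.pi * t : ℝ) * Complex.I)).im = 0 := by linarith
      dsimp only
      rw [← Complex.re_add_im (Complex.exp ((Real.pi * t : ℝ) * Complex.I)), h0] at h4 ⊢
      simp only [Complex.ofReal_zero, zero_mul, add_zero, Complex.norm_real, Real.norm_eq_abs] at h4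
      rcases eq_or_eq_neg_of_abs_eq h4 with h | h <;> rw [h] <;> simp
    · rintro z (rfl | rfl)
      · exact ⟨⟨0, by simp, by simp⟩, ⟨0, by simp, by simp⟩⟩
      · exact ⟨⟨1, by simp, by simp⟩, ⟨1, by simp, by simp⟩⟩
  · apply Subset.antisymm
    · intro z hz
      rw [mem_sphere_zero_iff_norm] at hz
      have hzexp : Complex.exp ((z.arg : ℝ) * Complex.I) = z := by
        have := Complex.norm_mul_exp_arg_mul_I z
        rwa [hz, Complex.ofReal_one, one_mul] at this
      rcases le_total 0 z.arg with h | h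
      · refine Or.inl ⟨z.arg / Real.pi, ⟨by positivity, ?_⟩, ?_⟩
        · exact (div_le_one Real.pi_pos).2 (Complex.arg_le_pi z)
        · dsimp only
          rw [mul_div_cancel₀ _ Real.pi_ne_zero, hzexp]
      · refine Or.inr ⟨-z.arg / Real.pi, ⟨?_, ?_⟩, ?_⟩
        · exact div_nonneg (by linarith) Real.pi_pos.le
        · exact (div_le_one Real.pi_pos).2 (by linarith [Complex.neg_pi_lt_arg z])
        · dsimp only
          rw [mul_div_cancel₀ _ Real.pi_ne_zero, ← Complex.exp_conj, map_mul, Complex.conj_I,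
            Complex.conj_ofReal, ← hzexp]
          simp [hzexp]
    · rintro z (⟨t, ht, rfl⟩ | ⟨t, ht, rfl⟩)
      · rw [mem_sphere_zero_iff_norm]; exact hnorm t
      · rw [mem_sphere_zero_iff_norm]; exact (RCLike.norm_conj _).trans (hnorm t)

/-- An injective continuous image of a closed disk carries logarithms. -/
lemma logAcyclic_image_closedBall {f : ℂ → ℂ} (hf : ContinuousOn f (closedBall 0 1))
    (hi : InjOn f (closedBall 0 1)) : LogAcyclic (f '' closedBall 0 1) := by
  intro F hF h0
  have hm : MapsTo f (closedBall 0 1) (f '' closedBall 0 1) := mapsTo_image f _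
  obtain ⟨g, hg, hgF⟩ := hasLog_closedBall (hF.comp hf hm) fun t ht => h0 _ (hm ht)
  refine ⟨fun z => g (Function.invFunOn f (closedBall 0 1) z), ?_, ?_⟩
  · exact hg.comp (continuousOn_invFunOn_image (isCompact_closedBall 0 1) hf hi)
      fun z hz => Function.invFunOn_mem hz
  · intro z hz
    refine (hgF _ (Function.invFunOn_mem hz)).trans ?_
    simp only [Function.comp_apply, Function.invFunOn_eq hz]

lemma closedBall_eq_union : closedBall (0 : ℂ) 1 = sphere 0 1 ∪ ball 0 1 := by
  rw [union_comm, ball_union_sphere]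

lemma disjoint_image_ball {α : Type*} {f : ℂ → α} (hi : InjOn f (closedBall 0 1)) :
    Disjoint (f '' ball 0 1) (f '' sphere 0 1) := by
  rw [disjoint_left]
  rintro _ ⟨x, hx, rfl⟩ ⟨y, hy, hyx⟩
  rw [hi (sphere_subset_closedBall hy) (ball_subset_closedBall hx) hyx] at hy
  rw [mem_sphere] at hy
  rw [mem_ball] at hx
  exact hx.ne hy

/-- The Schoenflies description of a closed disk in the plane. -/
lemma isJordanCurve_of_disk {f : ℂ → ℂ} (hf : ContinuousOn f (closedBall 0 1))
    (hi : InjOn f (closedBall 0 1)) : IsJordanCurve (f '' sphere 0 1) ∧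
      f '' closedBall 0 1 = Reg (f '' sphere 0 1) ∧ f '' ball 0 1 = Ins (f '' sphere 0 1) ∧
      interior (f '' closedBall 0 1) = Ins (f '' sphere 0 1) := by
  have hJ : IsJordanCurve (f '' sphere 0 1) := isJordanCurve_sphere.map
    (hf.mono sphere_subset_closedBall) (hi.mono sphere_subset_closedBall)
  have hA : IsCompact (f '' closedBall 0 1) := (isCompact_closedBall 0 1).image_of_continuousOn hf
  have hout : (f '' closedBall 0 1)ᶜ ⊆ Outs (f '' sphere 0 1) := by
    refine subset_ext_of_not_isBounded hJ.isCompact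
      ((logAcyclic_image_closedBall hf hi).isPreconnected_compl hA)
      (disjoint_compl_left.mono_right (image_mono sphere_subset_closedBall)) fun hb => ?_
    have := hb.union hA.isBounded
    rw [compl_union_self] at this
    exact NormedSpace.unbounded_univ ℝ ℂ this
  have hsplit : f '' closedBall 0 1 = f '' sphere 0 1 ∪ f '' ball 0 1 := by
    rw [closedBall_eq_union, image_union]
  have hins : Ins (f '' sphere 0 1) ⊆ f '' ball 0 1 := by
    intro z hz
    have : z ∈ f '' closedBall 0 1 := by
      by_contra hn
      exact disjoint_left.1 (disjoint_ins_ext _) hz (hout hn)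
    rw [hsplit] at this
    exact this.resolve_left hz.1
  have hball : f '' ball 0 1 = Ins (f '' sphere 0 1) := by
    refine Subset.antisymm ?_ hins
    obtain ⟨p, hp⟩ := hJ.ins_nonempty
    exact mem_ins_of_isPreconnected hJ.isCompact
      ((convex_ball (0 : ℂ) 1).isPreconnected.image f (hf.mono ball_subset_closedBall))
      (disjoint_image_ball hi) (hins hp) hp
  have hreg : f '' closedBall 0 1 = Reg (f '' sphere 0 1) := by rw [hsplit, hball, Reg]
  refine ⟨hJ, hreg, hball, ?_⟩
  rw [hreg, interior_eq_compl_closure_compl, compl_reg, hJ.closure_outs]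
  ext z
  simp only [Ins, Outs, mem_compl_iff, mem_union, mem_ofPred_eq]
  tauto

lemma isPreconnected_ball_diff {z : ℂ} : IsPreconnected (ball (0 : ℂ) 1 \ {z}) := by
  have hc : IsPreconnected ({z}ᶜ : Set ℂ) :=
    (isConnected_compl_singleton_of_one_lt_rank (by simp) z).isPreconnected
  refine isPreconnected_diff_of_notSep isOpen_ball isBounded_ball
    (convex_ball (0 : ℂ) 1).isPreconnected isCompact_singleton ?_ fun p hp q hq =>
      ⟨{z}ᶜ, hc, disjoint_compl_left, hp, hq⟩
  exact (subsingleton_singleton.anti inter_subset_left).isPreconnected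

/-! ### Closed disks in the sphere -/

/-- A chart of the sphere at the complement of a point, with its inverse. -/
structure SphereChart (p : ↥Sphere2) (τ : ℂ → ↥Sphere2) (σ : ↥Sphere2 → ℂ) : Prop where
  embedding : IsOpenEmbedding τ
  range : Set.range τ = {p}ᶜ
  left : ∀ w, σ (τ w) = w
  cont : ContinuousOn σ {p}ᶜ

lemma exists_sphereChart (p : ↥Sphere2) : ∃ τ σ, SphereChart p τ σ := by
  have : Fact (Module.finrank ℝ (EuclideanSpace ℝ (Fin 3)) = 2 + 1) := ⟨by simp⟩
  set s := stereographic' 2 p with hs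
  have hsrc : s.source = {p}ᶜ := stereographic'_source p
  have htgt : s.target = univ := stereographic'_target p
  let r := Complex.orthonormalBasisOneI.repr
  have hmem : ∀ w, s.symm w ∈ s.source := fun w => s.map_target (by rw [htgt]; trivial)
  have hsc : Continuous s.symm := by
    rw [← continuousOn_univ, ← htgt]
    exact s.continuousOn_symm
  have hleft : ∀ w, r.symm (s (s.symm (r w))) = w := fun w => by
    rw [s.right_inv (by rw [htgt]; trivial), LinearIsometryEquiv.symm_apply_apply]
  refine ⟨fun w => s.symm (r w), fun x => r.symm (s x), ⟨?_, ?_, hleft, ?_⟩⟩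
  · exact (s.symm.isOpenEmbedding htgt).comp r.toHomeomorph.isOpenEmbedding
  · apply Subset.antisymm
    · rintro _ ⟨w, rfl⟩
      exact hsrc ▸ hmem _
    · intro x hx
      rw [← hsrc] at hx
      exact ⟨r.symm (s x), by simp [s.left_inv hx]⟩
  · rw [← hsrc]
    exact r.symm.continuous.comp_continuousOn s.continuousOn

namespace SphereChart

variable {p : ↥Sphere2} {τ : ℂ → ↥Sphere2} {σ : ↥Sphere2 → ℂ}

lemma right (h : SphereChart p τ σ) {x : ↥Sphere2} (hx : x ≠ p) : τ (σ x) = x := by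
  obtain ⟨w, rfl⟩ : x ∈ Set.range τ := h.range ▸ hx
  rw [h.left]

lemma ne (h : SphereChart p τ σ) (w : ℂ) : τ w ≠ p := by
  have : τ w ∈ ({p}ᶜ : Set ↥Sphere2) := h.range ▸ mem_range_self w
  exact this

lemma injOn (h : SphereChart p τ σ) : InjOn σ {p}ᶜ := fun x hx y hy hxy => by
  rw [← h.right hx, ← h.right hy, hxy]

lemma preimage_eq (h : SphereChart p τ σ) {A : Set ↥Sphere2} (hA : p ∉ A) :
    τ ⁻¹' A = σ '' A := by
  ext w
  constructor
  · exact fun hw => ⟨τ w, hw, h.left w⟩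
  · rintro ⟨x, hx, rfl⟩
    rw [mem_preimage, h.right fun e => hA (e ▸ hx)]
    exact hx

end SphereChart

/-- A parametrized closed disk in the sphere. -/
structure SphereDisk (φ : ℂ → ↥Sphere2) : Prop where
  cont : ContinuousOn φ (closedBall 0 1)
  inj : InjOn φ (closedBall 0 1)

/-- A continuous map on a subtype is the restriction of a map on the whole type. -/
lemma exists_continuousOn_extension {α β : Type*} [TopologicalSpace α] [TopologicalSpace β]
    [Nonempty β] {S : Set α} (g : ↥S → β) (hg : Continuous g) :
    ∃ f : α → β, ContinuousOn f S ∧ ∀ x : ↥S, f x = g x := by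
  have hfg : ∀ x : ↥S, Function.extend Subtype.val g (fun _ => Classical.arbitrary β) x = g x :=
    fun x => Subtype.val_injective.extend_apply g _ x
  refine ⟨Function.extend Subtype.val g fun _ => Classical.arbitrary β, ?_, hfg⟩
  rw [continuousOn_iff_continuous_domRestrict]
  exact hg.congr fun x => (hfg x).symm

/-- A continuous injective map on a compact set is a homeomorphism onto its image. -/
lemma nonempty_homeomorph_image {α β : Type*} [TopologicalSpace α] [TopologicalSpace β]
    [T2Space β] {S : Set α} (hS : IsCompact S) {f : α → β} (hf : ContinuousOn f S)
    (hi : InjOn f S) : Nonempty (↥S ≃ₜ ↥(f '' S)) := by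
  have : CompactSpace ↥S := isCompact_iff_compactSpace.1 hS
  have hc : Continuous (Equiv.Set.imageOfInjOn f S hi) :=
    (hf.domRestrict).subtype_mk _
  exact ⟨hc.homeoOfEquivCompactToT2⟩

lemma nonempty_sphere_homeomorph : Nonempty (↥(sphere (0 : ℂ) 1) ≃ₜ ↥UnitCircle) := by
  let r := Complex.orthonormalBasisOneI.repr
  obtain ⟨e⟩ := nonempty_homeomorph_image (isCompact_sphere (0 : ℂ) 1) r.continuous.continuousOn
    r.injective.injOn
  refine ⟨e.trans (Homeomorph.setCongr ?_)⟩
  rw [r.image_sphere, map_zero]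

lemma IsClosedDisk.exists_sphereDisk {E : Set ↥Sphere2} (h : IsClosedDisk E) :
    ∃ φ, SphereDisk φ ∧ φ '' closedBall 0 1 = E := by
  obtain ⟨e⟩ := h
  let r := Complex.orthonormalBasisOneI.repr
  have hr : ∀ w : ↥(closedBall (0 : ℂ) 1), r w ∈ UnitDisk2 := fun w => by
    have := w.2
    rw [mem_closedBall_zero_iff] at this ⊢
    rwa [r.norm_map]
  have hg : Continuous fun w : ↥(closedBall (0 : ℂ) 1) => (e.symm ⟨r w, hr w⟩ : ↥Sphere2) := by
    have : Continuous fun w : ↥(closedBall (0 : ℂ) 1) => (⟨r w, hr w⟩ : ↥UnitDisk2) := by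
      fun_prop
    exact continuous_subtype_val.comp (e.symm.continuous.comp this)
  have : Nonempty ↥Sphere2 := ⟨e.symm ⟨0, by simp⟩⟩
  obtain ⟨φ, hφ, hφe⟩ := exists_continuousOn_extension _ hg
  refine ⟨φ, ⟨hφ, ?_⟩, ?_⟩
  · intro x hx y hy hxy
    rw [hφe ⟨x, hx⟩, hφe ⟨y, hy⟩] at hxy
    have := e.symm.injective (Subtype.val_injective hxy)
    exact r.injective (congrArg Subtype.val this)
  · apply Subset.antisymm
    · rintro _ ⟨x, hx, rfl⟩
      rw [hφe ⟨x, hx⟩]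
      exact Subtype.coe_prop _
    · intro x hx
      have hz : r.symm (e ⟨x, hx⟩) ∈ closedBall (0 : ℂ) 1 := by
        have := (e ⟨x, hx⟩).2
        rw [mem_closedBall_zero_iff] at this ⊢
        rwa [r.symm.norm_map]
      refine ⟨_, hz, ?_⟩
      rw [hφe ⟨_, hz⟩]
      simp

namespace SphereDisk

variable {φ : ℂ → ↥Sphere2} {p : ↥Sphere2} {τ : ℂ → ↥Sphere2} {σ : ↥Sphere2 → ℂ}

lemma isCompact (h : SphereDisk φ) : IsCompact (φ '' closedBall 0 1) :=
  (isCompact_closedBall 0 1).image_of_continuousOn h.cont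

/-- The circle homeomorphism for the boundary of a disk seen in a chart. -/
lemma nonempty_circle (h : SphereDisk φ) (hc : SphereChart p τ σ) (hp : p ∉ φ '' sphere 0 1) :
    IsJordanCurve ((σ ∘ φ) '' sphere 0 1) ∧
      Nonempty (↥((σ ∘ φ) '' sphere 0 1) ≃ₜ ↥UnitCircle) := by
  have hm : MapsTo φ (sphere 0 1) {p}ᶜ := fun z hz e => hp ⟨z, hz, e⟩
  have h1 : ContinuousOn (σ ∘ φ) (sphere 0 1) :=
    hc.cont.comp (h.cont.mono sphere_subset_closedBall) hm
  have h2 : InjOn (σ ∘ φ) (sphere 0 1) :=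
    hc.injOn.comp (h.inj.mono sphere_subset_closedBall) hm
  obtain ⟨e⟩ := nonempty_homeomorph_image (isCompact_sphere (0 : ℂ) 1) h1 h2
  obtain ⟨circ⟩ := nonempty_sphere_homeomorph
  exact ⟨isJordanCurve_sphere.map h1 h2, ⟨e.symm.trans circ⟩⟩

/-- A closed disk avoiding the centre of a chart. -/
lemma preimage_eq (h : SphereDisk φ) (hc : SphereChart p τ σ) (hp : p ∉ φ '' closedBall 0 1) :
    τ ⁻¹' (φ '' closedBall 0 1) = Reg ((σ ∘ φ) '' sphere 0 1) ∧
      τ ⁻¹' (φ '' ball 0 1) = Ins ((σ ∘ φ) '' sphere 0 1) ∧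
      τ ⁻¹' (interior (φ '' closedBall 0 1)) = Ins ((σ ∘ φ) '' sphere 0 1) := by
  have hm : MapsTo φ (closedBall 0 1) {p}ᶜ := fun z hz e => hp ⟨z, hz, e⟩
  obtain ⟨-, h2, h3, h4⟩ := isJordanCurve_of_disk (hc.cont.comp h.cont hm) (hc.injOn.comp h.inj hm)
  have hpre := hc.preimage_eq hp
  refine ⟨?_, ?_, ?_⟩
  · rw [hpre, ← image_comp, h2]
  · rw [hc.preimage_eq fun hn => hp (image_mono ball_subset_closedBall hn), ← image_comp, h3]
  · rw [hc.embedding.isOpenMap.preimage_interior_eq_interior_preimage hc.embedding.continuous,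
      hpre, ← image_comp, h4]

/-- A closed disk is not the whole sphere. -/
lemma exists_notMem (h : SphereDisk φ) : ∃ p, p ∉ φ '' closedBall 0 1 := by
  by_contra! hall
  have h0 : φ 0 ∉ φ '' sphere 0 1 := disjoint_left.1 (disjoint_image_ball h.inj)
    (mem_image_of_mem φ (mem_ball_self one_pos))
  obtain ⟨τ, σ, hc⟩ := exists_sphereChart (φ 0)
  obtain ⟨hJ, -⟩ := h.nonempty_circle hc h0
  apply hJ.not_isPreconnected_compl
  have hm : MapsTo φ (ball 0 1 \ {0}) {φ 0}ᶜ := fun z hz e =>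
    hz.2 (h.inj (ball_subset_closedBall hz.1) (mem_closedBall_self zero_le_one) e)
  have : ((σ ∘ φ) '' sphere 0 1)ᶜ = (σ ∘ φ) '' (ball 0 1 \ {0}) := by
    ext w
    constructor
    · intro hw
      obtain ⟨z, hz, hzw⟩ := hall (τ w)
      have hz0 : z ≠ 0 := fun e => hc.ne w (by rw [← hzw, e])
      rw [closedBall_eq_union] at hz
      rcases hz with hz | hz
      · exact absurd ⟨z, hz, by rw [Function.comp_apply, hzw, hc.left]⟩ hw
      · exact ⟨z, ⟨hz, hz0⟩, by rw [Function.comp_apply, hzw, hc.left]⟩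
    · rintro ⟨z, hz, rfl⟩ ⟨y, hy, hyz⟩
      have hy0 : φ y ≠ φ 0 := fun e => h0 ⟨y, hy, e⟩
      have := hc.injOn hy0 (hm hz) hyz
      exact disjoint_left.1 (disjoint_image_ball h.inj) (mem_image_of_mem φ hz.1) ⟨y, hy, this⟩
  rw [this]
  exact isPreconnected_ball_diff.image _
    (hc.cont.comp (h.cont.mono (sdiff_subset.trans ball_subset_closedBall)) hm)

lemma interior_eq (h : SphereDisk φ) : interior (φ '' closedBall 0 1) = φ '' ball 0 1 := by
  obtain ⟨q, hq⟩ := h.exists_notMem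
  obtain ⟨τ, σ, hc⟩ := exists_sphereChart q
  obtain ⟨-, h2, h3⟩ := h.preimage_eq hc hq
  ext x
  by_cases hx : x = q
  · subst hx
    exact iff_of_false (fun hn => hq (interior_subset hn))
      fun hn => hq (image_mono ball_subset_closedBall hn)
  · rw [← hc.right hx, ← mem_preimage, h3, ← h2, mem_preimage]

lemma closure_image_ball (h : SphereDisk φ) : closure (φ '' ball 0 1) = φ '' closedBall 0 1 := by
  apply Subset.antisymm
  · exact closure_minimal (image_mono ball_subset_closedBall) h.isCompact.isClosed
  · have hcl : closure (ball (0 : ℂ) 1) = closedBall 0 1 := closure_ball 0 one_ne_zero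
    rw [← hcl]
    exact ContinuousOn.image_closure (by rw [hcl]; exact h.cont)

/-- A disk containing the centre of a chart in its interior. -/
lemma preimage_eq_outs (h : SphereDisk φ) (hc : SphereChart p τ σ) (hp : p ∈ φ '' ball 0 1) :
    τ ⁻¹' (φ '' ball 0 1) = Outs ((σ ∘ φ) '' sphere 0 1) ∧
      τ ⁻¹' (φ '' sphere 0 1) = (σ ∘ φ) '' sphere 0 1 := by
  have hdisj := disjoint_image_ball h.inj
  have hps : p ∉ φ '' sphere 0 1 := disjoint_left.1 hdisj hp
  obtain ⟨hJ, -⟩ := h.nonempty_circle hc hps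
  have hsph : τ ⁻¹' (φ '' sphere 0 1) = (σ ∘ φ) '' sphere 0 1 := by
    rw [hc.preimage_eq hps, image_comp]
  refine ⟨?_, hsph⟩
  have hopen : IsOpen (φ '' ball 0 1) := by
    rw [← h.interior_eq]; exact isOpen_interior
  obtain ⟨z, hz, rfl⟩ := hp
  have hm : MapsTo φ (ball 0 1 \ {z}) {φ z}ᶜ := fun y hy e =>
    hy.2 (h.inj (ball_subset_closedBall hy.1) (ball_subset_closedBall hz) e)
  have hpre : τ ⁻¹' (φ '' ball 0 1) = (σ ∘ φ) '' (ball 0 1 \ {z}) := by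
    ext w
    constructor
    · rintro ⟨y, hy, hyw⟩
      refine ⟨y, ⟨hy, fun e => hc.ne w ?_⟩, by rw [Function.comp_apply, hyw, hc.left]⟩
      rw [← hyw, mem_singleton_iff.1 e]
    · rintro ⟨y, hy, rfl⟩
      exact ⟨y, hy.1, (hc.right (hm hy)).symm⟩
  have hconn : IsPreconnected (τ ⁻¹' (φ '' ball 0 1)) := by
    rw [hpre]
    exact isPreconnected_ball_diff.image _
      (hc.cont.comp (h.cont.mono (sdiff_subset.trans ball_subset_closedBall)) hm)
  have hne : ¬ Bornology.IsBounded (τ ⁻¹' (φ '' ball 0 1)) := by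
    intro hb
    have hK : IsCompact (closure (τ ⁻¹' (φ '' ball 0 1))) := hb.isCompact_closure
    have hK' : IsClosed (τ '' closure (τ ⁻¹' (φ '' ball 0 1))) :=
      (hK.image hc.embedding.continuous).isClosed
    have hsub : φ '' (ball 0 1 \ {z}) ⊆ τ '' closure (τ ⁻¹' (φ '' ball 0 1)) := by
      rintro _ ⟨y, hy, rfl⟩
      refine ⟨σ (φ y), subset_closure ?_, hc.right (hm hy)⟩
      rw [mem_preimage, hc.right (hm hy)]
      exact mem_image_of_mem φ hy.1
    have hzcl : z ∈ closure (ball (0 : ℂ) 1 \ {z}) := by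
      have h1 : z ∈ closure ({z}ᶜ : Set ℂ) := by simp
      have := isOpen_ball.inter_closure (s := ball (0 : ℂ) 1) (t := {z}ᶜ) ⟨hz, h1⟩
      rwa [← sdiff_eq] at this
    have hφz : φ z ∈ closure (φ '' (ball 0 1 \ {z})) :=
      ((h.cont z (ball_subset_closedBall hz)).mono
        (sdiff_subset.trans ball_subset_closedBall)).mem_closure_image hzcl
    obtain ⟨w, -, hw⟩ := closure_minimal hsub hK' hφz
    exact hc.ne w hw
  have hdisj' : Disjoint (τ ⁻¹' (φ '' ball 0 1)) ((σ ∘ φ) '' sphere 0 1) := by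
    rw [← hsph]; exact hdisj.preimage τ
  have hsub := subset_ext_of_not_isBounded hJ.isCompact hconn hdisj' hne
  refine Subset.antisymm hsub ?_
  have hne' : (τ ⁻¹' (φ '' ball 0 1)).Nonempty :=
    nonempty_iff_ne_empty.2 fun e => hne (e ▸ Bornology.isBounded_empty)
  refine (isPreconnected_ext hJ.isCompact).subset_left_of_subset_union
    (v := τ ⁻¹' (φ '' closedBall 0 1)ᶜ)
    (hopen.preimage hc.embedding.continuous)
    (h.isCompact.isClosed.isOpen_compl.preimage hc.embedding.continuous) ?_ ?_ ?_
  · exact (disjoint_compl_right.mono_left (image_mono ball_subset_closedBall)).preimage τ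
  · intro w hw
    by_cases hw' : τ w ∈ φ '' closedBall 0 1
    · rw [closedBall_eq_union, image_union] at hw'
      rcases hw' with hw' | hw'
      · exact absurd (show w ∈ τ ⁻¹' (φ '' sphere 0 1) from hw') (hsph ▸ hw.1)
      · exact Or.inl hw'
    · exact Or.inr hw'
  · rwa [inter_eq_right.2 hsub]

end SphereDisk

/-- A Sierpiński curve is a planar carpet with circles as boundary curves. -/
theorem IsSierpinskiFamily.exists_model {D : ℕ → Set ↥Sphere2} (h : IsSierpinskiFamily D) :
    ∃ C J, Model C J ∧ (∀ j, Nonempty (↥(Bd C J j) ≃ₜ ↥UnitCircle)) ∧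
      Nonempty (↥((⋃ i, D i)ᶜ) ≃ₜ ↥(Carpet C J)) := by
  obtain ⟨hD, hdisj, hdiam, hdense⟩ := h
  have hpar : ∀ i, ∃ φ, SphereDisk φ ∧ D i = φ '' ball 0 1 ∧
      closure (D i) = φ '' closedBall 0 1 := by
    intro i
    obtain ⟨E, hE, hDE⟩ := hD i
    obtain ⟨φ, hφ, rfl⟩ := hE.exists_sphereDisk
    rw [hφ.interior_eq] at hDE
    exact ⟨φ, hφ, hDE, by rw [hDE, hφ.closure_image_ball]⟩
  choose φ hφ hb hcb using hpar
  obtain ⟨p, hp⟩ : (D 0).Nonempty := by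
    rw [hb 0]; exact ⟨_, mem_image_of_mem _ (mem_ball_self one_pos)⟩
  obtain ⟨τ, σ, hc⟩ := exists_sphereChart p
  have hp0 : p ∈ φ 0 '' ball 0 1 := hb 0 ▸ hp
  obtain ⟨hout, hsph⟩ := (hφ 0).preimage_eq_outs hc hp0
  obtain ⟨hJ, hJc⟩ := (hφ 0).nonempty_circle hc
    (disjoint_left.1 (disjoint_image_ball (hφ 0).inj) hp0)
  set J := (σ ∘ φ 0) '' sphere 0 1 with hJdef
  rw [← hb 0] at hout
  have hpi : ∀ i, p ∉ φ (i + 1) '' closedBall 0 1 := fun i hn => by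
    rw [← hcb] at hn
    exact disjoint_left.1 (hdisj (Nat.succ_ne_zero i)) hn (subset_closure hp)
  obtain ⟨C, hC⟩ : ∃ C : ℕ → Set ℂ, ∀ i, C i = (σ ∘ φ (i + 1)) '' sphere 0 1 := ⟨_, fun _ => rfl⟩
  have hCJ : ∀ i, IsJordanCurve (C i) ∧ Nonempty (↥(C i) ≃ₜ ↥UnitCircle) := fun i => by
    rw [hC]
    exact (hφ (i + 1)).nonempty_circle hc
      fun hn => hpi i (image_mono sphere_subset_closedBall hn)
  have hreg : ∀ i, Reg (C i) = τ ⁻¹' closure (D (i + 1)) := fun i => by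
    rw [hC, hcb, ((hφ (i + 1)).preimage_eq hc (hpi i)).1]
  have hins : ∀ i, Ins (C i) = τ ⁻¹' D (i + 1) := fun i => by
    rw [hC, hb, ((hφ (i + 1)).preimage_eq hc (hpi i)).2.1]
  have hregJ : Reg J = τ ⁻¹' (D 0)ᶜ := by
    rw [preimage_compl, hout, ← compl_reg, compl_compl]
  have hinsJ : Ins J = τ ⁻¹' (closure (D 0))ᶜ := by
    rw [hcb 0, closedBall_eq_union, image_union, ← hb 0, preimage_compl, preimage_union, hsph, hout]
    ext z
    simp only [Ins, Outs, mem_compl_iff, mem_union, mem_ofPred_eq]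
    tauto
  have hopen : IsOpen (D 0) := by
    rw [hb, ← (hφ 0).interior_eq]; exact isOpen_interior
  have hinner : ∀ i, Reg (C i) ⊆ Ins J := fun i => by
    rw [hreg, hinsJ]
    exact preimage_mono (hdisj (Nat.succ_ne_zero i)).subset_compl_right
  have hmodel : Model C J := by
    refine ⟨⟨fun i => Or.inr (hCJ i).1, fun i j hij => ?_, ?_⟩, ⟨hJ, ?_, fun i => Or.inl (hinner i)⟩,
      fun i => (hCJ i).1, hinner⟩
    · simp only [hreg]
      exact (hdisj (fun e => hij (Nat.succ_injective e))).preimage τ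
    · have hsub : ∀ i, closure (D (i + 1)) ⊆ (D 0)ᶜ := fun i x hx hx0 =>
        disjoint_left.1 (hdisj (Nat.succ_ne_zero i)) hx (subset_closure hx0)
      have h0 : Tendsto (fun i => diam (closure (D (i + 1)))) atTop (𝓝 0) := by
        simp only [diam_closure]
        exact hdiam.comp (tendsto_add_atTop_nat 1)
      have hσ : ContinuousOn σ (D 0)ᶜ := hc.cont.mono fun x hx e => hx (by
        rw [mem_singleton_iff.1 e]; exact hp)
      have := tendsto_diam_image hopen.isClosed_compl.isCompact hσ hsub h0
      refine this.congr fun i => ?_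
      rw [hreg, hc.preimage_eq fun hn => hpi i (hcb (i + 1) ▸ hn)]
    · intro w hw
      rw [_root_.mem_closure_iff]
      intro U hU hwU
      have hV : IsOpen (τ '' (U ∩ Ins J)) :=
        hc.embedding.isOpenMap _ (hU.inter (isOpen_ins hJ.isCompact))
      obtain ⟨_, ⟨y, hy, rfl⟩, hyD⟩ := hdense.inter_open_nonempty _ hV ⟨τ w, w, ⟨hwU, hw⟩, rfl⟩
      obtain ⟨i, hi⟩ := mem_iUnion.1 hyD
      refine ⟨y, hy.1, ?_⟩
      rcases i with _ | i
      · have := hy.2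
        rw [hinsJ] at this
        exact absurd hi this
      · refine mem_iUnion.2 ⟨i, ?_⟩
        rw [hreg]; exact hi
  have hcarpet : Carpet C J = τ ⁻¹' (⋃ i, D i)ᶜ := by
    ext w
    simp only [Carpet, hregJ, hins, Set.mem_sdiff, mem_preimage, mem_compl_iff, mem_iUnion, not_exists]
    constructor
    · rintro ⟨h0, h1⟩ (_ | i)
      · exact h0
      · exact h1 i
    · exact fun hw => ⟨hw 0, fun i => hw (i + 1)⟩
  refine ⟨C, J, hmodel, ?_, ?_⟩
  · rintro (_ | i)
    · exact hJc
    · exact (hCJ i).2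
  · have himg : τ '' Carpet C J = (⋃ i, D i)ᶜ := by
      rw [hcarpet, image_preimage_eq_inter_range, hc.range, inter_eq_left]
      exact fun x hx e => hx (mem_iUnion.2 ⟨0, by rw [mem_singleton_iff.1 e]; exact hp⟩)
    obtain ⟨e⟩ := nonempty_homeomorph_image hmodel.isCompact_carpet
      hc.embedding.continuous.continuousOn hc.embedding.injective.injOn
    exact ⟨((e.trans (Homeomorph.setCongr himg))).symm⟩

/-- A compact relation between two spaces that is injective on both sides is a homeomorphism. -/
lemma exists_homeomorph_of_corr {α β : Type*} [TopologicalSpace α] [TopologicalSpace β]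
    [T2Space α] [T2Space β] {R : Set (α × β)} (hR : IsCompact R) (h1 : InjOn Prod.fst R)
    (h2 : InjOn Prod.snd R) {A : Set α} {B : Set β} (hA : Prod.fst '' R = A)
    (hB : Prod.snd '' R = B) : ∃ h : ↥A ≃ₜ ↥B, ∀ x : ↥A, ((x : α), (h x : β)) ∈ R := by
  subst hA hB
  have : CompactSpace ↥R := isCompact_iff_compactSpace.1 hR
  have hc1 : Continuous (Equiv.Set.imageOfInjOn Prod.fst R h1) :=
    (continuous_fst.comp continuous_subtype_val).subtype_mk _
  have hc2 : Continuous (Equiv.Set.imageOfInjOn Prod.snd R h2) :=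
    (continuous_snd.comp continuous_subtype_val).subtype_mk _
  refine ⟨hc1.homeoOfEquivCompactToT2.symm.trans hc2.homeoOfEquivCompactToT2, fun x => ?_⟩
  obtain ⟨r, rfl⟩ := hc1.homeoOfEquivCompactToT2.surjective x
  rw [Homeomorph.trans_apply, Homeomorph.symm_apply_apply]
  exact r.2

/-- Two carpets are homeomorphic. -/
lemma Model.nonempty_homeomorph {C C' : ℕ → Set ℂ} {J J' : Set ℂ} (h : Model C J)
    (h' : Model C' J') (e : ↥J ≃ₜ ↥J') : Nonempty (↥(Carpet C J) ≃ₜ ↥(Carpet C' J')) := by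
  have hcomp : CompactSpace ↥J := isCompact_iff_compactSpace.1 h.good.jordan.isCompact
  let Γ : Set (ℂ × ℂ) := range fun x : ↥J => ((x : ℂ), (e x : ℂ))
  have hΓ : IsCompact Γ := isCompact_range (by fun_prop)
  have h1 : Prod.fst '' Γ = J := by
    rw [← range_comp]; exact Subtype.range_coe
  have h2 : Prod.snd '' Γ = J' := by
    rw [← range_comp]
    exact (e.surjective.range_comp Subtype.val).trans Subtype.range_coe
  have hi1 : InjOn Prod.fst Γ := by
    rintro _ ⟨x, rfl⟩ _ ⟨y, rfl⟩ hxy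
    rw [Subtype.val_injective hxy]
  have hi2 : InjOn Prod.snd Γ := by
    rintro _ ⟨x, rfl⟩ _ ⟨y, rfl⟩ hxy
    rw [e.injective (Subtype.val_injective hxy)]
  obtain ⟨R, hR, -, hR1, hR2, hf, hs⟩ := h.holes.exists_carpet_corr h'.holes hΓ
    ⟨hi1, h1.symm ▸ h.good⟩ ⟨hi2, h2.symm ▸ h'.good⟩
  rw [h1] at hf
  rw [h2] at hs
  obtain ⟨g, -⟩ := exists_homeomorph_of_corr hR hR1 hR2 hf hs
  exact ⟨g⟩

/-! ### Extending homeomorphisms along an entwined exhaustion -/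

/-- A carpet presentation of a space, with circles as boundary curves. -/
structure CarpetModel (C : ℕ → Set ℂ) (J : Set ℂ) : Prop where
  model : Model C J
  circle : ∀ j, Nonempty (↥(Bd C J j) ≃ₜ ↥UnitCircle)

lemma IsSierpinskiCurve.exists_carpetModel {X : Type*} [TopologicalSpace X]
    (h : IsSierpinskiCurve X) :
    ∃ C J, CarpetModel C J ∧ Nonempty (X ≃ₜ ↥(Carpet C J)) := by
  obtain ⟨D, hD, ⟨e⟩⟩ := h
  obtain ⟨C, J, hm, hc, ⟨e'⟩⟩ := hD.exists_model
  exact ⟨C, J, ⟨hm, hc⟩, ⟨e.trans e'⟩⟩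

section

variable {X' X : Type*} [TopologicalSpace X'] [TopologicalSpace X]

/-- The boundary curves of a carpet are peripheral circles. -/
lemma CarpetModel.isPeriphCircleIn {C : ℕ → Set ℂ} {J : Set ℂ} (h : CarpetModel C J) {S : Set X}
    (b : ↥S ≃ₜ ↥(Carpet C J)) (j : Option ℕ) :
    IsPeriphCircleIn S (Subtype.val '' {x : ↥S | (b x : ℂ) ∈ Bd C J j}) := by
  refine ⟨Subtype.coe_image_subset _ _, ?_⟩
  rw [preimage_image_eq _ Subtype.val_injective]
  have hset : {x : ↥S | (b x : ℂ) ∈ Bd C J j} = b ⁻¹' (Subtype.val ⁻¹' Bd C J j) := rfl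
  constructor
  · obtain ⟨e⟩ := h.circle j
    let e₁ := b.sets hset
    let e₂ := (IsEmbedding.subtypeVal (p := (· ∈ Carpet C J))).homeomorphImage
      (Subtype.val ⁻¹' Bd C J j)
    have himg : Subtype.val '' (Subtype.val ⁻¹' Bd C J j : Set ↥(Carpet C J)) = Bd C J j := by
      rw [Subtype.image_preimage_coe, inter_eq_right.2 (h.model.bd_subset j)]
    exact ⟨(e₁.trans e₂).trans ((Homeomorph.setCongr himg).trans e)⟩
  · rw [hset, ← preimage_compl, b.isConnected_preimage]
    have hconn := h.model.isConnected_diff_bd j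
    have himg : Subtype.val '' ((Subtype.val ⁻¹' Bd C J j)ᶜ : Set ↥(Carpet C J)) =
        Carpet C J \ Bd C J j := by
      rw [← preimage_compl, Subtype.image_preimage_coe, sdiff_eq]
    rw [← himg] at hconn
    exact ⟨hconn.nonempty.of_image, IsInducing.subtypeVal.isPreconnected_image.1 hconn.isPreconnected⟩

/-- An entwined pair of Sierpiński curves is an embedding of carpets. -/
lemma CarpetModel.exists_embeds {C C₁ : ℕ → Set ℂ} {J J₁ : Set ℂ} (h : CarpetModel C J)
    (h₁ : CarpetModel C₁ J₁) {S T : Set X} (hST : S ⊆ T)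
    (hent : ∀ γ δ, IsPeriphCircleIn S γ → IsPeriphCircleIn T δ → Disjoint γ δ)
    (b : ↥S ≃ₜ ↥(Carpet C J)) (a : ↥T ≃ₜ ↥(Carpet C₁ J₁)) :
    ∃ e, Embeds C J C₁ J₁ e ∧ ∀ x : ↥S, e (b x) = a (inclusion hST x) := by
  have hcont : Continuous fun z : ↥(Carpet C J) => (a (inclusion hST (b.symm z)) : ℂ) :=
    continuous_subtype_val.comp
      (a.continuous.comp ((continuous_inclusion hST).comp b.symm.continuous))
  obtain ⟨e, he, hea⟩ := exists_continuousOn_extension _ hcont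
  have heb : ∀ x : ↥S, e (b x) = a (inclusion hST x) := fun x => by
    rw [hea, b.symm_apply_apply]
  refine ⟨e, ⟨h.model, h₁.model, he, ?_, ?_, ?_⟩, heb⟩
  · intro x hx y hy hxy
    rw [hea ⟨x, hx⟩, hea ⟨y, hy⟩] at hxy
    have := b.symm.injective (inclusion_injective hST (a.injective (Subtype.val_injective hxy)))
    exact congrArg Subtype.val this
  · rintro _ ⟨x, hx, rfl⟩
    rw [hea ⟨x, hx⟩]
    exact Subtype.coe_prop _
  · intro j k
    rw [disjoint_left]
    rintro _ ⟨x, hx, rfl⟩ hk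
    have hxC := h.model.bd_subset j hx
    rw [hea ⟨x, hxC⟩] at hk
    refine disjoint_left.1 (hent _ _ (h.isPeriphCircleIn b j) (h₁.isPeriphCircleIn a k))
      ⟨b.symm ⟨x, hxC⟩, ?_, rfl⟩ ⟨inclusion hST (b.symm ⟨x, hxC⟩), hk, rfl⟩
    rw [mem_ofPred_eq, b.apply_symm_apply]
    exact hx

/-- Homeomorphisms extend along entwined pairs of Sierpiński curves. -/
theorem exists_homeomorph_extension {S T : Set X} {S' T' : Set X'} (hST : S ⊆ T) (hST' : S' ⊆ T')
    (hent : ∀ γ δ, IsPeriphCircleIn S γ → IsPeriphCircleIn T δ → Disjoint γ δ)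
    (hent' : ∀ γ δ, IsPeriphCircleIn S' γ → IsPeriphCircleIn T' δ → Disjoint γ δ)
    (hS : IsSierpinskiCurve ↥S) (hT : IsSierpinskiCurve ↥T) (hT' : IsSierpinskiCurve ↥T')
    (h : ↥S ≃ₜ ↥S') :
    ∃ g : ↥T ≃ₜ ↥T', ∀ x : ↥S, g (inclusion hST x) = inclusion hST' (h x) := by
  obtain ⟨C, J, hC, ⟨b⟩⟩ := hS.exists_carpetModel
  obtain ⟨C₁, J₁, hC₁, ⟨a⟩⟩ := hT.exists_carpetModel
  obtain ⟨C₂, J₂, hC₂, ⟨a'⟩⟩ := hT'.exists_carpetModel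
  obtain ⟨e, he, hea⟩ := hC.exists_embeds hC₁ hST hent b a
  obtain ⟨e', he', hea'⟩ := hC.exists_embeds hC₂ hST' hent' (h.symm.trans b) a'
  obtain ⟨R, hR, hR1, hR2, hf, hs, hRe⟩ := he.exists_corr he'
  obtain ⟨g, hg⟩ := exists_homeomorph_of_corr hR hR1 hR2 hf hs
  refine ⟨(a.trans g).trans a'.symm, fun x => ?_⟩
  have h1 := hRe _ (b x).2
  have h2 := hea' (h x)
  rw [Homeomorph.trans_apply, h.symm_apply_apply] at h2
  rw [hea, h2] at h1
  have h3 := congrArg Prod.snd (hR1 h1 (hg (a (inclusion hST x))) rfl)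
  rw [Homeomorph.trans_apply, Homeomorph.trans_apply, Homeomorph.symm_apply_eq]
  exact Subtype.val_injective h3.symm

/-- Two Sierpiński curves are homeomorphic. -/
theorem IsSierpinskiCurve.nonempty_homeomorph (h : IsSierpinskiCurve X)
    (h' : IsSierpinskiCurve X') : Nonempty (X ≃ₜ X') := by
  obtain ⟨C, J, hC, ⟨b⟩⟩ := h.exists_carpetModel
  obtain ⟨C', J', hC', ⟨b'⟩⟩ := h'.exists_carpetModel
  obtain ⟨c⟩ := hC.circle none
  obtain ⟨c'⟩ := hC'.circle none
  obtain ⟨g⟩ := hC.model.nonempty_homeomorph hC'.model (c.trans c'.symm)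
  let e := (b.trans g).trans b'.symm
  exact ⟨e⟩

/-- Compatible continuous maps glue to a continuous map of direct limits. -/
lemma exists_continuous_glue {Xn : ℕ → Set X} {Xn' : ℕ → Set X'} (hmono : Monotone Xn)
    (hunion : ⋃ n, Xn n = univ)
    (htop : ∀ U : Set X, IsOpen U ↔ ∀ n, IsOpen (Subtype.val ⁻¹' U : Set ↥(Xn n)))
    (f : ∀ n, ↥(Xn n) → ↥(Xn' n)) (hf : ∀ n, Continuous (f n))
    (hcomp : ∀ n (x : ↥(Xn n)), (f (n + 1) (inclusion (hmono n.le_succ) x) : X') = f n x) :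
    ∃ F : X → X', Continuous F ∧ ∀ n (x : ↥(Xn n)), F x = f n x := by
  have hle : ∀ n m (hnm : n ≤ m) (x : ↥(Xn n)), (f m (inclusion (hmono hnm) x) : X') = f n x := by
    intro n m hnm
    induction m, hnm using Nat.le_induction with
    | base => exact fun x => rfl
    | succ m hnm ih => exact fun x => (hcomp m (inclusion (hmono hnm) x)).trans (ih x)
  have hex : ∀ x : X, ∃ n, x ∈ Xn n := fun x => mem_iUnion.1 (hunion ▸ mem_univ x)
  choose N hN using hex
  have hF : ∀ n (x : ↥(Xn n)), (f (N x) ⟨x, hN x⟩ : X') = f n x := fun n x => by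
    rcases le_total n (N x) with h | h
    · exact hle _ _ h x
    · exact (hle _ _ h ⟨x, hN x⟩).symm
  refine ⟨fun x => f (N x) ⟨x, hN x⟩, ?_, hF⟩
  refine continuous_def.2 fun U hU => (htop _).2 fun n => ?_
  have : (Subtype.val ⁻¹' ((fun x => (f (N x) ⟨x, hN x⟩ : X')) ⁻¹' U) : Set ↥(Xn n)) =
      f n ⁻¹' (Subtype.val ⁻¹' U) := by
    ext x
    simp only [mem_preimage, hF]
  rw [this]
  exact (hU.preimage continuous_subtype_val).preimage (hf n)

/-- Any two ω-Sierpiński curves are homeomorphic. -/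
theorem IsOmegaSierpinski.nonempty_homeomorph {Xn : ℕ → Set X} {Xn' : ℕ → Set X'}
    (h : IsOmegaSierpinski X Xn) (h' : IsOmegaSierpinski X' Xn') : Nonempty (X ≃ₜ X') := by
  obtain ⟨hmono, hunion, htop, hsier, hent⟩ := h
  obtain ⟨hmono', hunion', htop', hsier', hent'⟩ := h'
  have hstep : ∀ n (g : ↥(Xn n) ≃ₜ ↥(Xn' n)), ∃ g' : ↥(Xn (n + 1)) ≃ₜ ↥(Xn' (n + 1)),
      ∀ x, g' (inclusion (hmono n.le_succ) x) = inclusion (hmono' n.le_succ) (g x) := fun n g =>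
    exists_homeomorph_extension _ _ (hent n) (hent' n) (hsier n) (hsier _) (hsier' _) g
  choose next hnext using hstep
  obtain ⟨g₀⟩ := (hsier 0).nonempty_homeomorph (hsier' 0)
  obtain ⟨g, hg⟩ : ∃ g : ∀ n, ↥(Xn n) ≃ₜ ↥(Xn' n), ∀ n, g (n + 1) = next n (g n) :=
    ⟨fun n => Nat.rec g₀ next n, fun n => rfl⟩
  have hcomp : ∀ n x, g (n + 1) (inclusion (hmono n.le_succ) x) =
      inclusion (hmono' n.le_succ) (g n x) := fun n x => by rw [hg, hnext]
  have hcomp' : ∀ n y, (g (n + 1)).symm (inclusion (hmono' n.le_succ) y) =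
      inclusion (hmono n.le_succ) ((g n).symm y) := fun n y => by
    rw [Homeomorph.symm_apply_eq, hcomp, Homeomorph.apply_symm_apply]
  obtain ⟨F, hF, hFg⟩ := exists_continuous_glue hmono hunion htop (fun n => g n)
    (fun n => (g n).continuous) fun n x => congrArg Subtype.val (hcomp n x)
  obtain ⟨G, hG, hGg⟩ := exists_continuous_glue hmono' hunion' htop' (fun n => (g n).symm)
    (fun n => (g n).symm.continuous) fun n x => congrArg Subtype.val (hcomp' n x)
  refine ⟨⟨⟨F, G, fun x => ?_, fun y => ?_⟩, hF, hG⟩⟩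
  · obtain ⟨n, hn⟩ := mem_iUnion.1 (hunion ▸ mem_univ x)
    rw [hFg n ⟨x, hn⟩, hGg n, Homeomorph.symm_apply_apply]
  · obtain ⟨n, hn⟩ := mem_iUnion.1 (hunion' ▸ mem_univ y)
    rw [hGg n ⟨y, hn⟩, hFg n, Homeomorph.apply_symm_apply]

end

theorem stmt8 {X X' : Type*} [TopologicalSpace X] [TopologicalSpace X']
    (Xn : ℕ → Set X) (Xn' : ℕ → Set X')
    (h : IsOmegaSierpinski X Xn) (h' : IsOmegaSierpinski X' Xn') :
    Nonempty (X ≃ₜ X') :=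
  h.nonempty_homeomorph h'
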